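/- There is an absolute constant C > 0 such that the following holds. Let K be a number field with discriminant Δ_K, and suppose RH holds for ζ_K. Then for every real X > 1, |∑_p A_K(p)·log(p)·h_X(log p) − 1| ≤ C·X²·(log|Δ_K| + 2)·exp(−X/2), where the sum is over all rational primes p. -/

import Mathlib

open Polynomial NumberField MeasureTheory

def isDedekindZeta (K : Type*) [Field K] (f : ℂ → ℂ) : Prop :=
  (∀ s : ℂ, s ≠ 1 → DifferentiableAt ℂ f s) ∧
  ∀ s : ℂ, 1 < s.re → f s = ∑' I : Ideal (𝓞 K), (Nat.card ((𝓞 K) ⧸ I) : ℂ) ^ (-s)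

def RHFor (K : Type*) [Field K] : Prop :=
  ∀ f : ℂ → ℂ, isDedekindZeta K f → ∀ s : ℂ, f s = 0 → 0 < s.re → s.re < 1 → s.re = 1/2

/-- `A_R(n)`: the number of prime ideals of `R` whose quotient has exactly `n` elements,
i.e. whose absolute norm is `n`. -/
noncomputable def primeIdealCount (R : Type*) [CommRing R] (n : ℕ) : ℕ :=
  Nat.card {P : Ideal R // P.IsPrime ∧ Nat.card (R ⧸ P) = n}

/-- The weight function `h_X`. -/
noncomputable def hweight (X u : ℝ) : ℝ :=
  if X - Real.log 2 < u ∧ u ≤ X then 2 * Real.exp (-X) else 0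

section PoissonGaussian

open Matrix Set

variable {ι : Type*} [Fintype ι]

theorem summable_prod_pi_int (g : ℤ → ℝ) (hg : ∀ n, 0 ≤ g n) (hs : Summable g) :
    Summable fun m : ι → ℤ ↦ ∏ i, g (m i) := by
  classical
  refine summable_of_sum_le (c := ∏ _i : ι, ∑' n, g n)
    (fun m ↦ Finset.prod_nonneg fun i _ ↦ hg _) fun u ↦ ?_
  let t : ι → Finset ℤ := fun i ↦ u.image fun m ↦ m i
  calc ∑ m ∈ u, ∏ i, g (m i) ≤ ∑ m ∈ Fintype.piFinset t, ∏ i, g (m i) := by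
        refine Finset.sum_le_sum_of_subset_of_nonneg (fun m hm ↦ ?_)
          fun m _ _ ↦ Finset.prod_nonneg fun i _ ↦ hg _
        rw [Fintype.mem_piFinset]
        exact fun i ↦ Finset.mem_image_of_mem _ hm
    _ = ∏ i, ∑ n ∈ t i, g n := (Finset.prod_univ_sum t fun _ n ↦ g n).symm
    _ ≤ _ := Finset.prod_le_prod (fun i _ ↦ Finset.sum_nonneg fun n _ ↦ hg _)
        fun i _ ↦ hs.sum_le_tsum _ fun n _ ↦ hg n

theorem summable_exp_neg_mul_int_sq {c : ℝ} (hc : 0 < c) :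
    Summable fun n : ℤ ↦ Real.exp (-c * (n : ℝ) ^ 2) := by
  have h := Real.summable_pow_mul_exp_neg_nat_mul 0 hc
  simp only [pow_zero, one_mul] at h
  have key : ∀ n : ℕ, Real.exp (-c * ((n : ℕ) : ℝ) ^ 2) ≤ Real.exp (-c * n) := by
    intro n
    apply Real.exp_le_exp.mpr
    have : (n : ℝ) ≤ (n : ℝ) ^ 2 := by exact_mod_cast Nat.le_self_pow two_ne_zero n
    nlinarith
  have h2 : Summable fun n : ℕ ↦ Real.exp (-c * (n : ℝ) ^ 2) :=
    Summable.of_nonneg_of_le (fun n ↦ (Real.exp_pos _).le) key h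
  refine Summable.of_nat_of_neg (by simpa using h2) (by simpa using h2)

theorem summable_exp_neg_mul_sum_sq {c : ℝ} (hc : 0 < c) :
    Summable fun m : ι → ℤ ↦ Real.exp (-c * ∑ i, (m i : ℝ) ^ 2) := by
  have := summable_prod_pi_int (ι := ι) _ (fun n ↦ (Real.exp_pos _).le)
    (summable_exp_neg_mul_int_sq hc)
  refine this.congr fun m ↦ ?_
  rw [← Real.exp_sum, Finset.mul_sum]

theorem exists_pos_mul_sum_sq_le [DecidableEq ι] (S : Matrix ι ι ℝ) (hS : IsUnit S.det) :
    ∃ c : ℝ, 0 < c ∧ ∀ x : ι → ℝ, c * ∑ i, x i ^ 2 ≤ ∑ i, (S *ᵥ x) i ^ 2 := by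
  set M : ℝ := ∑ i, ∑ j, (S⁻¹ i j) ^ 2
  have hM : 0 ≤ M := by positivity
  refine ⟨(M + 1)⁻¹, by positivity, fun x ↦ ?_⟩
  rw [inv_mul_le_iff₀ (by positivity)]
  have hx : x = S⁻¹ *ᵥ (S *ᵥ x) := by
    rw [mulVec_mulVec, nonsing_inv_mul _ hS, one_mulVec]
  set y := S *ᵥ x
  have : ∑ i, x i ^ 2 ≤ M * ∑ i, y i ^ 2 := by
    rw [hx, Finset.sum_mul]
    refine Finset.sum_le_sum fun i _ ↦ ?_
    exact Finset.sum_mul_sq_le_sq_mul_sq _ _ _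
  have h0 : 0 ≤ ∑ i, y i ^ 2 := by positivity
  nlinarith

/-- The periodization of a Gaussian along the integer lattice. -/
noncomputable def gaussianFun (S : Matrix ι ι ℝ) (x : ι → ℝ) : ℂ :=
  Complex.exp (-Real.pi * ∑ i, (((S *ᵥ x) i : ℝ) : ℂ) ^ 2)

theorem continuous_gaussianFun (S : Matrix ι ι ℝ) : Continuous (gaussianFun S) := by
  unfold gaussianFun
  have : ∀ i, Continuous fun x : ι → ℝ ↦ (S *ᵥ x) i := fun i ↦ by
    simp only [mulVec, dotProduct]; fun_prop
  fun_prop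

theorem norm_gaussianFun (S : Matrix ι ι ℝ) (x : ι → ℝ) :
    ‖gaussianFun S x‖ = Real.exp (-Real.pi * ∑ i, (S *ᵥ x) i ^ 2) := by
  rw [gaussianFun, Complex.norm_exp]
  congr 1
  have : (-(Real.pi : ℂ) * ∑ i, (((S *ᵥ x) i : ℝ) : ℂ) ^ 2) =
    ((-Real.pi * ∑ i, (S *ᵥ x) i ^ 2 : ℝ) : ℂ) := by push_cast; ring
  rw [this, Complex.ofReal_re]

variable [DecidableEq ι]

theorem exists_gaussianFun_bound (S : Matrix ι ι ℝ) (hS : IsUnit S.det) (R : ℝ) :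
    ∃ u : (ι → ℤ) → ℝ, Summable u ∧
      ∀ m : ι → ℤ, ∀ x : ι → ℝ, (∀ i, |x i| ≤ R) → ‖gaussianFun S (x + fun i ↦ (m i : ℝ))‖ ≤ u m := by
  obtain ⟨c, hc, hcS⟩ := exists_pos_mul_sum_sq_le S hS
  refine ⟨fun m ↦ Real.exp (Real.pi * c * (Fintype.card ι * R ^ 2)) *
    Real.exp (-(Real.pi * c / 2) * ∑ i, (m i : ℝ) ^ 2),
    (summable_exp_neg_mul_sum_sq (by positivity)).mul_left _, fun m x hx ↦ ?_⟩
  beta_reduce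
  rw [norm_gaussianFun, ← Real.exp_add]
  apply Real.exp_le_exp.mpr
  have h1 := hcS (x + fun i ↦ (m i : ℝ))
  have h2 : ∑ i, ((m i : ℝ) ^ 2 / 2 - R ^ 2) ≤ ∑ i, (x + fun i ↦ (m i : ℝ)) i ^ 2 := by
    refine Finset.sum_le_sum fun i _ ↦ ?_
    have h3 : x i ^ 2 ≤ R ^ 2 := by
      rw [← sq_abs]; exact pow_le_pow_left₀ (abs_nonneg _) (hx i) 2
    simp only [Pi.add_apply]
    nlinarith [sq_nonneg (2 * x i + m i)]
  simp only [Finset.sum_sub_distrib, Finset.sum_const, Finset.card_univ, nsmul_eq_mul,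
    ← Finset.sum_div] at h2
  have h4 := mul_le_mul_of_nonneg_left h2 hc.le
  have := mul_le_mul_of_nonneg_left (h4.trans h1) Real.pi_pos.le
  nlinarith

theorem integral_gaussianFun_mul_exp (S : Matrix ι ι ℝ) (hS : IsUnit S.det) (m : ι → ℝ) :
    ∫ x : ι → ℝ, Complex.exp (-(2 * Real.pi * Complex.I) * ∑ i, (m i : ℂ) * (x i : ℂ)) *
      gaussianFun S x = (|S.det|⁻¹ : ℝ) * gaussianFun (S⁻¹)ᵀ m := by
  have hdet : S.det ≠ 0 := hS.ne_zero
  set w := (S⁻¹)ᵀ *ᵥ m with hw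
  let g : (ι → ℝ) → ℂ := fun y ↦ Complex.exp (-(Real.pi : ℂ) * ∑ i, (y i : ℂ) ^ 2 +
    ∑ i, (-(2 * Real.pi * Complex.I) * w i) * y i)
  have hg : ∀ x, g (S *ᵥ x) = Complex.exp (-(2 * Real.pi * Complex.I) *
      ∑ i, (m i : ℂ) * (x i : ℂ)) * gaussianFun S x := by
    intro x
    simp only [g, gaussianFun]
    rw [← Complex.exp_add, add_comm]
    congr 2
    have h1 : ∑ i, w i * (S *ᵥ x) i = ∑ i, m i * x i := by
      change w ⬝ᵥ (S *ᵥ x) = m ⬝ᵥ x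
      rw [hw, mulVec_transpose, dotProduct_mulVec, vecMul_vecMul, nonsing_inv_mul _ hS,
        vecMul_one]
    have h2 : ∑ i, (w i : ℂ) * ((S *ᵥ x) i : ℝ) = ∑ i, (m i : ℂ) * x i := by exact_mod_cast h1
    rw [← h2, Finset.mul_sum]
    exact Finset.sum_congr rfl fun i _ ↦ by ring
  simp_rw [← hg]
  have hmap := Real.map_matrix_volume_pi_eq_smul_volume_pi hdet
  have hemb : MeasurableEmbedding (toLin' S) := by
    have := (S.toLinearEquiv' (S.invertibleOfIsUnitDet hS)).toContinuousLinearEquiv.toHomeomorph.measurableEmbedding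
    exact this
  have h3 : ∫ x, g (S *ᵥ x) = ∫ y, g y ∂(Measure.map (toLin' S) volume) := by
    rw [hemb.integral_map]; rfl
  rw [h3, hmap, integral_smul_measure, GaussianFourier.integral_cexp_neg_mul_sum_add (by simp [Real.pi_pos]),
    ENNReal.toReal_ofReal (abs_nonneg _), div_self (by exact_mod_cast Real.pi_ne_zero),
    Complex.one_cpow, one_mul, Complex.real_smul, abs_inv]
  congr 1
  rw [gaussianFun]
  congr 1
  have hpi : (Real.pi : ℂ) ≠ 0 := by exact_mod_cast Real.pi_ne_zero
  rw [div_eq_iff (by simpa using hpi), Finset.mul_sum, Finset.sum_mul]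
  refine Finset.sum_congr rfl fun i _ ↦ ?_
  rw [← hw]
  ring_nf
  rw [Complex.I_sq]; ring

omit [Fintype ι] [DecidableEq ι] in
theorem map_coe_unitAddCircle_eq_iff (x y : ι → ℝ) :
    (fun i ↦ (x i : UnitAddCircle)) = (fun i ↦ (y i : UnitAddCircle)) ↔
      ∃ m : ι → ℤ, y = x + fun i ↦ (m i : ℝ) := by
  constructor
  · intro h
    have : ∀ i, ∃ n : ℤ, y i = x i + n := by
      intro i
      have h1 : ((y i - x i : ℝ) : UnitAddCircle) = 0 := by
        rw [AddCircle.coe_sub, ← congr_fun h i, sub_self]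
      obtain ⟨n, hn⟩ := AddCircle.coe_eq_zero_iff (1 : ℝ) |>.mp h1
      exact ⟨n, by simp at hn; linarith⟩
    choose m hm using this
    exact ⟨m, funext hm⟩
  · rintro ⟨m, rfl⟩
    funext i
    have : ((m i : ℝ) : UnitAddCircle) = 0 :=
      (AddCircle.coe_eq_zero_iff (1 : ℝ)).mpr ⟨m i, by simp⟩
    simp

/-- The half-open unit box with integral lower corner `m`. -/
def unitBox (m : ι → ℤ) : Set (ι → ℝ) := {x | ∀ i, x i ∈ Ioc ((m i : ℤ) : ℝ) (m i + 1)}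

omit [DecidableEq ι] in
theorem measurableSet_unitBox (m : ι → ℤ) : MeasurableSet (unitBox m) := by
  have : unitBox m = Set.pi univ fun i ↦ Ioc ((m i : ℤ) : ℝ) (m i + 1) := by
    ext; simp [unitBox]
  rw [this]
  exact MeasurableSet.univ_pi fun i ↦ measurableSet_Ioc

omit [DecidableEq ι] in
theorem volume_unitBox (m : ι → ℤ) : volume (unitBox m) = 1 := by
  have : unitBox m = Set.pi univ fun i ↦ Ioc ((m i : ℤ) : ℝ) (m i + 1) := by
    ext; simp [unitBox]
  rw [this, Real.volume_pi_Ioc]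
  simp

omit [Fintype ι] [DecidableEq ι] in
theorem mem_unitBox_iff (m : ι → ℤ) (x : ι → ℝ) : x ∈ unitBox m ↔ ∀ i, ⌈x i⌉ - 1 = m i := by
  refine forall_congr' fun i ↦ ?_
  rw [sub_eq_iff_eq_add, Int.ceil_eq_iff]
  simp

omit [Fintype ι] [DecidableEq ι] in
theorem iUnion_unitBox : ⋃ m : ι → ℤ, unitBox m = univ := by
  refine eq_univ_of_forall fun x ↦ mem_iUnion.mpr ⟨fun i ↦ ⌈x i⌉ - 1, ?_⟩
  simp [mem_unitBox_iff]

omit [Fintype ι] [DecidableEq ι] in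
theorem pairwise_disjoint_unitBox :
    Pairwise (Function.onFun Disjoint fun m : ι → ℤ ↦ unitBox m) := by
  intro m m' h
  rw [Function.onFun, Set.disjoint_left]
  intro x hx hx'
  rw [mem_unitBox_iff] at hx hx'
  exact h (funext fun i ↦ (hx i).symm.trans (hx' i))

omit [DecidableEq ι] in
theorem setIntegral_unitBox {E : Type*} [NormedAddCommGroup E] [NormedSpace ℝ E]
    (f : (ι → ℝ) → E) (m : ι → ℤ) :
    ∫ x in unitBox m, f x = ∫ x in unitBox 0, f (x + fun i ↦ (m i : ℝ)) := by
  have h := (measurePreserving_add_right (volume : Measure (ι → ℝ))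
    (fun i ↦ (m i : ℝ))).setIntegral_preimage_emb (measurableEmbedding_addRight _) f (unitBox m)
  rw [← h]
  congr 2
  ext x
  simp only [unitBox, mem_preimage, mem_ofPred_eq, mem_Ioc, Pi.add_apply, Pi.zero_apply, Int.cast_zero]
  exact forall_congr' fun i ↦ by constructor <;> rintro ⟨h1, h2⟩ <;> constructor <;> linarith

omit [DecidableEq ι] in
/-- Integrating over `ℝ^ι` is the same as integrating the periodization over the unit box. -/
theorem integral_eq_setIntegral_tsum (f : (ι → ℝ) → ℂ) (hf : Continuous f) (u : (ι → ℤ) → ℝ)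
    (hu : Summable u) (hfu : ∀ m : ι → ℤ, ∀ x : ι → ℝ, (∀ i, |x i| ≤ 1) →
      ‖f (x + fun i ↦ (m i : ℝ))‖ ≤ u m) :
    ∫ x, f x = ∫ x in unitBox 0, ∑' m : ι → ℤ, f (x + fun i ↦ (m i : ℝ)) := by
  have hb : ∀ x ∈ unitBox (0 : ι → ℤ), ∀ i, |x i| ≤ 1 := by
    intro x hx i
    have := hx i
    simp at this
    rw [abs_le]
    constructor <;> linarith
  have hbd : ∀ m : ι → ℤ, ∀ x ∈ unitBox (0 : ι → ℤ), ‖f (x + fun i ↦ (m i : ℝ))‖ ≤ u m :=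
    fun m x hx ↦ hfu m x (hb x hx)
  have hvol : volume (unitBox (0 : ι → ℤ)) < ⊤ := by simp [volume_unitBox]
  have h_int : ∀ m : ι → ℤ, IntegrableOn (fun x ↦ f (x + fun i ↦ (m i : ℝ))) (unitBox 0) := by
    intro m
    refine Measure.integrableOn_of_bounded hvol.ne
      (hf.comp (by fun_prop)).aestronglyMeasurable (M := u m) ?_
    exact (ae_restrict_iff' (measurableSet_unitBox _)).mpr (ae_of_all _ (hbd m))
  have h_int' : ∀ m : ι → ℤ, IntegrableOn f (unitBox m) := by
    intro m
    have h := (measurePreserving_add_right (volume : Measure (ι → ℝ))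
      (fun i ↦ (m i : ℝ))).integrableOn_comp_preimage (measurableEmbedding_addRight _)
      (f := f) (s := unitBox m)
    rw [← h]
    convert! h_int m using 1
    ext x
    simp only [unitBox, mem_preimage, mem_ofPred_eq, mem_Ioc, Pi.add_apply, Pi.zero_apply, Int.cast_zero]
    exact forall_congr' fun i ↦ by constructor <;> rintro ⟨h1, h2⟩ <;> constructor <;> linarith
  have hnorm : ∀ m : ι → ℤ, ∫ x in unitBox 0, ‖f (x + fun i ↦ (m i : ℝ))‖ ≤ u m := by
    intro m
    have := norm_setIntegral_le_of_norm_le_const (f := fun x ↦ ‖f (x + fun i ↦ (m i : ℝ))‖)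
      (C := u m) hvol
      (fun x hx ↦ by rw [norm_norm]; exact hbd m x hx)
    rw [Measure.real, volume_unitBox, ENNReal.toReal_one, mul_one] at this
    exact (Real.le_norm_self _).trans this
  have hsum : Summable fun m : ι → ℤ ↦ ∫ x in unitBox 0, ‖f (x + fun i ↦ (m i : ℝ))‖ :=
    Summable.of_nonneg_of_le (fun m ↦ integral_nonneg fun _ ↦ norm_nonneg _) hnorm hu
  have h1 := integral_tsum_of_summable_integral_norm (μ := volume.restrict (unitBox 0)) h_int hsum
  rw [← h1]
  have hnorm' : ∀ m : ι → ℤ, ∫ x in unitBox m, ‖f x‖ = 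
      ∫ x in unitBox 0, ‖f (x + fun i ↦ (m i : ℝ))‖ := by
    intro m
    exact setIntegral_unitBox (fun x ↦ ‖f x‖) m
  have hI : IntegrableOn f (⋃ m : ι → ℤ, unitBox m) := by
    refine integrableOn_iUnion_of_summable_integral_norm h_int' ?_
    simpa only [hnorm'] using hsum
  have h2 := hasSum_integral_iUnion (fun m : ι → ℤ ↦ measurableSet_unitBox m)
    pairwise_disjoint_unitBox hI
  rw [iUnion_unitBox, setIntegral_univ] at h2
  rw [← h2.tsum_eq]
  exact tsum_congr fun m ↦ setIntegral_unitBox f m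

theorem tsum_gaussianFun (S : Matrix ι ι ℝ) (hS : IsUnit S.det) :
    ∑' m : ι → ℤ, gaussianFun S (fun i ↦ (m i : ℝ)) =
      (|S.det|⁻¹ : ℝ) * ∑' m : ι → ℤ, gaussianFun (S⁻¹)ᵀ (fun i ↦ (m i : ℝ)) := by
  let P : (ι → ℝ) → ℂ := fun x ↦ ∑' m : ι → ℤ, gaussianFun S (x + fun i ↦ (m i : ℝ))
  have hP : Continuous P := by
    refine continuous_iff_continuousAt.mpr fun x ↦ ?_
    obtain ⟨u, hu, hu'⟩ := exists_gaussianFun_bound S hS (‖x‖ + 1)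
    have hc : ContinuousOn P (Metric.ball x 1) := by
      refine continuousOn_tsum (fun m ↦ ?_) hu fun m y hy ↦ hu' m y fun i ↦ ?_
      · exact ((continuous_gaussianFun S).comp (by fun_prop)).continuousOn
      · rw [Metric.mem_ball, dist_eq_norm] at hy
        have h1 := norm_le_pi_norm y i
        have h2 := norm_add_le (y - x) x
        rw [sub_add_cancel] at h2
        rw [← Real.norm_eq_abs]
        linarith
    exact hc.continuousAt (Metric.ball_mem_nhds x one_pos)
  let q : (ι → ℝ) → UnitAddTorus ι := Pi.map fun _ x ↦ (x : UnitAddCircle)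
  have hq : IsOpenQuotientMap q :=
    IsOpenQuotientMap.piMap fun _ ↦ QuotientAddGroup.isOpenQuotientMap_mk
  have hPq : ∀ x y, q x = q y → P x = P y := by
    intro x y hxy
    obtain ⟨k, rfl⟩ := (map_coe_unitAddCircle_eq_iff x y).mp hxy
    refine ((Equiv.addLeft k).tsum_eq fun m : ι → ℤ ↦
      gaussianFun S (x + fun i ↦ (m i : ℝ))).symm.trans (tsum_congr fun m ↦ ?_)
    congr 1
    funext i
    simp [add_assoc]
  let qc : C(ι → ℝ, UnitAddTorus ι) := ⟨q, hq.continuous⟩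
  have hqc : Topology.IsQuotientMap qc := hq.isQuotientMap
  let F : C(UnitAddTorus ι, ℂ) := hqc.lift ⟨P, hP⟩ fun x y h ↦ hPq x y h
  have hF : ∀ x, F (fun i ↦ (x i : UnitAddCircle)) = P x := fun x ↦
    congr_arg (fun f : C(ι → ℝ, ℂ) ↦ f x) (hqc.lift_comp ⟨P, hP⟩ fun x y h ↦ hPq x y h)
  have hmF : ∀ (n : ι → ℤ) (x : ι → ℝ), UnitAddTorus.mFourier (-n) (fun i ↦ (x i : UnitAddCircle))
      = Complex.exp (-(2 * Real.pi * Complex.I) * ∑ i, ((n i : ℝ) : ℂ) * (x i : ℂ)) := by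
    intro n x
    simp only [UnitAddTorus.mFourier, ContinuousMap.coe_mk, fourier_coe_apply]
    rw [← Complex.exp_sum, Finset.mul_sum]
    congr 1
    refine Finset.sum_congr rfl fun i _ ↦ ?_
    simp
    ring
  have hcoeff : ∀ n, UnitAddTorus.mFourierCoeff F n =
      (|S.det|⁻¹ : ℝ) * gaussianFun (S⁻¹)ᵀ (fun i ↦ (n i : ℝ)) := by
    intro n
    rw [UnitAddTorus.mFourierCoeff_eq_integral _ _ 0, ← integral_gaussianFun_mul_exp S hS]
    obtain ⟨u, hu, hu'⟩ := exists_gaussianFun_bound S hS 1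
    have hperiod : ∀ (m : ι → ℤ) (x : ι → ℝ),
        UnitAddTorus.mFourier (-n) (fun i ↦ ((x + fun i ↦ (m i : ℝ)) i : UnitAddCircle)) =
        UnitAddTorus.mFourier (-n) (fun i ↦ (x i : UnitAddCircle)) := by
      intro m x
      congr 1
      exact ((map_coe_unitAddCircle_eq_iff _ _).mpr ⟨m, rfl⟩).symm
    simp_rw [← hmF]
    rw [integral_eq_setIntegral_tsum _ _ u hu]
    · have hset : {x : ι → ℝ | ∀ i, x i ∈ Ioc ((0 : ι → ℝ) i) ((0 : ι → ℝ) i + 1)} =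
          unitBox (0 : ι → ℤ) := by simp [unitBox]
      rw [hset]
      refine (setIntegral_congr_fun (measurableSet_unitBox _) fun x _ ↦ ?_)
      · beta_reduce
        rw [hF x, smul_eq_mul, ← tsum_mul_left]
        refine tsum_congr fun m ↦ ?_
        rw [hperiod]
    · intro m x hx
      rw [norm_mul]
      refine (mul_le_of_le_one_left (norm_nonneg _) ?_).trans (hu' m x hx)
      exact (ContinuousMap.norm_coe_le_norm _ _).trans UnitAddTorus.mFourier_norm.le
    · refine Continuous.mul ?_ (continuous_gaussianFun S)
      simp_rw [hmF]
      fun_prop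
  have hS' : IsUnit ((S⁻¹)ᵀ).det := by
    rw [det_transpose]
    exact (isUnit_nonsing_inv_det_iff).mpr hS
  have hsum : Summable (UnitAddTorus.mFourierCoeff F) := by
    obtain ⟨u, hu, hu'⟩ := exists_gaussianFun_bound (S⁻¹)ᵀ hS' 0
    simp_rw [funext hcoeff]
    refine Summable.mul_left _ (Summable.of_norm_bounded hu fun m ↦ ?_)
    simpa using hu' m 0 (by simp)
  have h := UnitAddTorus.hasSum_mFourier_series_apply_of_summable hsum
    (fun i ↦ ((0 : ι → ℝ) i : UnitAddCircle))
  rw [hF] at h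
  have hP0 : P 0 = ∑' m : ι → ℤ, gaussianFun S (fun i ↦ (m i : ℝ)) := by simp [P]
  rw [← hP0, ← h.tsum_eq, ← tsum_mul_left]
  refine tsum_congr fun n ↦ ?_
  have h1 := hmF (-n) 0
  rw [neg_neg] at h1
  rw [h1, hcoeff]
  simp

end PoissonGaussian

section NumberFieldTheta

open Matrix InfinitePlace

variable {K : Type*} [Field K] [NumberField K]

/-- The trace of a number field element in terms of infinite places. -/
theorem trace_eq_sum_infinitePlace (a : K) :
    (Algebra.trace ℚ K a : ℝ) = ∑ w : InfinitePlace K, (mult w : ℝ) * (w.embedding a).re := by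
  classical
  have h := trace_eq_sum_embeddings (K := ℚ) (L := K) ℂ (x := a)
  rw [Fintype.sum_equiv (RingHom.equivRatAlgHom (R := K) (S := ℂ)).symm (fun σ : K →ₐ[ℚ] ℂ ↦ σ a)
    (fun φ : K →+* ℂ ↦ φ a) (fun σ ↦ rfl)] at h
  have h2 := congr_arg Complex.re h
  rw [eq_ratCast, Complex.ratCast_re, Complex.re_sum,
    ← Finset.univ.sum_fiberwise (fun φ ↦ InfinitePlace.mk φ)] at h2
  rw [h2]
  refine Finset.sum_congr rfl fun w _ ↦ ?_
  rw [← card_filter_mk_eq, ← nsmul_eq_mul, ← Finset.sum_const]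
  refine Finset.sum_congr rfl fun φ hφ ↦ ?_
  rw [Finset.mem_filter] at hφ
  obtain h | h := mk_eq_iff.mp (hφ.2.trans (mk_embedding w).symm)
  · rw [h]
  · rw [← h, ComplexEmbedding.conjugate_coe_eq, Complex.conj_re]

variable (K) in
/-- Real coordinates on the Minkowski space of `K`. -/
abbrev PlaceCoord := Σ w : InfinitePlace K, Fin (mult w)

/-- The quadratic form `∑ d_w y_w |α|_w²`. -/
noncomputable def placeForm (y : InfinitePlace K → ℝ) (α : K) : ℝ :=
  ∑ w : InfinitePlace K, (mult w : ℝ) * y w * w α ^ 2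

/-- Real or imaginary part, with a sign in front of the imaginary part. -/
noncomputable def coordPart (ε : ℝ) (j : ℕ) (z : ℂ) : ℝ := if j = 0 then z.re else ε * z.im

theorem sum_coordPart (w : InfinitePlace K) (ε : ℝ) (a b : K) :
    ∑ j : Fin (mult w), coordPart 1 j (w.embedding a) * coordPart ε j (w.embedding b) =
      (w.embedding a).re * (w.embedding b).re + ε * (w.embedding a).im * (w.embedding b).im := by
  obtain hw | hw := w.isReal_or_isComplex
  · have h1 : ∀ c : K, (w.embedding c).im = 0 := by
      intro c
      exact Complex.conj_eq_iff_im.mp (RingHom.congr_fun (isReal_iff.mp hw) c)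
    have hm : mult w = 1 := mult_isReal ⟨w, hw⟩
    rw [hm]
    simp [coordPart, h1]
  · have hm : mult w = 2 := mult_isComplex ⟨w, hw⟩
    rw [hm, Fin.sum_univ_two]
    simp [coordPart]
    ring

theorem card_placeCoord : Fintype.card (PlaceCoord K) = Module.finrank ℚ K := by
  rw [Fintype.card_sigma, ← sum_mult_eq]
  simp

variable {ι : Type*} [Fintype ι] [DecidableEq ι] (b : Module.Basis ι ℚ K)

noncomputable def coordEquiv : ι ≃ PlaceCoord K :=
  Fintype.equivOfCardEq (by rw [card_placeCoord, Module.finrank_eq_card_basis b])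

/-- The matrix whose associated quadratic form is `placeForm` in the basis `v`. -/
noncomputable def placeMatrix (v : ι → K) (ε : ℝ) (y : InfinitePlace K → ℝ) : Matrix ι ι ℝ :=
  of fun i j ↦ √(mult (coordEquiv b i).1 * y (coordEquiv b i).1) *
    coordPart ε (coordEquiv b i).2 ((coordEquiv b i).1.embedding (v j))

theorem placeMatrix_mulVec (v : ι → K) (ε : ℝ) (y : InfinitePlace K → ℝ) (m : ι → ℤ) (i : ι) :
    (placeMatrix b v ε y *ᵥ fun j ↦ (m j : ℝ)) i =
      √(mult (coordEquiv b i).1 * y (coordEquiv b i).1) *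
        coordPart ε (coordEquiv b i).2 ((coordEquiv b i).1.embedding (∑ j, m j • v j)) := by
  have hadd : ∀ (j : ℕ) (z : ι → ℂ), coordPart ε j (∑ i, z i) = ∑ i, coordPart ε j (z i) := by
    intro j z
    unfold coordPart
    split_ifs <;> simp [Finset.mul_sum]
  have hsmul : ∀ (j : ℕ) (n : ℤ) (z : ℂ), coordPart ε j (n • z) = n * coordPart ε j z := by
    intro j n z
    unfold coordPart
    split_ifs <;> simp; ring
  rw [map_sum, hadd, Finset.mul_sum]
  simp only [mulVec, dotProduct, placeMatrix, of_apply, map_zsmul, hsmul]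
  exact Finset.sum_congr rfl fun j _ ↦ by ring

theorem sum_placeMatrix_mulVec_sq (v : ι → K) {ε : ℝ} (hε : ε ^ 2 = 1) {y : InfinitePlace K → ℝ}
    (hy : ∀ w, 0 < y w) (m : ι → ℤ) :
    ∑ i, (placeMatrix b v ε y *ᵥ fun j ↦ (m j : ℝ)) i ^ 2 = placeForm y (∑ j, m j • v j) := by
  simp_rw [placeMatrix_mulVec, mul_pow]
  set α := ∑ j, m j • v j
  rw [Fintype.sum_equiv (coordEquiv b) _ (fun p : PlaceCoord K ↦ √(mult p.1 * y p.1) ^ 2 *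
    coordPart ε p.2 (p.1.embedding α) ^ 2) (fun i ↦ rfl), Fintype.sum_sigma]
  refine Finset.sum_congr rfl fun w _ ↦ ?_
  have h := sum_coordPart w 1 α α
  simp only
  rw [← Finset.mul_sum, Real.sq_sqrt (mul_nonneg (by positivity) (hy w).le), ← norm_embedding_eq,
    ← Complex.normSq_eq_norm_sq, Complex.normSq_apply]
  congr 1
  rw [one_mul] at h
  rw [← h]
  refine Finset.sum_congr rfl fun j _ ↦ ?_
  unfold coordPart
  split_ifs
  · ring
  · linear_combination (((w.embedding α).im) ^ 2) * hε

theorem placeMatrix_transpose_mul (v v' : ι → K) {y y' : InfinitePlace K → ℝ}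
    (hy : ∀ w, 0 < y w) (hy' : ∀ w, y' w = (y w)⁻¹) :
    (placeMatrix b v 1 y)ᵀ * placeMatrix b v' (-1) y' =
      of fun i j ↦ (Algebra.trace ℚ K (v i * v' j) : ℝ) := by
  ext i j
  rw [mul_apply, of_apply, trace_eq_sum_infinitePlace]
  simp only [transpose_apply, placeMatrix, of_apply]
  rw [Fintype.sum_equiv (coordEquiv b) _ (fun p : PlaceCoord K ↦ (√(mult p.1 * y p.1) *
    coordPart 1 p.2 (p.1.embedding (v i))) * (√(mult p.1 * y' p.1) *
      coordPart (-1) p.2 (p.1.embedding (v' j)))) (fun i ↦ rfl), Fintype.sum_sigma]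
  refine Finset.sum_congr rfl fun w _ ↦ ?_
  have h := sum_coordPart w (-1) (v i) (v' j)
  have hs : √(mult w * y w) * √(mult w * y' w) = mult w := by
    rw [← Real.sqrt_mul (mul_nonneg (by positivity) (hy w).le), hy',
      show (mult w : ℝ) * y w * (mult w * (y w)⁻¹) = mult w ^ 2 by field_simp [(hy w).ne'],
      Real.sqrt_sq (by positivity)]
  have h2 : (w.embedding (v i * v' j)).re = (w.embedding (v i)).re * (w.embedding (v' j)).re +
      (-1) * (w.embedding (v i)).im * (w.embedding (v' j)).im := by
    rw [map_mul, Complex.mul_re]; ring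
  rw [h2, ← h, Finset.mul_sum]
  refine Finset.sum_congr rfl fun k _ ↦ ?_
  linear_combination (coordPart 1 k (w.embedding (v i)) *
    coordPart (-1) k (w.embedding (v' j))) * hs

/-- `placeMatrix` with inverted weights and conjugated coordinates differs by a diagonal matrix. -/
theorem placeMatrix_det_eq (v : ι → K) {y y' : InfinitePlace K → ℝ}
    (hy : ∀ w, 0 < y w) (hy' : ∀ w, y' w = (y w)⁻¹) :
    |(placeMatrix b v (-1) y').det| =
      (∏ w : InfinitePlace K, y w ^ mult w)⁻¹ * |(placeMatrix b v 1 y).det| := by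
  let d : ι → ℝ := fun i ↦ (y (coordEquiv b i).1)⁻¹ * coordPart (-1) (coordEquiv b i).2 (1 + Complex.I)
  have hfac : placeMatrix b v (-1) y' = diagonal d * placeMatrix b v 1 y := by
    ext i j
    rw [diagonal_mul]
    simp only [placeMatrix, of_apply, d, hy']
    have hs : √(mult (coordEquiv b i).1 * (y (coordEquiv b i).1)⁻¹) =
        (y (coordEquiv b i).1)⁻¹ * √(mult (coordEquiv b i).1 * (y (coordEquiv b i).1)) := by
      rw [Real.sqrt_eq_iff_mul_self_eq (mul_nonneg (by positivity) (inv_pos.mpr (hy _)).le)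
        (mul_nonneg (inv_pos.mpr (hy _)).le (by positivity)), mul_mul_mul_comm,
        Real.mul_self_sqrt (mul_nonneg (by positivity) (hy _).le)]
      have := (hy (coordEquiv b i).1).ne'
      field_simp
    rw [hs]
    unfold coordPart
    split_ifs <;> simp <;> ring
  rw [hfac, det_mul, abs_mul, det_diagonal, Finset.abs_prod]
  congr 1
  have hd : ∀ i, |d i| = (y (coordEquiv b i).1)⁻¹ := by
    intro i
    rw [abs_mul, abs_of_pos (inv_pos.mpr (hy _))]
    unfold coordPart
    split_ifs <;> simp
  simp_rw [hd]
  rw [Fintype.prod_equiv (coordEquiv b) _ (fun p : PlaceCoord K ↦ (y p.1)⁻¹) (fun i ↦ rfl),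
    Fintype.prod_sigma, ← Finset.prod_inv_distrib]
  exact Finset.prod_congr rfl fun w _ ↦ by simp

theorem abs_det_placeMatrix {y : InfinitePlace K → ℝ} (hy : ∀ w, 0 < y w) :
    |(placeMatrix b b 1 y).det| =
      √(|(Algebra.discr ℚ b : ℝ)| * ∏ w : InfinitePlace K, y w ^ mult w) := by
  have h := congr_arg (fun M ↦ |det M|)
    (placeMatrix_transpose_mul b b b hy (y' := fun w ↦ (y w)⁻¹) fun _ ↦ rfl)
  simp only [det_mul, det_transpose, abs_mul] at h
  rw [placeMatrix_det_eq b b hy fun _ ↦ rfl] at h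
  have h2 : (of fun i j ↦ (Algebra.trace ℚ K (b i * b j) : ℝ)).det = (Algebra.discr ℚ b : ℝ) := by
    rw [Algebra.discr_def, ← eq_ratCast (algebraMap ℚ ℝ), RingHom.map_det]
    congr 1
  rw [h2] at h
  have hp : 0 < ∏ w : InfinitePlace K, y w ^ mult w := Finset.prod_pos fun w _ ↦ pow_pos (hy w) _
  rw [eq_comm, Real.sqrt_eq_iff_mul_self_eq (by positivity) (abs_nonneg _), ← h]
  field_simp

theorem gaussianFun_placeMatrix (v : ι → K) {ε : ℝ} (hε : ε ^ 2 = 1) {y : InfinitePlace K → ℝ}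
    (hy : ∀ w, 0 < y w) (m : ι → ℤ) :
    gaussianFun (placeMatrix b v ε y) (fun j ↦ (m j : ℝ)) =
      (Real.exp (-Real.pi * placeForm y (∑ j, m j • v j)) : ℝ) := by
  rw [← sum_placeMatrix_mulVec_sq b v hε hy, gaussianFun]
  push_cast
  rfl

theorem isUnit_det_placeMatrix {y : InfinitePlace K → ℝ} (hy : ∀ w, 0 < y w) :
    IsUnit (placeMatrix b b 1 y).det := by
  have hp : 0 < ∏ w : InfinitePlace K, y w ^ mult w := Finset.prod_pos fun w _ ↦ pow_pos (hy w) _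
  have hd := Algebra.discr_not_zero_of_basis ℚ b
  have hd' : (0 : ℝ) < |(Algebra.discr ℚ b : ℝ)| := by simpa using hd
  rw [isUnit_iff_ne_zero, ← abs_pos, abs_det_placeMatrix b hy]
  positivity

theorem summable_exp_placeForm {y : InfinitePlace K → ℝ} (hy : ∀ w, 0 < y w) :
    Summable fun m : ι → ℤ ↦ Real.exp (-Real.pi * placeForm y (∑ j, m j • b j)) := by
  obtain ⟨u, hu, hu'⟩ := exists_gaussianFun_bound _ (isUnit_det_placeMatrix b hy) 0
  refine Summable.of_norm_bounded hu fun m ↦ ?_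
  have h := hu' m 0 (by simp)
  rw [zero_add, gaussianFun_placeMatrix b b (by simp) hy, Complex.norm_real] at h
  exact h

/-- The theta transformation formula of a lattice in a number field. -/
theorem tsum_exp_placeForm {y y' : InfinitePlace K → ℝ} (hy : ∀ w, 0 < y w)
    (hy' : ∀ w, y' w = (y w)⁻¹) :
    ∑' m : ι → ℤ, Real.exp (-Real.pi * placeForm y (∑ j, m j • b j)) =
      (√(|(Algebra.discr ℚ b : ℝ)| * ∏ w : InfinitePlace K, y w ^ mult w))⁻¹ *
      ∑' m : ι → ℤ, Real.exp (-Real.pi * placeForm y' (∑ j, m j • b.traceDual j)) := by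
  have hS := isUnit_det_placeMatrix b hy
  have h := tsum_gaussianFun _ hS
  have hdual : ((placeMatrix b b 1 y)⁻¹)ᵀ = placeMatrix b b.traceDual (-1) y' := by
    have h1 := placeMatrix_transpose_mul b b b.traceDual hy hy'
    rw [show (of fun i j ↦ (Algebra.trace ℚ K (b i * b.traceDual j) : ℝ)) = 1 by
      ext i j
      rw [of_apply, Module.Basis.trace_mul_traceDual, one_apply]
      split_ifs <;> simp] at h1
    rw [transpose_nonsing_inv]
    exact inv_eq_right_inv h1
  have hypos' : ∀ w, 0 < y' w := fun w ↦ by rw [hy']; exact inv_pos.mpr (hy w)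
  rw [hdual, abs_det_placeMatrix b hy] at h
  simp_rw [gaussianFun_placeMatrix b _ (by simp : (1 : ℝ) ^ 2 = 1) hy,
    gaussianFun_placeMatrix b _ (by simp : (-1 : ℝ) ^ 2 = 1) hypos'] at h
  exact_mod_cast h

end NumberFieldTheta

section IdealTheta

open Matrix InfinitePlace nonZeroDivisors

variable {K : Type*} [Field K] [NumberField K]

/-- Integral coordinates on the lattice spanned by a basis. -/
noncomputable def latticeEquiv {ι : Type*} [Fintype ι] (b : Module.Basis ι ℚ K)
    (J : FractionalIdeal (𝓞 K)⁰ K) (hb : ∀ x, x ∈ Submodule.span ℤ (Set.range b) ↔ x ∈ J) :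
    (ι → ℤ) ≃ {α : K // α ∈ J} :=
  (b.restrictScalars ℤ).equivFun.symm.toEquiv.trans (Equiv.subtypeEquivRight hb)

theorem latticeEquiv_apply {ι : Type*} [Fintype ι] (b : Module.Basis ι ℚ K)
    (J : FractionalIdeal (𝓞 K)⁰ K) (hb : ∀ x, x ∈ Submodule.span ℤ (Set.range b) ↔ x ∈ J)
    (m : ι → ℤ) : (latticeEquiv b J hb m : K) = ∑ j, m j • b j := by
  simp [latticeEquiv, Module.Basis.equivFun_symm_apply]

/-- The trace dual of an invertible fractional ideal. -/
noncomputable def dualIdeal (J : (FractionalIdeal (𝓞 K)⁰ K)ˣ) : (FractionalIdeal (𝓞 K)⁰ K)ˣ :=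
  Units.mk0 (FractionalIdeal.dual ℤ ℚ (J : FractionalIdeal (𝓞 K)⁰ K))
    (FractionalIdeal.dual_ne_zero ℤ ℚ J.ne_zero)

theorem dualIdeal_dualIdeal (J : (FractionalIdeal (𝓞 K)⁰ K)ˣ) : dualIdeal (dualIdeal J) = J :=
  Units.ext (FractionalIdeal.dual_dual ℤ ℚ _)

theorem dualIdeal_eq_mul_inv (J : (FractionalIdeal (𝓞 K)⁰ K)ˣ) :
    dualIdeal J = dualIdeal 1 * J⁻¹ :=
  Units.ext (by
    simpa [dualIdeal] using FractionalIdeal.dual_eq_mul_inv ℤ ℚ (J : FractionalIdeal (𝓞 K)⁰ K))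

/-- The theta function of a fractional ideal. -/
noncomputable def idealTheta (J : (FractionalIdeal (𝓞 K)⁰ K)ˣ) (y : InfinitePlace K → ℝ) : ℝ :=
  ∑' α : {α : K // α ∈ (J : FractionalIdeal (𝓞 K)⁰ K)}, Real.exp (-Real.pi * placeForm y (α : K))

theorem summable_idealTheta (J : (FractionalIdeal (𝓞 K)⁰ K)ˣ) {y : InfinitePlace K → ℝ}
    (hy : ∀ w, 0 < y w) :
    Summable fun α : {α : K // α ∈ (J : FractionalIdeal (𝓞 K)⁰ K)} ↦
      Real.exp (-Real.pi * placeForm y (α : K)) := by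
  classical
  rw [← (latticeEquiv (basisOfFractionalIdeal K J) J
    fun x ↦ mem_span_basisOfFractionalIdeal K).summable_iff]
  refine (summable_exp_placeForm (basisOfFractionalIdeal K J) hy).congr fun m ↦ ?_
  simp only [Function.comp_apply, latticeEquiv_apply]

theorem idealTheta_pos (J : (FractionalIdeal (𝓞 K)⁰ K)ˣ) {y : InfinitePlace K → ℝ}
    (hy : ∀ w, 0 < y w) : 0 < idealTheta J y :=
  (summable_idealTheta J hy).tsum_pos (fun _ ↦ (Real.exp_pos _).le)
    ⟨0, FractionalIdeal.zero_mem _⟩ (Real.exp_pos _)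

theorem abs_discr_basisOfFractionalIdeal (J : (FractionalIdeal (𝓞 K)⁰ K)ˣ) 
    [DecidableEq (Module.Free.ChooseBasisIndex ℤ J)] :
    |(Algebra.discr ℚ (basisOfFractionalIdeal K J) : ℝ)| =
      (FractionalIdeal.absNorm (J : FractionalIdeal (𝓞 K)⁰ K) : ℝ) ^ 2 * |(discr K : ℝ)| := by
  classical
  have hcard := fractionalIdeal_rank K J
  rw [Module.finrank_eq_card_chooseBasisIndex, Module.finrank_eq_card_chooseBasisIndex] at hcard
  let e := Fintype.equivOfCardEq hcard.symm
  have h1 := det_basisOfFractionalIdeal_eq_absNorm K J e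
  have h2 := Algebra.discr_of_matrix_vecMul (A := ℚ) (integralBasis K : _ → K)
    ((integralBasis K).toMatrix ((basisOfFractionalIdeal K J).reindex e.symm))
  have h3 : (integralBasis K : _ → K) ᵥ* (((integralBasis K).toMatrix
      ((basisOfFractionalIdeal K J).reindex e.symm)).map (algebraMap ℚ K)) =
      (basisOfFractionalIdeal K J).reindex e.symm := by
    funext i
    simp only [vecMul, dotProduct, map_apply]
    conv_rhs => rw [← (integralBasis K).sum_repr ((basisOfFractionalIdeal K J).reindex e.symm i)]
    refine Finset.sum_congr rfl fun j _ ↦ ?_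
    rw [Module.Basis.toMatrix_apply, Algebra.smul_def, mul_comm]
  rw [h3, ← Module.Basis.det_apply, Module.Basis.coe_reindex, Algebra.discr_reindex,
    ← coe_discr, ← sq_abs, ← Module.Basis.coe_reindex, h1] at h2
  rw [h2]
  push_cast
  rw [abs_mul, abs_of_nonneg (by positivity : (0:ℝ) ≤ (FractionalIdeal.absNorm (J : FractionalIdeal (𝓞 K)⁰ K) : ℝ) ^ 2)]

theorem absNorm_pos (J : (FractionalIdeal (𝓞 K)⁰ K)ˣ) :
    (0 : ℝ) < FractionalIdeal.absNorm (J : FractionalIdeal (𝓞 K)⁰ K) := by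
  have h1 := FractionalIdeal.absNorm_nonneg (J : FractionalIdeal (𝓞 K)⁰ K)
  have h2 : FractionalIdeal.absNorm (J : FractionalIdeal (𝓞 K)⁰ K) ≠ 0 :=
    fun h ↦ J.ne_zero (FractionalIdeal.absNorm_eq_zero_iff.mp h)
  exact_mod_cast h1.lt_of_ne' h2

/-- The square root of the absolute discriminant of a fractional ideal. -/
noncomputable def idealCovol (J : (FractionalIdeal (𝓞 K)⁰ K)ˣ) : ℝ :=
  FractionalIdeal.absNorm (J : FractionalIdeal (𝓞 K)⁰ K) * √|(discr K : ℝ)|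

theorem idealCovol_pos (J : (FractionalIdeal (𝓞 K)⁰ K)ˣ) : 0 < idealCovol J := by
  have h : (0 : ℝ) < |(discr K : ℝ)| := by simpa using discr_ne_zero K
  exact mul_pos (absNorm_pos J) (Real.sqrt_pos.mpr h)

theorem idealTheta_eq (J : (FractionalIdeal (𝓞 K)⁰ K)ˣ) {y y' : InfinitePlace K → ℝ}
    (hy : ∀ w, 0 < y w) (hy' : ∀ w, y' w = (y w)⁻¹) :
    idealTheta J y = (idealCovol J * √(∏ w : InfinitePlace K, y w ^ mult w))⁻¹ *
      idealTheta (dualIdeal J) y' := by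
  classical
  have hb : ∀ x, x ∈ Submodule.span ℤ (Set.range (basisOfFractionalIdeal K J)) ↔
    x ∈ (J : FractionalIdeal (𝓞 K)⁰ K) := fun x ↦ mem_span_basisOfFractionalIdeal K
  have hb' : ∀ x, x ∈ Submodule.span ℤ (Set.range (basisOfFractionalIdeal K J).traceDual) ↔
      x ∈ (dualIdeal J : FractionalIdeal (𝓞 K)⁰ K) := by
    intro x
    have h1 := Submodule.traceDual_span_of_basis ℤ (K := ℚ)
      (J : Submodule (𝓞 K) K) (basisOfFractionalIdeal K J) (by
        ext x
        exact (hb x).symm)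
    rw [← h1]
    simp only [dualIdeal, Units.val_mk0, Submodule.restrictScalars_mem]
    rw [← FractionalIdeal.mem_coe, FractionalIdeal.coe_dual _ _ J.ne_zero]
  have h := tsum_exp_placeForm (basisOfFractionalIdeal K J) hy hy'
  rw [abs_discr_basisOfFractionalIdeal, mul_assoc, Real.sqrt_mul (by positivity),
    Real.sqrt_sq (absNorm_pos J).le, Real.sqrt_mul (abs_nonneg _), ← mul_assoc] at h
  rw [idealTheta, idealTheta, ← (latticeEquiv _ _ hb).tsum_eq, ← (latticeEquiv _ _ hb').tsum_eq]
  simp_rw [latticeEquiv_apply]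
  exact h

theorem idealCovol_mul_dualIdeal (J : (FractionalIdeal (𝓞 K)⁰ K)ˣ) :
    idealCovol J * idealCovol (dualIdeal J) = 1 := by
  have h1 := idealTheta_eq J (y := fun _ ↦ 1) (y' := fun _ ↦ 1) (by simp) (by simp)
  have h2 := idealTheta_eq (dualIdeal J) (y := fun _ ↦ 1) (y' := fun _ ↦ 1) (by simp) (by simp)
  rw [dualIdeal_dualIdeal] at h2
  have h3 := idealTheta_pos J (y := fun _ ↦ 1) (by simp)
  have h4 := idealCovol_pos J
  have h5 := idealCovol_pos (dualIdeal J)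
  simp only [one_pow, Finset.prod_const_one, Real.sqrt_one, mul_one] at h1 h2
  rw [h2, ← mul_assoc, ← mul_inv] at h1
  have h6 : (idealCovol J * idealCovol (dualIdeal J))⁻¹ = 1 := by
    refine mul_right_cancel₀ h3.ne' ?_
    rw [one_mul, ← h1]
  exact inv_eq_one.mp h6

end IdealTheta

section HeckeWeight

open InfinitePlace Units Units.dirichletUnitTheorem nonZeroDivisors
open scoped ENNReal

variable {K : Type*} [Field K] [NumberField K]

open scoped Classical in
/-- The trace-zero vector of scaling exponents attached to a point of the log space. -/
noncomputable def logScale (x : logSpace K) (w : InfinitePlace K) : ℝ :=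
  if h : w = w₀ then -(∑ v, x v) / mult (w₀ : InfinitePlace K) else x ⟨w, h⟩ / mult w

theorem mult_cast_pos (w : InfinitePlace K) : (0 : ℝ) < mult w := by exact_mod_cast mult_pos

theorem sum_mult_mul_logScale (x : logSpace K) :
    ∑ w : InfinitePlace K, mult w * logScale x w = 0 := by
  classical
  have h0 := (mult_cast_pos (w₀ : InfinitePlace K)).ne'
  rw [Fintype.sum_eq_add_sum_subtype_ne _ w₀]
  have h1 : ∀ v : {w : InfinitePlace K // w ≠ w₀}, mult v.1 * logScale x v.1 = x v := by
    intro v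
    rw [logScale, dif_neg v.2, mul_div_cancel₀ _ (mult_cast_pos v.1).ne']
  simp only [h1]
  rw [logScale, dif_pos rfl, mul_div_cancel₀ _ h0]
  simp

theorem logScale_add (x y : logSpace K) (w : InfinitePlace K) :
    logScale (x + y) w = logScale x w + logScale y w := by
  unfold logScale
  split_ifs with h
  · simp only [Pi.add_apply, Finset.sum_add_distrib]; ring
  · simp only [Pi.add_apply]; ring

theorem logScale_neg (x : logSpace K) (w : InfinitePlace K) :
    logScale (-x) w = -logScale x w := by
  unfold logScale
  split_ifs with h
  · simp only [Pi.neg_apply, Finset.sum_neg_distrib]; ring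
  · simp only [Pi.neg_apply]; ring

theorem continuous_logScale (w : InfinitePlace K) :
    Continuous fun x : logSpace K ↦ logScale x w := by
  unfold logScale
  split_ifs with h <;> fun_prop

theorem logScale_of_sum_eq_zero (v : InfinitePlace K → ℝ) (hv : ∑ w, mult w * v w = 0)
    (w : InfinitePlace K) : logScale (fun w ↦ mult w.1 * v w.1) w = v w := by
  classical
  have h0 := (mult_cast_pos w).ne'
  unfold logScale
  split_ifs with h
  · subst h
    rw [Fintype.sum_eq_add_sum_subtype_ne _ w₀] at hv
    rw [div_eq_iff h0]
    linarith
  · rw [mul_div_cancel_left₀ _ h0]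

/-- The weights of the quadratic form occurring in Hecke's integral. -/
noncomputable def heckeWeight (c : ℝ) (x : logSpace K) (w : InfinitePlace K) : ℝ :=
  c * Real.exp (2 * logScale x w)

theorem heckeWeight_pos {c : ℝ} (hc : 0 < c) (x : logSpace K) (w : InfinitePlace K) :
    0 < heckeWeight c x w := mul_pos hc (Real.exp_pos _)

theorem prod_heckeWeight (c : ℝ) (x : logSpace K) :
    ∏ w : InfinitePlace K, heckeWeight c x w ^ mult w = c ^ Module.finrank ℚ K := by
  simp only [heckeWeight, mul_pow, Finset.prod_mul_distrib, ← Real.exp_nat_mul]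
  rw [← Real.exp_sum, Finset.prod_pow_eq_pow_sum, sum_mult_eq]
  have : ∑ w : InfinitePlace K, (mult w : ℝ) * (2 * logScale x w) = 0 := by
    have h : (2 : ℝ) * ∑ w : InfinitePlace K, mult w * logScale x w = 0 := by
      rw [sum_mult_mul_logScale, mul_zero]
    rw [← h, Finset.mul_sum]
    exact Finset.sum_congr rfl fun _ _ ↦ by ring
  rw [this, Real.exp_zero, mul_one]

theorem heckeWeight_inv (c : ℝ) (x : logSpace K) (w : InfinitePlace K) :
    heckeWeight c⁻¹ (-x) w = (heckeWeight c x w)⁻¹ := by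
  simp [heckeWeight, logScale_neg, Real.exp_neg, mul_comm]

theorem placeForm_heckeWeight_unit (c : ℝ) (x : logSpace K) (u : (𝓞 K)ˣ) (α : K) :
    placeForm (heckeWeight c x) ((u : K) * α) =
      placeForm (heckeWeight c (x + logEmbedding K (Additive.ofMul u))) α := by
  refine Finset.sum_congr rfl fun w _ ↦ ?_
  have h1 : logScale (logEmbedding K (Additive.ofMul u)) w = Real.log (w (u : K)) :=
    logScale_of_sum_eq_zero (fun w ↦ Real.log (w (u : K))) (sum_mult_mul_log u) w
  have hu : 0 < w (u : K) := pos_iff.mpr (by simp)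
  rw [heckeWeight, heckeWeight, logScale_add, h1, map_mul, mul_pow, mul_add, Real.exp_add,
    two_mul (Real.log _), Real.exp_add, Real.exp_log hu]
  ring

theorem exists_placeForm_heckeWeight {α : K} (hα : α ≠ 0) : ∃ z : logSpace K,
    ∀ (c : ℝ) (x : logSpace K), placeForm (heckeWeight c x) α =
      placeForm (heckeWeight
        (c * |(Algebra.norm ℚ α : ℝ)| ^ (2 / (Module.finrank ℚ K : ℝ))) (x + z)) 1 := by
  set n : ℝ := (Module.finrank ℚ K : ℝ) with hn
  have hn0 : n ≠ 0 := by
    simpa [hn] using (Module.finrank_pos (R := ℚ) (M := K)).ne'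
  set N : ℝ := |(Algebra.norm ℚ α : ℝ)| with hN
  have hN0 : 0 < N := by
    rw [hN, abs_pos]
    exact_mod_cast (Algebra.norm_ne_zero_iff (R := ℚ)).mpr hα
  have hprod : ∏ w : InfinitePlace K, w α ^ mult w = N := by
    rw [InfinitePlace.prod_eq_abs_norm, hN]; push_cast; rfl
  have hw : ∀ w : InfinitePlace K, 0 < w α := fun w ↦ pos_iff.mpr hα
  let v : InfinitePlace K → ℝ := fun w ↦ Real.log (w α) - Real.log N / n
  have hv : ∑ w : InfinitePlace K, mult w * v w = 0 := by
    have h1 : Real.log N = ∑ w : InfinitePlace K, mult w * Real.log (w α) := by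
      rw [← hprod, Real.log_prod fun w _ ↦ (pow_pos (hw w) _).ne']
      simp
    have h2 : (∑ w : InfinitePlace K, (mult w : ℝ)) = n := by
      rw [hn, ← sum_mult_eq]; push_cast; rfl
    simp only [v, mul_sub, Finset.sum_sub_distrib, ← h1, ← Finset.sum_mul, h2]
    field_simp
    ring
  refine ⟨fun w ↦ mult w.1 * v w.1, fun c x ↦ Finset.sum_congr rfl fun w _ ↦ ?_⟩
  rw [heckeWeight, heckeWeight, logScale_add, logScale_of_sum_eq_zero v hv, map_one, one_pow,
    Real.rpow_def_of_pos hN0]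
  have h3 : w α ^ 2 = Real.exp (2 * Real.log (w α)) := by
    conv_lhs => rw [← Real.exp_log (hw w), ← Real.exp_nat_mul]
    push_cast
    rfl
  rw [h3]
  have h4 : Real.exp (2 * (logScale x w + v w)) * Real.exp (Real.log N * (2 / n)) =
      Real.exp (2 * logScale x w) * Real.exp (2 * Real.log (w α)) := by
    rw [← Real.exp_add, ← Real.exp_add]
    congr 1
    simp only [v]
    ring
  linear_combination (-(mult w : ℝ) * c) * h4

end HeckeWeight

section IdealGenerators

open nonZeroDivisors FractionalIdeal

variable {K : Type*} [Field K] [NumberField K]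

theorem mk_eq_one_iff_exists_spanSingleton (I : (FractionalIdeal (𝓞 K)⁰ K)ˣ) :
    ClassGroup.mk K I = 1 ↔
      ∃ x : K, (I : FractionalIdeal (𝓞 K)⁰ K) = spanSingleton (𝓞 K)⁰ x := by
  rw [ClassGroup.mk_eq_one_iff]
  constructor
  · intro hI
    obtain ⟨x, hx⟩ := @Submodule.IsPrincipal.principal _ _ _ _ _ _ hI
    refine ⟨x, Subtype.coe_injective ?_⟩
    simp only [val_eq_coe, hx, coe_spanSingleton]
  · rintro ⟨x, hx⟩
    exact ⟨⟨x, by rw [hx, coe_spanSingleton]⟩⟩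

/-- Nonzero elements of representatives of the ideal classes correspond to pairs of a nonzero
integral ideal and a unit. -/
theorem exists_equiv_sigma_classGroup (J : ClassGroup (𝓞 K) → (FractionalIdeal (𝓞 K)⁰ K)ˣ)
    (hJ : Function.Bijective fun c ↦ ClassGroup.mk K (J c)) :
    ∃ (e : (Ideal (𝓞 K))⁰ × (𝓞 K)ˣ ≃ Σ c, {α : K // α ∈ (J c : FractionalIdeal (𝓞 K)⁰ K) ∧ α ≠ 0})
      (cl : (Ideal (𝓞 K))⁰ → ClassGroup (𝓞 K)) (a : (Ideal (𝓞 K))⁰ → K),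
      (∀ I u, (e (I, u)).1 = cl I ∧ ((e (I, u)).2 : K) = u * a I) ∧
      ∀ I, a I ≠ 0 ∧ |(Algebra.norm ℚ (a I) : ℝ)| = Ideal.absNorm (I : Ideal (𝓞 K)) *
        FractionalIdeal.absNorm (J (cl I) : FractionalIdeal (𝓞 K)⁰ K) := by
  have key : ∀ I : (Ideal (𝓞 K))⁰, ∃ c : ClassGroup (𝓞 K), ∃ a : K,
      (FractionalIdeal.mk0 K I * J c : FractionalIdeal (𝓞 K)⁰ K) = spanSingleton (𝓞 K)⁰ a := by
    intro I
    obtain ⟨c, hc⟩ := hJ.2 (ClassGroup.mk K (FractionalIdeal.mk0 K I))⁻¹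
    have h1 : ClassGroup.mk K (FractionalIdeal.mk0 K I * J c) = 1 := by
      rw [map_mul]
      simp only at hc
      rw [hc, mul_inv_cancel]
    obtain ⟨a, ha⟩ := (mk_eq_one_iff_exists_spanSingleton _).mp h1
    exact ⟨c, a, by rw [← ha, Units.val_mul]⟩
  choose cl a ha using key
  have ha0 : ∀ I, a I ≠ 0 := by
    intro I h
    have h1 := ha I
    rw [h, spanSingleton_zero] at h1
    exact (FractionalIdeal.mk0 K I * J (cl I)).ne_zero h1
  have hmem : ∀ I (u : (𝓞 K)ˣ), (u : K) * a I ∈ (J (cl I) : FractionalIdeal (𝓞 K)⁰ K) := by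
    intro I u
    have h1 : a I ∈ (J (cl I) : FractionalIdeal (𝓞 K)⁰ K) := by
      rw [← spanSingleton_le_iff_mem, ← ha I]
      calc (FractionalIdeal.mk0 K I * J (cl I) : FractionalIdeal (𝓞 K)⁰ K)
          ≤ 1 * J (cl I) := by
            gcongr
            exact coeIdeal_le_one
        _ = J (cl I) := one_mul _
    have := Submodule.smul_mem (J (cl I) : Submodule (𝓞 K) K) (u : 𝓞 K) h1
    rwa [Algebra.smul_def] at this
  let Φ : (Ideal (𝓞 K))⁰ × (𝓞 K)ˣ → Σ c, {α : K // α ∈ (J c : FractionalIdeal (𝓞 K)⁰ K) ∧ α ≠ 0} :=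
    fun p ↦ ⟨cl p.1, (p.2 : K) * a p.1, hmem p.1 p.2, mul_ne_zero (by simp) (ha0 p.1)⟩
  have hspan : ∀ I (u : (𝓞 K)ˣ), spanSingleton (𝓞 K)⁰ ((u : K) * a I) =
      spanSingleton (𝓞 K)⁰ (a I) := by
    intro I u
    refine (spanSingleton_eq_spanSingleton.mpr ⟨u, ?_⟩).symm
    rw [Units.smul_def, Algebra.smul_def]
  have hΦ : Function.Bijective Φ := by
    constructor
    · rintro ⟨I, u⟩ ⟨I', u'⟩ h
      simp only [Φ, Sigma.mk.injEq] at h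
      obtain ⟨h1, h2⟩ := h
      have h3 : (u : K) * a I = u' * a I' := by
        have : ∀ (c c' : ClassGroup (𝓞 K)) (_ : c = c')
            (x : {α : K // α ∈ (J c : FractionalIdeal (𝓞 K)⁰ K) ∧ α ≠ 0})
            (x' : {α : K // α ∈ (J c' : FractionalIdeal (𝓞 K)⁰ K) ∧ α ≠ 0}),
            x ≍ x' → (x : K) = x' := by
          rintro c _ rfl x x' hx
          rw [eq_of_heq hx]
        exact this _ _ h1 _ _ h2
      have h4 : (FractionalIdeal.mk0 K I : FractionalIdeal (𝓞 K)⁰ K) = FractionalIdeal.mk0 K I' := by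
        have h5 : (FractionalIdeal.mk0 K I * J (cl I) : FractionalIdeal (𝓞 K)⁰ K) =
            FractionalIdeal.mk0 K I' * J (cl I) := by
          rw [ha I, h1, ha I', ← hspan I u, h3, hspan]
        exact (J (cl I)).isUnit.mul_right_cancel h5
      have h5 : I = I' := by
        rw [FractionalIdeal.coe_mk0, FractionalIdeal.coe_mk0] at h4
        exact Subtype.ext (coeIdeal_injective h4)
      subst h5
      have h6 := mul_right_cancel₀ (ha0 I) h3
      have h7 : u = u' := Units.coe_injective K h6
      rw [h7]
    · rintro ⟨c, α, hα, hα0⟩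
      have h1 : spanSingleton (𝓞 K)⁰ α * (J c : FractionalIdeal (𝓞 K)⁰ K)⁻¹ ≤ 1 := by
        calc spanSingleton (𝓞 K)⁰ α * (J c : FractionalIdeal (𝓞 K)⁰ K)⁻¹
            ≤ J c * (J c : FractionalIdeal (𝓞 K)⁰ K)⁻¹ := by
              gcongr
              exact spanSingleton_le_iff_mem.mpr hα
          _ = 1 := mul_inv_cancel₀ (J c).ne_zero
      obtain ⟨I, hI⟩ := le_one_iff_exists_coeIdeal.mp h1
      have hI1 : (I : FractionalIdeal (𝓞 K)⁰ K) * J c = spanSingleton (𝓞 K)⁰ α := by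
        rw [hI, mul_assoc, inv_mul_cancel₀ (J c).ne_zero, mul_one]
      have hI0 : I ∈ (Ideal (𝓞 K))⁰ := by
        refine mem_nonZeroDivisors_iff_ne_zero.mpr fun h ↦ hα0 ?_
        rw [h] at hI1
        exact spanSingleton_eq_zero_iff.mp (by simpa [eq_comm] using hI1)
      have hc : cl ⟨I, hI0⟩ = c := by
        apply hJ.1
        have h2 : ClassGroup.mk K (FractionalIdeal.mk0 K ⟨I, hI0⟩ * J (cl ⟨I, hI0⟩)) = 1 :=
          (mk_eq_one_iff_exists_spanSingleton _).mpr ⟨_, by rw [Units.val_mul, ha]⟩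
        have h3 : ClassGroup.mk K (FractionalIdeal.mk0 K ⟨I, hI0⟩ * J c) = 1 :=
          (mk_eq_one_iff_exists_spanSingleton _).mpr ⟨α, by
            rw [Units.val_mul, FractionalIdeal.coe_mk0, hI1]⟩
        rw [map_mul] at h2 h3
        exact mul_left_cancel (h2.trans h3.symm)
      have h2 := ha ⟨I, hI0⟩
      rw [hc, FractionalIdeal.coe_mk0, hI1, eq_comm, spanSingleton_eq_spanSingleton] at h2
      obtain ⟨u, hu⟩ := h2
      rw [Units.smul_def, Algebra.smul_def] at hu
      refine ⟨(⟨I, hI0⟩, u), ?_⟩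
      have : ∀ (c c' : ClassGroup (𝓞 K)) (_ : c = c') (x y : K) (_ : x = y)
          (hx : x ∈ (J c : FractionalIdeal (𝓞 K)⁰ K) ∧ x ≠ 0)
          (hy : y ∈ (J c' : FractionalIdeal (𝓞 K)⁰ K) ∧ y ≠ 0),
          (⟨c, x, hx⟩ : Σ c, {α : K // α ∈ (J c : FractionalIdeal (𝓞 K)⁰ K) ∧ α ≠ 0}) =
            ⟨c', y, hy⟩ := by
        rintro c _ rfl x _ rfl hx hy
        rfl
      exact this _ _ hc _ _ hu _ _
  refine ⟨Equiv.ofBijective Φ hΦ, cl, a, fun I u ↦ ⟨rfl, rfl⟩, fun I ↦ ⟨ha0 I, ?_⟩⟩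
  have h1 := congrArg FractionalIdeal.absNorm (ha I)
  rw [map_mul, FractionalIdeal.coe_mk0, coeIdeal_absNorm, absNorm_span_singleton] at h1
  have h2 := congrArg (fun q : ℚ ↦ (q : ℝ)) h1
  push_cast at h2
  exact h2.symm

end IdealGenerators

section HeckeIntegral

open InfinitePlace Units Units.dirichletUnitTheorem nonZeroDivisors
open scoped ENNReal Classical

variable {K : Type*} [Field K] [NumberField K]

theorem placeForm_nonneg {y : InfinitePlace K → ℝ} (hy : ∀ w, 0 ≤ y w) (α : K) :
    0 ≤ placeForm y α :=
  Finset.sum_nonneg fun w _ ↦ mul_nonneg (mul_nonneg (mult_cast_pos w).le (hy w)) (sq_nonneg _)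

theorem placeForm_mono {y y' : InfinitePlace K → ℝ} (h : ∀ w, y w ≤ y' w) (α : K) :
    placeForm y α ≤ placeForm y' α := by
  refine Finset.sum_le_sum fun w _ ↦ ?_
  gcongr
  exact h w

theorem placeForm_smul (c : ℝ) (y : InfinitePlace K → ℝ) (α : K) :
    placeForm (fun w ↦ c * y w) α = c * placeForm y α := by
  rw [placeForm, placeForm, Finset.mul_sum]
  exact Finset.sum_congr rfl fun w _ ↦ by ring

theorem heckeWeight_eq_mul (c : ℝ) (x : logSpace K) :
    heckeWeight c x = fun w ↦ c * heckeWeight 1 x w := by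
  funext w
  simp [heckeWeight]

theorem placeForm_heckeWeight (c : ℝ) (x : logSpace K) (α : K) :
    placeForm (heckeWeight c x) α = c * placeForm (heckeWeight 1 x) α := by
  rw [heckeWeight_eq_mul, placeForm_smul]

theorem continuous_placeForm_heckeWeight (α : K) :
    Continuous fun p : ℝ × logSpace K ↦ placeForm (heckeWeight p.1 p.2) α := by
  unfold placeForm heckeWeight
  refine continuous_finsetSum _ fun w _ ↦ ?_
  have := (continuous_logScale w).comp (continuous_snd (X := ℝ) (Y := logSpace K))
  simp only [Function.comp_def] at this
  fun_prop

theorem idealTheta_anti (J : (FractionalIdeal (𝓞 K)⁰ K)ˣ) {y y' : InfinitePlace K → ℝ}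
    (hy : ∀ w, 0 < y w) (h : ∀ w, y w ≤ y' w) : idealTheta J y' ≤ idealTheta J y := by
  refine (summable_idealTheta J fun w ↦ (hy w).trans_le (h w)).tsum_le_tsum (fun α ↦ ?_)
    (summable_idealTheta J hy)
  have := placeForm_mono h (α : K)
  have := Real.pi_pos
  refine Real.exp_le_exp.mpr ?_
  nlinarith

theorem exists_le_placeForm (J : (FractionalIdeal (𝓞 K)⁰ K)ˣ) : ∃ δ : ℝ, 0 < δ ∧
    ∀ α : K, α ∈ (J : FractionalIdeal (𝓞 K)⁰ K) → α ≠ 0 → δ ≤ placeForm (fun _ ↦ 1) α := by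
  have hs := (summable_idealTheta J (y := fun _ ↦ 1) (by simp)).tendsto_cofinite_zero
  have hev := hs.eventually (gt_mem_nhds (Real.exp_pos (-Real.pi)))
  rw [Filter.eventually_cofinite] at hev
  set S := hev.toFinset with hS
  have hpos : ∀ α : K, α ≠ 0 → 0 < placeForm (fun _ ↦ 1) α := by
    intro α hα
    refine Finset.sum_pos (fun w _ ↦ ?_) Finset.univ_nonempty
    have : 0 < w α := pos_iff.mpr hα
    have := mult_cast_pos w
    positivity
  have hfin : ((fun α : {α : K // α ∈ (J : FractionalIdeal (𝓞 K)⁰ K)} ↦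
      placeForm (fun _ ↦ 1) (α : K)) '' (S : Set _) \ {0}).Finite :=
    (S.finite_toSet.image _).subset Set.sdiff_subset
  have hmin : ∀ s : Finset ℝ, (∀ x ∈ s, 0 < x) → ∃ δ : ℝ, 0 < δ ∧ δ ≤ 1 ∧ ∀ x ∈ s, δ ≤ x := by
    intro s
    induction s using Finset.induction_on with
    | empty => exact fun _ ↦ ⟨1, one_pos, le_rfl, by simp⟩
    | insert a s _ ih =>
      intro h
      obtain ⟨δ, h1, h2, h3⟩ := ih fun x hx ↦ h x (Finset.mem_insert_of_mem hx)
      refine ⟨min δ a, lt_min h1 (h a (Finset.mem_insert_self _ _)),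
        (min_le_left _ _).trans h2, fun x hx ↦ ?_⟩
      rcases Finset.mem_insert.mp hx with rfl | hx
      · exact min_le_right _ _
      · exact (min_le_left _ _).trans (h3 x hx)
  obtain ⟨δ, h1, h2, h3⟩ := hmin hfin.toFinset (by
    intro x hx
    rw [Set.Finite.mem_toFinset] at hx
    obtain ⟨⟨α, _, rfl⟩, h0⟩ := hx
    exact (placeForm_nonneg (by simp) _).lt_of_ne' h0)
  refine ⟨δ, h1, fun α hα hα0 ↦ ?_⟩
  by_cases hmem : (⟨α, hα⟩ : {α : K // α ∈ (J : FractionalIdeal (𝓞 K)⁰ K)}) ∈ S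
  · refine h3 _ ?_
    rw [Set.Finite.mem_toFinset]
    exact ⟨⟨_, hmem, rfl⟩, (hpos α hα0).ne'⟩
  · rw [hS, Set.Finite.mem_toFinset, Set.mem_ofPred_eq, not_not, Real.exp_lt_exp] at hmem
    refine h2.trans ?_
    have := Real.pi_pos
    simp only at hmem
    nlinarith

/-- The contribution of the nonzero elements of an ideal to Hecke's integral. -/
noncomputable def heckeTail (J : (FractionalIdeal (𝓞 K)⁰ K)ˣ) (D : Set (logSpace K)) (c : ℝ) :
    ℝ≥0∞ :=
  ∫⁻ x in D, ∑' α : {α : K // α ∈ (J : FractionalIdeal (𝓞 K)⁰ K) ∧ α ≠ 0},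
    ENNReal.ofReal (Real.exp (-Real.pi * placeForm (heckeWeight c x) (α : K)))

theorem ofReal_idealTheta (J : (FractionalIdeal (𝓞 K)⁰ K)ˣ) {y : InfinitePlace K → ℝ}
    (hy : ∀ w, 0 < y w) : ENNReal.ofReal (idealTheta J y) =
      1 + ∑' α : {α : K // α ∈ (J : FractionalIdeal (𝓞 K)⁰ K) ∧ α ≠ 0},
        ENNReal.ofReal (Real.exp (-Real.pi * placeForm y (α : K))) := by
  rw [idealTheta, ENNReal.ofReal_tsum_of_nonneg (fun _ ↦ (Real.exp_pos _).le)
    (summable_idealTheta J hy)]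
  have h0 : (0 : K) ∈ (J : FractionalIdeal (𝓞 K)⁰ K) := FractionalIdeal.zero_mem _
  classical
  rw [ENNReal.tsum_eq_add_tsum_ite ⟨0, h0⟩]
  congr 1
  · simp [placeForm]
  · let i : {α : K // α ∈ (J : FractionalIdeal (𝓞 K)⁰ K) ∧ α ≠ 0} →
      {α : K // α ∈ (J : FractionalIdeal (𝓞 K)⁰ K)} := fun α ↦ ⟨α, α.2.1⟩
    have hi : Function.Injective i := fun a b h ↦ Subtype.ext (Subtype.mk.inj h)
    rw [← hi.tsum_eq]
    · refine tsum_congr fun α ↦ if_neg fun h ↦ α.2.2 (Subtype.mk.inj h)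
    · intro α hα
      have : α ≠ ⟨0, h0⟩ := fun h ↦ hα (if_pos h)
      exact ⟨⟨α, α.2, fun h ↦ this (Subtype.ext h)⟩, rfl⟩

theorem measurable_heckeTerm (c : ℝ) (α : K) : Measurable fun x : logSpace K ↦
    ENNReal.ofReal (Real.exp (-Real.pi * placeForm (heckeWeight c x) α)) := by
  have := (continuous_placeForm_heckeWeight (K := K) α).comp
    (Continuous.prodMk_right c)
  simp only [Function.comp_def] at this
  exact ENNReal.measurable_ofReal.comp (Real.measurable_exp.comp
    (this.measurable.const_mul (-Real.pi)))

theorem lintegral_idealTheta (J : (FractionalIdeal (𝓞 K)⁰ K)ˣ) (D : Set (logSpace K)) {c : ℝ}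
    (hc : 0 < c) : ∫⁻ x in D, ENNReal.ofReal (idealTheta J (heckeWeight c x)) =
      volume D + heckeTail J D c := by
  simp_rw [ofReal_idealTheta J (heckeWeight_pos hc _)]
  rw [lintegral_add_left measurable_const, heckeTail]
  simp

theorem lintegral_idealTheta_eq (J : (FractionalIdeal (𝓞 K)⁰ K)ˣ) (D : Set (logSpace K)) {c : ℝ}
    (hc : 0 < c) : ∫⁻ x in D, ENNReal.ofReal (idealTheta J (heckeWeight c x)) =
      ENNReal.ofReal ((idealCovol J * √(c ^ Module.finrank ℚ K))⁻¹) *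
        ∫⁻ x in -D, ENNReal.ofReal (idealTheta (dualIdeal J) (heckeWeight c⁻¹ x)) := by
  have h1 : ∀ x, ENNReal.ofReal (idealTheta J (heckeWeight c x)) =
      ENNReal.ofReal ((idealCovol J * √(c ^ Module.finrank ℚ K))⁻¹) *
        ENNReal.ofReal (idealTheta (dualIdeal J) (heckeWeight c⁻¹ (-x))) := by
    intro x
    rw [idealTheta_eq J (heckeWeight_pos hc x) (heckeWeight_inv c x), prod_heckeWeight,
      ENNReal.ofReal_mul]
    have := idealCovol_pos J
    positivity
  simp_rw [h1]
  rw [lintegral_const_mul' _ _ ENNReal.ofReal_ne_top]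
  congr 1
  have h2 := (Measure.measurePreserving_neg (volume : Measure (logSpace K)))
  have h3 := h2.setLIntegral_comp_emb (MeasurableEquiv.neg (logSpace K)).measurableEmbedding
    (fun x ↦ ENNReal.ofReal (idealTheta (dualIdeal J) (heckeWeight c⁻¹ x))) D
  rw [h3, ← Set.image_neg_eq_neg]

theorem exists_le_logScale {D : Set (logSpace K)} (hD : Bornology.IsBounded D) :
    ∃ R : ℝ, ∀ x ∈ D, ∀ w, -R ≤ logScale x w := by
  have h1 : IsCompact (closure D) := hD.isCompact_closure
  have h2 : ∀ w : InfinitePlace K, ∃ R : ℝ, ∀ x ∈ D, -R ≤ logScale x w := by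
    intro w
    obtain ⟨R, hR⟩ := (h1.image (continuous_logScale w)).bddBelow
    exact ⟨-R, fun x hx ↦ by
      rw [neg_neg]; exact hR (Set.mem_image_of_mem _ (subset_closure hx))⟩
  choose R hR using h2
  exact ⟨∑ w, |R w|, fun x hx w ↦ by
    have h3 := Finset.single_le_sum (f := fun w ↦ |R w|) (fun _ _ ↦ abs_nonneg _)
      (Finset.mem_univ w)
    have h4 := hR w x hx
    have h5 := le_abs_self (R w)
    linarith⟩

theorem exists_le_heckeWeight {D : Set (logSpace K)} (hD : Bornology.IsBounded D) :
    ∃ r : ℝ, 0 < r ∧ ∀ x ∈ D, ∀ c : ℝ, 0 < c → ∀ w, c * r ≤ heckeWeight c x w := by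
  obtain ⟨R, hR⟩ := exists_le_logScale hD
  refine ⟨Real.exp (2 * -R), Real.exp_pos _, fun x hx c hc w ↦ ?_⟩
  have := hR x hx w
  unfold heckeWeight
  gcongr

theorem heckeTail_ne_top (J : (FractionalIdeal (𝓞 K)⁰ K)ˣ) {D : Set (logSpace K)}
    (hD : Bornology.IsBounded D) (hDm : MeasurableSet D) {c : ℝ} (hc : 0 < c) :
    heckeTail J D c ≠ ∞ := by
  obtain ⟨r, hr, h⟩ := exists_le_heckeWeight hD
  have h1 : ∫⁻ x in D, ENNReal.ofReal (idealTheta J (heckeWeight c x)) ≤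
      ∫⁻ x in D, ENNReal.ofReal (idealTheta J (fun _ ↦ c * r)) := by
    refine setLIntegral_mono' hDm fun x hx ↦ ENNReal.ofReal_le_ofReal ?_
    exact idealTheta_anti J (fun _ ↦ mul_pos hc hr) (h x hx c hc)
  rw [lintegral_idealTheta J D hc, setLIntegral_const] at h1
  refine ne_top_of_le_ne_top ?_ (le_add_self.trans h1)
  exact ENNReal.mul_ne_top ENNReal.ofReal_ne_top hD.measure_lt_top.ne

theorem exists_heckeTail_le (J : (FractionalIdeal (𝓞 K)⁰ K)ˣ) {D : Set (logSpace K)}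
    (hD : Bornology.IsBounded D) (hDm : MeasurableSet D) {κ : ℝ} (hκ : 0 < κ) :
    ∃ δ : ℝ, 0 < δ ∧ ∀ t : ℝ, 1 ≤ t → heckeTail J D (t * κ) ≤
      ENNReal.ofReal (Real.exp (-δ * (t - 1))) * heckeTail J D κ := by
  obtain ⟨r, hr, h⟩ := exists_le_heckeWeight hD
  obtain ⟨δ, hδ, h'⟩ := exists_le_placeForm J
  have hpi := Real.pi_pos
  refine ⟨Real.pi * (κ * r * δ), by positivity, fun t ht ↦ ?_⟩
  rw [heckeTail, heckeTail, ← lintegral_const_mul' _ _ ENNReal.ofReal_ne_top]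
  refine setLIntegral_mono' hDm fun x hx ↦ ?_
  rw [← ENNReal.tsum_mul_left]
  refine ENNReal.tsum_le_tsum fun α ↦ ?_
  rw [← ENNReal.ofReal_mul (Real.exp_pos _).le, ← Real.exp_add]
  refine ENNReal.ofReal_le_ofReal (Real.exp_le_exp.mpr ?_)
  rw [placeForm_heckeWeight (t * κ), placeForm_heckeWeight κ]
  have h1 : κ * r * δ ≤ κ * placeForm (heckeWeight 1 x) (α : K) := by
    have h2 := placeForm_mono (h x hx 1 one_pos) (α : K)
    have h3 := placeForm_smul (1 * r) (fun _ : InfinitePlace K ↦ 1) (α : K)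
    simp only [mul_one, one_mul] at h2 h3
    rw [h3] at h2
    have h4 := h' α α.2.1 α.2.2
    rw [mul_assoc]
    exact mul_le_mul_of_nonneg_left ((mul_le_mul_of_nonneg_left h4 hr.le).trans h2) hκ.le
  have h5 : 0 ≤ Real.pi * (t - 1) := mul_nonneg hpi.le (by linarith)
  nlinarith [mul_le_mul_of_nonneg_left h1 h5]

end HeckeIntegral

section Unfolding

open InfinitePlace Units Units.dirichletUnitTheorem nonZeroDivisors
open scoped ENNReal Classical

variable {K : Type*} [Field K] [NumberField K]

theorem tsum_units_eq_torsionOrder_mul (G : Additive ((𝓞 K)ˣ ⧸ torsion K) → ℝ≥0∞) :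
    ∑' u : (𝓞 K)ˣ, G (Additive.ofMul (QuotientGroup.mk u)) = torsionOrder K * ∑' q, G q := by
  have hfin : Fintype (torsion K) := Fintype.ofFinite _
  let e := Subgroup.groupEquivQuotientProdSubgroup (s := torsion K)
  have he : ∀ u, (e u).1 = QuotientGroup.mk u := fun u ↦ rfl
  calc ∑' u : (𝓞 K)ˣ, G (Additive.ofMul (QuotientGroup.mk u))
      = ∑' u : (𝓞 K)ˣ, (fun p : ((𝓞 K)ˣ ⧸ torsion K) × torsion K ↦
          G (Additive.ofMul p.1)) (e u) := rfl
    _ = ∑' p : ((𝓞 K)ˣ ⧸ torsion K) × torsion K, G (Additive.ofMul p.1) :=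
        e.tsum_eq (fun p : ((𝓞 K)ˣ ⧸ torsion K) × torsion K ↦ G (Additive.ofMul p.1))
    _ = ∑' q : (𝓞 K)ˣ ⧸ torsion K, ∑' _ : torsion K, G (Additive.ofMul q) :=
        ENNReal.tsum_prod (f := fun q _ ↦ G (Additive.ofMul q))
    _ = ∑' q : (𝓞 K)ˣ ⧸ torsion K, torsionOrder K * G (Additive.ofMul q) := by
        refine tsum_congr fun q ↦ ?_
        rw [tsum_fintype, Finset.sum_const, nsmul_eq_mul, Finset.card_univ, torsionOrder,
          Nat.card_eq_fintype_card]
    _ = torsionOrder K * ∑' q, G q := by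
        rw [ENNReal.tsum_mul_left]
        rfl

theorem tsum_units_setLIntegral {D : Set (logSpace K)}
    (hD : IsAddFundamentalDomain (unitLattice K) D volume) (F : logSpace K → ℝ≥0∞) :
    ∑' u : (𝓞 K)ˣ, ∫⁻ x in D, F (x + logEmbedding K (Additive.ofMul u)) =
      torsionOrder K * ∫⁻ x, F x := by
  have hinv : VAddInvariantMeasure (unitLattice K) (logSpace K) volume :=
    inferInstanceAs <| VAddInvariantMeasure (unitLattice K).toAddSubgroup (logSpace K) volume
  have hmeas : MeasurableConstVAdd (unitLattice K) (logSpace K) :=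
    inferInstanceAs <| MeasurableConstVAdd (unitLattice K).toAddSubgroup (logSpace K)
  have hc : Countable (unitLattice K) := inferInstance
  rw [hD.lintegral_eq_tsum'' F, ← (logEmbeddingEquiv K).toEquiv.tsum_eq,
    ← tsum_units_eq_torsionOrder_mul]
  refine tsum_congr fun u ↦ lintegral_congr fun x ↦ ?_
  congr 1
  rw [LinearEquiv.coe_toEquiv, Submodule.vadd_def, logEmbeddingEquiv_apply, vadd_eq_add, add_comm]

/-- The archimedean integral in Hecke's unfolding. -/
noncomputable def archIntegral (K : Type*) [Field K] [NumberField K] (c : ℝ) : ℝ≥0∞ :=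
  ∫⁻ x : logSpace K, ENNReal.ofReal (Real.exp (-Real.pi * placeForm (heckeWeight c x) (1 : K)))

theorem sum_heckeTail {D : Set (logSpace K)}
    (hD : IsAddFundamentalDomain (unitLattice K) D volume)
    (J : ClassGroup (𝓞 K) → (FractionalIdeal (𝓞 K)⁰ K)ˣ)
    (hJ : Function.Bijective fun c ↦ ClassGroup.mk K (J c)) (t : ℝ) :
    ∑ c, heckeTail (J c) D (t * (idealCovol (J c)) ^ (-(2 / (Module.finrank ℚ K : ℝ)))) =
      torsionOrder K * ∑' I : (Ideal (𝓞 K))⁰, archIntegral K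
        (t * (Ideal.absNorm (I : Ideal (𝓞 K)) / √|(discr K : ℝ)|) ^
          (2 / (Module.finrank ℚ K : ℝ))) := by
  obtain ⟨e, cl, a, he, ha⟩ := exists_equiv_sigma_classGroup J hJ
  set κ : ClassGroup (𝓞 K) → ℝ :=
    fun c ↦ (idealCovol (J c)) ^ (-(2 / (Module.finrank ℚ K : ℝ))) with hκ
  have hcount : ∀ c, Countable {α : K // α ∈ (J c : FractionalIdeal (𝓞 K)⁰ K) ∧ α ≠ 0} := by
    intro c
    have h1 := (latticeEquiv (basisOfFractionalIdeal K (J c)) (J c)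
      fun x ↦ mem_span_basisOfFractionalIdeal K).symm.injective.countable
    exact (Subtype.map_injective (fun α h ↦ h.1) Function.injective_id :
      Function.Injective (Subtype.map id fun α (h : α ∈ (J c : FractionalIdeal (𝓞 K)⁰ K) ∧ α ≠ 0) ↦
        (h.1 : id α ∈ (J c : FractionalIdeal (𝓞 K)⁰ K)))).countable
  have h1 : ∀ c, heckeTail (J c) D (t * κ c) =
      ∑' α : {α : K // α ∈ (J c : FractionalIdeal (𝓞 K)⁰ K) ∧ α ≠ 0}, ∫⁻ x in D,
        ENNReal.ofReal (Real.exp (-Real.pi * placeForm (heckeWeight (t * κ c) x) (α : K))) := by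
    intro c
    have := hcount c
    rw [heckeTail, lintegral_tsum fun α ↦ (measurable_heckeTerm _ _).aemeasurable]
  simp_rw [hκ] at h1 ⊢
  simp_rw [h1]
  rw [← tsum_fintype (L := SummationFilter.unconditional _), ← ENNReal.tsum_sigma, ← e.tsum_eq,
    ENNReal.tsum_prod (f := fun I u ↦ ∫⁻ x in D, ENNReal.ofReal (Real.exp (-Real.pi * placeForm
      (heckeWeight (t * idealCovol (J (e (I, u)).1) ^ (-(2 / (Module.finrank ℚ K : ℝ)))) x)
        ((e (I, u)).2 : K)))), ← ENNReal.tsum_mul_left]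
  refine tsum_congr fun I ↦ ?_
  set F : logSpace K → ℝ≥0∞ := fun x ↦ ENNReal.ofReal (Real.exp (-Real.pi * placeForm
    (heckeWeight (t * κ (cl I)) x) (a I))) with hF
  have h2 : ∀ u : (𝓞 K)ˣ, ∫⁻ x in D, ENNReal.ofReal (Real.exp (-Real.pi * placeForm
      (heckeWeight (t * idealCovol (J (e (I, u)).1) ^ (-(2 / (Module.finrank ℚ K : ℝ)))) x)
        ((e (I, u)).2 : K))) =
      ∫⁻ x in D, F (x + logEmbedding K (Additive.ofMul u)) := by
    intro u
    refine lintegral_congr fun x ↦ ?_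
    have h5 : idealCovol (J (e (I, u)).1) ^ (-(2 / (Module.finrank ℚ K : ℝ))) = κ (cl I) := by
      rw [hκ]
      exact congrArg (fun c ↦ idealCovol (J c) ^ (-(2 / (Module.finrank ℚ K : ℝ)))) (he I u).1
    rw [h5, (he I u).2, placeForm_heckeWeight_unit]
  simp_rw [h2]
  rw [tsum_units_setLIntegral hD]
  congr 1
  obtain ⟨z, hz⟩ := exists_placeForm_heckeWeight (ha I).1
  simp_rw [hF, hz]
  rw [lintegral_add_right_eq_self (μ := volume) (fun x : logSpace K ↦ ENNReal.ofReal (Real.exp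
    (-Real.pi * placeForm (heckeWeight (t * κ (cl I) *
      |(Algebra.norm ℚ (a I) : ℝ)| ^ (2 / (Module.finrank ℚ K : ℝ))) x) 1))) z, archIntegral]
  have h3 : κ (cl I) * |(Algebra.norm ℚ (a I) : ℝ)| ^ (2 / (Module.finrank ℚ K : ℝ)) =
      (Ideal.absNorm (I : Ideal (𝓞 K)) / √|(discr K : ℝ)|) ^ (2 / (Module.finrank ℚ K : ℝ)) := by
    have hc := idealCovol_pos (J (cl I))
    have hN := absNorm_pos (J (cl I))
    simp only [hκ]
    rw [(ha I).2, Real.rpow_neg hc.le, ← Real.inv_rpow hc.le, ← Real.mul_rpow (by positivity)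
      (by positivity)]
    congr 1
    unfold idealCovol
    field_simp
  rw [mul_assoc, h3]

end Unfolding

section ArchimedeanIntegral

open InfinitePlace Units Units.dirichletUnitTheorem
open scoped ENNReal NNReal Classical

theorem integral_exp_mul_exp_neg_exp {a r : ℝ} (ha : 0 < a) (hr : 0 < r) :
    Integrable (fun y : ℝ ↦ Real.exp (a * y) * Real.exp (-(r * Real.exp y))) ∧
      ∫ y : ℝ, Real.exp (a * y) * Real.exp (-(r * Real.exp y)) = (1 / r) ^ a * Real.Gamma a := by
  have h_int : IntegrableOn (fun t : ℝ ↦ t ^ (a - 1) * Real.exp (-(r * t))) (Set.Ioi 0) := by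
    have h := integrableOn_rpow_mul_exp_neg_mul_rpow (p := 1) (s := a - 1) (b := r) (by linarith)
      one_pos hr
    simpa using h
  have hd : ∀ x ∈ Set.univ, HasDerivWithinAt Real.exp (Real.exp x) Set.univ x :=
    fun x _ ↦ (Real.hasDerivAt_exp x).hasDerivWithinAt
  have hi : Set.InjOn Real.exp Set.univ := Real.exp_injective.injOn
  have him : Real.exp '' Set.univ = Set.Ioi 0 := by rw [Set.image_univ, Real.range_exp]
  have hfun : ∀ y : ℝ, |Real.exp y| • ((Real.exp y) ^ (a - 1) * Real.exp (-(r * Real.exp y))) =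
      Real.exp (a * y) * Real.exp (-(r * Real.exp y)) := by
    intro y
    rw [abs_of_pos (Real.exp_pos y), _root_.smul_eq_mul, ← mul_assoc, ← Real.exp_mul, ← Real.exp_add]
    ring_nf
  constructor
  · have h := integrableOn_image_iff_integrableOn_abs_deriv_smul MeasurableSet.univ hd hi
      (fun t : ℝ ↦ t ^ (a - 1) * Real.exp (-(r * t)))
    rw [him] at h
    have h2 := h.mp h_int
    simp_rw [hfun] at h2
    simpa using h2
  · have h := integral_image_eq_integral_abs_deriv_smul MeasurableSet.univ hd hi
      (fun t : ℝ ↦ t ^ (a - 1) * Real.exp (-(r * t)))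
    rw [him, Real.integral_rpow_mul_exp_neg_mul_Ioi ha hr] at h
    simp_rw [hfun] at h
    simpa using h.symm

variable {K : Type*} [Field K] [NumberField K]

theorem logScale_smul (c : ℝ) (x : logSpace K) (w : InfinitePlace K) :
    logScale (c • x) w = c * logScale x w := by
  unfold logScale
  split_ifs with h
  · simp only [Pi.smul_apply, _root_.smul_eq_mul, ← Finset.mul_sum]; ring
  · simp only [Pi.smul_apply, _root_.smul_eq_mul]; ring

theorem sum_mult_eq_finrank : ∑ w : InfinitePlace K, (mult w : ℝ) = Module.finrank ℚ K := by
  exact_mod_cast sum_mult_eq (K := K)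

/-- Logarithmic coordinates on the archimedean places: a scale and a point of trace zero. -/
noncomputable def archCoord (K : Type*) [Field K] [NumberField K] :
    (ℝ × logSpace K) →ₗ[ℝ] (InfinitePlace K → ℝ) where
  toFun p := fun w ↦ p.1 + 2 * logScale p.2 w
  map_add' p q := by
    ext w
    simp only [Prod.fst_add, Prod.snd_add, logScale_add, Pi.add_apply]; ring
  map_smul' c p := by
    ext w
    simp only [Prod.smul_fst, Prod.smul_snd, logScale_smul, Pi.smul_apply, _root_.smul_eq_mul,
      RingHom.id_apply]; ring

theorem sum_mult_mul_archCoord (p : ℝ × logSpace K) :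
    ∑ w, mult w * archCoord K p w = Module.finrank ℚ K * p.1 := by
  have h := sum_mult_mul_logScale p.2
  have : ∀ w : InfinitePlace K, (mult w : ℝ) * archCoord K p w =
      mult w * p.1 + 2 * (mult w * logScale p.2 w) := by
    intro w
    simp only [archCoord, LinearMap.coe_mk, AddHom.coe_mk]; ring
  simp_rw [this]
  rw [Finset.sum_add_distrib, ← Finset.mul_sum, h, ← Finset.sum_mul, sum_mult_eq_finrank]
  ring

theorem archCoord_injective : Function.Injective (archCoord K) := by
  rw [injective_iff_map_eq_zero]
  intro p hp
  have h1 := sum_mult_mul_archCoord p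
  rw [hp] at h1
  have hn : (Module.finrank ℚ K : ℝ) ≠ 0 := by
    exact_mod_cast (Module.finrank_pos (R := ℚ) (M := K)).ne'
  have h2 : p.1 = 0 := by
    simpa [hn] using h1.symm
  refine Prod.ext h2 ?_
  ext v
  have h3 := congrFun hp v.1
  have h4 := (mult_cast_pos v.1).ne'
  simp only [archCoord, LinearMap.coe_mk, AddHom.coe_mk, h2, logScale, v.2, dif_neg,
    not_false_eq_true, Pi.zero_apply] at h3
  field_simp at h3
  simpa using h3

theorem exists_lintegral_archCoord : ∃ c : ℝ≥0, 0 < c ∧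
    ∀ G : (InfinitePlace K → ℝ) → ℝ≥0∞, Measurable G →
      ∫⁻ p : ℝ × logSpace K, G (archCoord K p) = c * ∫⁻ y, G y := by
  have hr : Module.finrank ℝ (ℝ × logSpace K) = Module.finrank ℝ (InfinitePlace K → ℝ) := by
    rw [Module.finrank_prod, Module.finrank_self, Module.finrank_pi, Module.finrank_pi,
      Fintype.card_subtype_compl, Fintype.card_subtype_eq]
    have := Fintype.card_pos (α := InfinitePlace K)
    omega
  let e := (LinearMap.linearEquivOfInjective (archCoord K) archCoord_injective
    hr).toContinuousLinearEquiv
  have he : ∀ p, e p = archCoord K p := fun p ↦ rfl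
  have h1 : (volume : Measure (logSpace K)).IsAddHaarMeasure := by
    change Measure.IsAddHaarMeasure (Measure.pi fun _ ↦ volume)
    infer_instance
  have h2 : (volume : Measure (ℝ × logSpace K)).IsAddHaarMeasure := by
    rw [Measure.volume_eq_prod]
    infer_instance
  have : (Measure.map e (volume : Measure (ℝ × logSpace K))).IsAddHaarMeasure :=
    e.isAddHaarMeasure_map volume
  refine ⟨(Measure.map e (volume : Measure (ℝ × logSpace K))).addHaarScalarFactor volume,
    Measure.addHaarScalarFactor_pos_of_isAddHaarMeasure _ _, fun G hG ↦ ?_⟩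
  simp_rw [← he]
  rw [← lintegral_map hG e.continuous.measurable]
  exact (congrArg (fun μ ↦ ∫⁻ y, G y ∂μ)
    (Measure.isAddLeftInvariant_eq_smul (Measure.map e volume) volume)).trans
      (lintegral_smul_measure _ _)

/-- The product of the archimedean Euler factors. -/
noncomputable def gammaArch (K : Type*) [Field K] [NumberField K] (σ : ℝ) : ℝ :=
  ∏ w : InfinitePlace K, (1 / (Real.pi * mult w)) ^ (mult w * σ / 2) *
    Real.Gamma (mult w * σ / 2)

theorem exists_lintegral_rpow_mul_archIntegral : ∃ c : ℝ≥0, 0 < c ∧ ∀ σ : ℝ, 0 < σ →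
    ∫⁻ t in Set.Ioi (0 : ℝ), ENNReal.ofReal (t ^ (Module.finrank ℚ K * σ / 2 - 1)) *
      archIntegral K t = c * ENNReal.ofReal (gammaArch K σ) := by
  obtain ⟨c, hc, h⟩ := exists_lintegral_archCoord (K := K)
  refine ⟨c, hc, fun σ hσ ↦ ?_⟩
  set n : ℝ := (Module.finrank ℚ K : ℝ) with hn
  set φ : (InfinitePlace K) → ℝ → ℝ := fun w y ↦
    Real.exp (mult w * σ / 2 * y) * Real.exp (-(Real.pi * mult w * Real.exp y)) with hφ
  have hpos : ∀ w : InfinitePlace K, 0 < mult w * σ / 2 := fun w ↦ by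
    have := mult_cast_pos w; positivity
  have hpos' : ∀ w : InfinitePlace K, 0 < Real.pi * mult w := fun w ↦ by
    have := mult_cast_pos w; positivity
  have hφi := fun w ↦ (integral_exp_mul_exp_neg_exp (hpos w) (hpos' w))
  have hG : ∫⁻ y : InfinitePlace K → ℝ, ENNReal.ofReal (∏ w, φ w (y w)) =
      ENNReal.ofReal (gammaArch K σ) := by
    have hi : Integrable (fun y : InfinitePlace K → ℝ ↦ ∏ w, φ w (y w)) :=
      Integrable.fintype_prod fun w ↦ (hφi w).1
    rw [← ofReal_integral_eq_lintegral_ofReal hi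
      (Filter.Eventually.of_forall fun y ↦ by positivity),
      integral_fintype_prod_volume_eq_prod]
    congr 1
    exact Finset.prod_congr rfl fun w _ ↦ (hφi w).2
  have hprod : ∀ p : ℝ × logSpace K, ∏ w, φ w (archCoord K p w) =
      Real.exp (n * σ / 2 * p.1) *
        Real.exp (-Real.pi * placeForm (heckeWeight (Real.exp p.1) p.2) (1 : K)) := by
    intro p
    simp only [hφ]
    rw [Finset.prod_mul_distrib, ← Real.exp_sum, ← Real.exp_sum]
    congr 2
    · have := sum_mult_mul_archCoord p
      rw [show n * σ / 2 * p.1 = (n * p.1) * (σ / 2) by ring, hn, ← this, Finset.sum_mul]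
      exact Finset.sum_congr rfl fun w _ ↦ by ring
    · rw [placeForm, Finset.mul_sum]
      refine Finset.sum_congr rfl fun w _ ↦ ?_
      simp only [archCoord, LinearMap.coe_mk, AddHom.coe_mk, heckeWeight, map_one, Real.exp_add]
      ring
  rw [← hG, ← h _ (by fun_prop)]
  simp_rw [hprod]
  have him : Real.exp '' Set.univ = Set.Ioi 0 := by rw [Set.image_univ, Real.range_exp]
  rw [← him, lintegral_image_eq_lintegral_abs_deriv_mul MeasurableSet.univ
    (fun x _ ↦ (Real.hasDerivAt_exp x).hasDerivWithinAt) Real.exp_injective.injOn,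
    Measure.restrict_univ, Measure.volume_eq_prod, lintegral_prod]
  · refine lintegral_congr fun τ ↦ ?_
    simp_rw [ENNReal.ofReal_mul (Real.exp_nonneg (n * σ / 2 * τ))]
    rw [lintegral_const_mul' _ _ ENNReal.ofReal_ne_top, archIntegral, ← mul_assoc,
      ← ENNReal.ofReal_mul (abs_nonneg _), abs_of_pos (Real.exp_pos τ), ← Real.exp_mul,
      ← Real.exp_add]
    congr 3
    ring
  · refine Measurable.aemeasurable ?_
    refine ENNReal.measurable_ofReal.comp (Continuous.measurable ?_)
    simp only [placeForm, heckeWeight]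
    have := fun w : InfinitePlace K ↦ continuous_logScale w
    fun_prop

theorem gammaArch_pos {σ : ℝ} (hσ : 0 < σ) : 0 < gammaArch K σ := by
  refine Finset.prod_pos fun w _ ↦ ?_
  have h := mult_cast_pos w
  have := Real.Gamma_pos_of_pos (s := mult w * σ / 2) (by positivity)
  have := Real.pi_pos
  positivity

/-- Rescaling the argument in the Mellin transform of the archimedean integral. -/
theorem lintegral_rpow_mul_archIntegral_mul (s : ℝ) {b : ℝ} (hb : 0 < b) :
    ∫⁻ t in Set.Ioi (0 : ℝ), ENNReal.ofReal (t ^ (s - 1)) * archIntegral K (t * b) =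
      ENNReal.ofReal (b ^ (-s)) *
        ∫⁻ t in Set.Ioi (0 : ℝ), ENNReal.ofReal (t ^ (s - 1)) * archIntegral K t := by
  have him : (fun t ↦ t * b) '' Set.Ioi (0 : ℝ) = Set.Ioi 0 := by
    ext x
    simp only [Set.mem_image, Set.mem_Ioi]
    exact ⟨fun ⟨y, hy, h⟩ ↦ h ▸ mul_pos hy hb, fun h ↦ ⟨x / b, div_pos h hb, by field_simp⟩⟩
  conv_rhs => rw [← him]
  rw [lintegral_image_eq_lintegral_abs_deriv_mul (f' := fun _ ↦ b) measurableSet_Ioi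
    (fun x _ ↦ by simpa using ((hasDerivAt_id x).mul_const b).hasDerivWithinAt)
    (mul_left_injective₀ hb.ne').injOn, ← lintegral_const_mul' _ _ ENNReal.ofReal_ne_top]
  refine setLIntegral_congr_fun measurableSet_Ioi fun t ht ↦ ?_
  have ht : 0 < t := ht
  rw [← mul_assoc, ← mul_assoc, ← ENNReal.ofReal_mul (by positivity), ← ENNReal.ofReal_mul
    (by positivity)]
  congr 2
  rw [abs_of_pos hb, Real.mul_rpow ht.le hb.le, Real.rpow_neg hb.le, Real.rpow_sub_one hb.ne']
  have := (Real.rpow_pos_of_pos hb s).ne'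
  field_simp

end ArchimedeanIntegral

section HeckeSum

open InfinitePlace Units Units.dirichletUnitTheorem nonZeroDivisors
open scoped ENNReal NNReal Classical Pointwise

theorem exists_isAddFundamentalDomain_unitLattice (K : Type*) [Field K] [NumberField K] :
    ∃ D : Set (logSpace K), IsAddFundamentalDomain (unitLattice K) D volume ∧
      IsAddFundamentalDomain (unitLattice K) (-D) volume ∧ Bornology.IsBounded D ∧
      MeasurableSet D ∧ volume D ≠ 0 := by
  have hv : (volume : Measure (logSpace K)).IsAddHaarMeasure := by
    change Measure.IsAddHaarMeasure (Measure.pi fun _ ↦ volume)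
    infer_instance
  have hF : IsAddFundamentalDomain (unitLattice K)
      (ZSpan.fundamentalDomain ((basisUnitLattice K).ofZLatticeBasis ℝ)) volume :=
    ZLattice.isAddFundamentalDomain _ _
  refine ⟨_, hF, ?_, ZSpan.fundamentalDomain_isBounded _, ZSpan.fundamentalDomain_measurableSet _,
    ZSpan.measure_fundamentalDomain_ne_zero _⟩
  rw [← Set.neg_preimage]
  refine hF.preimage_of_equiv (f := fun x ↦ -x) ?_ (e := fun g ↦ -g) (Equiv.neg _).bijective ?_
  · exact (Measure.measurePreserving_neg volume).quasiMeasurePreserving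
  · intro g x
    simp only [Submodule.vadd_def, vadd_eq_add, Submodule.coe_neg]
    abel

variable {K : Type*} [Field K] [NumberField K]

theorem archIntegral_anti {c c' : ℝ} (h : c ≤ c') : archIntegral K c' ≤ archIntegral K c := by
  refine lintegral_mono fun x ↦ ENNReal.ofReal_le_ofReal ?_
  have h1 : placeForm (heckeWeight c x) (1 : K) ≤ placeForm (heckeWeight c' x) 1 := by
    refine placeForm_mono (fun w ↦ ?_) _
    unfold heckeWeight
    gcongr
  have := Real.pi_pos
  refine Real.exp_le_exp.mpr ?_
  nlinarith

/-- The sum over integral ideals of the archimedean integrals. -/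
noncomputable def heckeSum (K : Type*) [Field K] [NumberField K] (t : ℝ) : ℝ≥0∞ :=
  ∑' I : (Ideal (𝓞 K))⁰, archIntegral K
    (t * (Ideal.absNorm (I : Ideal (𝓞 K)) / √|(discr K : ℝ)|) ^ (2 / (Module.finrank ℚ K : ℝ)))

theorem heckeSum_anti {t t' : ℝ} (h : t ≤ t') : heckeSum K t' ≤ heckeSum K t :=
  ENNReal.tsum_le_tsum fun I ↦ archIntegral_anti (by gcongr)

theorem exists_classGroup_representatives (K : Type*) [Field K] [NumberField K] :
    ∃ J : ClassGroup (𝓞 K) → (FractionalIdeal (𝓞 K)⁰ K)ˣ,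
      Function.Bijective (fun c ↦ ClassGroup.mk K (J c)) ∧
      Function.Bijective (fun c ↦ ClassGroup.mk K (dualIdeal (J c))) := by
  have hs : ∀ c : ClassGroup (𝓞 K), ∃ J : (FractionalIdeal (𝓞 K)⁰ K)ˣ,
      ClassGroup.mk K J = c := fun c ↦
    ClassGroup.induction (K := K) (P := fun c ↦ ∃ J : (FractionalIdeal (𝓞 K)⁰ K)ˣ,
      ClassGroup.mk K J = c) (fun I ↦ ⟨I, rfl⟩) c
  choose J hJ using hs
  refine ⟨J, ?_, ?_⟩
  · simp_rw [hJ]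
    exact Function.bijective_id
  · have h : ∀ c, ClassGroup.mk K (dualIdeal (J c)) = ClassGroup.mk K (dualIdeal 1) * c⁻¹ := by
      intro c
      rw [dualIdeal_eq_mul_inv, map_mul, map_inv, hJ]
    simp_rw [h]
    exact ((Equiv.inv (ClassGroup (𝓞 K))).trans 
      (Equiv.mulLeft (ClassGroup.mk K (dualIdeal 1)))).bijective

theorem idealCovol_rpow_pos (J : (FractionalIdeal (𝓞 K)⁰ K)ˣ) (r : ℝ) : 0 < idealCovol J ^ r :=
  Real.rpow_pos_of_pos (idealCovol_pos J) r

theorem torsionOrder_cast_ne_zero : (torsionOrder K : ℝ≥0∞) ≠ 0 := by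
  exact_mod_cast torsionOrder_ne_zero K

theorem heckeSum_ne_top {t : ℝ} (ht : 0 < t) : heckeSum K t ≠ ∞ := by
  obtain ⟨D, hD, -, hb, hm, -⟩ := exists_isAddFundamentalDomain_unitLattice K
  obtain ⟨J, hJ, -⟩ := exists_classGroup_representatives K
  have h := sum_heckeTail hD J hJ t
  intro h'
  change _ = (torsionOrder K : ℝ≥0∞) * heckeSum K t at h
  rw [h', ENNReal.mul_top torsionOrder_cast_ne_zero] at h
  rw [ENNReal.sum_eq_top] at h
  obtain ⟨c, -, hc⟩ := h
  exact heckeTail_ne_top (J c) hb hm (mul_pos ht (idealCovol_rpow_pos _ _)) hc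

theorem exists_heckeSum_le (K : Type*) [Field K] [NumberField K] : ∃ δ : ℝ, 0 < δ ∧
    ∀ t : ℝ, 1 ≤ t → heckeSum K t ≤ ENNReal.ofReal (Real.exp (-δ * (t - 1))) * heckeSum K 1 := by
  obtain ⟨D, hD, -, hb, hm, -⟩ := exists_isAddFundamentalDomain_unitLattice K
  obtain ⟨J, hJ, -⟩ := exists_classGroup_representatives K
  have h := sum_heckeTail hD J hJ
  change ∀ t, _ = (torsionOrder K : ℝ≥0∞) * heckeSum K t at h
  have hne : (Finset.univ : Finset (ClassGroup (𝓞 K))).Nonempty := Finset.univ_nonempty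
  choose δ hδ hle using fun c ↦ exists_heckeTail_le (J c) hb hm
    (idealCovol_rpow_pos (J c) (-(2 / (Module.finrank ℚ K : ℝ))))
  refine ⟨Finset.univ.inf' hne δ, (Finset.lt_inf'_iff hne).mpr fun c _ ↦ hδ c, fun t ht ↦ ?_⟩
  rw [← ENNReal.mul_le_mul_iff_right (torsionOrder_cast_ne_zero (K := K))
    (ENNReal.natCast_ne_top _), ← h,
    mul_left_comm, ← h, Finset.mul_sum]
  refine Finset.sum_le_sum fun c _ ↦ (hle c t ht).trans ?_
  rw [one_mul]
  have := Finset.inf'_le δ (Finset.mem_univ c)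
  gcongr

theorem exists_heckeSum_feq (K : Type*) [Field K] [NumberField K] :
    ∃ V : ℝ≥0∞, V ≠ 0 ∧ V ≠ ∞ ∧ ∀ t : ℝ, 0 < t →
      V + torsionOrder K * heckeSum K (1 / t) =
        ENNReal.ofReal (t ^ ((Module.finrank ℚ K : ℝ) / 2)) *
          (V + torsionOrder K * heckeSum K t) := by
  obtain ⟨D, hD, hD', hb, hm, h0⟩ := exists_isAddFundamentalDomain_unitLattice K
  obtain ⟨J, hJ, hJ'⟩ := exists_classGroup_representatives K
  have h := sum_heckeTail hD J hJ
  have h' := sum_heckeTail hD' (fun c ↦ dualIdeal (J c)) hJ'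
  change ∀ t, _ = (torsionOrder K : ℝ≥0∞) * heckeSum K t at h h'
  set n : ℝ := (Module.finrank ℚ K : ℝ) with hn
  have hn0 : n ≠ 0 := by
    rw [hn]
    exact_mod_cast (Module.finrank_pos (R := ℚ) (M := K)).ne'
  have hvneg : volume (-D) = volume D := Measure.measure_neg volume D
  refine ⟨∑ _c : ClassGroup (𝓞 K), volume D, ?_, ?_, fun t ht ↦ ?_⟩
  · simp [h0]
  · exact (ENNReal.sum_lt_top.mpr fun c _ ↦ hb.measure_lt_top).ne
  · rw [← h, ← h', ← Finset.sum_add_distrib]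
    conv_rhs => rw [← hvneg]
    rw [← Finset.sum_add_distrib, Finset.mul_sum]
    refine Finset.sum_congr rfl fun c _ ↦ ?_
    have hc := idealCovol_pos (J c)
    have hκ := idealCovol_rpow_pos (J c) (-(2 / n))
    have hc' : idealCovol (dualIdeal (J c)) = (idealCovol (J c))⁻¹ :=
      eq_inv_of_mul_eq_one_right (idealCovol_mul_dualIdeal (J c))
    have h2 : (1 / t * idealCovol (J c) ^ (-(2 / n)))⁻¹ =
        t * idealCovol (dualIdeal (J c)) ^ (-(2 / n)) := by
      rw [hc', Real.inv_rpow hc.le]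
      field_simp
    rw [← lintegral_idealTheta _ _ (by positivity), lintegral_idealTheta_eq _ _ (by positivity),
      ← lintegral_idealTheta _ _ (mul_pos ht (idealCovol_rpow_pos _ _)), h2]
    congr 2
    rw [← Real.rpow_natCast, ← hn, Real.mul_rpow (by positivity) hκ.le, ← Real.rpow_mul hc.le,
      show -(2 / n) * n = -2 by field_simp, Real.sqrt_eq_rpow, Real.mul_rpow (by positivity)
      (by positivity), ← Real.rpow_mul (by positivity), ← Real.rpow_mul hc.le, one_div,
      Real.inv_rpow ht.le]
    norm_num
    rw [Real.rpow_neg_one]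
    field_simp

theorem lintegral_rpow_mul_heckeSum (K : Type*) [Field K] [NumberField K] : ∃ c : ℝ≥0, 0 < c ∧
    ∀ σ : ℝ, 0 < σ →
      ∫⁻ t in Set.Ioi (0 : ℝ), ENNReal.ofReal (t ^ (Module.finrank ℚ K * σ / 2 - 1)) *
        heckeSum K t = c * ENNReal.ofReal (gammaArch K σ * |(discr K : ℝ)| ^ (σ / 2)) *
          ∑' I : (Ideal (𝓞 K))⁰,
            ENNReal.ofReal ((Ideal.absNorm (I : Ideal (𝓞 K)) : ℝ) ^ (-σ)) := by
  obtain ⟨c, hc, h⟩ := exists_lintegral_rpow_mul_archIntegral (K := K)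
  refine ⟨c, hc, fun σ hσ ↦ ?_⟩
  set n : ℝ := (Module.finrank ℚ K : ℝ) with hn
  have hn0 : n ≠ 0 := by
    rw [hn]
    exact_mod_cast (Module.finrank_pos (R := ℚ) (M := K)).ne'
  have hΔ : (0 : ℝ) < |(discr K : ℝ)| := by simpa using discr_ne_zero K
  have hcount : Countable (Ideal (𝓞 K))⁰ := by
    have : Countable (Ideal (𝓞 K)) := by
      have h1 : Function.Surjective fun s : Finset (𝓞 K) ↦ Ideal.span (s : Set (𝓞 K)) := by
        intro I
        exact (IsNoetherian.noetherian I)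
      have : Countable (𝓞 K) := by
        have h2 := (RingOfIntegers.basis K).equivFun.toEquiv.injective.countable
        exact h2
      exact h1.countable
    infer_instance
  have hmeas : Measurable (archIntegral K) :=
    Antitone.measurable fun _ _ h ↦ archIntegral_anti h
  have hN : ∀ I : (Ideal (𝓞 K))⁰, (0 : ℝ) < Ideal.absNorm (I : Ideal (𝓞 K)) := by
    intro I
    have := Ideal.absNorm_ne_zero_iff_mem_nonZeroDivisors.mpr I.2
    positivity
  simp_rw [heckeSum, ← ENNReal.tsum_mul_left]
  rw [lintegral_tsum fun I ↦ by fun_prop]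
  refine tsum_congr fun I ↦ ?_
  have hNI := hN I
  rw [lintegral_rpow_mul_archIntegral_mul _ (by positivity), h σ hσ, mul_left_comm, mul_assoc,
    ← ENNReal.ofReal_mul (by positivity), ← ENNReal.ofReal_mul
      (mul_nonneg (gammaArch_pos hσ).le (by positivity))]
  congr 2
  rw [← Real.rpow_mul (by positivity), show 2 / n * -(n * σ / 2) = -σ by field_simp,
    Real.div_rpow hNI.le (by positivity), Real.sqrt_eq_rpow, ← Real.rpow_mul hΔ.le,
    show 1 / 2 * -σ = -(σ / 2) by ring, Real.rpow_neg hΔ.le]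
  field_simp

end HeckeSum

section HeckeLambda

open InfinitePlace Units nonZeroDivisors Filter Asymptotics
open scoped ENNReal NNReal

theorem exists_norm_mellin_le {f : ℝ → ℂ} (hf : ∀ s, MellinConvergent f s) (a b : ℝ) :
    ∃ C : ℝ, ∀ s : ℂ, a ≤ s.re → s.re ≤ b → ‖mellin f s‖ ≤ C := by
  have ha := (hf (a : ℂ)).norm
  have hb := (hf (b : ℂ)).norm
  refine ⟨∫ t in Set.Ioi (0 : ℝ), (‖(t : ℂ) ^ ((a : ℂ) - 1) • f t‖ +
    ‖(t : ℂ) ^ ((b : ℂ) - 1) • f t‖), fun s h1 h2 ↦ ?_⟩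
  refine norm_integral_le_of_norm_le (ha.add hb) ?_
  refine (ae_restrict_iff' measurableSet_Ioi).mpr (Eventually.of_forall fun t ht ↦ ?_)
  have ht : 0 < t := ht
  simp only [norm_smul, Complex.norm_cpow_eq_rpow_re_of_pos ht, Complex.sub_re, Complex.one_re,
    Complex.ofReal_re]
  rw [← add_mul]
  gcongr
  rcases le_total t 1 with h | h
  · have := Real.rpow_le_rpow_of_exponent_ge ht h (show a - 1 ≤ s.re - 1 by linarith)
    have := Real.rpow_pos_of_pos ht (b - 1)
    linarith
  · have := Real.rpow_le_rpow_of_exponent_le h (show s.re - 1 ≤ b - 1 by linarith)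
    have := Real.rpow_pos_of_pos ht (a - 1)
    linarith

theorem exists_heckeLambda (K : Type*) [Field K] [NumberField K] :
    ∃ (L : ℂ → ℂ) (A B : ℝ), 0 < A ∧ 0 < B ∧ Differentiable ℂ L ∧
      (∀ s, L (((Module.finrank ℚ K : ℝ) / 2 : ℝ) - s) = L s) ∧
      (∀ a b : ℝ, ∃ C : ℝ, ∀ s : ℂ, a ≤ s.re → s.re ≤ b → ‖L s‖ ≤ C) ∧
      ∀ σ : ℝ, 1 < σ →
        Summable (fun I : (Ideal (𝓞 K))⁰ ↦ (Ideal.absNorm (I : Ideal (𝓞 K)) : ℝ) ^ (-σ)) ∧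
        L ((Module.finrank ℚ K * σ / 2 : ℝ)) =
          ((A * (gammaArch K σ * |(discr K : ℝ)| ^ (σ / 2) *
            ∑' I : (Ideal (𝓞 K))⁰, (Ideal.absNorm (I : Ideal (𝓞 K)) : ℝ) ^ (-σ)) +
            B / (Module.finrank ℚ K * σ / 2) +
            B / (Module.finrank ℚ K / 2 - Module.finrank ℚ K * σ / 2) : ℝ) : ℂ) := by
  obtain ⟨V, hV0, hV, hfeq⟩ := exists_heckeSum_feq K
  obtain ⟨δ, hδ, hdec⟩ := exists_heckeSum_le K
  obtain ⟨c, hc, hmel⟩ := lintegral_rpow_mul_heckeSum K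
  have hw0 := torsionOrder_cast_ne_zero (K := K)
  have hwt : (torsionOrder K : ℝ≥0∞) ≠ ∞ := ENNReal.natCast_ne_top _
  set n : ℝ := (Module.finrank ℚ K : ℝ) with hn
  have hn0 : 0 < n := by
    rw [hn]
    exact_mod_cast (Module.finrank_pos (R := ℚ) (M := K))
  set w : ℝ≥0∞ := (torsionOrder K : ℝ≥0∞) with hw
  have hT : ∀ t : ℝ, 0 < t → w * heckeSum K t ≠ ∞ := fun t ht ↦
    ENNReal.mul_ne_top hwt (heckeSum_ne_top ht)
  set F : ℝ → ℝ := fun t ↦ (V + w * heckeSum K t).toReal with hF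
  have hFV : ∀ t : ℝ, 0 < t → F t - V.toReal = (w * heckeSum K t).toReal := by
    intro t ht
    rw [hF]
    simp only
    rw [ENNReal.toReal_add hV (hT t ht)]
    ring
  have hanti : AntitoneOn F (Set.Ioi 0) := by
    intro t ht t' ht' h
    refine ENNReal.toReal_mono (ENNReal.add_ne_top.mpr ⟨hV, hT t ht⟩) ?_
    gcongr
    exact heckeSum_anti h
  have h_int : LocallyIntegrableOn (fun t ↦ (F t : ℂ)) (Set.Ioi 0) := by
    rw [locallyIntegrableOn_iff isOpen_Ioi.isLocallyClosed]
    intro k hk hkc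
    exact ((hanti.mono hk).integrableOn_isCompact hkc).ofReal
  have htop : ∀ r : ℝ, (fun t ↦ (F t : ℂ) - (V.toReal : ℂ)) =O[atTop] fun t ↦ t ^ r := by
    intro r
    have h1 : (fun t ↦ (F t : ℂ) - (V.toReal : ℂ)) =O[atTop] fun t : ℝ ↦ Real.exp (-δ * t) := by
      refine IsBigO.of_bound (Real.exp δ * (w * heckeSum K 1).toReal) ?_
      filter_upwards [eventually_ge_atTop 1] with t ht
      have ht0 : 0 < t := by linarith
      rw [← Complex.ofReal_sub, hFV t ht0, Complex.norm_real, Real.norm_of_nonneg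
        ENNReal.toReal_nonneg, Real.norm_of_nonneg (Real.exp_nonneg _)]
      have h2 : w * heckeSum K t ≤
          ENNReal.ofReal (Real.exp (-δ * (t - 1))) * (w * heckeSum K 1) := by
        rw [mul_left_comm]
        gcongr
        exact hdec t ht
      have h3 := ENNReal.toReal_mono (ENNReal.mul_ne_top ENNReal.ofReal_ne_top (hT 1 one_pos)) h2
      rw [ENNReal.toReal_mul (a := ENNReal.ofReal _), ENNReal.toReal_ofReal (Real.exp_nonneg _)]
        at h3
      rw [show -δ * (t - 1) = δ + -δ * t by ring, Real.exp_add] at h3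
      linarith
    exact h1.trans (isLittleO_exp_neg_mul_rpow_atTop hδ r).isBigO
  let P : WeakFEPair ℂ :=
    { f := fun t ↦ (F t : ℂ)
      g := fun t ↦ (F t : ℂ)
      k := n / 2
      ε := 1
      f₀ := V.toReal
      g₀ := V.toReal
      hf_int := h_int
      hg_int := h_int
      hk := by positivity
      hε := one_ne_zero
      h_feq := by
        intro t ht
        have ht : 0 < t := ht
        simp only [hF]
        rw [hfeq t ht, ENNReal.toReal_mul, ENNReal.toReal_ofReal (by positivity), one_mul,
          _root_.smul_eq_mul, Complex.ofReal_mul]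
      hf_top := htop
      hg_top := htop }
  have hsymm : P.symm = P := by
    simp only [P, WeakFEPair.symm, inv_one]
  have hconv : ∀ s, MellinConvergent P.f_modif s :=
    fun s ↦ (P.isStrongFEPair_toStrongFEPair.hasMellin s).1
  refine ⟨P.Λ₀, (w * c).toReal, V.toReal, ?_, ENNReal.toReal_pos hV0 hV, P.differentiable_Λ₀,
    fun s ↦ ?_, exists_norm_mellin_le hconv, fun σ hσ ↦ ?_⟩
  · exact ENNReal.toReal_pos (mul_ne_zero hw0 (by exact_mod_cast hc.ne'))
      (ENNReal.mul_ne_top hwt ENNReal.coe_ne_top)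
  · have := P.functional_equation₀ s
    rw [hsymm] at this
    simpa [P] using this
  · have hσ0 : 0 < σ := by linarith
    have hre : P.k < ((n * σ / 2 : ℝ) : ℂ).re := by
      simp only [P, Complex.ofReal_re]
      nlinarith
    obtain ⟨hm1, hm2⟩ := P.hasMellin hre
    set φ : ℝ → ℝ := fun t ↦ t ^ (n * σ / 2 - 1) * (w * heckeSum K t).toReal with hφ
    have hcongr : ∀ t ∈ Set.Ioi (0 : ℝ), (t : ℂ) ^ (((n * σ / 2 : ℝ) : ℂ) - 1) • (P.f t - P.f₀) =
        (φ t : ℂ) := by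
      intro t ht
      have ht : 0 < t := ht
      simp only [P, hφ]
      rw [← Complex.ofReal_sub, hFV t ht, _root_.smul_eq_mul, Complex.ofReal_mul,
        Complex.ofReal_cpow ht.le]
      push_cast
      ring
    have hi : IntegrableOn φ (Set.Ioi 0) := by
      have h1 := (integrableOn_congr_fun hcongr measurableSet_Ioi).mp hm1
      exact (integrable_congr (Eventually.of_forall fun t ↦ Complex.ofReal_re (φ t))).mp h1.re
    have hval : P.Λ ((n * σ / 2 : ℝ) : ℂ) = ((∫ t in Set.Ioi 0, φ t : ℝ) : ℂ) := by
      rw [← hm2, mellin, setIntegral_congr_fun measurableSet_Ioi hcongr, integral_complex_ofReal]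
    have hφ0 : 0 ≤ᵐ[volume.restrict (Set.Ioi 0)] φ := by
      refine (ae_restrict_iff' measurableSet_Ioi).mpr (Eventually.of_forall fun t ht ↦ ?_)
      exact mul_nonneg (Real.rpow_nonneg (le_of_lt ht) _) ENNReal.toReal_nonneg
    have hl := ofReal_integral_eq_lintegral_ofReal hi hφ0
    have hl2 : ∫⁻ t in Set.Ioi (0 : ℝ), ENNReal.ofReal (φ t) =
        w * ∫⁻ t in Set.Ioi (0 : ℝ), ENNReal.ofReal (t ^ (n * σ / 2 - 1)) * heckeSum K t := by
      rw [← lintegral_const_mul' _ _ hwt]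
      refine setLIntegral_congr_fun measurableSet_Ioi fun t ht ↦ ?_
      simp only [hφ]
      rw [ENNReal.ofReal_mul (Real.rpow_nonneg (le_of_lt ht) _), ENNReal.ofReal_toReal (hT t ht)]
      ring
    rw [hl2, hmel σ hσ0] at hl
    have hG : 0 < gammaArch K σ * |(discr K : ℝ)| ^ (σ / 2) := by
      have hΔ : (0 : ℝ) < |(discr K : ℝ)| := by simpa using discr_ne_zero K
      have := gammaArch_pos (K := K) hσ0
      positivity
    have hfin : ∑' I : (Ideal (𝓞 K))⁰,
        ENNReal.ofReal ((Ideal.absNorm (I : Ideal (𝓞 K)) : ℝ) ^ (-σ)) ≠ ∞ := by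
      intro h
      rw [h, ENNReal.mul_top, ENNReal.mul_top hw0] at hl
      · exact ENNReal.ofReal_ne_top hl
      · exact mul_ne_zero (by exact_mod_cast hc.ne') (by simpa using hG)
    have hnn : ∀ I : (Ideal (𝓞 K))⁰, 0 ≤ (Ideal.absNorm (I : Ideal (𝓞 K)) : ℝ) ^ (-σ) :=
      fun I ↦ by positivity
    have hsum : Summable fun I : (Ideal (𝓞 K))⁰ ↦
        (Ideal.absNorm (I : Ideal (𝓞 K)) : ℝ) ^ (-σ) := by
      have := ENNReal.summable_toReal hfin
      simpa only [ENNReal.toReal_ofReal (hnn _)] using this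
    refine ⟨hsum, ?_⟩
    rw [← ENNReal.ofReal_tsum_of_nonneg hnn hsum] at hl
    have hl3 := congrArg ENNReal.toReal hl
    rw [ENNReal.toReal_ofReal (integral_nonneg_of_ae hφ0), ← mul_assoc, ← mul_assoc,
      ENNReal.toReal_mul, ENNReal.toReal_mul, ENNReal.toReal_ofReal hG.le,
      ENNReal.toReal_ofReal (tsum_nonneg hnn)] at hl3
    rw [P.Λ₀_eq, hval, hl3]
    simp only [P]
    push_cast
    simp only [_root_.smul_eq_mul]
    ring

end HeckeLambda

section ExpSeries

/-- The exponential series `∑ aᵢ exp (-lᵢ s)`. -/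
noncomputable def expSeries {ι : Type*} (a l : ι → ℝ) (s : ℂ) : ℂ :=
  ∑' i, (a i : ℂ) * Complex.exp (-(l i) * s)

variable {ι : Type*} {a l : ι → ℝ}

theorem norm_expSeries_term (ha : ∀ i, 0 ≤ a i) (i : ι) (s : ℂ) :
    ‖(a i : ℂ) * Complex.exp (-(l i) * s)‖ = a i * Real.exp (-l i * s.re) := by
  rw [norm_mul, Complex.norm_exp, Complex.norm_real, Real.norm_of_nonneg (ha i)]
  simp

theorem norm_expSeries_term_le (ha : ∀ i, 0 ≤ a i) (hl : ∀ i, 0 ≤ l i) {σ : ℝ} {s : ℂ}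
    (hs : σ ≤ s.re) (i : ι) :
    ‖(a i : ℂ) * Complex.exp (-(l i) * s)‖ ≤ a i * Real.exp (-l i * σ) := by
  rw [norm_expSeries_term ha]
  refine mul_le_mul_of_nonneg_left (Real.exp_le_exp.mpr ?_) (ha i)
  nlinarith [hl i]

theorem summable_expSeries (ha : ∀ i, 0 ≤ a i) (hl : ∀ i, 0 ≤ l i) {σ : ℝ} {s : ℂ}
    (hs : σ ≤ s.re) (h : Summable fun i ↦ a i * Real.exp (-l i * σ)) :
    Summable fun i ↦ (a i : ℂ) * Complex.exp (-(l i) * s) :=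
  Summable.of_norm_bounded h fun i ↦ norm_expSeries_term_le ha hl hs i

theorem norm_expSeries_le (ha : ∀ i, 0 ≤ a i) (hl : ∀ i, 0 ≤ l i) {σ : ℝ} {s : ℂ}
    (hs : σ ≤ s.re) (h : Summable fun i ↦ a i * Real.exp (-l i * σ)) :
    ‖expSeries a l s‖ ≤ ∑' i, a i * Real.exp (-l i * σ) :=
  tsum_of_norm_bounded h.hasSum fun i ↦ norm_expSeries_term_le ha hl hs i

theorem expSeries_ofReal (σ : ℝ) :
    expSeries a l σ = ((∑' i, a i * Real.exp (-l i * σ) : ℝ) : ℂ) := by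
  rw [expSeries, Complex.ofReal_tsum]
  push_cast
  rfl

theorem expSeries_re (ha : ∀ i, 0 ≤ a i) (hl : ∀ i, 0 ≤ l i) {s : ℂ}
    (h : Summable fun i ↦ a i * Real.exp (-l i * s.re)) :
    (expSeries a l s).re = ∑' i, a i * (Real.exp (-l i * s.re) * Real.cos (l i * s.im)) := by
  rw [expSeries, Complex.re_tsum (summable_expSeries ha hl le_rfl h)]
  refine tsum_congr fun i ↦ ?_
  rw [Complex.re_ofReal_mul, Complex.exp_re]
  simp

theorem summable_mul_expSeries (ha : ∀ i, 0 ≤ a i) (hl : ∀ i, 0 ≤ l i)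
    (h : ∀ σ : ℝ, 1 < σ → Summable fun i ↦ a i * Real.exp (-l i * σ)) {σ : ℝ} (hσ : 1 < σ) :
    Summable fun i ↦ a i * l i * Real.exp (-l i * σ) := by
  set ε := (σ - 1) / 2 with hε
  have hε0 : 0 < ε := by rw [hε]; linarith
  refine Summable.of_nonneg_of_le (fun i ↦ mul_nonneg (mul_nonneg (ha i) (hl i))
    (Real.exp_pos _).le) (fun i ↦ ?_) ((h (σ - ε) (by rw [hε]; linarith)).mul_left ε⁻¹)
  have h1 : -l i * σ = -l i * (σ - ε) - l i * ε := by ring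
  have h2 : l i * ε ≤ Real.exp (l i * ε) := by linarith [Real.add_one_le_exp (l i * ε)]
  have h3 : l i * Real.exp (-(l i * ε)) ≤ ε⁻¹ := by
    rw [Real.exp_neg, ← div_eq_mul_inv, div_le_iff₀ (Real.exp_pos _), inv_mul_eq_div,
      le_div_iff₀ hε0]
    exact h2
  calc a i * l i * Real.exp (-l i * σ)
      = a i * Real.exp (-l i * (σ - ε)) * (l i * Real.exp (-(l i * ε))) := by
        rw [h1, sub_eq_add_neg, Real.exp_add]; ring
    _ ≤ a i * Real.exp (-l i * (σ - ε)) * ε⁻¹ :=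
        mul_le_mul_of_nonneg_left h3 (mul_nonneg (ha i) (Real.exp_pos _).le)
    _ = _ := by ring

theorem hasDerivAt_expSeries (ha : ∀ i, 0 ≤ a i) (hl : ∀ i, 0 ≤ l i)
    (h : ∀ σ : ℝ, 1 < σ → Summable fun i ↦ a i * Real.exp (-l i * σ)) {s : ℂ} (hs : 1 < s.re) :
    HasDerivAt (expSeries a l) (-expSeries (fun i ↦ a i * l i) l s) s := by
  set σ := (1 + s.re) / 2 with hσ
  have hσ1 : 1 < σ := by rw [hσ]; linarith
  have hσ2 : σ < s.re := by rw [hσ]; linarith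
  have hal : ∀ i, 0 ≤ a i * l i := fun i ↦ mul_nonneg (ha i) (hl i)
  have key := hasDerivAt_tsum_of_isPreconnected (𝕜 := ℂ) (t := {z : ℂ | σ < z.re})
    (g := fun i z ↦ (a i : ℂ) * Complex.exp (-(l i) * z))
    (g' := fun i z ↦ -(((a i * l i : ℝ) : ℂ) * Complex.exp (-(l i) * z))) (y₀ := s) (y := s)
    (summable_mul_expSeries ha hl h hσ1) (isOpen_lt continuous_const Complex.continuous_re)
    (convex_halfSpace_re_gt σ).isPreconnected
    (fun i z _ ↦ by
      have h1 : HasDerivAt (fun z : ℂ ↦ -(l i : ℂ) * z) (-(l i : ℂ)) z := by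
        simpa using (hasDerivAt_id z).const_mul (-(l i : ℂ))
      convert! h1.cexp.const_mul (a i : ℂ) using 1
      push_cast
      ring)
    (fun i z hz ↦ by
      rw [norm_neg]
      exact norm_expSeries_term_le hal hl (le_of_lt hz) i)
    hσ2 (summable_expSeries ha hl le_rfl (h _ hs)) hσ2
  rw [tsum_neg] at key
  exact key

theorem differentiableOn_expSeries (ha : ∀ i, 0 ≤ a i) (hl : ∀ i, 0 ≤ l i)
    (h : ∀ σ : ℝ, 1 < σ → Summable fun i ↦ a i * Real.exp (-l i * σ)) :
    DifferentiableOn ℂ (expSeries a l) {s | 1 < s.re} := fun _ hs ↦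
  (hasDerivAt_expSeries ha hl h hs).differentiableAt.differentiableWithinAt

theorem eq_of_eq_ofReal_of_one_lt {f g : ℂ → ℂ} (hf : DifferentiableOn ℂ f {s | 1 < s.re})
    (hg : DifferentiableOn ℂ g {s | 1 < s.re}) (h : ∀ σ : ℝ, 1 < σ → f σ = g σ) {s : ℂ}
    (hs : 1 < s.re) : f s = g s := by
  have ho : IsOpen {s : ℂ | 1 < s.re} := isOpen_lt continuous_const Complex.continuous_re
  refine (hf.analyticOnNhd ho).eqOn_of_preconnected_of_frequently_eq (hg.analyticOnNhd ho)
    (convex_halfSpace_re_gt 1).isPreconnected (z₀ := 2) (by simp) ?_ hs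
  have h1 : Filter.Tendsto (fun x : ℝ ↦ (x : ℂ)) (nhdsWithin 2 {2}ᶜ) (nhdsWithin 2 {2}ᶜ) := by
    refine tendsto_nhdsWithin_iff.mpr ⟨?_, ?_⟩
    · exact ((Complex.continuous_ofReal.tendsto 2).mono_left nhdsWithin_le_nhds)
    · filter_upwards [self_mem_nhdsWithin] with x hx
      simpa using fun h ↦ hx (by exact_mod_cast h)
  refine h1.frequently (Filter.Eventually.frequently ?_)
  have : ∀ᶠ x : ℝ in nhds 2, 1 < x := lt_mem_nhds (by norm_num)
  filter_upwards [nhdsWithin_le_nhds this] with x hx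
  exact h x hx

end ExpSeries

section ZetaProduct

open nonZeroDivisors IsDedekindDomain Ideal
open scoped ENNReal

variable (K : Type*) [Field K] [NumberField K]

/-- The logarithm of the norm of an ideal. -/
noncomputable def logNorm (I : (Ideal (𝓞 K))⁰) : ℝ := Real.log (absNorm (I : Ideal (𝓞 K)))

/-- The logarithm of the norm of a maximal ideal. -/
noncomputable def logNormPrime (v : HeightOneSpectrum (𝓞 K)) : ℝ := Real.log (absNorm v.asIdeal)

/-- The logarithm of the norm of the prime power `v ^ (k + 1)`. -/
noncomputable def logNormPow (x : HeightOneSpectrum (𝓞 K) × ℕ) : ℝ :=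
  (x.2 + 1) * logNormPrime K x.1

/-- The Dedekind zeta series. -/
noncomputable def zetaSeries : ℂ → ℂ := expSeries (fun _ ↦ 1) (logNorm K)

/-- The series of the negative logarithmic derivative of the zeta function. -/
noncomputable def mangoldtSeries : ℂ → ℂ := expSeries (fun x ↦ logNormPrime K x.1) (logNormPow K)

/-- The series of `log ζ`. -/
noncomputable def logZetaSeries : ℂ → ℂ := expSeries (fun x ↦ ((x.2 : ℝ) + 1)⁻¹) (logNormPow K)

variable {K}

theorem absNorm_pos_of_mem (I : (Ideal (𝓞 K))⁰) : 0 < absNorm (I : Ideal (𝓞 K)) :=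
  Nat.pos_of_ne_zero (absNorm_ne_zero_of_nonZeroDivisors I)

theorem logNorm_nonneg (I : (Ideal (𝓞 K))⁰) : 0 ≤ logNorm K I := Real.log_natCast_nonneg _

theorem logNormPrime_pos (v : HeightOneSpectrum (𝓞 K)) : 0 < logNormPrime K v :=
  Real.log_pos (by exact_mod_cast NumberField.HeightOneSpectrum.one_lt_absNorm v)

theorem logNormPow_pos (x : HeightOneSpectrum (𝓞 K) × ℕ) : 0 < logNormPow K x :=
  mul_pos (by positivity) (logNormPrime_pos _)

/-- The prime power `v ^ (k + 1)` as a nonzero ideal. -/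
def primePow (x : HeightOneSpectrum (𝓞 K) × ℕ) : (Ideal (𝓞 K))⁰ :=
  ⟨x.1.asIdeal ^ (x.2 + 1), mem_nonZeroDivisors_of_ne_zero (pow_ne_zero _ x.1.ne_bot)⟩

theorem logNorm_mul (I J : (Ideal (𝓞 K))⁰) : logNorm K (I * J) = logNorm K I + logNorm K J := by
  unfold logNorm
  rw [Submonoid.coe_mul, map_mul, Nat.cast_mul, Real.log_mul]
  · exact_mod_cast (absNorm_pos_of_mem I).ne'
  · exact_mod_cast (absNorm_pos_of_mem J).ne'

theorem logNorm_primePow (x : HeightOneSpectrum (𝓞 K) × ℕ) :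
    logNorm K (primePow x) = logNormPow K x := by
  unfold logNorm logNormPow primePow logNormPrime
  simp

open scoped Classical in
theorem tsum_logNormPrime_dvd (I : Ideal (𝓞 K)) (hI : I ≠ 0) :
    ∑' x : HeightOneSpectrum (𝓞 K) × ℕ, (if x.1.asIdeal ^ (x.2 + 1) ∣ I then
      ENNReal.ofReal (logNormPrime K x.1) else 0) = ENNReal.ofReal (Real.log (absNorm I)) := by
  induction I using UniqueFactorizationMonoid.induction_on_prime with
  | h₁ => exact absurd rfl hI
  | h₂ I hu =>
    obtain rfl : I = 1 := by rwa [Ideal.isUnit_iff, ← Ideal.one_eq_top] at hu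
    have : ∀ x : HeightOneSpectrum (𝓞 K) × ℕ, ¬ x.1.asIdeal ^ (x.2 + 1) ∣ 1 := by
      intro x hx
      have := isUnit_of_dvd_one ((dvd_pow_self _ x.2.succ_ne_zero).trans hx)
      exact x.1.isPrime.ne_top (Ideal.isUnit_iff.mp this)
    rw [tsum_congr fun x ↦ if_neg (this x)]
    simp
  | h₃ J P hJ hP ih =>
    have ih := ih hJ
    set v₀ : HeightOneSpectrum (𝓞 K) := ⟨P, Ideal.isPrime_of_prime hP, hP.ne_zero⟩ with hv₀
    rw [ENNReal.tsum_prod'] at ih ⊢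
    have hstep : ∀ v : HeightOneSpectrum (𝓞 K),
        ∑' k : ℕ, (if v.asIdeal ^ (k + 1) ∣ P * J then ENNReal.ofReal (logNormPrime K v) else 0) =
        (if v = v₀ then ENNReal.ofReal (logNormPrime K v₀) else 0) +
        ∑' k : ℕ, (if v.asIdeal ^ (k + 1) ∣ J then ENNReal.ofReal (logNormPrime K v) else 0) := by
      intro v
      by_cases hv : v = v₀
      · subst hv
        rw [tsum_eq_zero_add' ENNReal.summable]
        congr 1
        · simp [v₀]
        · refine tsum_congr fun k ↦ ?_
          have : P ^ (k + 1 + 1) ∣ P * J ↔ P ^ (k + 1) ∣ J := by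
            rw [pow_succ' P (k + 1)]
            exact mul_dvd_mul_iff_left hP.ne_zero
          simp only [v₀, this]
      · rw [if_neg hv, zero_add]
        refine tsum_congr fun k ↦ ?_
        have : v.asIdeal ^ (k + 1) ∣ P * J ↔ v.asIdeal ^ (k + 1) ∣ J := by
          refine ⟨fun h ↦ v.prime.pow_dvd_of_dvd_mul_left _ ?_ h, fun h ↦ h.mul_left _⟩
          intro h
          refine hv (HeightOneSpectrum.ext ?_)
          exact (v₀.isMaximal.eq_of_le v.isPrime.ne_top (Ideal.dvd_iff_le.mp h)).symm
        simp only [this]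
    simp only at hstep ⊢
    rw [tsum_congr hstep, ENNReal.tsum_add, tsum_ite_eq, ih, map_mul, Nat.cast_mul, Real.log_mul,
      ENNReal.ofReal_add]
    · rfl
    · exact Real.log_natCast_nonneg _
    · exact Real.log_natCast_nonneg _
    · exact_mod_cast fun h ↦ hP.ne_zero (Ideal.absNorm_eq_zero_iff.mp h)
    · exact_mod_cast fun h ↦ hJ (Ideal.absNorm_eq_zero_iff.mp h)

theorem summable_zetaSeries {σ : ℝ} (hσ : 1 < σ) :
    Summable fun I : (Ideal (𝓞 K))⁰ ↦ (1 : ℝ) * Real.exp (-logNorm K I * σ) := by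
  obtain ⟨_, _, _, _, _, _, _, _, h⟩ := exists_heckeLambda K
  refine (h σ hσ).1.congr fun I ↦ ?_
  have h0 : (0 : ℝ) < absNorm (I : Ideal (𝓞 K)) := by exact_mod_cast absNorm_pos_of_mem I
  rw [one_mul, Real.rpow_def_of_pos h0, logNorm]
  congr 1
  ring

open scoped Classical in
theorem tsum_mangoldt_mul_zeta (σ : ℝ) :
    (∑' x : HeightOneSpectrum (𝓞 K) × ℕ,
        ENNReal.ofReal (logNormPrime K x.1 * Real.exp (-logNormPow K x * σ))) *
      (∑' I : (Ideal (𝓞 K))⁰, ENNReal.ofReal (Real.exp (-logNorm K I * σ))) =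
    ∑' I : (Ideal (𝓞 K))⁰, ENNReal.ofReal (logNorm K I * Real.exp (-logNorm K I * σ)) := by
  have h1 : ∀ I : (Ideal (𝓞 K))⁰, ENNReal.ofReal (logNorm K I * Real.exp (-logNorm K I * σ)) =
      ∑' x : HeightOneSpectrum (𝓞 K) × ℕ, (if x.1.asIdeal ^ (x.2 + 1) ∣ (I : Ideal (𝓞 K)) then
      ENNReal.ofReal (logNormPrime K x.1) else 0) *
        ENNReal.ofReal (Real.exp (-logNorm K I * σ)) := by
    intro I
    rw [ENNReal.tsum_mul_right, tsum_logNormPrime_dvd _ (nonZeroDivisors.ne_zero I.2),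
      ENNReal.ofReal_mul (logNorm_nonneg I)]
    rfl
  rw [tsum_congr h1, ENNReal.tsum_comm, ← ENNReal.tsum_mul_right]
  refine tsum_congr fun x ↦ ?_
  rw [← ENNReal.tsum_mul_left]
  have hinj : Function.Injective fun J : (Ideal (𝓞 K))⁰ ↦ primePow x * J := by
    intro J J' h
    have h : primePow x * J = primePow x * J' := h
    have h2 := congrArg (fun t : (Ideal (𝓞 K))⁰ ↦ (t : Ideal (𝓞 K))) h
    simp only [Submonoid.coe_mul] at h2
    exact Subtype.ext (mul_left_cancel₀ (nonZeroDivisors.ne_zero (primePow x).2) h2)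
  rw [← hinj.tsum_eq (f := fun I : (Ideal (𝓞 K))⁰ ↦
    (if x.1.asIdeal ^ (x.2 + 1) ∣ (I : Ideal (𝓞 K)) then
      ENNReal.ofReal (logNormPrime K x.1) else 0) *
        ENNReal.ofReal (Real.exp (-logNorm K I * σ)))]
  · refine tsum_congr fun J ↦ ?_
    have hd : x.1.asIdeal ^ (x.2 + 1) ∣ ((primePow x * J : (Ideal (𝓞 K))⁰) : Ideal (𝓞 K)) := by
      rw [Submonoid.coe_mul]
      exact dvd_mul_right _ _
    rw [if_pos hd, logNorm_mul, logNorm_primePow, ENNReal.ofReal_mul (logNormPrime_pos _).le,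
      mul_assoc, ← ENNReal.ofReal_mul (Real.exp_pos _).le, ← Real.exp_add]
    congr 3
    ring
  · intro I hI
    have hd : x.1.asIdeal ^ (x.2 + 1) ∣ (I : Ideal (𝓞 K)) := by
      by_contra h
      simp [h] at hI
    obtain ⟨J, hJ⟩ := hd
    have hJ0 : J ≠ 0 := by
      rintro rfl
      exact nonZeroDivisors.ne_zero I.2 (by simpa using hJ)
    exact ⟨⟨J, mem_nonZeroDivisors_of_ne_zero hJ0⟩, Subtype.ext hJ.symm⟩

theorem one_le_tsum_zeta (σ : ℝ) :
    1 ≤ ∑' I : (Ideal (𝓞 K))⁰, ENNReal.ofReal (Real.exp (-logNorm K I * σ)) := by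
  refine le_trans ?_ (ENNReal.le_tsum 1)
  simp [logNorm]

theorem summable_mangoldt {σ : ℝ} (hσ : 1 < σ) :
    Summable fun x : HeightOneSpectrum (𝓞 K) × ℕ ↦
      logNormPrime K x.1 * Real.exp (-logNormPow K x * σ) := by
  have h1 := summable_mul_expSeries (fun _ ↦ zero_le_one) logNorm_nonneg
    (fun σ hσ ↦ summable_zetaSeries (K := K) hσ) hσ
  simp only [one_mul] at h1
  have hne : ∑' x : HeightOneSpectrum (𝓞 K) × ℕ,
      ENNReal.ofReal (logNormPrime K x.1 * Real.exp (-logNormPow K x * σ)) ≠ ∞ := by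
    refine ne_top_of_le_ne_top (b := ∑' I : (Ideal (𝓞 K))⁰,
      ENNReal.ofReal (logNorm K I * Real.exp (-logNorm K I * σ))) h1.tsum_ofReal_ne_top ?_
    rw [← tsum_mangoldt_mul_zeta]
    exact le_mul_of_one_le_right' (one_le_tsum_zeta σ)
  refine (ENNReal.summable_toReal hne).congr fun x ↦ ?_
  rw [ENNReal.toReal_ofReal (mul_nonneg (logNormPrime_pos _).le (Real.exp_pos _).le)]

theorem summable_logZeta {σ : ℝ} (hσ : 1 < σ) :
    Summable fun x : HeightOneSpectrum (𝓞 K) × ℕ ↦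
      ((x.2 : ℝ) + 1)⁻¹ * Real.exp (-logNormPow K x * σ) := by
  refine Summable.of_nonneg_of_le (fun x ↦ by positivity) (fun x ↦ ?_)
    ((summable_mangoldt (K := K) hσ).mul_left (Real.log 2)⁻¹)
  have h2 : Real.log 2 ≤ logNormPrime K x.1 := Real.log_le_log (by norm_num)
    (by exact_mod_cast NumberField.HeightOneSpectrum.one_lt_absNorm x.1)
  rw [← mul_assoc]
  refine mul_le_mul_of_nonneg_right ?_ (Real.exp_pos _).le
  have hl2 : 0 < Real.log 2 := Real.log_pos (by norm_num)
  have h3 : ((x.2 : ℝ) + 1)⁻¹ ≤ 1 := inv_le_one_of_one_le₀ (by linarith [x.2.cast_nonneg (α := ℝ)])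
  have h4 : 1 ≤ (Real.log 2)⁻¹ * logNormPrime K x.1 := by
    rw [inv_mul_eq_div, le_div_iff₀ hl2]; linarith
  linarith

theorem zetaSeries_mul_mangoldtSeries_ofReal {σ : ℝ} (hσ : 1 < σ) :
    zetaSeries K σ * mangoldtSeries K σ = expSeries (logNorm K) (logNorm K) σ := by
  unfold zetaSeries mangoldtSeries
  rw [expSeries_ofReal, expSeries_ofReal, expSeries_ofReal, ← Complex.ofReal_mul]
  congr 1
  have h1 := congrArg ENNReal.toReal (tsum_mangoldt_mul_zeta (K := K) σ)
  have hs1 := summable_zetaSeries (K := K) hσ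
  have hs3 := summable_mul_expSeries (fun _ ↦ zero_le_one) logNorm_nonneg
    (fun σ hσ ↦ summable_zetaSeries (K := K) hσ) hσ
  simp only [one_mul] at hs1 hs3 ⊢
  have hn2 : ∀ x : HeightOneSpectrum (𝓞 K) × ℕ,
      0 ≤ logNormPrime K x.1 * Real.exp (-logNormPow K x * σ) :=
    fun x ↦ mul_nonneg (logNormPrime_pos _).le (Real.exp_pos _).le
  have hn3 : ∀ I : (Ideal (𝓞 K))⁰, 0 ≤ logNorm K I * Real.exp (-logNorm K I * σ) :=
    fun x ↦ mul_nonneg (logNorm_nonneg _) (Real.exp_pos _).le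
  have hn1 : ∀ I : (Ideal (𝓞 K))⁰, 0 ≤ Real.exp (-logNorm K I * σ) :=
    fun _ ↦ (Real.exp_pos _).le
  rw [ENNReal.toReal_mul, ← ENNReal.ofReal_tsum_of_nonneg hn2 (summable_mangoldt hσ),
    ← ENNReal.ofReal_tsum_of_nonneg hn1 hs1,
    ← ENNReal.ofReal_tsum_of_nonneg hn3 hs3,
    ENNReal.toReal_ofReal (tsum_nonneg hn2),
    ENNReal.toReal_ofReal (tsum_nonneg hn1),
    ENNReal.toReal_ofReal (tsum_nonneg hn3)] at h1
  rw [← h1, mul_comm]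

theorem differentiableOn_zetaSeries : DifferentiableOn ℂ (zetaSeries K) {s | 1 < s.re} :=
  differentiableOn_expSeries (fun _ ↦ zero_le_one) logNorm_nonneg
    (fun _ hσ ↦ summable_zetaSeries hσ)

theorem differentiableOn_mangoldtSeries : DifferentiableOn ℂ (mangoldtSeries K) {s | 1 < s.re} :=
  differentiableOn_expSeries (fun x ↦ (logNormPrime_pos x.1).le)
    (fun x ↦ (logNormPow_pos x).le) (fun _ hσ ↦ summable_mangoldt hσ)

theorem hasDerivAt_zetaSeries {s : ℂ} (hs : 1 < s.re) :
    HasDerivAt (zetaSeries K) (-(zetaSeries K s * mangoldtSeries K s)) s := by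
  have h := hasDerivAt_expSeries (fun _ ↦ zero_le_one) logNorm_nonneg
    (fun σ hσ ↦ summable_zetaSeries (K := K) hσ) hs
  simp only [one_mul] at h
  have hsum : ∀ σ : ℝ, 1 < σ →
      Summable fun I : (Ideal (𝓞 K))⁰ ↦ logNorm K I * Real.exp (-logNorm K I * σ) := by
    intro σ hσ
    have := summable_mul_expSeries (fun _ ↦ zero_le_one) logNorm_nonneg
      (fun σ hσ ↦ summable_zetaSeries (K := K) hσ) hσ
    simpa only [one_mul] using this
  have hD := differentiableOn_expSeries logNorm_nonneg logNorm_nonneg hsum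
  have heq : zetaSeries K s * mangoldtSeries K s = expSeries (logNorm K) (logNorm K) s :=
    eq_of_eq_ofReal_of_one_lt (f := fun s ↦ zetaSeries K s * mangoldtSeries K s)
      (differentiableOn_zetaSeries.mul differentiableOn_mangoldtSeries) hD
      (fun σ hσ ↦ zetaSeries_mul_mangoldtSeries_ofReal hσ) hs
  rw [heq]
  exact h

theorem hasDerivAt_logZetaSeries {s : ℂ} (hs : 1 < s.re) :
    HasDerivAt (logZetaSeries K) (-mangoldtSeries K s) s := by
  have h := hasDerivAt_expSeries (fun x ↦ by positivity) (fun x ↦ (logNormPow_pos x).le)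
    (fun σ hσ ↦ summable_logZeta (K := K) hσ) hs
  have heq : (fun x : HeightOneSpectrum (𝓞 K) × ℕ ↦ ((x.2 : ℝ) + 1)⁻¹ * logNormPow K x) =
      fun x ↦ logNormPrime K x.1 := by
    ext x
    unfold logNormPow
    field_simp
  rw [heq] at h
  exact h

variable (K) in
theorem exists_zetaSeries_eq :
    ∃ c : ℂ, c ≠ 0 ∧ ∀ s : ℂ, 1 < s.re → zetaSeries K s = c * Complex.exp (logZetaSeries K s) := by
  have hd : ∀ s : ℂ, 1 < s.re →
      HasDerivAt (fun s ↦ zetaSeries K s * Complex.exp (-logZetaSeries K s)) 0 s := by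
    intro s hs
    convert! (hasDerivAt_zetaSeries hs).mul (hasDerivAt_logZetaSeries hs).neg.cexp using 1
    ring
  have ho : IsOpen {s : ℂ | 1 < s.re} := isOpen_lt continuous_const Complex.continuous_re
  have hconst : ∀ s : ℂ, 1 < s.re → zetaSeries K s * Complex.exp (-logZetaSeries K s) =
      zetaSeries K 2 * Complex.exp (-logZetaSeries K 2) := by
    intro s hs
    refine ho.is_const_of_deriv_eq_zero (convex_halfSpace_re_gt 1).isPreconnected
      (fun z hz ↦ (hd z hz).differentiableAt.differentiableWithinAt)
      (fun z hz ↦ (hd z hz).deriv) hs (by simp)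
  refine ⟨zetaSeries K 2 * Complex.exp (-logZetaSeries K 2), mul_ne_zero ?_ (Complex.exp_ne_zero _),
    fun s hs ↦ ?_⟩
  · have h2 : zetaSeries K 2 = ((∑' I : (Ideal (𝓞 K))⁰,
        (1 : ℝ) * Real.exp (-logNorm K I * 2) : ℝ) : ℂ) := by
      have := expSeries_ofReal (a := fun _ : (Ideal (𝓞 K))⁰ ↦ (1 : ℝ)) (l := logNorm K) 2
      exact_mod_cast this
    rw [h2]
    have hp : 0 < ∑' I : (Ideal (𝓞 K))⁰, (1 : ℝ) * Real.exp (-logNorm K I * 2) :=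
      (summable_zetaSeries (by norm_num)).tsum_pos (fun _ ↦ by positivity) 1 (by positivity)
    exact_mod_cast hp.ne'
  · rw [← hconst s hs, mul_assoc, ← Complex.exp_add, neg_add_cancel, Complex.exp_zero, mul_one]

end ZetaProduct

section ArchimedeanFactor

open InfinitePlace Complex

variable (K : Type*) [Field K] [NumberField K]

/-- The archimedean factor of the Dedekind zeta function. -/
noncomputable def archFactor (s : ℂ) : ℂ :=
  Gammaℝ s ^ (nrRealPlaces K + nrComplexPlaces K) * Gammaℝ (s + 1) ^ nrComplexPlaces K

variable {K}

theorem archFactor_ne_zero {s : ℂ} (hs : 0 < s.re) : archFactor K s ≠ 0 :=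
  mul_ne_zero (pow_ne_zero _ (Gammaℝ_ne_zero_of_re_pos hs))
    (pow_ne_zero _ (Gammaℝ_ne_zero_of_re_pos (by simp; linarith)))

theorem gammaArch_eq_archFactor (σ : ℝ) :
    (gammaArch K σ : ℂ) = (2 ^ nrComplexPlaces K : ℂ)⁻¹ * archFactor K σ := by
  classical
  have hreal : ∀ w : InfinitePlace K, IsReal w →
      (((1 / (Real.pi * mult w)) ^ (mult w * σ / 2) * Real.Gamma (mult w * σ / 2) : ℝ) : ℂ) =
        Gammaℝ σ := by
    intro w hw
    rw [Gammaℝ_def, mult, if_pos hw, Nat.cast_one, mul_one, one_mul, one_div,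
      Real.inv_rpow Real.pi_pos.le, ← Real.rpow_neg Real.pi_pos.le]
    push_cast [ofReal_cpow Real.pi_pos.le]
    rw [neg_div, ← ofReal_ofNat, ← ofReal_div, Gamma_ofReal]
  have hcomplex : ∀ w : InfinitePlace K, ¬ IsReal w →
      (((1 / (Real.pi * mult w)) ^ (mult w * σ / 2) * Real.Gamma (mult w * σ / 2) : ℝ) : ℂ) =
        2⁻¹ * (Gammaℝ σ * Gammaℝ (σ + 1)) := by
    intro w hw
    have h2 : (0 : ℝ) ≤ Real.pi * 2 := by positivity
    rw [Gammaℝ_mul_Gammaℝ_add_one, Gammaℂ_def, mult, if_neg hw, Nat.cast_ofNat,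
      mul_div_cancel_left₀ _ (two_ne_zero' ℝ), one_div,
      Real.inv_rpow h2, ← Real.rpow_neg h2]
    push_cast [ofReal_cpow h2]
    rw [Gamma_ofReal, mul_comm (2 : ℂ) (Real.pi : ℂ)]
    ring
  have hcard1 : (Finset.univ.filter fun w : InfinitePlace K ↦ IsReal w).card = nrRealPlaces K := by
    rw [nrRealPlaces, Fintype.card_subtype]
  have hcard2 : (Finset.univ.filter fun w : InfinitePlace K ↦ ¬ IsReal w).card =
      nrComplexPlaces K := by
    simp_rw [not_isReal_iff_isComplex]
    rw [nrComplexPlaces, Fintype.card_subtype]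
  rw [gammaArch, ofReal_prod, ← Finset.prod_filter_mul_prod_filter_not Finset.univ
    (fun w : InfinitePlace K ↦ IsReal w),
    Finset.prod_congr rfl fun w hw ↦ hreal w (Finset.mem_filter.mp hw).2,
    Finset.prod_congr rfl fun w hw ↦ hcomplex w (Finset.mem_filter.mp hw).2,
    Finset.prod_const, Finset.prod_const, hcard1, hcard2, archFactor, mul_pow, mul_pow, pow_add,
    inv_pow]
  ring

end ArchimedeanFactor

section CompletedZeta

open InfinitePlace nonZeroDivisors Module

variable (K : Type*) [Field K] [NumberField K]

/-- The logarithm of the absolute value of the discriminant. -/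
noncomputable def logDiscr : ℝ := Real.log |(discr K : ℝ)|

theorem one_le_abs_discr : (1 : ℝ) ≤ |(discr K : ℝ)| := by
  have := Int.one_le_abs (discr_ne_zero K)
  exact_mod_cast this

theorem differentiableOn_archFactor : DifferentiableOn ℂ (archFactor K) {s | 0 < s.re} := by
  have h : ∀ s : ℂ, 0 < s.re → DifferentiableAt ℂ Complex.Gammaℝ s := by
    intro s hs
    have h1 := (Complex.differentiable_Gammaℝ_inv s).inv
      (inv_ne_zero (Complex.Gammaℝ_ne_zero_of_re_pos hs))
    have h2 : (fun s ↦ (Complex.Gammaℝ s)⁻¹)⁻¹ = Complex.Gammaℝ := by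
      ext; simp
    rwa [h2] at h1
  intro s (hs : 0 < s.re)
  refine DifferentiableAt.differentiableWithinAt ?_
  refine ((h s hs).pow _).mul (DifferentiableAt.pow ?_ _)
  have h2 := h (s + 1) (by simp only [Complex.add_re, Complex.one_re]; linarith)
  exact h2.comp s (differentiableAt_id.add_const 1)

theorem _root_.Differentiable.eq_of_eq_ofReal_of_one_lt {f g : ℂ → ℂ} (hf : Differentiable ℂ f)
    (hg : Differentiable ℂ g) (h : ∀ σ : ℝ, 1 < σ → f σ = g σ) (s : ℂ) : f s = g s := by
  have h2 : ∀ᶠ z in nhds (2 : ℂ), f z = g z := by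
    have ho : IsOpen {s : ℂ | 1 < s.re} := isOpen_lt continuous_const Complex.continuous_re
    filter_upwards [ho.mem_nhds (by simp : (2 : ℂ) ∈ {s : ℂ | 1 < s.re})] with z hz
    exact _root_.eq_of_eq_ofReal_of_one_lt hf.differentiableOn hg.differentiableOn h hz
  have hf' : AnalyticOnNhd ℂ f Set.univ := fun z _ ↦ hf.analyticAt z
  have hg' : AnalyticOnNhd ℂ g Set.univ := fun z _ ↦ hg.analyticAt z
  exact congrFun (hf'.eq_of_eventuallyEq hg' h2) s

theorem exists_completedZeta :
    ∃ Ξ : ℂ → ℂ, Differentiable ℂ Ξ ∧ (∀ s, Ξ (1 - s) = Ξ s) ∧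
      (∀ s, Ξ (starRingEnd ℂ s) = starRingEnd ℂ (Ξ s)) ∧
      (∀ a b : ℝ, ∃ C : ℝ, ∀ s : ℂ, a ≤ s.re → s.re ≤ b → ‖Ξ s‖ ≤ C * (1 + ‖s‖) ^ 2) ∧
      Ξ 1 ≠ 0 ∧
      ∀ s : ℂ, 1 < s.re → Ξ s =
        s * (s - 1) * Complex.exp (logDiscr K / 2 * s) * archFactor K s * zetaSeries K s := by
  obtain ⟨L, A, B, hA, hB, hL, hFE, hbd, hval⟩ := exists_heckeLambda K
  set n : ℝ := (finrank ℚ K : ℝ) with hn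
  have hn0 : 0 < n := by rw [hn]; exact_mod_cast finrank_pos
  set D : ℂ := A * (((2 : ℝ) ^ nrComplexPlaces K : ℝ) : ℂ)⁻¹ with hD
  have hA' : (A : ℂ) ≠ 0 := by exact_mod_cast hA.ne'
  have hB' : (B : ℂ) ≠ 0 := by exact_mod_cast hB.ne'
  have hn' : (n : ℂ) ≠ 0 := by exact_mod_cast hn0.ne'
  have hD0 : D ≠ 0 := mul_ne_zero hA' (inv_ne_zero (by exact_mod_cast pow_ne_zero _ two_ne_zero))
  have hDr : starRingEnd ℂ D = D := by
    rw [hD, map_mul, map_inv₀, Complex.conj_ofReal, Complex.conj_ofReal]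
  set Ξ : ℂ → ℂ := fun s ↦ (s * (s - 1) * L (n * s / 2) + 2 * B / n) / D with hΞ
  have hdiff : Differentiable ℂ Ξ := by
    rw [hΞ]
    have : Differentiable ℂ fun s : ℂ ↦ L (n * s / 2) := hL.comp (by fun_prop)
    fun_prop
  have hreal : ∀ σ : ℝ, 1 < σ → Ξ σ = σ * (σ - 1) * Complex.exp (logDiscr K / 2 * σ) *
      archFactor K σ * zetaSeries K σ := by
    intro σ hσ
    have h1 := (hval σ hσ).2
    have h2 : (n : ℂ) * σ / 2 = ((n * σ / 2 : ℝ) : ℂ) := by push_cast; rfl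
    have h3 : zetaSeries K σ =
        ((∑' I : (Ideal (𝓞 K))⁰, (Ideal.absNorm (I : Ideal (𝓞 K)) : ℝ) ^ (-σ) : ℝ) : ℂ) := by
      rw [zetaSeries, expSeries_ofReal]
      congr 1
      refine tsum_congr fun I ↦ ?_
      have h0 : (0 : ℝ) < Ideal.absNorm (I : Ideal (𝓞 K)) := by
        exact_mod_cast absNorm_pos_of_mem I
      rw [one_mul, Real.rpow_def_of_pos h0, logNorm]
      congr 1
      ring
    have h4 : Complex.exp (logDiscr K / 2 * σ) = ((|(discr K : ℝ)| ^ (σ / 2) : ℝ) : ℂ) := by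
      rw [Real.rpow_def_of_pos (by linarith [one_le_abs_discr K]), logDiscr]
      push_cast
      congr 1
      ring
    have hσ0 : (σ : ℂ) ≠ 0 := by exact_mod_cast (by linarith : σ ≠ 0)
    have hσ1 : (1 : ℂ) - σ ≠ 0 := by
      intro h
      have : (1 : ℂ) = σ := by linear_combination h
      exact hσ.ne (by exact_mod_cast this)
    rw [hΞ, h3, h4]
    simp only
    rw [h2, h1, hD]
    push_cast
    rw [gammaArch_eq_archFactor]
    have h5 : (n : ℂ) / 2 - n * σ / 2 = n * (1 - σ) / 2 := by ring
    rw [h5]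
    have h6 : (2 ^ nrComplexPlaces K : ℂ) ≠ 0 := pow_ne_zero _ two_ne_zero
    field_simp
    ring
  refine ⟨Ξ, hdiff, fun s ↦ ?_, ?_, ?_, ?_, ?_⟩
  · have h := hFE (n * s / 2)
    have h2 : ((n / 2 : ℝ) : ℂ) - n * s / 2 = n * (1 - s) / 2 := by push_cast; ring
    rw [h2] at h
    simp only [hΞ, h]
    ring
  · have hc : Differentiable ℂ fun s ↦ starRingEnd ℂ (Ξ (starRingEnd ℂ s)) := by
      intro s
      have := (hdiff (starRingEnd ℂ s)).conj_conj
      rwa [Complex.conj_conj] at this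
    have heq : ∀ σ : ℝ, 1 < σ → starRingEnd ℂ (Ξ (starRingEnd ℂ σ)) = Ξ σ := by
      intro σ hσ
      have h2 : (n : ℂ) * σ / 2 = ((n * σ / 2 : ℝ) : ℂ) := by push_cast; rfl
      simp only [hΞ, Complex.conj_ofReal]
      rw [h2, (hval σ hσ).2, map_div₀, hDr]
      simp only [map_add, map_mul, map_sub, map_div₀, Complex.conj_ofReal, map_one, map_ofNat]
    have h := hc.eq_of_eq_ofReal_of_one_lt hdiff heq
    intro s
    rw [← h s, Complex.conj_conj]
  · intro a b
    obtain ⟨C, hC⟩ := hbd (n * a / 2) (n * b / 2)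
    refine ⟨(|C| + ‖2 * (B : ℂ) / n‖) / ‖D‖, fun s h1 h2 ↦ ?_⟩
    have hre : ((n : ℂ) * s / 2).re = n * s.re / 2 := by
      rw [mul_div_assoc, Complex.re_ofReal_mul]
      simp [mul_div_assoc]
    have h3 := hC (n * s / 2) (by rw [hre]; gcongr) (by rw [hre]; gcongr)
    rw [hΞ]
    simp only
    rw [norm_div, div_mul_eq_mul_div]
    gcongr
    refine (norm_add_le _ _).trans ?_
    rw [add_mul]
    have hs := norm_nonneg s
    have hs1 : ‖s - 1‖ ≤ 1 + ‖s‖ := (norm_sub_le _ _).trans (by simp [add_comm])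
    refine add_le_add ?_ ?_
    · rw [norm_mul, norm_mul]
      calc ‖s‖ * ‖s - 1‖ * ‖L (n * s / 2)‖ ≤ (1 + ‖s‖) * (1 + ‖s‖) * |C| := by
            gcongr
            · linarith
            · exact h3.trans (le_abs_self _)
        _ = _ := by ring
    · exact le_mul_of_one_le_right (norm_nonneg _) (one_le_pow₀ (by linarith))
  · simp only [hΞ]
    rw [sub_self, mul_zero, zero_mul, zero_add]
    exact div_ne_zero (div_ne_zero (mul_ne_zero two_ne_zero hB') hn') hD0
  · intro s hs
    refine eq_of_eq_ofReal_of_one_lt (g := fun s ↦ s * (s - 1) * Complex.exp (logDiscr K / 2 * s) *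
      archFactor K s * zetaSeries K s) hdiff.differentiableOn ?_ hreal hs
    refine DifferentiableOn.mul (DifferentiableOn.mul ?_ ?_) differentiableOn_zetaSeries
    · exact Differentiable.differentiableOn (by fun_prop)
    · exact (differentiableOn_archFactor K).mono fun z (hz : 1 < z.re) ↦ show 0 < z.re by linarith

end CompletedZeta

section ZeroFree

open InfinitePlace nonZeroDivisors IsDedekindDomain

variable (K : Type*) [Field K] [NumberField K]

/-- The reciprocal of `s * archFactor K s`, extended to an entire function. -/
noncomputable def archFactorInv (s : ℂ) : ℂ :=
  (2 * Real.pi * Complex.Gammaℝ (s + 2))⁻¹ *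
    (Complex.Gammaℝ s)⁻¹ ^ (nrRealPlaces K + nrComplexPlaces K - 1) *
    (Complex.Gammaℝ (s + 1))⁻¹ ^ nrComplexPlaces K

theorem differentiable_archFactorInv : Differentiable ℂ (archFactorInv K) := by
  have h := Complex.differentiable_Gammaℝ_inv
  have h1 : Differentiable ℂ fun s ↦ (Complex.Gammaℝ (s + 1))⁻¹ :=
    h.comp (differentiable_id.add_const 1)
  have h2 : Differentiable ℂ fun s ↦ (2 * Real.pi * Complex.Gammaℝ (s + 2))⁻¹ := by
    simp only [mul_inv]
    exact (h.comp (differentiable_id.add_const 2)).const_mul _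
  exact (h2.mul (h.pow _)).mul (h1.pow _)

theorem archFactorInv_eq {s : ℂ} (hs : 0 < s.re) :
    archFactorInv K s = (s * archFactor K s)⁻¹ := by
  have hs0 : s ≠ 0 := by
    rintro rfl
    simp at hs
  have hpos : 0 < nrRealPlaces K + nrComplexPlaces K := by
    rw [← card_eq_nrRealPlaces_add_nrComplexPlaces]
    exact Fintype.card_pos
  obtain ⟨m, hm⟩ := Nat.exists_eq_succ_of_ne_zero hpos.ne'
  have hpi : (Real.pi : ℂ) ≠ 0 := by exact_mod_cast Real.pi_ne_zero
  rw [archFactorInv, archFactor, hm, Nat.succ_sub_one, Complex.Gammaℝ_add_two hs0,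
    show 2 * (Real.pi : ℂ) * (Complex.Gammaℝ s * s / 2 / Real.pi) = s * Complex.Gammaℝ s by
      field_simp, Nat.succ_eq_add_one, pow_succ, mul_inv, mul_inv, mul_inv, mul_inv, inv_pow,
      inv_pow]
  ring

variable {K}

theorem zetaSeries_eq_tsum {s : ℂ} (hs : 1 < s.re) :
    zetaSeries K s = ∑' I : Ideal (𝓞 K), (Nat.card ((𝓞 K) ⧸ I) : ℂ) ^ (-s) := by
  have hs0 : s ≠ 0 := by
    rintro rfl
    norm_num at hs
  have hinj : Function.Injective fun I : (Ideal (𝓞 K))⁰ ↦ (I : Ideal (𝓞 K)) :=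
    Subtype.val_injective
  have hcard : ∀ I : Ideal (𝓞 K), Nat.card ((𝓞 K) ⧸ I) = Ideal.absNorm I := fun I ↦ by
    rw [Ideal.absNorm_apply]
    rfl
  simp only [hcard]
  rw [← hinj.tsum_eq, zetaSeries, expSeries]
  · refine tsum_congr fun I ↦ ?_
    have h0 : (Ideal.absNorm (I : Ideal (𝓞 K)) : ℂ) ≠ 0 := by
      exact_mod_cast (absNorm_pos_of_mem I).ne'
    rw [Complex.ofReal_one, one_mul, Complex.cpow_def_of_ne_zero h0, logNorm, ← Complex.natCast_log]
    congr 1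
    ring
  · intro I hI
    have : I ≠ 0 := by
      rintro rfl
      simp [hs0] at hI
    exact ⟨⟨I, mem_nonZeroDivisors_of_ne_zero this⟩, rfl⟩

theorem three_add_four_mul_cos_add_cos_nonneg (x : ℝ) :
    0 ≤ 3 + 4 * Real.cos x + Real.cos (2 * x) := by
  rw [Real.cos_two_mul]
  nlinarith [sq_nonneg (1 + Real.cos x)]

theorem re_logZetaSeries_nonneg {σ : ℝ} (hσ : 1 < σ) (t : ℝ) :
    0 ≤ (3 * logZetaSeries K σ + 4 * logZetaSeries K (σ + t * Complex.I) +
      logZetaSeries K (σ + (2 * t : ℝ) * Complex.I)).re := by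
  have hre : ∀ y : ℝ, (logZetaSeries K (σ + y * Complex.I)).re =
      ∑' x : HeightOneSpectrum (𝓞 K) × ℕ, ((x.2 : ℝ) + 1)⁻¹ *
        (Real.exp (-logNormPow K x * σ) * Real.cos (logNormPow K x * y)) := by
    intro y
    have := expSeries_re (a := fun x : HeightOneSpectrum (𝓞 K) × ℕ ↦ ((x.2 : ℝ) + 1)⁻¹)
      (l := logNormPow K) (s := σ + y * Complex.I) (fun x ↦ by positivity)
      (fun x ↦ (logNormPow_pos x).le) (by simpa using summable_logZeta hσ)
    simpa [logZetaSeries] using this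
  have hsum : ∀ y : ℝ, Summable fun x : HeightOneSpectrum (𝓞 K) × ℕ ↦ ((x.2 : ℝ) + 1)⁻¹ *
        (Real.exp (-logNormPow K x * σ) * Real.cos (logNormPow K x * y)) := by
    intro y
    refine Summable.of_norm_bounded (summable_logZeta (K := K) hσ) fun x ↦ ?_
    rw [norm_mul, norm_mul, Real.norm_of_nonneg (by positivity), Real.norm_of_nonneg
      (Real.exp_pos _).le]
    refine mul_le_mul_of_nonneg_left ?_ (by positivity)
    exact mul_le_of_le_one_right (Real.exp_pos _).le (Real.abs_cos_le_one _)
  have h0 := hre 0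
  simp only [Complex.ofReal_zero, zero_mul, add_zero] at h0
  have h3 : (3 * logZetaSeries K σ + 4 * logZetaSeries K (σ + t * Complex.I) +
      logZetaSeries K (σ + (2 * t : ℝ) * Complex.I)).re = 3 * (logZetaSeries K σ).re +
      4 * (logZetaSeries K (σ + t * Complex.I)).re +
      (logZetaSeries K (σ + (2 * t : ℝ) * Complex.I)).re := by
    simp [Complex.add_re]
  rw [h3, h0, hre, hre, ← tsum_mul_left, ← tsum_mul_left,
    ← ((hsum 0).mul_left 3).tsum_add ((hsum t).mul_left 4),
    ← (((hsum 0).mul_left 3).add ((hsum t).mul_left 4)).tsum_add (hsum (2 * t))]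
  refine tsum_nonneg fun x ↦ ?_
  have h := three_add_four_mul_cos_add_cos_nonneg (logNormPow K x * t)
  have h5 : 0 ≤ ((x.2 : ℝ) + 1)⁻¹ * Real.exp (-logNormPow K x * σ) := by positivity
  have h6 := mul_nonneg h5 h
  simp only [mul_zero, Real.cos_zero]
  rw [show logNormPow K x * (2 * t) = 2 * (logNormPow K x * t) by ring]
  linarith

theorem ne_zero_of_one_add_mul_I {q : ℂ → ℂ} (hq : Differentiable ℂ q)
    (hqζ : ∀ s : ℂ, 1 < s.re → q s = (s - 1) * zetaSeries K s) {t : ℝ} (ht : t ≠ 0) :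
    q (1 + t * Complex.I) ≠ 0 := by
  intro h0
  obtain ⟨c, hc, hζ⟩ := exists_zetaSeries_eq K
  have hlow : ∀ δ : ℝ, 0 < δ → ‖c‖ ^ 8 * |t| ^ 5 ≤
      δ * (‖q (1 + δ)‖ ^ 3 * ‖(δ : ℂ)⁻¹ * (q (1 + t * Complex.I + δ) - q (1 + t * Complex.I))‖ ^ 4 *
        ‖q (1 + (2 * t : ℝ) * Complex.I + δ)‖) := by
    intro δ hδ
    have e1 := hqζ (1 + δ) (by simp; linarith)
    have e2 := hqζ (1 + t * Complex.I + δ) (by simp; linarith)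
    have e3 := hqζ (1 + (2 * t : ℝ) * Complex.I + δ) (by simp; linarith)
    have hp := re_logZetaSeries_nonneg (K := K) (σ := 1 + δ) (by linarith) t
    rw [hζ _ (by simp; linarith)] at e1 e2 e3
    rw [h0, sub_zero, e1, e2, e3]
    have f2 : ((1 + δ : ℝ) : ℂ) + t * Complex.I = 1 + t * Complex.I + δ := by push_cast; ring
    have f3 : ((1 + δ : ℝ) : ℂ) + (2 * t : ℝ) * Complex.I = 1 + (2 * t : ℝ) * Complex.I + δ := by
      push_cast; ring
    have f1 : ((1 + δ : ℝ) : ℂ) = 1 + δ := by push_cast; rfl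
    rw [f2, f3, f1] at hp
    set E1 := logZetaSeries K (1 + δ)
    set E2 := logZetaSeries K (1 + t * Complex.I + δ)
    set E3 := logZetaSeries K (1 + (2 * t : ℝ) * Complex.I + δ)
    have hexp : 1 ≤ ‖Complex.exp E1‖ ^ 3 * ‖Complex.exp E2‖ ^ 4 * ‖Complex.exp E3‖ := by
      rw [Complex.norm_exp, Complex.norm_exp, Complex.norm_exp, ← Real.exp_nat_mul,
        ← Real.exp_nat_mul, ← Real.exp_add, ← Real.exp_add]
      refine Real.one_le_exp ?_
      simpa [Complex.add_re] using hp
    have n1 : ‖(1 + δ : ℂ) - 1‖ = δ := by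
      rw [add_sub_cancel_left, Complex.norm_real, Real.norm_of_nonneg hδ.le]
    have n2 : |t| ≤ ‖(1 + t * Complex.I + δ : ℂ) - 1‖ := by
      have := Complex.abs_im_le_norm ((1 + t * Complex.I + δ : ℂ) - 1)
      simpa using this
    have n3 : |t| ≤ ‖(1 + (2 * t : ℝ) * Complex.I + δ : ℂ) - 1‖ := by
      have := Complex.abs_im_le_norm ((1 + (2 * t : ℝ) * Complex.I + δ : ℂ) - 1)
      have h2 : |t| ≤ |2 * t| := by rw [abs_mul, abs_two]; linarith [abs_nonneg t]
      refine h2.trans ?_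
      simpa using this
    have hδn : ‖(δ : ℂ)⁻¹‖ = δ⁻¹ := by rw [norm_inv, Complex.norm_real, Real.norm_of_nonneg hδ.le]
    simp only [norm_mul, n1, hδn]
    set N2 := ‖(1 + t * Complex.I + δ : ℂ) - 1‖
    set N3 := ‖(1 + (2 * t : ℝ) * Complex.I + δ : ℂ) - 1‖
    have hrw : δ * ((δ * (‖c‖ * ‖Complex.exp E1‖)) ^ 3 *
        (δ⁻¹ * (N2 * (‖c‖ * ‖Complex.exp E2‖))) ^ 4 * (N3 * (‖c‖ * ‖Complex.exp E3‖))) =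
        ‖c‖ ^ 8 * (N2 ^ 4 * N3) *
          (‖Complex.exp E1‖ ^ 3 * ‖Complex.exp E2‖ ^ 4 * ‖Complex.exp E3‖) := by
      field_simp
    rw [hrw]
    calc ‖c‖ ^ 8 * |t| ^ 5 = ‖c‖ ^ 8 * (|t| ^ 4 * |t|) * 1 := by ring
      _ ≤ _ := by gcongr
  have hlim : Filter.Tendsto (fun δ : ℝ ↦
      δ * (‖q (1 + δ)‖ ^ 3 * ‖(δ : ℂ)⁻¹ * (q (1 + t * Complex.I + δ) - q (1 + t * Complex.I))‖ ^ 4 *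
        ‖q (1 + (2 * t : ℝ) * Complex.I + δ)‖)) (nhdsWithin 0 (Set.Ioi 0))
      (nhds (0 * (‖q (1 + (0 : ℝ))‖ ^ 3 * ‖deriv q (1 + t * Complex.I)‖ ^ 4 *
        ‖q (1 + (2 * t : ℝ) * Complex.I + (0 : ℝ))‖))) := by
    have hcont : ∀ z : ℂ, Filter.Tendsto (fun δ : ℝ ↦ q (z + δ)) (nhdsWithin 0 (Set.Ioi 0))
        (nhds (q (z + (0 : ℝ)))) := by
      intro z
      refine Filter.Tendsto.mono_left ?_ nhdsWithin_le_nhds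
      have : Continuous fun δ : ℝ ↦ q (z + δ) := hq.continuous.comp (by fun_prop)
      exact this.tendsto 0
    refine Filter.Tendsto.mul (tendsto_nhdsWithin_of_tendsto_nhds Filter.tendsto_id) ?_
    refine Filter.Tendsto.mul (((hcont 1).norm.pow 3).mul (Filter.Tendsto.pow ?_ 4))
      (hcont _).norm
    have hd := (hq (1 + t * Complex.I)).hasDerivAt
    rw [hasDerivAt_iff_tendsto_slope_zero] at hd
    have h1 : Filter.Tendsto (fun x : ℝ ↦ (x : ℂ)) (nhdsWithin 0 (Set.Ioi 0))
        (nhdsWithin 0 {0}ᶜ) := by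
      refine tendsto_nhdsWithin_iff.mpr ⟨?_, ?_⟩
      · exact (Complex.continuous_ofReal.tendsto 0).mono_left nhdsWithin_le_nhds
      · filter_upwards [self_mem_nhdsWithin] with x hx
        simpa using ne_of_gt hx
    exact (hd.comp h1).norm
  rw [zero_mul] at hlim
  have hge := ge_of_tendsto hlim (by
    filter_upwards [self_mem_nhdsWithin] with δ hδ using hlow δ hδ)
  have hpos : 0 < ‖c‖ ^ 8 * |t| ^ 5 := by
    have := norm_pos_iff.mpr hc
    have := abs_pos.mpr ht
    positivity
  linarith

variable (K) in
/-- Under the Riemann hypothesis, the completed zeta function has zeros on the critical line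
only. -/
theorem exists_completedZeta_of_RHFor (hRH : RHFor K) :
    ∃ Ξ : ℂ → ℂ, Differentiable ℂ Ξ ∧ (∀ s, Ξ (1 - s) = Ξ s) ∧
      (∀ s, Ξ (starRingEnd ℂ s) = starRingEnd ℂ (Ξ s)) ∧
      (∀ a b : ℝ, ∃ C : ℝ, ∀ s : ℂ, a ≤ s.re → s.re ≤ b → ‖Ξ s‖ ≤ C * (1 + ‖s‖) ^ 2) ∧
      (∀ s : ℂ, 1 / 2 < s.re → Ξ s ≠ 0) ∧
      ∀ s : ℂ, 1 < s.re → Ξ s =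
        s * (s - 1) * Complex.exp (logDiscr K / 2 * s) * archFactor K s * zetaSeries K s := by
  obtain ⟨Ξ, hd, hfe, hconj, hgrowth, h1, hprod⟩ := exists_completedZeta K
  refine ⟨Ξ, hd, hfe, hconj, hgrowth, ?_, hprod⟩
  set q : ℂ → ℂ := fun s ↦ Ξ s * Complex.exp (-(logDiscr K / 2 * s)) * archFactorInv K s with hq
  have hqd : Differentiable ℂ q := by
    have := differentiable_archFactorInv K
    rw [hq]
    fun_prop
  have hqζ : ∀ s : ℂ, 1 < s.re → q s = (s - 1) * zetaSeries K s := by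
    intro s hs
    have hs0 : s ≠ 0 := by
      rintro rfl
      norm_num at hs
    have ha : archFactor K s ≠ 0 := archFactor_ne_zero (by linarith)
    simp only [hq]
    rw [hprod s hs, archFactorInv_eq K (by linarith), Complex.exp_neg]
    have := Complex.exp_ne_zero (logDiscr K / 2 * s)
    field_simp
  have hf : isDedekindZeta K fun s ↦ q s / (s - 1) := by
    refine ⟨fun s hs ↦ ?_, fun s hs ↦ ?_⟩
    · have : s - 1 ≠ 0 := sub_ne_zero.mpr hs
      exact (hqd s).div (by fun_prop) this
    · have : s - 1 ≠ 0 := by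
        intro h
        rw [sub_eq_zero] at h
        rw [h] at hs
        norm_num at hs
      rw [← zetaSeries_eq_tsum hs]
      beta_reduce
      rw [hqζ s hs, mul_div_cancel_left₀ _ this]
  obtain ⟨c, hc, hζ⟩ := exists_zetaSeries_eq K
  intro s hs h0
  have hq0 : q s = 0 := by simp [hq, h0]
  rcases lt_trichotomy s.re 1 with h | h | h
  · have := hRH _ hf s (by simp [hq0]) (by linarith) h
    linarith
  · have hs1 : s = 1 + s.im * Complex.I := by
      conv_lhs => rw [← Complex.re_add_im s, h]
      simp
    rcases eq_or_ne s.im 0 with hi | hi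
    · rw [hs1, hi] at h0
      exact h1 (by simpa using h0)
    · exact ne_zero_of_one_add_mul_I hqd hqζ hi (by rw [← hs1]; exact hq0)
  · rw [hqζ s h, hζ s h] at hq0
    have : s - 1 ≠ 0 := by
      intro h'
      rw [sub_eq_zero] at h'
      rw [h'] at h
      norm_num at h
    exact mul_ne_zero this (mul_ne_zero hc (Complex.exp_ne_zero _)) hq0

end ZeroFree

section GammaBounds

open Complex in
theorem norm_betaIntegral_le (z : ℂ) (a : ℝ) :
    ‖betaIntegral z a‖ ≤ ‖betaIntegral z.re a‖ := by
  have h : ∀ w : ℂ, w.re = z.re → ∀ x ∈ Set.Ioc (0 : ℝ) 1,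
      ‖(x : ℂ) ^ (w - 1) * (1 - (x : ℂ)) ^ ((a : ℂ) - 1)‖ =
        x ^ (z.re - 1) * ‖(1 - (x : ℂ)) ^ ((a : ℂ) - 1)‖ := by
    intro w hw x hx
    rw [norm_mul, norm_cpow_eq_rpow_re_of_pos hx.1]
    simp [hw]
  have hcast : ∀ x ∈ Set.Ioc (0 : ℝ) 1,
      (x : ℂ) ^ ((z.re : ℂ) - 1) * (1 - (x : ℂ)) ^ ((a : ℂ) - 1) =
        ((x ^ (z.re - 1) * (1 - x) ^ (a - 1) : ℝ) : ℂ) := by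
    intro x hx
    push_cast
    rw [ofReal_cpow hx.1.le, ofReal_cpow (by linarith [hx.2])]
    push_cast
    rfl
  rw [betaIntegral, betaIntegral]
  refine (intervalIntegral.norm_integral_le_integral_norm zero_le_one).trans ?_
  have e1 : ∫ x : ℝ in (0 : ℝ)..1, ‖(x : ℂ) ^ (z - 1) * (1 - (x : ℂ)) ^ ((a : ℂ) - 1)‖ =
      ∫ x : ℝ in (0 : ℝ)..1, x ^ (z.re - 1) * (1 - x) ^ (a - 1) := by
    rw [intervalIntegral.integral_of_le zero_le_one, intervalIntegral.integral_of_le zero_le_one]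
    refine setIntegral_congr_fun measurableSet_Ioc fun x hx ↦ ?_
    beta_reduce
    rw [h z rfl x hx, ← h z.re (by simp) x hx, hcast x hx, norm_real, Real.norm_of_nonneg]
    exact mul_nonneg (Real.rpow_nonneg hx.1.le _) (Real.rpow_nonneg (by linarith [hx.2]) _)
  have e2 : ∫ x : ℝ in (0 : ℝ)..1, (x : ℂ) ^ ((z.re : ℂ) - 1) * (1 - (x : ℂ)) ^ ((a : ℂ) - 1) =
      ((∫ x : ℝ in (0 : ℝ)..1, x ^ (z.re - 1) * (1 - x) ^ (a - 1) : ℝ) : ℂ) := by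
    rw [← intervalIntegral.integral_ofReal, intervalIntegral.integral_of_le zero_le_one,
      intervalIntegral.integral_of_le zero_le_one]
    exact setIntegral_congr_fun measurableSet_Ioc fun x hx ↦ hcast x hx
  rw [e1, e2, norm_real]
  exact le_abs_self _

theorem norm_Gamma_mul_Gamma_add_le {z : ℂ} {a : ℝ} (hz : 0 < z.re) (ha : 0 < a) :
    ‖Complex.Gamma z‖ * Real.Gamma (z.re + a) ≤ Real.Gamma z.re * ‖Complex.Gamma (z + a)‖ := by
  have h1 := congrArg norm (Complex.Gamma_mul_Gamma_eq_betaIntegral hz (t := a) (by simpa using ha))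
  have h2 := congrArg norm (Complex.Gamma_mul_Gamma_eq_betaIntegral (s := z.re) (t := a)
    (by simpa using hz) (by simpa using ha))
  have h3 := norm_betaIntegral_le z a
  rw [← Complex.ofReal_add, Complex.Gamma_ofReal, Complex.Gamma_ofReal, Complex.Gamma_ofReal] at h2
  rw [Complex.Gamma_ofReal] at h1
  simp only [norm_mul, Complex.norm_real] at h1 h2
  have p1 := Real.Gamma_pos_of_pos hz
  have p2 := Real.Gamma_pos_of_pos ha
  have p3 := Real.Gamma_pos_of_pos (show 0 < z.re + a by linarith)
  rw [Real.norm_of_nonneg p1.le, Real.norm_of_nonneg p2.le, Real.norm_of_nonneg p3.le] at h2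
  rw [Real.norm_of_nonneg p2.le] at h1
  have h4 : ‖Complex.Gamma z‖ * Real.Gamma (z.re + a) * Real.Gamma a =
      ‖Complex.Gamma (z + a)‖ * (Real.Gamma (z.re + a) * ‖Complex.betaIntegral z a‖) := by
    linear_combination Real.Gamma (z.re + a) * h1
  have h5 : Real.Gamma (z.re + a) * ‖Complex.betaIntegral z a‖ ≤
      Real.Gamma z.re * Real.Gamma a := by
    rw [h2]
    gcongr
  refine le_of_mul_le_mul_right ?_ p2
  rw [h4]
  calc _ ≤ ‖Complex.Gamma (z + a)‖ * (Real.Gamma z.re * Real.Gamma a) := by gcongr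
    _ = _ := by ring

theorem exp_neg_pi_mul_abs_le_norm_Gamma_half (y : ℝ) :
    Real.exp (-(Real.pi / 2 * |y|)) ≤ ‖Complex.Gamma (1 / 2 + y * Complex.I)‖ := by
  have h := Complex.Gamma_mul_Gamma_one_sub (1 / 2 + y * Complex.I)
  have hc : (1 : ℂ) - (1 / 2 + y * Complex.I) =
      (starRingEnd ℂ) (1 / 2 + y * Complex.I) := by
    have h2 : (starRingEnd ℂ) 2 = 2 := map_ofNat _ 2
    simp [h2]
    ring
  rw [hc, Complex.Gamma_conj] at h
  have hn := congrArg norm h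
  rw [norm_mul, Complex.norm_conj, norm_div, Complex.norm_real,
    Real.norm_of_nonneg Real.pi_pos.le] at hn
  have hs0 : Complex.sin (Real.pi * (1 / 2 + y * Complex.I)) ≠ 0 := by
    intro h0
    rw [h0, div_zero, mul_eq_zero, map_eq_zero, or_self] at h
    exact Complex.Gamma_ne_zero_of_re_pos (by simp) h
  have hs : ‖Complex.sin (Real.pi * (1 / 2 + y * Complex.I))‖ ≤ Real.exp (Real.pi * |y|) := by
    have h1 := Complex.norm_exp (-(Real.pi * (1 / 2 + y * Complex.I)) * Complex.I)
    have h2 := Complex.norm_exp ((Real.pi * (1 / 2 + y * Complex.I)) * Complex.I)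
    simp only [Complex.mul_re, Complex.neg_re, Complex.neg_im, Complex.mul_im, Complex.I_re,
      Complex.I_im, Complex.ofReal_re, Complex.ofReal_im, Complex.add_im, Complex.add_re] at h1 h2
    norm_num at h1 h2
    rw [Complex.sin, norm_div, norm_mul, Complex.norm_I, mul_one]
    have h3 : ‖(2 : ℂ)‖ = 2 := by simp
    rw [h3, div_le_iff₀ two_pos]
    refine (norm_sub_le _ _).trans ?_
    have h4 : Real.exp (Real.pi * y) ≤ Real.exp (Real.pi * |y|) :=
      Real.exp_le_exp.mpr (mul_le_mul_of_nonneg_left (le_abs_self y) Real.pi_pos.le)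
    have h5 : Real.exp (-(Real.pi * y)) ≤ Real.exp (Real.pi * |y|) :=
      Real.exp_le_exp.mpr (by nlinarith [neg_abs_le y, Real.pi_pos])
    have h1' : ‖Complex.exp (-(Real.pi * (1 / 2 + y * Complex.I)) * Complex.I)‖ =
        Real.exp (Real.pi * y) := by rw [← h1, neg_mul]
    have h2' : ‖Complex.exp ((Real.pi * (1 / 2 + y * Complex.I)) * Complex.I)‖ =
        Real.exp (-(Real.pi * y)) := by rw [← h2]
    rw [h1', h2']
    linarith
  have hpos : 0 < ‖Complex.sin (Real.pi * (1 / 2 + y * Complex.I))‖ := norm_pos_iff.mpr hs0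
  refine le_of_sq_le_sq ?_ (norm_nonneg _)
  rw [← sq] at hn
  rw [hn, le_div_iff₀ hpos, ← Real.exp_nat_mul]
  calc _ ≤ Real.exp ((2 : ℕ) * -(Real.pi / 2 * |y|)) * Real.exp (Real.pi * |y|) := by gcongr
    _ = 1 := by
      rw [← Real.exp_add, Real.exp_eq_one_iff]
      push_cast
      ring
    _ ≤ _ := by linarith [Real.pi_gt_three]

theorem exists_le_norm_Gamma {x : ℝ} (hx : 1 / 2 < x) :
    ∃ c : ℝ, 0 < c ∧ ∀ y : ℝ, c * Real.exp (-(Real.pi / 2 * |y|)) ≤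
      ‖Complex.Gamma (x + y * Complex.I)‖ := by
  have p1 := Real.Gamma_pos_of_pos (show (0 : ℝ) < 1 / 2 by norm_num)
  have p2 := Real.Gamma_pos_of_pos (show (0 : ℝ) < x by linarith)
  refine ⟨Real.Gamma x / Real.Gamma (1 / 2), by positivity, fun y ↦ ?_⟩
  have h := norm_Gamma_mul_Gamma_add_le (z := 1 / 2 + y * Complex.I) (a := x - 1 / 2) (by simp)
    (by linarith)
  have e1 : (1 / 2 + y * Complex.I : ℂ).re = 1 / 2 := by simp
  have e2 : (1 / 2 + y * Complex.I : ℂ) + ((x - 1 / 2 : ℝ) : ℂ) = x + y * Complex.I := by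
    push_cast
    ring
  rw [e1, e2, add_sub_cancel] at h
  rw [div_mul_eq_mul_div, div_le_iff₀ p1, mul_comm ‖_‖]
  refine le_trans ?_ h
  rw [mul_comm]
  gcongr
  exact exp_neg_pi_mul_abs_le_norm_Gamma_half y

end GammaBounds

section LowerBounds

open Complex in
/-- A Harnack-type inequality for nonvanishing holomorphic functions on a disc. -/
theorem exp_mul_norm_le_of_forall_ne_zero {f : ℂ → ℂ} {c z : ℂ} {R M : ℝ}
    (hf : DifferentiableOn ℂ f (Metric.ball c R)) (h0 : ∀ w ∈ Metric.ball c R, f w ≠ 0)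
    (hM : 0 < M) (hbd : ∀ w ∈ Metric.ball c R, ‖f w‖ ≤ Real.exp M * ‖f c‖)
    (hz : z ∈ Metric.ball c R) :
    Real.exp (-(2 * M * ‖z - c‖ / (R - ‖z - c‖))) * ‖f c‖ ≤ ‖f z‖ := by
  have hR : 0 < R := Metric.pos_of_mem_ball hz
  have hc : c ∈ Metric.ball c R := Metric.mem_ball_self hR
  have hd : DifferentiableOn ℂ (fun w ↦ deriv f w / f w) (Metric.ball c R) :=
    (hf.deriv Metric.isOpen_ball).div hf h0
  obtain ⟨g, hg⟩ := hd.isExactOn_ball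
  have hfa : ∀ w ∈ Metric.ball c R, HasDerivAt f (deriv f w) w := fun w hw ↦
    (hf.differentiableAt (Metric.isOpen_ball.mem_nhds hw)).hasDerivAt
  have hconst : ∀ w ∈ Metric.ball c R, f w = f c * exp (g w - g c) := by
    intro w hw
    have hder : ∀ w ∈ Metric.ball c R, HasDerivAt (fun w ↦ f w * exp (-g w)) 0 w := by
      intro w hw
      have h := (hfa w hw).mul (hg w hw).neg.cexp
      have e : deriv f w * exp (-g w) + f w * (exp (-g w) * -(deriv f w / f w)) = 0 := by
        field_simp [h0 w hw]
        ring
      exact e ▸ h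
    have := (convex_ball c R).is_const_of_fderivWithin_eq_zero (𝕜 := ℂ)
      (f := fun w ↦ f w * exp (-g w))
      (fun w hw ↦ (hder w hw).differentiableAt.differentiableWithinAt)
      (fun w hw ↦ by
        rw [fderivWithin_of_isOpen Metric.isOpen_ball hw]
        ext
        simp [(hder w hw).deriv]) hw hc
    rw [sub_eq_add_neg, exp_add]
    have e1 : exp (-g w) * exp (g w) = 1 := by rw [← exp_add]; simp
    calc f w = f w * exp (-g w) * exp (g w) := by rw [mul_assoc, e1, mul_one]
      _ = _ := by rw [this]; ring
  have hre : ∀ w ∈ Metric.ball c R, (g w - g c).re ≤ M := by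
    intro w hw
    have h1 := hbd w hw
    rw [hconst w hw, norm_mul, norm_exp, mul_comm] at h1
    exact Real.exp_le_exp.mp (le_of_mul_le_mul_right h1 (norm_pos_iff.mpr (h0 c hc)))
  have hmaps : ∀ w ∈ Metric.ball (0 : ℂ) R, c + w ∈ Metric.ball c R := by
    intro w hw
    simpa using hw
  have hbc := borelCaratheodory_zero (f := fun w ↦ g (c + w) - g c) (z := z - c) hM
    (fun w hw ↦ (((hg _ (hmaps w hw)).comp_const_add c w).sub_const
      (g c)).differentiableAt.differentiableWithinAt)
    (fun w hw ↦ hre _ (hmaps w hw)) hR (by simpa [dist_eq_norm] using hz) (by simp)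
  beta_reduce at hbc
  rw [add_sub_cancel] at hbc
  rw [hconst z hz, norm_mul, norm_exp, mul_comm]
  refine mul_le_mul_of_nonneg_left (Real.exp_le_exp.mpr ?_) (norm_nonneg _)
  linarith [neg_abs_le (g z - g c).re, abs_re_le_norm (g z - g c)]

/-- `f t` decays at most exponentially in `|t|`. -/
def ExpLower (f : ℝ → ℝ) : Prop := ∃ k : ℝ, 0 ≤ k ∧ ∀ t, Real.exp (-(k * (1 + |t|))) ≤ f t

theorem ExpLower.mul {f g : ℝ → ℝ} (hf : ExpLower f) (hg : ExpLower g) :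
    ExpLower fun t ↦ f t * g t := by
  obtain ⟨k, hk, hf⟩ := hf
  obtain ⟨l, hl, hg⟩ := hg
  refine ⟨k + l, by positivity, fun t ↦ ?_⟩
  rw [add_mul, neg_add, Real.exp_add]
  exact mul_le_mul (hf t) (hg t) (Real.exp_pos _).le ((Real.exp_pos _).le.trans (hf t))

theorem ExpLower.of_one_le {f : ℝ → ℝ} (hf : ∀ t, 1 ≤ f t) : ExpLower f :=
  ⟨0, le_rfl, by simpa using hf⟩

theorem ExpLower.pow {f : ℝ → ℝ} (hf : ExpLower f) (m : ℕ) : ExpLower fun t ↦ f t ^ m := by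
  induction m with
  | zero => exact .of_one_le (by simp)
  | succ m ih => simpa only [pow_succ] using ih.mul hf

theorem ExpLower.of_le {f : ℝ → ℝ} {c a : ℝ} (hc : 0 < c) (ha : 0 ≤ a)
    (hf : ∀ t, c * Real.exp (-(a * |t|)) ≤ f t) : ExpLower f := by
  refine ⟨a + |Real.log c|, by positivity, fun t ↦ le_trans ?_ (hf t)⟩
  nth_rewrite 2 [← Real.exp_log hc]
  rw [← Real.exp_add, Real.exp_le_exp]
  nlinarith [neg_abs_le (Real.log c), abs_nonneg t, abs_nonneg (Real.log c)]

theorem norm_Gammaℝ {z : ℂ} : ‖Complex.Gammaℝ z‖ =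
    Real.pi ^ (-z.re / 2) * ‖Complex.Gamma (z / 2)‖ := by
  rw [Complex.Gammaℝ_def, norm_mul, Complex.norm_cpow_eq_rpow_re_of_pos Real.pi_pos]
  simp

theorem expLower_Gammaℝ {x : ℝ} (hx : 1 < x) :
    ExpLower fun t ↦ ‖Complex.Gammaℝ (x + t * Complex.I)‖ := by
  obtain ⟨c, hc, h⟩ := exists_le_norm_Gamma (show 1 / 2 < x / 2 by linarith)
  refine .of_le (c := Real.pi ^ (-x / 2) * c) (a := Real.pi / 4)
    (mul_pos (Real.rpow_pos_of_pos Real.pi_pos _) hc) (by positivity) fun t ↦ ?_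
  rw [norm_Gammaℝ, mul_assoc]
  have h1 := h (t / 2)
  have e1 : (x + t * Complex.I : ℂ).re = x := by simp
  have e2 : (x + t * Complex.I : ℂ) / 2 = (x / 2 : ℝ) + (t / 2 : ℝ) * Complex.I := by
    push_cast
    ring
  rw [e1, e2]
  refine mul_le_mul_of_nonneg_left ?_ (Real.rpow_nonneg Real.pi_pos.le _)
  rwa [show Real.pi / 2 * |t / 2| = Real.pi / 4 * |t| by rw [abs_div, abs_two]; ring] at h1

theorem norm_Gammaℝ_le {z : ℂ} {a : ℝ} (hz : 4 ≤ z.re) (ha : 0 < a) :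
    ‖Complex.Gammaℝ z‖ ≤ Real.pi ^ (a / 2) * ‖Complex.Gammaℝ (z + a)‖ := by
  rw [norm_Gammaℝ, norm_Gammaℝ]
  have h := norm_Gamma_mul_Gamma_add_le (z := z / 2) (a := a / 2) (by simp; linarith)
    (by linarith)
  have e0 : (z / 2).re = z.re / 2 := by simp
  have e1 : z / 2 + ((a / 2 : ℝ) : ℂ) = (z + a) / 2 := by push_cast; ring
  have e2 : Real.pi ^ (a / 2) * (Real.pi ^ (-(z + a).re / 2) * ‖Complex.Gamma ((z + a) / 2)‖) =
      Real.pi ^ (-z.re / 2) * ‖Complex.Gamma ((z + a) / 2)‖ := by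
    rw [← mul_assoc, ← Real.rpow_add Real.pi_pos]
    congr 2
    simp
    ring
  rw [e0, e1] at h
  rw [e2]
  refine mul_le_mul_of_nonneg_left ?_ (Real.rpow_nonneg Real.pi_pos.le _)
  have p1 := Real.Gamma_pos_of_pos (show 0 < z.re / 2 by linarith)
  have hm : Real.Gamma (z.re / 2) ≤ Real.Gamma (z.re / 2 + a / 2) :=
    Real.Gamma_strictMonoOn_Ici.monotoneOn (by simp; linarith) (by simp; linarith) (by linarith)
  refine le_of_mul_le_mul_left ?_ p1
  refine le_trans ?_ h
  rw [mul_comm]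
  gcongr

end LowerBounds

section Positivity

open InfinitePlace nonZeroDivisors IsDedekindDomain

/-- `Ξ` is the entire completed Dedekind zeta function of `K`, up to a constant, and all its zeros
lie on the critical line. -/
structure IsCompletedZeta (K : Type*) [Field K] [NumberField K] (Ξ : ℂ → ℂ) : Prop where
  differentiable : Differentiable ℂ Ξ
  one_sub : ∀ s, Ξ (1 - s) = Ξ s
  conj : ∀ s, Ξ (starRingEnd ℂ s) = starRingEnd ℂ (Ξ s)
  growth : ∀ a b : ℝ, ∃ C : ℝ, ∀ s : ℂ, a ≤ s.re → s.re ≤ b → ‖Ξ s‖ ≤ C * (1 + ‖s‖) ^ 2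
  ne_zero : ∀ s : ℂ, 1 / 2 < s.re → Ξ s ≠ 0
  eq_mul : ∀ s : ℂ, 1 < s.re → Ξ s =
    s * (s - 1) * Complex.exp (logDiscr K / 2 * s) * archFactor K s * zetaSeries K s

variable {K : Type*} [Field K] [NumberField K] {Ξ : ℂ → ℂ}

theorem logDiscr_nonneg : 0 ≤ logDiscr K := Real.log_nonneg (one_le_abs_discr K)

theorem exists_norm_zetaSeries_bounds : ∃ m M : ℝ, 0 < m ∧ 0 < M ∧ ∀ s : ℂ, 2 ≤ s.re →
    m ≤ ‖zetaSeries K s‖ ∧ ‖zetaSeries K s‖ ≤ M := by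
  obtain ⟨c, hc, h⟩ := exists_zetaSeries_eq K
  have hc' := norm_pos_iff.mpr hc
  set S := ∑' x : HeightOneSpectrum (𝓞 K) × ℕ, ((x.2 : ℝ) + 1)⁻¹ * Real.exp (-logNormPow K x * 2)
  refine ⟨‖c‖ * Real.exp (-S), ‖c‖ * Real.exp S, by positivity, by positivity, fun s hs ↦ ?_⟩
  have hS : ‖logZetaSeries K s‖ ≤ S := norm_expSeries_le (fun x ↦ by positivity)
    (fun x ↦ (logNormPow_pos x).le) hs (summable_logZeta one_lt_two)
  have hre := Complex.abs_re_le_norm (logZetaSeries K s)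
  rw [h s (by linarith), norm_mul, Complex.norm_exp]
  constructor
  · gcongr
    linarith [neg_abs_le (logZetaSeries K s).re]
  · gcongr
    linarith [le_abs_self (logZetaSeries K s).re]

theorem norm_archFactor_le {a : ℝ} (ha : 0 < a) : ∃ M : ℝ, 0 < M ∧ ∀ s : ℂ, 4 ≤ s.re →
    ‖archFactor K s‖ ≤ M * ‖archFactor K (s + a)‖ := by
  set p := Real.pi ^ (a / 2)
  have hp : 0 < p := Real.rpow_pos_of_pos Real.pi_pos _
  refine ⟨p ^ (nrRealPlaces K + nrComplexPlaces K) * p ^ nrComplexPlaces K, by positivity,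
    fun s hs ↦ ?_⟩
  have h1 := norm_Gammaℝ_le hs ha
  have h2 := norm_Gammaℝ_le (z := s + 1) (by simp; linarith) ha
  rw [add_right_comm] at h2
  simp only [archFactor, norm_mul, norm_pow]
  calc _ ≤ (p * ‖Complex.Gammaℝ (s + a)‖) ^ (nrRealPlaces K + nrComplexPlaces K) *
      (p * ‖Complex.Gammaℝ (s + a + 1)‖) ^ nrComplexPlaces K := by gcongr
    _ = _ := by ring

theorem IsCompletedZeta.expLower (h : IsCompletedZeta K Ξ) :
    ExpLower fun t ↦ ‖Ξ (8 + t * Complex.I)‖ := by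
  obtain ⟨m, M, hm, hM, hζ⟩ := exists_norm_zetaSeries_bounds (K := K)
  have e1 : ExpLower fun t ↦ ‖Complex.exp (logDiscr K / 2 * (8 + t * Complex.I))‖ := by
    refine .of_one_le fun t ↦ ?_
    rw [Complex.norm_exp]
    refine Real.one_le_exp ?_
    have : ((logDiscr K / 2 * (8 + t * Complex.I) : ℂ)).re = logDiscr K / 2 * 8 := by
      rw [show (logDiscr K / 2 * (8 + t * Complex.I) : ℂ) = ((logDiscr K / 2 * 8 : ℝ) : ℂ) +
        ((logDiscr K / 2 * t : ℝ) : ℂ) * Complex.I by push_cast; ring]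
      simp
    rw [this]
    have := logDiscr_nonneg (K := K)
    positivity
  have e2 : ExpLower fun t ↦ ‖archFactor K (8 + t * Complex.I)‖ := by
    have h8 := (expLower_Gammaℝ (x := 8) (by norm_num)).pow (nrRealPlaces K + nrComplexPlaces K)
    have h9 := (expLower_Gammaℝ (x := 9) (by norm_num)).pow (nrComplexPlaces K)
    have := h8.mul h9
    simp only [archFactor, norm_mul, norm_pow]
    have e : ∀ t : ℝ, (8 + t * Complex.I + 1 : ℂ) = ((9 : ℝ) : ℂ) + t * Complex.I := by
      intro t
      push_cast
      ring
    simp only [e]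
    exact_mod_cast this
  have e3 : ExpLower fun t ↦ ‖zetaSeries K (8 + t * Complex.I)‖ :=
    .of_le hm le_rfl fun t ↦ by
      have := (hζ (8 + t * Complex.I) (by norm_num)).1
      simpa using this
  have e4 : ExpLower fun t ↦ ‖(8 + t * Complex.I) * (8 + t * Complex.I - 1)‖ := by
    refine .of_one_le fun t ↦ ?_
    rw [norm_mul]
    have h1 := Complex.re_le_norm (8 + t * Complex.I)
    have h2 := Complex.re_le_norm (8 + t * Complex.I - 1)
    norm_num at h1 h2
    nlinarith
  have := ((e4.mul e1).mul e2).mul e3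
  have hne : ∀ t : ℝ, 1 < (8 + t * Complex.I : ℂ).re := fun t ↦ by simp
  simp only [h.eq_mul _ (hne _)]
  simpa only [norm_mul] using this

/-- Lower bound for the completed zeta function to the right of the critical line. -/
theorem IsCompletedZeta.exists_exp_le (h : IsCompletedZeta K Ξ) {σ : ℝ} (hσ : 1 / 2 < σ) :
    ∃ k : ℝ, 0 ≤ k ∧ ∀ s : ℂ, σ ≤ s.re → s.re ≤ 8 →
      Real.exp (-(k * (1 + |s.im|))) ≤ ‖Ξ s‖ := by
  obtain ⟨k, hk, hlow⟩ := h.expLower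
  obtain ⟨C, hC⟩ := h.growth 0 16
  have hC0 : 0 ≤ C := by
    have := (norm_nonneg _).trans (hC 0 (by simp) (by simp))
    simpa using this
  set m := max (8 - σ) 0 with hm
  have hm0 : 0 ≤ m := le_max_right _ _
  have hm1 : m < 15 / 2 := max_lt (by linarith) (by norm_num)
  set A := C + 34 + k with hA
  have hA0 : 0 < A := by positivity
  refine ⟨2 * A * m / (15 / 2 - m) + k, ?_, fun s hs hs8 ↦ ?_⟩
  · have : 0 < 15 / 2 - m := by linarith
    positivity
  set t := s.im with ht
  set c : ℂ := 8 + t * Complex.I with hc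
  have hnorm : ‖s - c‖ = 8 - s.re := by
    have : s - c = ((s.re - 8 : ℝ) : ℂ) := by
      rw [hc, ht]
      apply Complex.ext <;> simp
    rw [this, Complex.norm_real, Real.norm_of_nonpos (by linarith)]
    ring
  have hle : ‖s - c‖ ≤ m := by
    rw [hnorm]
    exact le_trans (by linarith) (le_max_left _ _)
  have hball : ∀ w ∈ Metric.ball c (15 / 2), 1 / 2 < w.re ∧ w.re ≤ 16 ∧ ‖w‖ ≤ 16 + |t| := by
    intro w hw
    rw [Metric.mem_ball, dist_eq_norm] at hw
    have h1 := Complex.abs_re_le_norm (w - c)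
    have h2 : (w - c).re = w.re - 8 := by simp [hc]
    rw [h2] at h1
    have h3 := abs_le.mp (h1.trans hw.le)
    have h4 := abs_lt.mp (h1.trans_lt hw)
    refine ⟨by linarith [h4.1], by linarith [h3.2], ?_⟩
    have h5 : ‖c‖ ≤ 8 + |t| := by
      refine (norm_add_le _ _).trans ?_
      simp
    have h6 : ‖w‖ ≤ ‖w - c‖ + ‖c‖ := by simpa using norm_add_le (w - c) c
    linarith
  have hMpos : 0 < A * (1 + |t|) := by positivity
  have key := exp_mul_norm_le_of_forall_ne_zero (f := Ξ) (c := c) (z := s) (R := 15 / 2)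
    (M := A * (1 + |t|)) h.differentiable.differentiableOn
    (fun w hw ↦ h.ne_zero w (hball w hw).1) hMpos (fun w hw ↦ ?_)
    (by rw [Metric.mem_ball, dist_eq_norm]; linarith)
  · refine le_trans ?_ key
    calc Real.exp (-((2 * A * m / (15 / 2 - m) + k) * (1 + |t|))) =
        Real.exp (-(2 * (A * (1 + |t|)) * m / (15 / 2 - m))) * Real.exp (-(k * (1 + |t|))) := by
          rw [← Real.exp_add]
          congr 1
          ring
      _ ≤ _ := by
        have hd : 0 < 15 / 2 - m := by linarith
        gcongr
        exact hlow t
  · obtain ⟨h1, h2, h3⟩ := hball w hw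
    have h4 := hC w (by linarith) h2
    have h5 := hlow t
    calc ‖Ξ w‖ ≤ C * (1 + ‖w‖) ^ 2 := h4
      _ ≤ Real.exp C * Real.exp (16 + |t|) ^ 2 := by
        gcongr
        · linarith [Real.add_one_le_exp C]
        · linarith [Real.add_one_le_exp (16 + |t|)]
      _ = Real.exp (C + 2 * (16 + |t|)) := by
        rw [← Real.exp_nat_mul, ← Real.exp_add]
        norm_num
      _ ≤ Real.exp (A * (1 + |t|) + -(k * (1 + |t|))) := by
        rw [Real.exp_le_exp, hA]
        nlinarith [abs_nonneg t]
      _ = Real.exp (A * (1 + |t|)) * Real.exp (-(k * (1 + |t|))) := Real.exp_add _ _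
      _ ≤ _ := by gcongr

end Positivity

section Monotonicity

open InfinitePlace nonZeroDivisors IsDedekindDomain

variable {K : Type*} [Field K] [NumberField K] {Ξ : ℂ → ℂ}

theorem norm_le_norm_add_ofReal {z : ℂ} {a : ℝ} (hz : 0 ≤ z.re) (ha : 0 ≤ a) :
    ‖z‖ ≤ ‖z + a‖ := by
  refine le_of_sq_le_sq ?_ (norm_nonneg _)
  rw [← Complex.normSq_eq_norm_sq, ← Complex.normSq_eq_norm_sq, Complex.normSq_apply,
    Complex.normSq_apply]
  simp only [Complex.add_re, Complex.ofReal_re, Complex.add_im, Complex.ofReal_im, add_zero]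
  nlinarith [mul_nonneg hz ha]

theorem IsCompletedZeta.exists_norm_le_right (h : IsCompletedZeta K Ξ) {a : ℝ} (ha : 0 < a) :
    ∃ M : ℝ, 0 < M ∧ ∀ s : ℂ, 4 ≤ s.re → ‖Ξ s‖ ≤ M * ‖Ξ (s + a)‖ := by
  obtain ⟨m, M, hm, hM, hζ⟩ := exists_norm_zetaSeries_bounds (K := K)
  obtain ⟨M', hM', harch⟩ := norm_archFactor_le (K := K) ha
  refine ⟨M' * (M / m), by positivity, fun s hs ↦ ?_⟩
  have hre : (s + a).re = s.re + a := by simp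
  rw [h.eq_mul s (by linarith), h.eq_mul (s + a) (by rw [hre]; linarith)]
  have h1 := norm_le_norm_add_ofReal (z := s) (by linarith) ha.le
  have h2 := norm_le_norm_add_ofReal (z := s - 1) (by simp; linarith) ha.le
  rw [sub_add_eq_add_sub] at h2
  have h3 : ‖Complex.exp (logDiscr K / 2 * s)‖ ≤ ‖Complex.exp (logDiscr K / 2 * (s + a))‖ := by
    rw [Complex.norm_exp, Complex.norm_exp, Real.exp_le_exp]
    have e : (logDiscr K / 2 * (s + a) : ℂ) = logDiscr K / 2 * s + ((logDiscr K / 2 * a : ℝ) : ℂ) := by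
      push_cast
      ring
    rw [e, Complex.add_re, Complex.ofReal_re]
    have := mul_nonneg (logDiscr_nonneg (K := K)) ha.le
    linarith
  have h4 := harch s hs
  have h5 : ‖zetaSeries K s‖ ≤ M / m * ‖zetaSeries K (s + a)‖ := by
    refine (hζ s (by linarith)).2.trans ?_
    rw [div_mul_eq_mul_div, le_div_iff₀ hm]
    gcongr
    exact (hζ (s + a) (by rw [hre]; linarith)).1
  simp only [norm_mul]
  calc _ ≤ ‖s + a‖ * ‖s + a - 1‖ * ‖Complex.exp (logDiscr K / 2 * (s + a))‖ *
        (M' * ‖archFactor K (s + a)‖) * (M / m * ‖zetaSeries K (s + a)‖) := by gcongr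
    _ = _ := by ring

theorem IsCompletedZeta.norm_sub_le_norm_add (h : IsCompletedZeta K Ξ) {a : ℝ} (ha : 0 < a)
    (ha' : a ≤ 1 / 4) {s : ℂ} (hs : 1 / 2 ≤ s.re) : ‖Ξ (s - a)‖ ≤ ‖Ξ (s + a)‖ := by
  set f : ℂ → ℂ := fun w ↦ Ξ (1 / 2 + w - a) / Ξ (1 / 2 + w + a) with hf
  have hne : ∀ w : ℂ, 0 ≤ w.re → Ξ (1 / 2 + w + a) ≠ 0 := by
    intro w hw
    refine h.ne_zero _ ?_
    simp
    linarith
  have hdiff : DiffContOnCl ℂ f {z | 0 < z.re} := by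
    refine DifferentiableOn.diffContOnCl fun w hw ↦ ?_
    rw [Complex.closure_setOfPred_lt_re] at hw
    have h1 : DifferentiableAt ℂ (fun w : ℂ ↦ Ξ (1 / 2 + w - a)) w :=
      (h.differentiable _).comp w (by fun_prop)
    have h2 : DifferentiableAt ℂ (fun w : ℂ ↦ Ξ (1 / 2 + w + a)) w :=
      (h.differentiable _).comp w (by fun_prop)
    exact (h1.div h2 (hne w hw)).differentiableWithinAt
  obtain ⟨M, hM, hright⟩ := h.exists_norm_le_right (a := 2 * a) (by linarith)
  obtain ⟨k, hk, hlow⟩ := h.exists_exp_le (σ := 1 / 2 + a) (by linarith)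
  obtain ⟨C, hC⟩ := h.growth 0 8
  have hC0 : 0 ≤ C := by
    have := (norm_nonneg _).trans (hC 0 (by simp) (by simp))
    simpa using this
  have hfar : ∀ w : ℂ, 7 ≤ w.re → ‖f w‖ ≤ M := by
    intro w hw
    have h1 := hright (1 / 2 + w - a) (by simp; linarith)
    rw [show (1 / 2 + w - a : ℂ) + ((2 * a : ℝ) : ℂ) = 1 / 2 + w + a by push_cast; ring] at h1
    rw [hf, norm_div, div_le_iff₀ (norm_pos_iff.mpr (hne w (by linarith)))]
    exact h1
  have hnear : ∀ w : ℂ, 0 ≤ w.re → w.re ≤ 7 →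
      ‖f w‖ ≤ C * Real.exp (4 + k) * Real.exp ((2 + k) * ‖w‖) := by
    intro w hw hw7
    have h1 := hC (1 / 2 + w - a) (by simp; linarith) (by simp; linarith)
    have h2 := hlow (1 / 2 + w + a) (by simp; linarith) (by simp; linarith)
    have e2 : (1 / 2 + w + a : ℂ).im = w.im := by simp
    rw [e2] at h2
    have h3 : 1 + ‖(1 / 2 + w - a : ℂ)‖ ≤ Real.exp (2 + ‖w‖) := by
      have e3 : (1 / 2 + w - a : ℂ) = ((1 / 2 - a : ℝ) : ℂ) + w := by push_cast; ring
      have h4 : ‖(1 / 2 + w - a : ℂ)‖ ≤ 1 / 2 + ‖w‖ := by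
        rw [e3]
        refine (norm_add_le _ _).trans ?_
        rw [Complex.norm_real, Real.norm_of_nonneg (by linarith)]
        linarith
      linarith [Real.add_one_le_exp (2 + ‖w‖)]
    have h6 : Real.exp (-(k * (1 + ‖w‖))) ≤ ‖Ξ (1 / 2 + w + a)‖ := by
      refine le_trans (Real.exp_le_exp.mpr ?_) h2
      have := Complex.abs_im_le_norm w
      gcongr
    rw [hf, norm_div, div_le_iff₀ (norm_pos_iff.mpr (hne w hw))]
    calc ‖Ξ (1 / 2 + w - a)‖ ≤ C * Real.exp (2 + ‖w‖) ^ 2 := h1.trans (by gcongr)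
      _ = C * Real.exp (4 + k) * Real.exp ((2 + k) * ‖w‖) * Real.exp (-(k * (1 + ‖w‖))) := by
        rw [mul_assoc, mul_assoc, ← Real.exp_add, ← Real.exp_add, ← Real.exp_nat_mul]
        congr 2
        push_cast
        ring
      _ ≤ _ := by gcongr
  have hbig : ∃ c < (2 : ℝ), ∃ B, f =O[Bornology.cobounded ℂ ⊓ Filter.principal {z | 0 < z.re}]
      fun z ↦ Real.exp (B * ‖z‖ ^ c) := by
    refine ⟨1, by norm_num, 2 + k, Asymptotics.IsBigO.of_bound
      (max M (C * Real.exp (4 + k))) ?_⟩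
    rw [Filter.eventually_inf_principal]
    refine Filter.Eventually.of_forall fun w hw ↦ ?_
    rw [Real.rpow_one, Real.norm_of_nonneg (Real.exp_pos _).le]
    rcases le_total w.re 7 with h7 | h7
    · refine (hnear w (le_of_lt hw) h7).trans ?_
      gcongr
      exact le_max_right _ _
    · refine (hfar w h7).trans ?_
      have h1 : 1 ≤ Real.exp ((2 + k) * ‖w‖) := Real.one_le_exp (by positivity)
      have h2 : M ≤ max M (C * Real.exp (4 + k)) := le_max_left _ _
      nlinarith
  have hreal : Filter.IsBoundedUnder (· ≤ ·) Filter.atTop fun x : ℝ ↦ ‖f x‖ := by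
    refine Filter.isBoundedUnder_of_eventually_le (a := M) ?_
    filter_upwards [Filter.eventually_ge_atTop 7] with x hx
    exact hfar x (by simpa using hx)
  have him : ∀ x : ℝ, ‖f (x * Complex.I)‖ ≤ 1 := by
    intro x
    have e : (1 / 2 + x * Complex.I - a : ℂ) =
        1 - (starRingEnd ℂ) (1 / 2 + x * Complex.I + a) := by
      have h2 : (starRingEnd ℂ) 2 = 2 := map_ofNat _ 2
      simp [h2]
      ring
    rw [hf]
    beta_reduce
    rw [e, h.one_sub, h.conj, norm_div, Complex.norm_conj]
    exact div_self_le_one _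
  have key := PhragmenLindelof.right_half_plane_of_bounded_on_real hdiff hbig hreal him
    (z := s - 1 / 2) (by simp; linarith)
  rw [hf] at key
  beta_reduce at key
  rw [add_sub_cancel, norm_div, div_le_one (norm_pos_iff.mpr ?_)] at key
  · exact key
  · refine h.ne_zero _ ?_
    simp
    linarith

/-- The logarithmic derivative of the completed zeta function has nonnegative real part to the
right of the critical line. -/
theorem IsCompletedZeta.re_logDeriv_nonneg (h : IsCompletedZeta K Ξ) {s : ℂ} (hs : 1 / 2 < s.re) :
    0 ≤ (logDeriv Ξ s).re := by
  have hne := h.ne_zero s hs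
  have hd := (h.differentiable s).hasDerivAt
  have hline : HasDerivAt (fun x : ℝ ↦ Ξ (s + x)) (deriv Ξ s) 0 := by
    have h1 : HasDerivAt (fun x : ℝ ↦ s + (x : ℂ)) 1 0 :=
      (Complex.ofRealCLM.hasDerivAt (x := 0)).const_add s
    have h2 : HasDerivAt Ξ (deriv Ξ s) (s + ((0 : ℝ) : ℂ)) := by simpa using hd
    exact (HasDerivAt.comp (h := fun x : ℝ ↦ s + (x : ℂ)) (0 : ℝ) h2 h1).congr_deriv (mul_one _)
  have hsq : HasDerivAt (fun x : ℝ ↦ ‖Ξ (s + x)‖ ^ 2)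
      (2 * (deriv Ξ s * starRingEnd ℂ (Ξ s)).re) 0 := by
    have hr : HasDerivAt (fun x : ℝ ↦ (Ξ (s + x)).re) (deriv Ξ s).re 0 :=
      Complex.reCLM.hasFDerivAt.comp_hasDerivAt (0 : ℝ) hline
    have hi : HasDerivAt (fun x : ℝ ↦ (Ξ (s + x)).im) (deriv Ξ s).im 0 :=
      Complex.imCLM.hasFDerivAt.comp_hasDerivAt (0 : ℝ) hline
    have h1 := (hr.pow 2).add (hi.pow 2)
    have e : (fun x : ℝ ↦ ‖Ξ (s + x)‖ ^ 2) =
        ((fun x : ℝ ↦ (Ξ (s + x)).re) ^ 2 + (fun x : ℝ ↦ (Ξ (s + x)).im) ^ 2) := by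
      ext x
      rw [← Complex.normSq_eq_norm_sq, Complex.normSq_apply]
      simp
      ring
    rw [e]
    refine h1.congr_deriv ?_
    simp
    ring
  have hslope := hasDerivAt_iff_tendsto_slope_zero.mp
    (hsq.sub (HasDerivAt.comp_const_sub (f := fun x : ℝ ↦ ‖Ξ (s + x)‖ ^ 2) 0 0
      (hsq.congr_deriv rfl |> fun h ↦ by rwa [sub_zero])))
  have hge : 0 ≤ 2 * (deriv Ξ s * starRingEnd ℂ (Ξ s)).re -
      -(2 * (deriv Ξ s * starRingEnd ℂ (Ξ s)).re) := by
    refine ge_of_tendsto (hslope.mono_left (nhdsGT_le_nhdsNE 0)) ?_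
    filter_upwards [Ioo_mem_nhdsGT (show (0 : ℝ) < 1 / 4 by norm_num)] with x hx
    have h1 := h.norm_sub_le_norm_add hx.1 hx.2.le hs.le
    rw [_root_.smul_eq_mul]
    refine mul_nonneg (inv_nonneg.mpr hx.1.le) ?_
    have h2 : ‖Ξ (s - x)‖ ^ 2 ≤ ‖Ξ (s + x)‖ ^ 2 := by gcongr
    simpa [sub_eq_add_neg] using h2
  have hpos : 0 ≤ (deriv Ξ s * starRingEnd ℂ (Ξ s)).re := by linarith
  rw [logDeriv_apply, Complex.div_re, ← add_div]
  refine div_nonneg ?_ (Complex.normSq_nonneg _)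
  simpa using hpos

end Monotonicity

section LogDerivative

open InfinitePlace nonZeroDivisors IsDedekindDomain

/-- A holomorphic function on a half-plane with nonnegative real part grows at most
quadratically. -/
theorem exists_norm_le_of_re_nonneg {F : ℂ → ℂ} {α : ℝ} (hF : DifferentiableOn ℂ F {s | α < s.re})
    (hre : ∀ s : ℂ, α < s.re → 0 ≤ (F s).re) {σ : ℝ} (hσ : α < σ) :
    ∃ C : ℝ, 0 < C ∧ ∀ s : ℂ, σ ≤ s.re → ‖F s‖ ≤ C * (1 + ‖s‖ ^ 2) := by
  have hne : ∀ z ∈ Metric.ball (0 : ℂ) 1, 1 - z ≠ 0 := by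
    intro z hz h0
    rw [mem_ball_zero_iff, ← sub_eq_zero.mp h0] at hz
    simp at hz
  have hmem : ∀ z ∈ Metric.ball (0 : ℂ) 1, α < (α + (1 + z) / (1 - z) : ℂ).re := by
    intro z hz
    have h0 := hne z hz
    rw [mem_ball_zero_iff] at hz
    rw [Complex.add_re, Complex.ofReal_re, Complex.div_re, ← add_div]
    refine lt_add_of_pos_right _ (div_pos ?_ (Complex.normSq_pos.mpr h0))
    have h1 : Complex.normSq z < 1 := by
      rw [Complex.normSq_eq_norm_sq]
      nlinarith [norm_nonneg z]
    rw [Complex.normSq_apply] at h1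
    simp
    nlinarith
  set f : ℂ → ℂ := fun z ↦ -F (α + (1 + z) / (1 - z)) with hf
  have hd : DifferentiableOn ℂ f (Metric.ball 0 1) := by
    refine (hF.comp (fun z hz ↦ ?_) (fun z hz ↦ hmem z hz)).neg
    have h0 := hne z hz
    have h1 : DifferentiableAt ℂ (fun z : ℂ ↦ (1 + z) / (1 - z)) z :=
      DifferentiableAt.div (by fun_prop) (by fun_prop) h0
    exact (h1.const_add _).differentiableWithinAt
  have key : ∀ z ∈ Metric.ball (0 : ℂ) 1, ‖f z‖ ≤ (2 + 2 * ‖f 0‖) / (1 - ‖z‖) := by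
    intro z hz
    have h := Complex.borelCaratheodory (M := 1) one_pos hd (fun w hw ↦ by
      have := hre _ (hmem w hw)
      show (f w).re ≤ 1
      simp only [hf, Complex.neg_re]
      linarith) one_pos hz
    rw [mem_ball_zero_iff] at hz
    have h1 : 0 < 1 - ‖z‖ := by linarith
    refine h.trans ?_
    rw [← add_div]
    refine div_le_div_of_nonneg_right ?_ h1.le
    nlinarith [norm_nonneg (f 0), norm_nonneg z]
  set A := 2 + 2 * ‖f 0‖
  have hA : 0 < A := by positivity
  refine ⟨A * (|α| + 2) ^ 2 / (σ - α), by
    have : 0 < σ - α := by linarith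
    positivity, fun s hs ↦ ?_⟩
  set w := s - α with hw
  have hwre : 0 < w.re := by simp [hw]; linarith
  have hw1 : w + 1 ≠ 0 := by
    intro h0
    have := congrArg Complex.re h0
    simp at this
    linarith
  set z := (w - 1) / (w + 1) with hz
  have hnz : 1 - ‖z‖ ^ 2 = 4 * w.re / ‖w + 1‖ ^ 2 := by
    have h1 : ‖w + 1‖ ^ 2 ≠ 0 := pow_ne_zero _ (norm_ne_zero_iff.mpr hw1)
    rw [hz, norm_div, div_pow, eq_div_iff h1, sub_mul, div_mul_cancel₀ _ h1,
      ← Complex.normSq_eq_norm_sq, ← Complex.normSq_eq_norm_sq, Complex.normSq_apply,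
      Complex.normSq_apply]
    simp
    ring
  have hpos : 0 < ‖w + 1‖ ^ 2 := by
    have := norm_pos_iff.mpr hw1
    positivity
  have hz1 : ‖z‖ < 1 := by
    have : 0 < 4 * w.re / ‖w + 1‖ ^ 2 := by positivity
    nlinarith [norm_nonneg z]
  have hcay : (α + (1 + z) / (1 - z) : ℂ) = s := by
    have h0 := hne z (by simpa using hz1)
    have : (1 + z) / (1 - z) = w := by
      rw [div_eq_iff h0, hz]
      field_simp
      ring
    rw [this, hw]
    ring
  have h := key z (by simpa using hz1)
  simp only [hf] at h
  rw [hcay, norm_neg] at h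
  have h2 : 1 / (1 - ‖z‖) ≤ ‖w + 1‖ ^ 2 / (σ - α) := by
    have h3 : 0 < σ - α := by linarith
    rw [div_le_div_iff₀ (by linarith) h3]
    have h4 : (1 - ‖z‖) * (1 + ‖z‖) * ‖w + 1‖ ^ 2 = 4 * w.re := by
      have : (1 - ‖z‖) * (1 + ‖z‖) = 4 * w.re / ‖w + 1‖ ^ 2 := by rw [← hnz]; ring
      rw [this, div_mul_cancel₀ _ hpos.ne']
    have h5 : σ - α ≤ w.re := by simp [hw]; linarith
    have h6 : (1 - ‖z‖) * (1 + ‖z‖) * ‖w + 1‖ ^ 2 ≤ (1 - ‖z‖) * 2 * ‖w + 1‖ ^ 2 := by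
      gcongr
      linarith
    nlinarith
  have h7 : ‖w + 1‖ ^ 2 ≤ (|α| + 2) ^ 2 * (1 + ‖s‖ ^ 2) := by
    have h8 : ‖w + 1‖ ≤ ‖s‖ + (|α| + 1) := by
      rw [hw, sub_add]
      refine (norm_sub_le _ _).trans ?_
      gcongr
      refine (norm_sub_le _ _).trans ?_
      simp
    have h9 : ‖w + 1‖ ^ 2 ≤ (‖s‖ + (|α| + 1)) ^ 2 := by gcongr
    nlinarith [sq_nonneg ((|α| + 1) * ‖s‖ - 1), abs_nonneg α, norm_nonneg s]
  calc ‖F s‖ ≤ A * (1 / (1 - ‖z‖)) := by rw [mul_one_div]; exact h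
    _ ≤ A * ((|α| + 2) ^ 2 * (1 + ‖s‖ ^ 2) / (σ - α)) := by
      have h3 : 0 < σ - α := by linarith
      refine mul_le_mul_of_nonneg_left (h2.trans ?_) hA.le
      exact div_le_div_of_nonneg_right h7 h3.le
    _ = _ := by ring

theorem re_digamma_le {x : ℝ} (hx : 0 < x) : (Complex.digamma x).re ≤ Real.log x := by
  have hne : ∀ m : ℕ, (x : ℂ) ≠ -m := by
    intro m h
    have h1 : x = -m := by exact_mod_cast h
    have h2 : (0 : ℝ) ≤ m := Nat.cast_nonneg m
    linarith
  have hpos := Real.Gamma_pos_of_pos hx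
  have h1 := (Complex.differentiableAt_Gamma x hne).hasDerivAt.real_of_complex
  simp only [Complex.Gamma_ofReal, Complex.ofReal_re] at h1
  have h2 := h1.log hpos.ne'
  have h3 := Real.convexOn_log_Gamma.le_slope_of_hasDerivAt (x := x) (y := x + 1) hx
    (show 0 < x + 1 by linarith) (by linarith) h2
  rw [slope_def_field] at h3
  simp only [Function.comp_apply, add_sub_cancel_left, div_one] at h3
  rw [Real.Gamma_add_one hx.ne', Real.log_mul hx.ne' hpos.ne', add_sub_cancel_right] at h3
  rw [Complex.digamma_def, logDeriv_apply, Complex.Gamma_ofReal, Complex.div_ofReal_re]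
  exact h3

theorem logDeriv_Gammaℝ {s : ℂ} (hs : 0 < s.re) :
    logDeriv Complex.Gammaℝ s = -(Real.log Real.pi / 2 : ℝ) + Complex.digamma (s / 2) / 2 := by
  have hpi : (Real.pi : ℂ) ≠ 0 := by exact_mod_cast Real.pi_ne_zero
  have hne : ∀ m : ℕ, s / 2 ≠ -m := by
    intro m h
    have h1 := congrArg Complex.re h
    simp at h1
    have h2 : (0 : ℝ) ≤ m := Nat.cast_nonneg m
    linarith
  have hG := (Complex.differentiableAt_Gamma _ hne)
  have hp : HasDerivAt (fun s : ℂ ↦ (Real.pi : ℂ) ^ (-s / 2))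
      ((Real.pi : ℂ) ^ (-s / 2) * Complex.log Real.pi * (-1 / 2)) s :=
    ((hasDerivAt_id s).neg.div_const 2).const_cpow (Or.inl hpi)
  have hG2 : HasDerivAt (fun s : ℂ ↦ Complex.Gamma (s / 2))
      (deriv Complex.Gamma (s / 2) * (1 / 2)) s :=
    HasDerivAt.comp (h := fun s : ℂ ↦ s / 2) s hG.hasDerivAt ((hasDerivAt_id s).div_const 2)
  have hm := hp.mul hG2
  have h0 : Complex.Gamma (s / 2) ≠ 0 := Complex.Gamma_ne_zero hne
  have h1 : (Real.pi : ℂ) ^ (-s / 2) ≠ 0 := by simp [Complex.cpow_eq_zero_iff, hpi]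
  have e : Complex.Gammaℝ = (fun s : ℂ ↦ (Real.pi : ℂ) ^ (-s / 2)) * fun s ↦ Complex.Gamma (s / 2) := by
    ext s
    rw [Complex.Gammaℝ_def]
    rfl
  rw [logDeriv_apply, e, hm.deriv, Complex.digamma_def, logDeriv_apply, Pi.mul_apply]
  push_cast
  rw [Complex.ofReal_log Real.pi_pos.le]
  field_simp

theorem logDeriv_Gammaℝ_add_two {s : ℂ} (hs : 0 < s.re) :
    logDeriv Complex.Gammaℝ (s + 2) = logDeriv Complex.Gammaℝ s + 1 / s := by
  have hne : ∀ m : ℕ, s / 2 ≠ -m := by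
    intro m h
    have h1 := congrArg Complex.re h
    simp at h1
    have h2 : (0 : ℝ) ≤ m := Nat.cast_nonneg m
    linarith
  have hs0 : s ≠ 0 := by
    rintro rfl
    simp at hs
  rw [logDeriv_Gammaℝ hs, logDeriv_Gammaℝ (by simp; linarith), show (s + 2) / 2 = s / 2 + 1 by ring,
    Complex.digamma_apply_add_one _ hne]
  field_simp
  ring

theorem re_logDeriv_Gammaℝ_le {x : ℝ} (hx : 0 < x) :
    (logDeriv Complex.Gammaℝ x).re ≤ Real.log x / 2 := by
  rw [logDeriv_Gammaℝ (by simpa using hx)]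
  have h := re_digamma_le (show 0 < x / 2 by linarith)
  have e : (Complex.digamma (x / 2) / 2).re = (Complex.digamma ((x / 2 : ℝ) : ℂ)).re / 2 := by
    push_cast
    simp
  rw [Complex.add_re, e, Complex.neg_re, Complex.ofReal_re]
  have h1 : Real.log (x / 2) ≤ Real.log x := Real.log_le_log (by linarith) (by linarith)
  have h2 : 0 ≤ Real.log Real.pi := Real.log_nonneg (by linarith [Real.pi_gt_three])
  linarith

end LogDerivative

section LogDerivative

open InfinitePlace nonZeroDivisors IsDedekindDomain

variable {K : Type*} [Field K] [NumberField K] {Ξ : ℂ → ℂ}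

theorem zetaSeries_ne_zero {s : ℂ} (hs : 1 < s.re) : zetaSeries K s ≠ 0 := by
  obtain ⟨c, hc, h⟩ := exists_zetaSeries_eq K
  rw [h s hs]
  exact mul_ne_zero hc (Complex.exp_ne_zero _)

theorem IsCompletedZeta.differentiableAt_logDeriv (h : IsCompletedZeta K Ξ) {s : ℂ}
    (hs : 1 / 2 < s.re) : DifferentiableAt ℂ (logDeriv Ξ) s :=
  ((h.differentiable.contDiff.deriv' (n := 1)).differentiable one_ne_zero s).div
    (h.differentiable s) (h.ne_zero s hs)

theorem IsCompletedZeta.logDeriv_conj (h : IsCompletedZeta K Ξ) (s : ℂ) :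
    logDeriv Ξ (starRingEnd ℂ s) = starRingEnd ℂ (logDeriv Ξ s) := by
  have e : starRingEnd ℂ ∘ Ξ ∘ starRingEnd ℂ = Ξ := by
    ext s
    simp [h.conj]
  have h1 : deriv Ξ (starRingEnd ℂ s) = starRingEnd ℂ (deriv Ξ s) := by
    conv_lhs => rw [← e]
    rw [deriv_conj_conj]
    simp
  rw [logDeriv_apply, logDeriv_apply, h1, h.conj, map_div₀]

theorem differentiableAt_Gammaℝ {s : ℂ} (hs : 0 < s.re) :
    DifferentiableAt ℂ Complex.Gammaℝ s := by
  have h1 := (Complex.differentiable_Gammaℝ_inv s).inv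
    (inv_ne_zero (Complex.Gammaℝ_ne_zero_of_re_pos hs))
  exact h1.congr_of_eventuallyEq (.of_forall fun z ↦ by simp)

theorem IsCompletedZeta.logDeriv_eq (h : IsCompletedZeta K Ξ) {s : ℂ} (hs : 1 < s.re) :
    logDeriv Ξ s = 1 / s + 1 / (s - 1) + logDiscr K / 2 +
      ((nrRealPlaces K + nrComplexPlaces K : ℕ) * logDeriv Complex.Gammaℝ s +
      nrComplexPlaces K * logDeriv Complex.Gammaℝ (s + 1)) - mangoldtSeries K s := by
  have hs0 : s ≠ 0 := by
    rintro rfl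
    norm_num at hs
  have hs1 : s - 1 ≠ 0 := by
    intro h0
    rw [sub_eq_zero.mp h0] at hs
    norm_num at hs
  have ho : IsOpen {s : ℂ | 1 < s.re} := isOpen_lt continuous_const Complex.continuous_re
  have hloc : Ξ =ᶠ[nhds s] fun s ↦ s * (s - 1) * Complex.exp (logDiscr K / 2 * s) *
      archFactor K s * zetaSeries K s := by
    filter_upwards [ho.mem_nhds hs] with z hz using h.eq_mul z hz
  have hG1 := differentiableAt_Gammaℝ (s := s) (by linarith)
  have hG2 := differentiableAt_Gammaℝ (s := s + 1) (by simp; linarith)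
  have hG3 : DifferentiableAt ℂ (fun z ↦ Complex.Gammaℝ (z + 1)) s :=
    DifferentiableAt.comp (f := fun z : ℂ ↦ z + 1) s hG2 (by fun_prop)
  have hg1 := Complex.Gammaℝ_ne_zero_of_re_pos (s := s) (by linarith)
  have hg2 := Complex.Gammaℝ_ne_zero_of_re_pos (s := s + 1) (by simp; linarith)
  have hζ := hasDerivAt_zetaSeries (K := K) hs
  have hζ0 := zetaSeries_ne_zero (K := K) hs
  have hA : DifferentiableAt ℂ (archFactor K) s := (hG1.pow _).mul (hG3.pow _)
  have hA0 := archFactor_ne_zero (K := K) (s := s) (by linarith)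
  have lζ : logDeriv (zetaSeries K) s = -mangoldtSeries K s := by
    rw [logDeriv_apply, hζ.deriv]
    field_simp
  have lA : logDeriv (archFactor K) s =
      (nrRealPlaces K + nrComplexPlaces K : ℕ) * logDeriv Complex.Gammaℝ s +
      nrComplexPlaces K * logDeriv Complex.Gammaℝ (s + 1) := by
    have e : archFactor K = fun s ↦ Complex.Gammaℝ s ^ (nrRealPlaces K + nrComplexPlaces K) *
      Complex.Gammaℝ (s + 1) ^ nrComplexPlaces K := rfl
    rw [e, logDeriv_mul (f := fun s ↦ Complex.Gammaℝ s ^ (nrRealPlaces K + nrComplexPlaces K))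
        (g := fun s ↦ Complex.Gammaℝ (s + 1) ^ nrComplexPlaces K) s
        (pow_ne_zero _ hg1) (pow_ne_zero _ hg2) (hG1.pow _) (hG3.pow _),
      logDeriv_fun_pow hG1, logDeriv_fun_pow hG3]
    have e2 : logDeriv (fun z ↦ Complex.Gammaℝ (z + 1)) s = logDeriv Complex.Gammaℝ (s + 1) := by
      rw [logDeriv_apply, logDeriv_apply, deriv_comp_add_const]
    rw [e2]
  have lE : logDeriv (fun s : ℂ ↦ Complex.exp (logDiscr K / 2 * s)) s = logDiscr K / 2 := by
    have hE : HasDerivAt (fun s : ℂ ↦ Complex.exp (logDiscr K / 2 * s))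
        (Complex.exp (logDiscr K / 2 * s) * (logDiscr K / 2 * 1)) s :=
      ((hasDerivAt_id s).const_mul _).cexp
    rw [logDeriv_apply, hE.deriv, mul_one, mul_div_cancel_left₀ _ (Complex.exp_ne_zero _)]
  have l1 : logDeriv (fun s : ℂ ↦ s - 1) s = 1 / (s - 1) := by
    rw [logDeriv_apply, deriv_sub_const]
    simp
  rw [(logDeriv_congr_nhds hloc).eq_of_nhds,
    logDeriv_mul (f := fun s : ℂ ↦ s * (s - 1) * Complex.exp (logDiscr K / 2 * s) * archFactor K s)
      (g := zetaSeries K) s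
      (mul_ne_zero (mul_ne_zero (mul_ne_zero hs0 hs1) (Complex.exp_ne_zero _)) hA0) hζ0
      ((by fun_prop : DifferentiableAt ℂ (fun s : ℂ ↦ s * (s - 1) *
        Complex.exp (logDiscr K / 2 * s)) s).mul hA) hζ.differentiableAt,
    logDeriv_mul (f := fun s : ℂ ↦ s * (s - 1) * Complex.exp (logDiscr K / 2 * s))
      (g := archFactor K) s
      (mul_ne_zero (mul_ne_zero hs0 hs1) (Complex.exp_ne_zero _)) hA0 (by fun_prop) hA,
    logDeriv_mul (f := fun s : ℂ ↦ s * (s - 1)) (g := fun s ↦ Complex.exp (logDiscr K / 2 * s)) s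
      (mul_ne_zero hs0 hs1) (Complex.exp_ne_zero _) (by fun_prop) (by fun_prop),
    logDeriv_mul (f := fun s : ℂ ↦ s) (g := fun s ↦ s - 1) s hs0 hs1 (by fun_prop) (by fun_prop),
    lζ, lA, lE, l1, logDeriv_id']
  ring

/-- The difference of the logarithmic derivative of the completed zeta function at `s` and `s + 2`
has no contribution of Gamma factors. -/
theorem IsCompletedZeta.logDeriv_sub_logDeriv_add_two (h : IsCompletedZeta K Ξ) {s : ℂ}
    (hs : 1 < s.re) :
    logDeriv Ξ s - logDeriv Ξ (s + 2) = 1 / s + 1 / (s - 1) - 1 / (s + 2) - 1 / (s + 1) -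
      (nrRealPlaces K + nrComplexPlaces K : ℕ) / s - nrComplexPlaces K / (s + 1) -
      (mangoldtSeries K s - mangoldtSeries K (s + 2)) := by
  rw [h.logDeriv_eq hs, h.logDeriv_eq (s := s + 2) (by simp; linarith),
    logDeriv_Gammaℝ_add_two (s := s) (by linarith), show s + 2 + 1 = s + 1 + 2 by ring,
    logDeriv_Gammaℝ_add_two (s := s + 1) (by simp; linarith), show s + 2 - 1 = s + 1 by ring]
  ring

theorem IsCompletedZeta.re_logDeriv_ofReal_le (h : IsCompletedZeta K Ξ) {x : ℝ} (hx : 3 / 2 ≤ x) :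
    (logDeriv Ξ x).re ≤ 3 + logDiscr K / 2 + Module.finrank ℚ K / 2 * Real.log (x + 1) := by
  have hn : (Module.finrank ℚ K : ℝ) = nrRealPlaces K + 2 * nrComplexPlaces K := by
    rw [← card_add_two_mul_card_eq_rank]
    push_cast
    rfl
  have hZ : 0 ≤ (mangoldtSeries K x).re := by
    unfold mangoldtSeries
    rw [expSeries_ofReal, Complex.ofReal_re]
    exact tsum_nonneg fun x ↦ mul_nonneg (logNormPrime_pos x.1).le (Real.exp_pos _).le
  have h1 := re_logDeriv_Gammaℝ_le (x := x) (by linarith)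
  have h2 := re_logDeriv_Gammaℝ_le (x := x + 1) (by linarith)
  have h3 : Real.log x ≤ Real.log (x + 1) := Real.log_le_log (by linarith) (by linarith)
  have h4 : 1 / x ≤ 2 / 3 := by rw [div_le_div_iff₀ (by linarith) (by norm_num)]; linarith
  have h5 : 1 / (x - 1) ≤ 2 := by rw [div_le_iff₀ (by linarith)]; linarith
  rw [h.logDeriv_eq (by simp; linarith)]
  have e1 : (1 / (x : ℂ) + 1 / (x - 1) + logDiscr K / 2).re =
      1 / x + 1 / (x - 1) + logDiscr K / 2 := by
    rw [← Complex.ofReal_re (1 / x + 1 / (x - 1) + logDiscr K / 2)]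
    push_cast
    rfl
  rw [Complex.sub_re, Complex.add_re, e1, Complex.add_re, ← Complex.ofReal_natCast,
    Complex.re_ofReal_mul, ← Complex.ofReal_natCast, Complex.re_ofReal_mul, hn]
  push_cast at h2 ⊢
  have h6 : ((nrRealPlaces K : ℝ) + nrComplexPlaces K) * (logDeriv Complex.Gammaℝ x).re ≤
      ((nrRealPlaces K : ℝ) + nrComplexPlaces K) * (Real.log (x + 1) / 2) := by
    gcongr
    linarith
  have h7 : (nrComplexPlaces K : ℝ) * (logDeriv Complex.Gammaℝ (x + 1)).re ≤
      nrComplexPlaces K * (Real.log (x + 1) / 2) := by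
    gcongr
  nlinarith

theorem IsCompletedZeta.exists_norm_logDeriv_le (h : IsCompletedZeta K Ξ) {σ : ℝ}
    (hσ : 1 / 2 < σ) :
    ∃ C : ℝ, 0 < C ∧ ∀ s : ℂ, σ ≤ s.re → ‖logDeriv Ξ s‖ ≤ C * (1 + ‖s‖ ^ 2) := by
  have h1 : ∀ s : ℂ, ((1 / 2 : ℝ) : ℝ) < s.re → 0 ≤ (logDeriv Ξ s).re :=
    fun s hs ↦ h.re_logDeriv_nonneg hs
  exact exists_norm_le_of_re_nonneg (fun s hs ↦ (h.differentiableAt_logDeriv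
    hs).differentiableWithinAt) h1 hσ

end LogDerivative

section Contour

open Filter Topology

/-- `f` is bounded by a multiple of `1 / (1 + ‖s‖ ^ 2)` on `S`. -/
def QuadDecay (f : ℂ → ℂ) (S : Set ℂ) : Prop :=
  ∃ C : ℝ, ∀ s ∈ S, ‖f s‖ ≤ C * (1 + ‖s‖ ^ 2)⁻¹

theorem QuadDecay.mono {f : ℂ → ℂ} {S T : Set ℂ} (h : QuadDecay f T) (hST : S ⊆ T) :
    QuadDecay f S :=
  let ⟨C, hC⟩ := h
  ⟨C, fun s hs ↦ hC s (hST hs)⟩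

theorem QuadDecay.of_le {f : ℂ → ℂ} {S : Set ℂ} (hS : IsClosed S) (hf : ContinuousOn f S)
    {C R : ℝ} (h : ∀ s ∈ S, R ≤ ‖s‖ → ‖f s‖ ≤ C / ‖s‖ ^ 2) : QuadDecay f S := by
  set R' := max R 1
  obtain ⟨B, hB⟩ := ((isCompact_closedBall (0 : ℂ) R').inter_left hS).exists_bound_of_continuousOn
    (hf.mono Set.inter_subset_left)
  refine ⟨2 * |C| + |B| * (1 + R' ^ 2), fun s hs ↦ ?_⟩
  have hpos : 0 < 1 + ‖s‖ ^ 2 := by positivity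
  rw [← div_eq_mul_inv, le_div_iff₀ hpos]
  rcases le_total ‖s‖ R' with h1 | h1
  · have h2 := hB s ⟨hs, by simpa using h1⟩
    have h3 : ‖f s‖ ≤ |B| := h2.trans (le_abs_self _)
    have h4 : ‖f s‖ * (1 + ‖s‖ ^ 2) ≤ |B| * (1 + R' ^ 2) := by gcongr
    linarith [abs_nonneg C]
  · have h2 := h s hs ((le_max_left _ _).trans h1)
    have h3 : 1 ≤ ‖s‖ := (le_max_right _ _).trans h1
    have h4 : ‖f s‖ ≤ |C| / ‖s‖ ^ 2 := h2.trans (by gcongr; exact le_abs_self C)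
    have h5 : 1 ≤ ‖s‖ ^ 2 := one_le_pow₀ h3
    have h6 : ‖f s‖ * ‖s‖ ^ 2 ≤ |C| := by rwa [le_div_iff₀ (by linarith)] at h4
    have h7 : 0 ≤ |B| * (1 + R' ^ 2) := by positivity
    nlinarith [norm_nonneg (f s)]

theorem norm_im_le_add_mul_I (a t : ℝ) : |t| ≤ ‖(a + t * Complex.I : ℂ)‖ := by
  simpa using Complex.abs_im_le_norm (a + t * Complex.I)

theorem norm_re_le_add_mul_I (a t : ℝ) : |a| ≤ ‖(a + t * Complex.I : ℂ)‖ := by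
  simpa using Complex.abs_re_le_norm (a + t * Complex.I)

theorem QuadDecay.exists_norm_le {f : ℂ → ℂ} {S : Set ℂ} (h : QuadDecay f S) :
    ∃ C : ℝ, 0 ≤ C ∧ ∀ a t : ℝ, (a + t * Complex.I : ℂ) ∈ S →
      ‖f (a + t * Complex.I)‖ ≤ C * (1 + t ^ 2)⁻¹ := by
  obtain ⟨C, hC⟩ := h
  refine ⟨|C|, abs_nonneg _, fun a t hat ↦ (hC _ hat).trans ?_⟩
  have h1 : t ^ 2 ≤ ‖(a + t * Complex.I : ℂ)‖ ^ 2 := by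
    rw [← sq_abs t]
    have := norm_im_le_add_mul_I a t
    gcongr
  gcongr
  exact le_abs_self C

theorem integrable_line {f : ℂ → ℂ} {a : ℝ} (hf : ∀ s : ℂ, s.re = a → ContinuousAt f s)
    (hd : QuadDecay f {s | s.re = a}) : Integrable fun t : ℝ ↦ f (a + t * Complex.I) := by
  obtain ⟨C, -, hC⟩ := hd.exists_norm_le
  refine (integrable_inv_one_add_sq.const_mul C).mono' ?_ (.of_forall fun t ↦ hC a t (by simp))
  refine Continuous.aestronglyMeasurable (continuous_iff_continuousAt.mpr fun t ↦ ?_)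
  exact ContinuousAt.comp (f := fun t : ℝ ↦ (a + t * Complex.I : ℂ)) (hf _ (by simp)) (by fun_prop)

/-- The line of integration may be shifted across a strip of holomorphy. -/
theorem integral_line_eq_of_le {f : ℂ → ℂ} {a b : ℝ} (hab : a ≤ b)
    (hf : ∀ s : ℂ, a ≤ s.re → s.re ≤ b → DifferentiableAt ℂ f s)
    (hd : QuadDecay f {s | a ≤ s.re ∧ s.re ≤ b}) :
    ∫ t : ℝ, f (a + t * Complex.I) = ∫ t : ℝ, f (b + t * Complex.I) := by
  have hrect : ∀ T : ℝ, (∫ x in a..b, f (x + (-T : ℝ) * Complex.I)) -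
      (∫ x in a..b, f (x + T * Complex.I)) + Complex.I • (∫ y in (-T)..T, f (b + y * Complex.I)) -
      Complex.I • (∫ y in (-T)..T, f (a + y * Complex.I)) = 0 := by
    intro T
    have h := Complex.integral_boundary_rect_eq_zero_of_differentiableOn f
      (a + (-T : ℝ) * Complex.I) (b + T * Complex.I) (fun s hs ↦ by
        refine (hf s ?_ ?_).differentiableWithinAt
        · have := hs.1
          simp [Set.uIcc_of_le hab] at this
          exact this.1
        · have := hs.1
          simp [Set.uIcc_of_le hab] at this
          exact this.2)
    simpa using h
  obtain ⟨C, hC0, hC⟩ := hd.exists_norm_le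
  have hhor : ∀ T : ℝ, ‖∫ x in a..b, f (x + T * Complex.I)‖ ≤ C * (1 + T ^ 2)⁻¹ * |b - a| := by
    intro T
    refine intervalIntegral.norm_integral_le_of_norm_le_const fun x hx ↦ hC x T ?_
    rw [Set.uIoc_of_le hab] at hx
    simp [hx.1.le, hx.2]
  have hlim : Tendsto (fun T : ℝ ↦ C * (1 + T ^ 2)⁻¹ * |b - a|) atTop (𝓝 0) := by
    have h1 : Tendsto (fun T : ℝ ↦ 1 + T ^ 2) atTop atTop :=
      tendsto_atTop_add_const_left _ _ (tendsto_pow_atTop two_ne_zero)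
    simpa using (h1.inv_tendsto_atTop.const_mul C).mul_const |b - a|
  have hh1 : Tendsto (fun T : ℝ ↦ ∫ x in a..b, f (x + T * Complex.I)) atTop (𝓝 0) :=
    squeeze_zero_norm hhor hlim
  have hh2 : Tendsto (fun T : ℝ ↦ ∫ x in a..b, f (x + (-T : ℝ) * Complex.I)) atTop (𝓝 0) :=
    squeeze_zero_norm (fun T ↦ by simpa using hhor (-T)) hlim
  have hI : ∀ c : ℝ, a ≤ c → c ≤ b →
      Tendsto (fun T : ℝ ↦ ∫ y in (-T)..T, f (c + y * Complex.I)) atTop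
        (𝓝 (∫ t : ℝ, f (c + t * Complex.I))) := by
    intro c hac hcb
    refine intervalIntegral_tendsto_integral (integrable_line (fun s hs ↦
      (hf s (by rwa [hs]) (by rwa [hs])).continuousAt) (hd.mono fun s hs ↦ ?_))
      tendsto_neg_atTop_atBot tendsto_id
    have : s.re = c := hs
    exact ⟨by rwa [this], by rwa [this]⟩
  have h1 := ((hh2.sub hh1).add ((hI b hab le_rfl).const_smul Complex.I)).sub
    ((hI a le_rfl hab).const_smul Complex.I)
  simp only [hrect] at h1
  have h2 := tendsto_nhds_unique h1 tendsto_const_nhds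
  simp only [sub_zero, zero_add, _root_.smul_eq_mul] at h2
  rw [← mul_sub, mul_eq_zero] at h2
  exact (sub_eq_zero.mp (h2.resolve_left Complex.I_ne_zero)).symm

theorem integral_line_eq_zero_right {f : ℂ → ℂ} {a : ℝ}
    (hf : ∀ s : ℂ, a ≤ s.re → DifferentiableAt ℂ f s) (hd : QuadDecay f {s | a ≤ s.re}) :
    ∫ t : ℝ, f (a + t * Complex.I) = 0 := by
  have hshift : ∀ b : ℝ, a ≤ b →
      ∫ t : ℝ, f (b + t * Complex.I) = ∫ t : ℝ, f (a + t * Complex.I) := fun b hab ↦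
    (integral_line_eq_of_le hab (fun s h1 _ ↦ hf s h1) (hd.mono fun s hs ↦ hs.1)).symm
  obtain ⟨C, hC0, hC⟩ := hd.exists_norm_le
  obtain ⟨C', hC'⟩ := hd
  have hlim : Tendsto (fun b : ℝ ↦ ∫ t : ℝ, f (b + t * Complex.I)) atTop (𝓝 (∫ _ : ℝ, (0 : ℂ))) := by
    refine tendsto_integral_filter_of_dominated_convergence (fun t ↦ C * (1 + t ^ 2)⁻¹) ?_ ?_
      (integrable_inv_one_add_sq.const_mul C) (.of_forall fun t ↦ ?_)
    · filter_upwards [eventually_ge_atTop a] with b hb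
      refine Continuous.aestronglyMeasurable (continuous_iff_continuousAt.mpr fun t ↦ ?_)
      exact ContinuousAt.comp (f := fun t : ℝ ↦ (b + t * Complex.I : ℂ))
        (hf _ (by simpa using hb)).continuousAt (by fun_prop)
    · filter_upwards [eventually_ge_atTop a] with b hb
      exact .of_forall fun t ↦ hC b t (by simpa using hb)
    · have h1 : Tendsto (fun b : ℝ ↦ |C'| * (1 + b ^ 2)⁻¹) atTop (𝓝 0) := by
        have h1 : Tendsto (fun T : ℝ ↦ 1 + T ^ 2) atTop atTop :=
          tendsto_atTop_add_const_left _ _ (tendsto_pow_atTop two_ne_zero)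
        simpa using h1.inv_tendsto_atTop.const_mul |C'|
      refine squeeze_zero_norm' ?_ h1
      filter_upwards [eventually_ge_atTop a] with b hb
      refine (hC' _ (by simpa using hb)).trans ?_
      have h1 : b ^ 2 ≤ ‖(b + t * Complex.I : ℂ)‖ ^ 2 := by
        rw [← sq_abs b]
        have := norm_re_le_add_mul_I b t
        gcongr
      gcongr
      exact le_abs_self C'
  have hconst : Tendsto (fun b : ℝ ↦ ∫ t : ℝ, f (b + t * Complex.I)) atTop
      (𝓝 (∫ t : ℝ, f (a + t * Complex.I))) :=
    tendsto_const_nhds.congr' (by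
      filter_upwards [eventually_ge_atTop a] with b hb using (hshift b hb).symm)
  simpa using tendsto_nhds_unique hconst hlim

theorem integral_line_eq_zero_left {f : ℂ → ℂ} {a : ℝ}
    (hf : ∀ s : ℂ, s.re ≤ a → DifferentiableAt ℂ f s) (hd : QuadDecay f {s | s.re ≤ a}) :
    ∫ t : ℝ, f (a + t * Complex.I) = 0 := by
  have h := integral_line_eq_zero_right (f := fun s ↦ f (-s)) (a := -a) (fun s hs ↦ by
      refine DifferentiableAt.comp (f := fun s : ℂ ↦ -s) s (hf _ ?_) (by fun_prop)
      simp
      linarith) (by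
    obtain ⟨C, hC⟩ := hd
    refine ⟨C, fun s hs ↦ ?_⟩
    have hs' : -a ≤ s.re := hs
    have := hC (-s) (by simp; linarith)
    simpa using this)
  rw [← integral_neg_eq_self] at h
  simpa [add_comm] using h

end Contour

section Poisson

open Filter Topology

theorem integral_inv_sq_add_sq_real {d : ℝ} (hd : 0 < d) :
    ∫ t : ℝ, (d ^ 2 + t ^ 2)⁻¹ = Real.pi / d := by
  have h := Measure.integral_comp_mul_left (fun t : ℝ ↦ (1 + t ^ 2)⁻¹) d⁻¹
  rw [integral_univ_inv_one_add_sq, inv_inv, abs_of_pos hd, _root_.smul_eq_mul] at h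
  have e : ∀ t : ℝ, (d ^ 2 + t ^ 2)⁻¹ = (d ^ 2)⁻¹ * (1 + (d⁻¹ * t) ^ 2)⁻¹ := by
    intro t
    rw [← mul_inv]
    congr 1
    field_simp
  simp only [e]
  rw [integral_const_mul, h]
  field_simp

theorem integrable_inv_sq_add_sq_real {d : ℝ} (hd : 0 < d) :
    Integrable fun t : ℝ ↦ (d ^ 2 + t ^ 2)⁻¹ := by
  by_contra h
  have h1 := integral_inv_sq_add_sq_real hd
  rw [integral_undef h] at h1
  exact (div_pos Real.pi_pos hd).ne h1

/-- The kernel `1 / ((u ^ 2 + t ^ 2) (4 u ^ 2 + t ^ 2))`. -/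
noncomputable def quarticKernel (u t : ℝ) : ℝ := (u ^ 2 + t ^ 2)⁻¹ * ((2 * u) ^ 2 + t ^ 2)⁻¹

theorem quarticKernel_nonneg (u t : ℝ) : 0 ≤ quarticKernel u t := by
  unfold quarticKernel
  positivity

/-- A Poisson formula for functions of quadratic growth on the right half-plane. -/
theorem integral_mul_quarticKernel {f : ℂ → ℂ} {δ : ℝ} (hδ : 0 < δ)
    (hf : ∀ s : ℂ, -δ < s.re → DifferentiableAt ℂ f s)
    {C : ℝ} (hC : ∀ s : ℂ, 0 ≤ s.re → ‖f s‖ ≤ C * (1 + ‖s‖ ^ 2)) {u : ℝ} (hu : 0 < u) :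
    Integrable (fun t : ℝ ↦ f (t * Complex.I) * quarticKernel u t) ∧
    ∫ t : ℝ, f (t * Complex.I) * quarticKernel u t =
      Real.pi / (3 * u ^ 3) * (f u - f (2 * u) / 2) := by
  have hu0 : (u : ℂ) ≠ 0 := by exact_mod_cast hu.ne'
  set A : ℂ → ℂ := fun w ↦ (f u * ((2 * u) ^ 2 - w ^ 2) - f (2 * u) * (u ^ 2 - w ^ 2)) /
    (3 * u ^ 2) with hA
  set U : Set ℂ := {s | -δ < s.re}
  have hU : IsOpen U := isOpen_lt continuous_const Complex.continuous_re
  have hmem : ∀ s : ℂ, 0 ≤ s.re → U ∈ 𝓝 s := fun s hs ↦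
    hU.mem_nhds (show -δ < s.re by linarith)
  set g : ℂ → ℂ := fun w ↦ f w - A w with hg
  have hgd : DifferentiableOn ℂ g U := fun s hs ↦
    ((hf s hs).sub (by fun_prop)).differentiableWithinAt
  have hgu : g u = 0 := by
    simp only [hg, hA]
    field_simp
    ring
  have hgu2 : g (2 * u) = 0 := by
    simp only [hg, hA]
    field_simp
    ring
  set g2 := dslope (dslope g u) (2 * u) with hg2
  have hg2d : DifferentiableOn ℂ g2 U :=
    (Complex.differentiableOn_dslope (hmem _ (by simp; linarith))).mpr
      ((Complex.differentiableOn_dslope (hmem _ (by simp; linarith))).mpr hgd)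
  have hfac : ∀ w : ℂ, (w - u) * ((w - 2 * u) * g2 w) = g w := by
    have h1 : ∀ w : ℂ, (w - u) * dslope g u w = g w := fun w ↦ by
      rw [← _root_.smul_eq_mul, sub_smul_dslope, hgu, sub_zero]
    have h2 : dslope g u (2 * u) = 0 := by
      have := h1 (2 * u)
      rw [hgu2, show (2 * u - u : ℂ) = u by ring] at this
      exact (mul_eq_zero.mp this).resolve_left hu0
    intro w
    rw [← h1 w, ← _root_.smul_eq_mul (w - 2 * u), sub_smul_dslope, h2, sub_zero]
  have hden : ∀ w : ℂ, 0 ≤ w.re → ‖w‖ ≤ ‖w + u‖ ∧ ‖w‖ ≤ ‖w + 2 * u‖ := by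
    have : ∀ v : ℝ, 0 ≤ v → ∀ w : ℂ, 0 ≤ w.re → ‖w‖ ≤ ‖w + v‖ := by
      intro v hv w hw
      rw [← abs_of_nonneg (norm_nonneg w), ← abs_of_nonneg (norm_nonneg (w + v)), ← sq_le_sq,
        ← Complex.normSq_eq_norm_sq, ← Complex.normSq_eq_norm_sq, Complex.normSq_apply,
        Complex.normSq_apply]
      simp
      nlinarith [mul_nonneg hv hw]
    intro w hw
    exact ⟨this u hu.le w hw, by simpa using this (2 * u) (by linarith) w hw⟩
  have hne : ∀ w : ℂ, 0 ≤ w.re → ∀ v : ℝ, 0 < v → w + v ≠ 0 := by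
    intro w hw v hv h
    have := congrArg Complex.re h
    simp at this
    linarith
  set Q : ℂ → ℂ := fun w ↦ g2 w / ((w + u) * (w + 2 * u)) with hQ
  have hne2 : ∀ w : ℂ, 0 ≤ w.re → (w + u) * (w + 2 * u) ≠ 0 := fun w hw ↦
    mul_ne_zero (hne w hw u hu) (by simpa using hne w hw (2 * u) (by linarith))
  have hQd : ∀ s : ℂ, 0 ≤ s.re → DifferentiableAt ℂ Q s := fun s hs ↦
    (hg2d.differentiableAt (hmem s hs)).div (by fun_prop) (hne2 s hs)
  have hQdecay : QuadDecay Q {s | 0 ≤ s.re} := by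
    set C2 := |C| + (‖f u‖ * ((2 * u) ^ 2 + 1) + ‖f (2 * u)‖ * (u ^ 2 + 1)) / (3 * u ^ 2)
    refine .of_le (isClosed_le continuous_const Complex.continuous_re)
      (fun s hs ↦ (hQd s hs).continuousAt.continuousWithinAt) (C := 8 * C2) (R := 4 * u + 1) ?_
    intro s hs hsR
    have hs' : 0 ≤ s.re := hs
    have hs0 : 0 < ‖s‖ := by linarith
    have hs1 : 1 ≤ ‖s‖ := by linarith
    obtain ⟨d1, d2⟩ := hden s hs'
    have d3 : ‖s‖ / 2 ≤ ‖s - u‖ := by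
      have := norm_sub_norm_le s u
      rw [Complex.norm_of_nonneg hu.le] at this
      linarith
    have d4 : ‖s‖ / 2 ≤ ‖s - 2 * u‖ := by
      have := norm_sub_norm_le s ((2 * u : ℝ) : ℂ)
      rw [Complex.norm_of_nonneg (by linarith)] at this
      push_cast at this
      linarith
    have hAs : ‖A s‖ ≤ (‖f u‖ * ((2 * u) ^ 2 + 1) + ‖f (2 * u)‖ * (u ^ 2 + 1)) / (3 * u ^ 2) *
        (1 + ‖s‖ ^ 2) := by
      have e1 : ∀ v : ℝ, ‖(v : ℂ) ^ 2 - s ^ 2‖ ≤ (v ^ 2 + 1) * (1 + ‖s‖ ^ 2) := by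
        intro v
        refine (norm_sub_le _ _).trans ?_
        rw [norm_pow, norm_pow, Complex.norm_real, Real.norm_eq_abs, sq_abs]
        nlinarith [mul_nonneg (sq_nonneg v) (sq_nonneg ‖s‖)]
      have e2 := e1 u
      have e3 := e1 (2 * u)
      push_cast at e3
      have e4 : ‖(3 * u ^ 2 : ℂ)‖ = 3 * u ^ 2 := by
        rw [norm_mul, norm_pow, Complex.norm_of_nonneg hu.le]
        simp
      rw [hA, norm_div, e4, div_mul_eq_mul_div]
      refine div_le_div_of_nonneg_right ((norm_sub_le _ _).trans ?_) (by positivity)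
      rw [norm_mul, norm_mul, add_mul, mul_assoc, mul_assoc]
      gcongr
    have hgs : ‖g s‖ ≤ C2 * (1 + ‖s‖ ^ 2) := by
      refine (norm_sub_le _ _).trans ?_
      rw [add_mul]
      refine add_le_add ((hC s hs').trans ?_) hAs
      gcongr
      exact le_abs_self C
    have hC2 : 0 ≤ C2 := by positivity
    rw [← hfac s, norm_mul, norm_mul] at hgs
    have h1 : (‖s‖ / 2) * ((‖s‖ / 2) * ‖g2 s‖) ≤ C2 * (2 * ‖s‖ ^ 2) := by
      calc _ ≤ ‖s - u‖ * (‖s - 2 * u‖ * ‖g2 s‖) := by gcongr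
        _ ≤ C2 * (1 + ‖s‖ ^ 2) := hgs
        _ ≤ _ := by
          have : 1 ≤ ‖s‖ ^ 2 := one_le_pow₀ hs1
          gcongr
          linarith
    have h2 : ‖g2 s‖ ≤ 8 * C2 := by
      have h3 : 0 < ‖s‖ ^ 2 := by positivity
      have h4 : ‖s‖ ^ 2 * ‖g2 s‖ ≤ ‖s‖ ^ 2 * (8 * C2) := by linarith
      exact le_of_mul_le_mul_left h4 h3
    rw [hQ, norm_div, norm_mul]
    calc ‖g2 s‖ / (‖s + u‖ * ‖s + 2 * u‖) ≤ 8 * C2 / (‖s‖ * ‖s‖) := by gcongr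
      _ = _ := by rw [sq]
  have hQ0 := integral_line_eq_zero_right hQd hQdecay
  have hQi := integrable_line (f := Q) (a := 0) (fun s hs ↦ (hQd s hs.ge).continuousAt)
    (hQdecay.mono fun s hs ↦ (show s.re = 0 from hs).ge)
  have hi1 : Integrable fun t : ℝ ↦ (((u ^ 2 + t ^ 2)⁻¹ : ℝ) : ℂ) := (integrable_inv_sq_add_sq_real hu).ofReal (𝕜 := ℂ)
  have hi2 : Integrable fun t : ℝ ↦ ((((2 * u) ^ 2 + t ^ 2)⁻¹ : ℝ) : ℂ) :=
    (integrable_inv_sq_add_sq_real (d := 2 * u) (by linarith)).ofReal (𝕜 := ℂ)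
  have hcast : ∀ t d : ℝ, 0 < d → ((d : ℂ) ^ 2 + t ^ 2) ≠ 0 := by
    intro t d hd
    have : 0 < d ^ 2 + t ^ 2 := by positivity
    exact_mod_cast this.ne'
  have hQt : ∀ t : ℝ, f (t * Complex.I) * quarticKernel u t = Q ((0 : ℝ) + t * Complex.I) +
      (f u / (3 * u ^ 2) * ((u ^ 2 + t ^ 2)⁻¹ : ℝ) -
        f (2 * u) / (3 * u ^ 2) * (((2 * u) ^ 2 + t ^ 2)⁻¹ : ℝ)) := by
    intro t
    have n1 := hcast t u hu
    have n2 := hcast t (2 * u) (by linarith)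
    have m1 : (t * Complex.I) ^ 2 = -(t : ℂ) ^ 2 := by rw [mul_pow, Complex.I_sq]; ring
    have n3 : ((t * Complex.I) - u) * ((t * Complex.I) - 2 * u) *
        (((t * Complex.I) + u) * ((t * Complex.I) + 2 * u)) =
        (u ^ 2 + t ^ 2) * ((2 * u) ^ 2 + t ^ 2) := by
      linear_combination ((t * Complex.I) ^ 2 - t ^ 2 - u ^ 2 - (2 * u) ^ 2) * m1
    have n4 := hfac (t * Complex.I)
    push_cast at n2
    have n5 := mul_ne_zero n1 n2
    rw [← n3] at n5
    have n6 : Q ((0 : ℝ) + t * Complex.I) = g (t * Complex.I) /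
        ((u ^ 2 + t ^ 2) * ((2 * u) ^ 2 + t ^ 2)) := by
      rw [← n3, ← n4, hQ]
      simp only [Complex.ofReal_zero, zero_add]
      rw [← mul_assoc, mul_div_mul_left _ _ (left_ne_zero_of_mul n5)]
    rw [n6, hg, hA]
    simp only [quarticKernel, m1, sub_neg_eq_add]
    push_cast
    generalize ((2 * u : ℂ) ^ 2 + t ^ 2) = b at n2
    generalize ((u : ℂ) ^ 2 + t ^ 2) = a at n1
    field_simp
    ring
  simp only [hQt]
  have hi3 : Integrable fun t : ℝ ↦ f u / (3 * u ^ 2) * (((u ^ 2 + t ^ 2)⁻¹ : ℝ) : ℂ) -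
      f (2 * u) / (3 * u ^ 2) * (((2 * u) ^ 2 + t ^ 2)⁻¹ : ℝ) := (hi1.const_mul (f u / (3 * u ^ 2))).sub (hi2.const_mul (f (2 * u) / (3 * u ^ 2)))
  refine ⟨hQi.add hi3, ?_⟩
  rw [integral_add hQi hi3, hQ0, integral_sub (hi1.const_mul _) (hi2.const_mul _),
    integral_const_mul, integral_const_mul, integral_complex_ofReal, integral_complex_ofReal,
    integral_inv_sq_add_sq_real hu, integral_inv_sq_add_sq_real (d := 2 * u) (by linarith)]
  push_cast
  field_simp
  ring

end Poisson

section Poisson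

variable {K : Type*} [Field K] [NumberField K] {Ξ : ℂ → ℂ}

/-- Weighted integrals of the real part of the logarithmic derivative on vertical lines are bounded
in terms of its values on the real line. -/
theorem IsCompletedZeta.integral_re_logDeriv_le (h : IsCompletedZeta K Ξ) {σ u : ℝ}
    (hσ : 1 / 2 < σ) (hu : 1 ≤ u) :
    Integrable (fun t : ℝ ↦ (logDeriv Ξ (σ + t * Complex.I)).re * quarticKernel u t) ∧
    ∫ t : ℝ, (logDeriv Ξ (σ + t * Complex.I)).re * quarticKernel u t ≤
      Real.pi / (3 * u ^ 3) *
        (3 + logDiscr K / 2 + Module.finrank ℚ K / 2 * Real.log (σ + u + 1)) := by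
  obtain ⟨C, hC0, hC⟩ := h.exists_norm_logDeriv_le hσ
  have hP := integral_mul_quarticKernel (f := fun w ↦ logDeriv Ξ (σ + w)) (δ := σ - 1 / 2)
    (by linarith) (fun s hs ↦ by
      refine DifferentiableAt.comp (f := fun w : ℂ ↦ σ + w) s (h.differentiableAt_logDeriv ?_)
        (by fun_prop)
      simp only [Complex.add_re, Complex.ofReal_re]
      linarith) (C := C * (2 + 2 * σ ^ 2)) (fun s hs ↦ by
      refine (hC _ (by simpa using hs)).trans ?_
      rw [mul_assoc]
      have h1 : ‖(σ : ℂ) + s‖ ≤ |σ| + ‖s‖ := by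
        simpa using norm_add_le (σ : ℂ) s
      have h2 : ‖(σ : ℂ) + s‖ ^ 2 ≤ (|σ| + ‖s‖) ^ 2 := by gcongr
      gcongr
      nlinarith [sq_nonneg (|σ| - ‖s‖), sq_abs σ, sq_nonneg ‖s‖,
        mul_nonneg (sq_nonneg σ) (sq_nonneg ‖s‖)]) (u := u) (by linarith)
  obtain ⟨hi, he⟩ := hP
  have e : ∀ t : ℝ, (logDeriv Ξ (σ + t * Complex.I) * quarticKernel u t).re =
      (logDeriv Ξ (σ + t * Complex.I)).re * quarticKernel u t := fun t ↦ Complex.re_mul_ofReal _ _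
  have hir := Complex.reCLM.integrable_comp hi
  have her := Complex.reCLM.integral_comp_comm hi
  simp only [Complex.reCLM_apply, e] at hir her
  refine ⟨hir, ?_⟩
  rw [her, he]
  have h1 := h.re_logDeriv_ofReal_le (x := σ + u) (by linarith)
  have h2 : 0 ≤ (logDeriv Ξ (σ + 2 * u)).re := h.re_logDeriv_nonneg (by
    simp
    linarith)
  have e2 : ((Real.pi : ℂ) / (3 * u ^ 3) * (logDeriv Ξ (σ + u) - logDeriv Ξ (σ + 2 * u) / 2)).re =
      Real.pi / (3 * u ^ 3) * ((logDeriv Ξ (σ + u)).re - (logDeriv Ξ (σ + 2 * u)).re / 2) := by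
    rw [show (Real.pi : ℂ) / (3 * u ^ 3) = ((Real.pi / (3 * u ^ 3) : ℝ) : ℂ) by push_cast; rfl,
      Complex.re_ofReal_mul, Complex.sub_re]
    simp
  rw [e2]
  push_cast at h1
  have h3 : 0 ≤ Real.pi / (3 * u ^ 3) := by positivity
  gcongr
  linarith

/-- The function `(exp (c s) - 1) / s`. -/
noncomputable def expQuot (c : ℝ) : ℂ → ℂ := dslope (fun s ↦ Complex.exp (c * s)) 0

theorem expQuot_zero (c : ℝ) : expQuot c 0 = c := by
  have h : HasDerivAt (fun s : ℂ ↦ Complex.exp (c * s)) (Complex.exp (c * 0) * (c * 1)) 0 :=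
    ((hasDerivAt_id (0 : ℂ)).const_mul (c : ℂ)).cexp
  rw [expQuot, dslope_same, h.deriv]
  simp

theorem mul_expQuot (c : ℝ) (s : ℂ) : s * expQuot c s = Complex.exp (c * s) - 1 := by
  have := sub_smul_dslope (fun s : ℂ ↦ Complex.exp (c * s)) 0 s
  simpa [expQuot] using this

theorem differentiable_expQuot (c : ℝ) : Differentiable ℂ (expQuot c) := by
  rw [← differentiableOn_univ]
  refine (Complex.differentiableOn_dslope Filter.univ_mem).mpr ?_
  rw [differentiableOn_univ]
  fun_prop

theorem norm_expQuot_le {c σ : ℝ} (hc : 0 < c) (hσ : 0 ≤ σ) {s : ℂ} (hs : s.re ≤ σ) :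
    ‖expQuot c s‖ ≤ c * Real.exp (c * σ) := by
  rcases eq_or_ne s 0 with rfl | h0
  · rw [expQuot_zero, Complex.norm_of_nonneg hc.le]
    exact le_mul_of_one_le_right hc.le (Real.one_le_exp (by positivity))
  · have hconv : Convex ℝ {z : ℂ | z.re ≤ σ} := convex_halfSpace_re_le σ
    have h1 := hconv.norm_image_sub_le_of_norm_hasDerivWithin_le
      (f := fun z : ℂ ↦ Complex.exp (c * z)) (f' := fun z ↦ Complex.exp (c * z) * (c * 1))
      (C := c * Real.exp (c * σ)) (x := 0) (y := s)
      (fun z _ ↦ (((hasDerivAt_id z).const_mul (c : ℂ)).cexp).hasDerivWithinAt)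
      (fun z hz ↦ by
        have hz' : z.re ≤ σ := hz
        rw [mul_one, norm_mul, Complex.norm_exp, Complex.re_ofReal_mul, Complex.norm_of_nonneg hc.le,
          mul_comm]
        gcongr) (by simpa using hσ) hs
    simp only [mul_zero, Complex.exp_zero, sub_zero] at h1
    rw [← mul_expQuot, norm_mul, mul_comm] at h1
    exact le_of_mul_le_mul_right h1 (norm_pos_iff.mpr h0)

/-- The two-sided Laplace transform of a smoothed indicator function of `[a, b]`. -/
noncomputable def windowTransform (a b η : ℝ) (s : ℂ) : ℂ :=
  (expQuot b s - expQuot a s) * (expQuot η s / η) ^ 3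

theorem differentiable_windowTransform (a b η : ℝ) : Differentiable ℂ (windowTransform a b η) :=
  ((differentiable_expQuot b).sub (differentiable_expQuot a)).mul
    (((differentiable_expQuot η).div_const _).pow 3)

theorem mul_windowTransform (a b η : ℝ) (hη : η ≠ 0) (s : ℂ) : s ^ 4 * windowTransform a b η s =
    (Complex.exp (b * s) - Complex.exp (a * s)) * (Complex.exp (η * s) - 1) ^ 3 / η ^ 3 := by
  have hη' : (η : ℂ) ≠ 0 := by exact_mod_cast hη
  have h1 : s ^ 4 * windowTransform a b η s =
      (s * expQuot b s - s * expQuot a s) * (s * expQuot η s) ^ 3 / η ^ 3 := by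
    unfold windowTransform
    field_simp
  rw [h1, mul_expQuot, mul_expQuot, mul_expQuot]
  ring

section

variable {a b η σ : ℝ} (ha : 0 < a) (hab : a ≤ b) (hη : 0 < η) (hσ : 0 ≤ σ)

include ha hab hη hσ

theorem norm_mul_windowTransform_le {s : ℂ} (hs : s.re ≤ σ) :
    ‖s‖ * ‖windowTransform a b η s‖ ≤ 2 * Real.exp (b * σ) * (1 + Real.exp (η * σ)) ^ 3 ∧
    η ^ 3 * ‖s‖ ^ 4 * ‖windowTransform a b η s‖ ≤
      2 * Real.exp (b * σ) * (1 + Real.exp (η * σ)) ^ 3 := by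
  have hexp : ∀ c : ℝ, 0 < c → ‖Complex.exp (c * s)‖ ≤ Real.exp (c * σ) := by
    intro c hc
    rw [Complex.norm_exp, Complex.re_ofReal_mul]
    gcongr
  have h1 : ‖s * (expQuot b s - expQuot a s)‖ ≤ 2 * Real.exp (b * σ) := by
    rw [mul_sub, mul_expQuot, mul_expQuot, sub_sub_sub_cancel_right]
    refine (norm_sub_le _ _).trans ?_
    have h2 := hexp b (by linarith)
    have h3 : ‖Complex.exp (a * s)‖ ≤ Real.exp (b * σ) := (hexp a ha).trans (by gcongr)
    linarith
  have h2 : ‖expQuot η s / η‖ ≤ 1 + Real.exp (η * σ) := by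
    rw [norm_div, Complex.norm_of_nonneg hη.le, div_le_iff₀ hη]
    have := norm_expQuot_le hη hσ hs
    nlinarith
  have h3 : ‖s * expQuot η s‖ ≤ 1 + Real.exp (η * σ) := by
    rw [mul_expQuot]
    refine (norm_sub_le _ _).trans ?_
    have := hexp η hη
    rw [norm_one]
    linarith
  constructor
  · rw [windowTransform, norm_mul, ← mul_assoc, ← norm_mul, norm_pow]
    gcongr
  · have e : η ^ 3 * ‖s‖ ^ 4 * ‖windowTransform a b η s‖ =
        ‖s * (expQuot b s - expQuot a s)‖ * ‖s * expQuot η s‖ ^ 3 := by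
      unfold windowTransform
      simp only [norm_mul, norm_pow, norm_div, Complex.norm_of_nonneg hη.le]
      field_simp
    rw [e]
    gcongr

theorem exists_norm_windowTransform_le :
    ∃ C : ℝ, 0 ≤ C ∧ ∀ s : ℂ, s.re ≤ σ → ‖windowTransform a b η s‖ * ‖s‖ ^ 4 ≤ C := by
  refine ⟨2 * Real.exp (b * σ) * (1 + Real.exp (η * σ)) ^ 3 / η ^ 3, by positivity, fun s hs ↦ ?_⟩
  rw [le_div_iff₀ (by positivity)]
  linarith [(norm_mul_windowTransform_le ha hab hη hσ hs).2]

/-- A dyadic majorant for the transform of a window. -/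
theorem norm_windowTransform_le_sum {J : ℕ} (hJ : 1 ≤ 2 ^ J * η) (hσ' : 1 / 2 ≤ σ) (t : ℝ) :
    ‖windowTransform a b η (σ + t * Complex.I)‖ ≤
      20 * (2 * Real.exp (b * σ) * (1 + Real.exp (η * σ)) ^ 3) *
        ∑ j ∈ Finset.range (J + 1), (2 ^ j) ^ 3 * quarticKernel (2 ^ j) t := by
  set M := 2 * Real.exp (b * σ) * (1 + Real.exp (η * σ)) ^ 3
  have hM : 0 < M := by positivity
  set w := ‖windowTransform a b η (σ + t * Complex.I)‖
  obtain ⟨h1, h2⟩ := norm_mul_windowTransform_le ha hab hη hσ (s := σ + t * Complex.I) (by simp)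
  have hσs := norm_re_le_add_mul_I σ t
  have hts := norm_im_le_add_mul_I σ t
  rw [abs_of_nonneg hσ] at hσs
  set r := ‖(σ + t * Complex.I : ℂ)‖
  have hw : 0 ≤ w := norm_nonneg _
  have key : ∀ j ≤ J, w ≤ 20 * M * ((2 ^ j) ^ 3 * quarticKernel (2 ^ j) t) →
      w ≤ 20 * M * ∑ j ∈ Finset.range (J + 1), (2 ^ j) ^ 3 * quarticKernel (2 ^ j) t := by
    intro j hj hle
    refine hle.trans ?_
    gcongr
    exact Finset.single_le_sum (f := fun j : ℕ ↦ (2 ^ j : ℝ) ^ 3 * quarticKernel (2 ^ j) t)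
      (fun i _ ↦ mul_nonneg (by positivity) (quarticKernel_nonneg _ _))
      (Finset.mem_range_succ_iff.mpr hj)
  have hker : ∀ u : ℝ, 0 < u → |t| ≤ u → 1 / (10 * u) ≤ u ^ 3 * quarticKernel u t := by
    intro u hu htu
    have h3 : t ^ 2 ≤ u ^ 2 := by rw [← sq_abs t]; gcongr
    unfold quarticKernel
    rw [← mul_inv, ← div_eq_mul_inv, div_le_div_iff₀ (by positivity) (by positivity)]
    have h4 : (u ^ 2 + t ^ 2) * ((2 * u) ^ 2 + t ^ 2) ≤ (2 * u ^ 2) * (5 * u ^ 2) := by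
      gcongr <;> nlinarith
    nlinarith
  by_cases hex : ∃ j : ℕ, j ≤ J ∧ |t| ≤ 2 ^ j
  · classical
    set j := Nat.find hex with hj
    obtain ⟨hjJ, htj⟩ := Nat.find_spec hex
    have h3 := hker (2 ^ j) (by positivity) htj
    have h4 : 2 ^ j / 2 ≤ r := by
      rcases Nat.eq_zero_or_pos j with h0 | h0
      · rw [h0]
        norm_num
        linarith
      · have h5 := Nat.find_min hex (Nat.sub_lt h0 one_pos)
        have h6 : (2 : ℝ) ^ (j - 1) < |t| := by
          by_contra hcon
          exact h5 ⟨(Nat.sub_le _ _).trans hjJ, not_lt.mp hcon⟩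
        have h7 : (2 : ℝ) ^ j = 2 ^ (j - 1) * 2 := by
          rw [← pow_succ, Nat.sub_add_cancel h0]
        linarith
    refine key j hjJ ?_
    have h5 : (0 : ℝ) < 2 ^ j := by positivity
    have h6 : 2 ^ j / 2 * w ≤ M := (by gcongr : 2 ^ j / 2 * w ≤ r * w).trans h1
    calc w ≤ 20 * M * (1 / (10 * 2 ^ j)) := by
          rw [mul_one_div, le_div_iff₀ (by positivity)]
          linarith
      _ ≤ _ := by gcongr
  · have hlt : (2 : ℝ) ^ J < |t| := by
      by_contra hcon
      exact hex ⟨J, le_rfl, not_lt.mp hcon⟩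
    refine key J le_rfl ?_
    set u : ℝ := 2 ^ J
    have hu : 0 < u := by positivity
    have ht : 0 < |t| := hu.trans hlt
    have h3 : u ^ 2 ≤ t ^ 2 := by rw [← sq_abs t]; gcongr
    have h4 : u ^ 3 / (10 * t ^ 4) ≤ u ^ 3 * quarticKernel u t := by
      unfold quarticKernel
      rw [← mul_inv, ← div_eq_mul_inv]
      have hle : (u ^ 2 + t ^ 2) * ((2 * u) ^ 2 + t ^ 2) ≤ 10 * t ^ 4 :=
        calc (u ^ 2 + t ^ 2) * ((2 * u) ^ 2 + t ^ 2) ≤ (2 * t ^ 2) * (5 * t ^ 2) := by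
              gcongr <;> nlinarith
          _ = 10 * t ^ 4 := by ring
      exact div_le_div_of_nonneg_left (by positivity) (by positivity) hle
    have h5 : η ^ 3 * t ^ 4 * w ≤ M := by
      refine le_trans ?_ h2
      have : t ^ 4 ≤ r ^ 4 := by
        rw [← Even.pow_abs (by decide : Even 4) t]
        gcongr
      gcongr
    have ht4 : 0 < t ^ 4 := by
      rw [← Even.pow_abs (by decide : Even 4) t]
      positivity
    have h6 : t ^ 4 * w ≤ M * u ^ 3 := by
      have h7 : 1 ≤ (u * η) ^ 3 := one_le_pow₀ hJ
      calc t ^ 4 * w ≤ (u * η) ^ 3 * (t ^ 4 * w) := le_mul_of_one_le_left (by positivity) h7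
        _ = u ^ 3 * (η ^ 3 * t ^ 4 * w) := by ring
        _ ≤ u ^ 3 * M := by gcongr
        _ = _ := mul_comm _ _
    calc w ≤ 20 * M * (u ^ 3 / (10 * t ^ 4)) := by
          rw [mul_div_assoc', le_div_iff₀ (by positivity)]
          nlinarith [mul_pos hM (pow_pos hu 3)]
      _ ≤ _ := by gcongr

end

end Poisson

section Poisson

/-- An integral over a vertical line against a function of quadratic growth which is real on the
real line only depends on the real part of this function on a line further left. -/
theorem integral_line_mul_eq_two_mul_re {Φ G : ℂ → ℂ} {b c C₁ C₂ : ℝ} (hcb : c ≤ b)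
    (hC₁ : 0 ≤ C₁) (hΦ : Differentiable ℂ Φ) (hΦb : ∀ s : ℂ, s.re ≤ b → ‖Φ s‖ * ‖s‖ ^ 4 ≤ C₁)
    (hG : ∀ s : ℂ, c ≤ s.re → DifferentiableAt ℂ G s)
    (hGb : ∀ s : ℂ, c ≤ s.re → ‖G s‖ ≤ C₂ * (1 + ‖s‖ ^ 2))
    (hGc : ∀ s : ℂ, G (starRingEnd ℂ s) = starRingEnd ℂ (G s)) :
    ∫ t : ℝ, Φ (b + t * Complex.I) * G (b + t * Complex.I) =
      2 * ∫ t : ℝ, Φ (c + t * Complex.I) * (G (c + t * Complex.I)).re := by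
  have hC₂ : 0 ≤ C₂ := by
    have h1 := (norm_nonneg _).trans (hGb c (by simp))
    exact nonneg_of_mul_nonneg_left h1 (by positivity)
  have hGb' : ∀ s : ℂ, c ≤ s.re → 1 ≤ ‖s‖ → ‖G s‖ ≤ C₂ * (2 * ‖s‖ ^ 2) := fun s hs h1 ↦ by
    refine (hGb s hs).trans ?_
    have : 1 ≤ ‖s‖ ^ 2 := one_le_pow₀ h1
    gcongr
    linarith
  have hclosed : IsClosed {s : ℂ | c ≤ s.re} := isClosed_le continuous_const Complex.continuous_re
  have hd₁ : ∀ s : ℂ, c ≤ s.re → DifferentiableAt ℂ (fun s ↦ Φ s * G s) s := fun s hs ↦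
    (hΦ s).mul (hG s hs)
  have hq₁ : QuadDecay (fun s ↦ Φ s * G s) {s | c ≤ s.re ∧ s.re ≤ b} := by
    refine QuadDecay.of_le (C := 2 * C₁ * C₂) (R := 1) ?_
      (fun s hs ↦ (hd₁ s hs.1).continuousAt.continuousWithinAt) fun s hs h1 ↦ ?_
    · exact hclosed.inter (isClosed_le Complex.continuous_re continuous_const)
    · have h2 := hGb' s hs.1 h1
      have h3 := hΦb s hs.2
      rw [norm_mul, le_div_iff₀ (by positivity)]
      calc ‖Φ s‖ * ‖G s‖ * ‖s‖ ^ 2 ≤ ‖Φ s‖ * (C₂ * (2 * ‖s‖ ^ 2)) * ‖s‖ ^ 2 := by gcongr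
        _ = 2 * C₂ * (‖Φ s‖ * ‖s‖ ^ 4) := by ring
        _ ≤ 2 * C₂ * C₁ := by gcongr
        _ = _ := by ring
  have hd₂ : ∀ s : ℂ, c ≤ s.re → DifferentiableAt ℂ (fun s ↦ Φ (2 * c - s) * G s) s := fun s hs ↦
    (DifferentiableAt.comp (f := fun s : ℂ ↦ 2 * c - s) s (hΦ _) (by fun_prop)).mul (hG s hs)
  have hq₂ : QuadDecay (fun s ↦ Φ (2 * c - s) * G s) {s | c ≤ s.re} := by
    refine QuadDecay.of_le (C := 32 * C₁ * C₂) (R := 1 + 4 * |c|) hclosed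
      (fun s hs ↦ (hd₂ s hs).continuousAt.continuousWithinAt) fun s hs h1 ↦ ?_
    have hs' : c ≤ s.re := hs
    have hc0 := abs_nonneg c
    have h2 := hGb' s hs (by linarith)
    have h3 := hΦb (2 * c - s) (by
      simp
      linarith)
    have h4 : ‖s‖ ≤ 2 * ‖2 * c - s‖ := by
      have h5 : ‖s‖ ≤ ‖(2 * c : ℂ)‖ + ‖2 * c - s‖ := by
        simpa using norm_sub_le (2 * c : ℂ) (2 * c - s)
      have h6 : ‖(2 * c : ℂ)‖ = 2 * |c| := by simp
      linarith
    have hs0 : 0 < ‖s‖ := by linarith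
    rw [norm_mul, le_div_iff₀ (by positivity)]
    calc ‖Φ (2 * c - s)‖ * ‖G s‖ * ‖s‖ ^ 2 ≤
        ‖Φ (2 * c - s)‖ * (C₂ * (2 * ‖s‖ ^ 2)) * ‖s‖ ^ 2 := by gcongr
      _ = 2 * C₂ * (‖Φ (2 * c - s)‖ * ‖s‖ ^ 4) := by ring
      _ ≤ 2 * C₂ * (‖Φ (2 * c - s)‖ * (2 * ‖2 * c - s‖) ^ 4) := by gcongr
      _ = 32 * C₂ * (‖Φ (2 * c - s)‖ * ‖2 * c - s‖ ^ 4) := by ring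
      _ ≤ 32 * C₂ * C₁ := by gcongr
      _ = _ := by ring
  have h₁ := integral_line_eq_of_le hcb (fun s hs _ ↦ hd₁ s hs) hq₁
  have h₂ := integral_line_eq_zero_right hd₂ hq₂
  have hi₁ := integrable_line (a := c) (fun s hs ↦ (hd₁ s hs.ge).continuousAt)
    (hq₁.mono fun s (hs : s.re = c) ↦ ⟨hs.ge, hs.le.trans hcb⟩)
  have hi₂ := (integrable_line (a := c) (fun s hs ↦ (hd₂ s hs.ge).continuousAt)
    (hq₂.mono fun s (hs : s.re = c) ↦ hs.ge)).comp_neg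
  have e : ∀ t : ℝ, Φ (2 * c - (c + ((-t : ℝ) : ℂ) * Complex.I)) * G (c + ((-t : ℝ) : ℂ) * Complex.I)
      = Φ (c + t * Complex.I) * starRingEnd ℂ (G (c + t * Complex.I)) := fun t ↦ by
    rw [← hGc]
    congr 2
    · push_cast
      ring
    · simp
  rw [← integral_neg_eq_self] at h₂
  simp only [e] at h₂ hi₂
  rw [← h₁, ← add_zero (∫ t : ℝ, Φ (c + t * Complex.I) * G (c + t * Complex.I)), ← h₂,
    ← integral_add hi₁ hi₂, ← integral_const_mul]
  congr 1
  ext t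
  rw [← mul_add, Complex.add_conj]
  push_cast
  ring

end Poisson

section

variable {K : Type*} [Field K] [NumberField K] {Ξ : ℂ → ℂ}

/-- Under the Riemann hypothesis, the smoothed sum over zeros of the Dedekind zeta function is
bounded as follows. -/
theorem IsCompletedZeta.norm_integral_windowTransform_le (h : IsCompletedZeta K Ξ)
    {a b η σ c : ℝ} (ha : 0 < a) (hab : a ≤ b) (hη : 0 < η) (hσ : 1 / 2 < σ) (hσ2 : σ ≤ 2)
    (hc : 0 ≤ c) (hc2 : c ≤ 2) {J : ℕ} (hJ : 1 ≤ 2 ^ J * η) :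
    ‖∫ t : ℝ, windowTransform a b η (2 + t * Complex.I) * logDeriv Ξ (2 + t * Complex.I + c)‖ ≤
      2 * (20 * (2 * Real.exp (b * σ) * (1 + Real.exp (η * σ)) ^ 3) * ((J + 1) * (Real.pi / 3 *
        (3 + logDiscr K / 2 + Module.finrank ℚ K / 2 * (J + 2))))) := by
  obtain ⟨C₁, hC₁, hC₁'⟩ := exists_norm_windowTransform_le ha hab hη (zero_le_two (α := ℝ))
  obtain ⟨C₂, hC₂, hC₂'⟩ := h.exists_norm_logDeriv_le hσ
  have hrefl := integral_line_mul_eq_two_mul_re (Φ := windowTransform a b η)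
    (G := fun s ↦ logDeriv Ξ (s + c)) (C₂ := C₂ * (1 + 2 * c ^ 2 + 2)) hσ2 hC₁
    (differentiable_windowTransform a b η) hC₁' (fun s hs ↦ by
      refine DifferentiableAt.comp (f := fun s : ℂ ↦ s + c) s (h.differentiableAt_logDeriv ?_)
        (by fun_prop)
      simp
      linarith) (fun s hs ↦ by
      refine (hC₂' _ (by simp; linarith)).trans ?_
      rw [mul_assoc]
      have h1 : ‖s + (c : ℂ)‖ ≤ ‖s‖ + |c| := by
        simpa using norm_add_le s (c : ℂ)
      have h2 : ‖s + (c : ℂ)‖ ^ 2 ≤ (‖s‖ + |c|) ^ 2 := by gcongr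
      gcongr
      nlinarith [sq_nonneg (|c| - ‖s‖), sq_abs c, sq_nonneg ‖s‖, sq_nonneg c,
        mul_nonneg (sq_nonneg c) (sq_nonneg ‖s‖)]) (fun s ↦ by
      rw [← h.logDeriv_conj]
      simp)
  push_cast at hrefl
  rw [hrefl, norm_mul, Complex.norm_ofNat]
  refine mul_le_mul_of_nonneg_left ?_ zero_le_two
  set M := 20 * (2 * Real.exp (b * σ) * (1 + Real.exp (η * σ)) ^ 3)
  have hM : 0 < M := by positivity
  have hre : ∀ t : ℝ, 0 ≤ (logDeriv Ξ (σ + t * Complex.I + c)).re := fun t ↦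
    h.re_logDeriv_nonneg (by simp; linarith)
  have hlog : ∀ j ∈ Finset.range (J + 1), Real.log (σ + c + 2 ^ j + 1) ≤ J + 2 := by
    intro j hj
    have h1 : (2 : ℝ) ^ j ≤ 2 ^ J :=
      pow_le_pow_right₀ one_le_two (Finset.mem_range_succ_iff.mp hj)
    have h2 : σ + c + 2 ^ j + 1 ≤ 2 ^ J * 6 := by
      have : (1 : ℝ) ≤ 2 ^ J := one_le_pow₀ one_le_two
      linarith
    have h3 : Real.log (2 ^ J * 6) ≤ J + 2 := by
      rw [Real.log_mul (by positivity) (by norm_num), Real.log_pow]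
      have h4 := Real.log_two_lt_d9
      have h5 : Real.log 6 ≤ 2 := by
        rw [Real.log_le_iff_le_exp (by norm_num)]
        have h6 : Real.exp 2 = Real.exp 1 ^ 2 := by
          rw [← Real.exp_nat_mul]
          norm_num
        have := Real.exp_one_gt_d9
        rw [h6]
        nlinarith
      have : (0 : ℝ) ≤ J := J.cast_nonneg
      nlinarith
    refine (Real.log_le_log ?_ h2).trans h3
    positivity
  set B := Real.pi / 3 * (3 + logDiscr K / 2 + Module.finrank ℚ K / 2 * (J + 2)) with hB
  have hline : ∀ j ∈ Finset.range (J + 1),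
      Integrable (fun t : ℝ ↦ (logDeriv Ξ (σ + t * Complex.I + c)).re *
        ((2 ^ j) ^ 3 * quarticKernel (2 ^ j) t)) ∧
      ∫ t : ℝ, (logDeriv Ξ (σ + t * Complex.I + c)).re *
        ((2 ^ j) ^ 3 * quarticKernel (2 ^ j) t) ≤ B := by
    intro j hj
    obtain ⟨h1, h2⟩ := h.integral_re_logDeriv_le (σ := σ + c) (u := 2 ^ j) (by linarith)
      (one_le_pow₀ one_le_two)
    have e : ∀ t : ℝ, (((σ + c : ℝ) : ℂ) + t * Complex.I) = σ + t * Complex.I + c := fun t ↦ by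
      push_cast
      ring
    simp only [e] at h1 h2
    have e2 : ∀ t : ℝ, (logDeriv Ξ (σ + t * Complex.I + c)).re *
        ((2 ^ j) ^ 3 * quarticKernel (2 ^ j) t) =
        (2 ^ j) ^ 3 * ((logDeriv Ξ (σ + t * Complex.I + c)).re * quarticKernel (2 ^ j) t) :=
      fun t ↦ by ring
    simp only [e2]
    refine ⟨h1.const_mul _, ?_⟩
    rw [integral_const_mul]
    calc ((2 : ℝ) ^ j) ^ 3 * _ ≤ ((2 : ℝ) ^ j) ^ 3 * _ := mul_le_mul_of_nonneg_left h2 (by positivity)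
      _ = Real.pi / 3 * (3 + logDiscr K / 2 +
          Module.finrank ℚ K / 2 * Real.log (σ + c + 2 ^ j + 1)) := by
        field_simp
      _ ≤ _ := by
        rw [hB]
        have := hlog j hj
        gcongr
  have hsum : Integrable fun t : ℝ ↦ M * ∑ j ∈ Finset.range (J + 1),
      (logDeriv Ξ (σ + t * Complex.I + c)).re * ((2 ^ j) ^ 3 * quarticKernel (2 ^ j) t) :=
    (integrable_finsetSum _ fun j hj ↦ (hline j hj).1).const_mul _
  refine (norm_integral_le_of_norm_le hsum (.of_forall fun t ↦ ?_)).trans ?_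
  · rw [norm_mul, Complex.norm_of_nonneg (hre t), ← Finset.mul_sum, mul_left_comm, mul_comm]
    refine mul_le_mul_of_nonneg_left ?_ (hre t)
    exact norm_windowTransform_le_sum ha hab hη (by linarith) hJ hσ.le t
  · rw [integral_const_mul, integral_finsetSum _ fun j hj ↦ (hline j hj).1]
    refine mul_le_mul_of_nonneg_left ?_ hM.le
    refine (Finset.sum_le_card_nsmul _ _ _ fun j hj ↦ (hline j hj).2).trans_eq ?_
    simp

end

section Residue

open Filter Topology

/-- Residue evaluation of the integral of `Φ s / (s - β)` over a vertical line to the right of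
`β`. -/
theorem integral_line_div_sub {Φ : ℂ → ℂ} {b β C : ℝ} (hβ : β < b) (hC : 0 ≤ C)
    (hΦ : Differentiable ℂ Φ) (hΦb : ∀ s : ℂ, s.re ≤ b → 1 ≤ ‖s‖ → ‖Φ s‖ * ‖s‖ ≤ C) :
    Integrable (fun t : ℝ ↦ Φ (b + t * Complex.I) * (1 / (b + t * Complex.I - β))) ∧
    ∫ t : ℝ, Φ (b + t * Complex.I) * (1 / (b + t * Complex.I - β)) = 2 * Real.pi * Φ β := by
  set d : ℝ := b - β with hd
  have hd0 : 0 < d := by linarith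
  set p : ℝ := b + d with hp
  have hdc : (d : ℂ) ≠ 0 := by exact_mod_cast hd0.ne'
  have hpd : (β : ℂ) - p = -(2 * d) := by
    rw [hp, hd]
    push_cast
    ring
  have hnorm : ∀ c : ℝ, ∀ s : ℂ, 2 * |c| ≤ ‖s‖ → ‖s‖ / 2 ≤ ‖s - c‖ := fun c s hs ↦ by
    have h1 := norm_sub_norm_le s (c : ℂ)
    rw [Complex.norm_real, Real.norm_eq_abs] at h1
    linarith
  have hΦd : ∀ s : ℂ, s.re ≤ b → 1 ≤ ‖s‖ → ‖Φ s‖ ≤ C / ‖s‖ := fun s hs h1 ↦ by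
    rw [le_div_iff₀ (by linarith)]
    exact hΦb s hs h1
  set Ψ : ℂ → ℂ := fun s ↦ Φ s - Φ β * (β - p) / (s - p) with hΨ
  have hΨβ : Ψ β = 0 := by
    have : (β : ℂ) - p ≠ 0 := by
      rw [hpd]
      simpa using hdc
    simp only [hΨ]
    field_simp
    ring
  set U : Set ℂ := {s | s.re < p}
  have hU : IsOpen U := isOpen_lt Complex.continuous_re continuous_const
  have hbp : b < p := by linarith
  have hUb : ∀ s : ℂ, s.re ≤ b → U ∈ 𝓝 s := fun s hs ↦ hU.mem_nhds (lt_of_le_of_lt hs hbp)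
  have hsp : ∀ s : ℂ, s.re < p → s - p ≠ 0 := fun s hs h0 ↦ by
    rw [sub_eq_zero.mp h0, Complex.ofReal_re] at hs
    exact lt_irrefl _ hs
  have hΨd : DifferentiableOn ℂ Ψ U := fun s hs ↦ by
    refine ((hΦ s).sub (DifferentiableAt.div (by fun_prop) (by fun_prop)
      (hsp s hs))).differentiableWithinAt
  have hDd : DifferentiableOn ℂ (dslope Ψ β) U :=
    (Complex.differentiableOn_dslope (hUb β (by simpa using hβ.le))).mpr hΨd
  have hD : ∀ s : ℂ, s ≠ β → dslope Ψ β s = Ψ s / (s - β) := fun s hs ↦ by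
    rw [dslope_of_ne _ hs, slope_def_field, hΨβ, sub_zero]
  have hDat : ∀ s : ℂ, s.re ≤ b → DifferentiableAt ℂ (dslope Ψ β) s := fun s hs ↦
    (hDd s (lt_of_le_of_lt hs hbp)).differentiableAt (hUb s hs)
  have hclosed : IsClosed {s : ℂ | s.re ≤ b} := isClosed_le Complex.continuous_re continuous_const
  have hlarge : ∀ s : ℂ, 1 + 2 * |β| + 2 * |p| ≤ ‖s‖ →
      1 ≤ ‖s‖ ∧ ‖s‖ / 2 ≤ ‖s - β‖ ∧ ‖s‖ / 2 ≤ ‖s - p‖ := fun s hs ↦ by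
    have := abs_nonneg β
    have := abs_nonneg p
    exact ⟨by linarith, hnorm _ _ (by linarith), hnorm _ _ (by linarith)⟩
  have hq : QuadDecay (dslope Ψ β) {s | s.re ≤ b} := by
    refine QuadDecay.of_le (C := (C + 2 * ‖Φ β * (β - p)‖) * 2) (R := 1 + 2 * |β| + 2 * |p|)
      hclosed (fun s hs ↦ (hDat s hs).continuousAt.continuousWithinAt) fun s hs h1 ↦ ?_
    obtain ⟨h2, h3, h4⟩ := hlarge s h1
    have hs0 : 0 < ‖s‖ := by linarith
    have hsβ : s ≠ β := fun h0 ↦ by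
      have : ‖s - β‖ = 0 := by rw [h0, sub_self, norm_zero]
      linarith
    rw [hD s hsβ, norm_div]
    have h5 : ‖Ψ s‖ ≤ (C + 2 * ‖Φ β * (β - p)‖) / ‖s‖ := by
      refine (norm_sub_le _ _).trans ?_
      rw [add_div]
      refine add_le_add (hΦd s hs h2) ?_
      rw [norm_div]
      calc _ ≤ ‖Φ β * (β - p)‖ / (‖s‖ / 2) := by gcongr
        _ = _ := by field_simp
    calc ‖Ψ s‖ / ‖s - β‖ ≤ (C + 2 * ‖Φ β * (β - p)‖) / ‖s‖ / (‖s‖ / 2) := by gcongr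
      _ = _ := by field_simp
  have hq₂ : QuadDecay (fun s ↦ Φ s * (1 / (s - β))) {s | s.re = b} := by
    have hne : ∀ s ∈ {s : ℂ | s.re = b}, s - β ≠ 0 := fun s hs h0 ↦ by
      have hs' : s.re = b := hs
      rw [sub_eq_zero.mp h0, Complex.ofReal_re] at hs'
      linarith
    refine QuadDecay.of_le (C := 2 * C) (R := 1 + 2 * |β| + 2 * |p|)
      (isClosed_eq Complex.continuous_re continuous_const) (fun s hs ↦ ?_) fun s hs h1 ↦ ?_
    · have : ContinuousAt (fun s : ℂ ↦ Φ s * (1 / (s - β))) s :=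
        hΦ.continuous.continuousAt.mul (continuousAt_const.div (by fun_prop) (hne s hs))
      exact this.continuousWithinAt
    · obtain ⟨h2, h3, h4⟩ := hlarge s h1
      have h5 := hΦd s (le_of_eq hs) h2
      have hs0 : 0 < ‖s‖ := by linarith
      rw [norm_mul, norm_div, norm_one]
      calc ‖Φ s‖ * (1 / ‖s - β‖) ≤ C / ‖s‖ * (1 / (‖s‖ / 2)) := by gcongr
        _ = _ := by field_simp
  have hne : ∀ t : ℝ, (b + t * Complex.I : ℂ) ≠ β := fun t h0 ↦ by
    have := congr_arg Complex.re h0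
    simp at this
    linarith
  have hi₂ : Integrable fun t : ℝ ↦ Φ (b + t * Complex.I) * (1 / (b + t * Complex.I - β)) := by
    refine integrable_line (fun s hs ↦ ?_) hq₂
    refine hΦ.continuous.continuousAt.mul (ContinuousAt.div (by fun_prop) (by fun_prop) fun h0 ↦ ?_)
    rw [sub_eq_zero.mp h0, Complex.ofReal_re] at hs
    linarith
  refine ⟨hi₂, ?_⟩
  have h0 := integral_line_eq_zero_left hDat hq
  have e : ∀ t : ℝ, dslope Ψ β (b + t * Complex.I) =
      Φ (b + t * Complex.I) * (1 / (b + t * Complex.I - β)) -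
        Φ β * (2 * d) * ((d ^ 2 + t ^ 2)⁻¹ : ℝ) := fun t ↦ by
    rw [hD _ (hne t)]
    have h1 : (b + t * Complex.I : ℂ) - β ≠ 0 := sub_ne_zero.mpr (hne t)
    have h2 : (b + t * Complex.I : ℂ) - p ≠ 0 := hsp _ (by simpa using hbp)
    have h3 : ((d : ℂ) ^ 2 + t ^ 2) = -((b + t * Complex.I - β) * (b + t * Complex.I - p)) := by
      rw [hp, hd]
      push_cast
      linear_combination (t : ℂ) ^ 2 * Complex.I_sq
    push_cast
    rw [h3]
    simp only [hΨ]
    rw [hpd]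
    field_simp
  simp only [e] at h0
  have hi₃ : Integrable fun t : ℝ ↦ (((d ^ 2 + t ^ 2)⁻¹ : ℝ) : ℂ) :=
    (integrable_inv_sq_add_sq_real hd0).ofReal
  rw [integral_sub hi₂ (hi₃.const_mul _),
    integral_const_mul, integral_complex_ofReal, integral_inv_sq_add_sq_real hd0, sub_eq_zero] at h0
  rw [h0]
  push_cast
  field_simp

end Residue

section Perron

open Filter Topology

/-- The normalized remainder of the Taylor expansion of order three of `exp (y s)`. -/
noncomputable def expRemainder (y : ℝ) : ℂ → ℂ :=
  Function.update (fun s ↦ (Complex.exp (y * s) - 1 - y * s - (y * s) ^ 2 / 2) / s ^ 3) 0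
    ((y ^ 3 / 6 : ℝ) : ℂ)

theorem expRemainder_zero (y : ℝ) : expRemainder y 0 = ((y ^ 3 / 6 : ℝ) : ℂ) :=
  Function.update_self ..

theorem expRemainder_of_ne {y : ℝ} {s : ℂ} (hs : s ≠ 0) : expRemainder y s =
    (Complex.exp (y * s) - 1 - y * s - (y * s) ^ 2 / 2) / s ^ 3 :=
  Function.update_of_ne hs ..

theorem differentiable_expRemainder (y : ℝ) : Differentiable ℂ (expRemainder y) := by
  have hne : ∀ s : ℂ, s ≠ 0 → DifferentiableAt ℂ (expRemainder y) s := fun s hs ↦ by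
    have h1 : DifferentiableAt ℂ
        (fun s : ℂ ↦ (Complex.exp (y * s) - 1 - y * s - (y * s) ^ 2 / 2) / s ^ 3) s :=
      DifferentiableAt.div (by fun_prop) (by fun_prop) (pow_ne_zero 3 hs)
    refine h1.congr_of_eventuallyEq ?_
    filter_upwards [isOpen_ne.mem_nhds hs] with z hz using expRemainder_of_ne hz
  intro s
  rcases eq_or_ne s 0 with rfl | hs
  swap
  · exact hne s hs
  refine AnalyticAt.differentiableAt (Complex.analyticAt_of_differentiable_on_punctured_nhds_of_continuousAt
    (eventually_nhdsWithin_of_forall fun z hz ↦ hne z hz) ?_)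
  rw [Metric.continuousAt_iff']
  intro ε hε
  have hlim : Tendsto (fun s : ℂ ↦ |y| ^ 4 * ‖s‖) (𝓝 0) (𝓝 0) := by
    have : Continuous (fun s : ℂ ↦ |y| ^ 4 * ‖s‖) := by fun_prop
    simpa using this.tendsto 0
  have hlim₂ : Tendsto (fun s : ℂ ↦ ‖(y : ℂ) * s‖) (𝓝 0) (𝓝 0) := by
    have : Continuous (fun s : ℂ ↦ ‖(y : ℂ) * s‖) := by fun_prop
    simpa using this.tendsto 0
  filter_upwards [hlim.eventually_lt_const hε, hlim₂.eventually_le_const one_pos] with z hz1 hz2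
  rcases eq_or_ne z 0 with rfl | hz
  · simpa using hε
  refine lt_of_le_of_lt ?_ hz1
  rw [dist_eq_norm, expRemainder_zero, expRemainder_of_ne hz]
  have h1 := Complex.exp_bound hz2 (n := 4) (by norm_num)
  simp only [Finset.sum_range_succ, Finset.sum_range_zero, Nat.factorial] at h1
  have h2 : (Complex.exp (y * z) - 1 - y * z - (y * z) ^ 2 / 2) / z ^ 3 - ((y ^ 3 / 6 : ℝ) : ℂ) =
      (Complex.exp (y * z) - (1 + y * z + (y * z) ^ 2 / 2 + (y * z) ^ 3 / 6)) / z ^ 3 := by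
    push_cast
    field_simp
    ring
  rw [h2, norm_div, norm_pow, div_le_iff₀ (by positivity)]
  norm_num at h1
  refine h1.trans ?_
  rw [mul_pow]
  have h3 : 0 ≤ |y| ^ 4 * ‖z‖ ^ 4 := by positivity
  rw [show |y| ^ 4 * ‖z‖ * ‖z‖ ^ 3 = |y| ^ 4 * ‖z‖ ^ 4 by ring]
  linarith

theorem quadDecay_inv_pow {b : ℝ} (hb : 0 < b) {y : ℝ} (hy : y ≤ 0) {k : ℕ} (hk : 2 ≤ k) :
    QuadDecay (fun s ↦ Complex.exp (y * s) / s ^ k) {s | b ≤ s.re} := by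
  have hne : ∀ s ∈ {s : ℂ | b ≤ s.re}, s ≠ 0 := fun s hs h0 ↦ by
    have hs' : b ≤ s.re := hs
    rw [h0, Complex.zero_re] at hs'
    linarith
  refine QuadDecay.of_le (C := 1) (R := 1) (isClosed_le continuous_const Complex.continuous_re)
    (fun s hs ↦ ?_) fun s hs h1 ↦ ?_
  · have h2 : ContinuousAt (fun s : ℂ ↦ Complex.exp (y * s) / s ^ k) s :=
      ContinuousAt.div (by fun_prop) (by fun_prop) (pow_ne_zero k (hne s hs))
    exact h2.continuousWithinAt
  · have hs' : b ≤ s.re := hs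
    rw [norm_div, norm_pow, Complex.norm_exp, Complex.re_ofReal_mul]
    have h2 : Real.exp (y * s.re) ≤ 1 := by
      rw [Real.exp_le_one_iff]
      nlinarith
    have h3 : ‖s‖ ^ 2 ≤ ‖s‖ ^ k := pow_le_pow_right₀ h1 hk
    have h4 : 0 < ‖s‖ := by linarith
    gcongr

theorem integral_line_exp_div_pow_eq_zero {b : ℝ} (hb : 0 < b) {y : ℝ} (hy : y ≤ 0) {k : ℕ}
    (hk : 2 ≤ k) :
    ∫ t : ℝ, Complex.exp (y * (b + t * Complex.I)) / (b + t * Complex.I) ^ k = 0 := by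
  refine integral_line_eq_zero_right (f := fun s ↦ Complex.exp (y * s) / s ^ k) (fun s hs ↦ ?_)
    (quadDecay_inv_pow hb hy hk)
  have hs0 : s ≠ 0 := fun h0 ↦ by
    rw [h0, Complex.zero_re] at hs
    linarith
  exact DifferentiableAt.div (by fun_prop) (by fun_prop) (pow_ne_zero k hs0)

theorem integrable_line_exp_div_pow {b : ℝ} (hb : 0 < b) (y : ℝ) {k : ℕ} (hk : 2 ≤ k) :
    Integrable fun t : ℝ ↦ Complex.exp (y * (b + t * Complex.I)) / (b + t * Complex.I) ^ k := by
  have hne : ∀ t : ℝ, (b + t * Complex.I : ℂ) ≠ 0 := fun t h0 ↦ by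
    have := congr_arg Complex.re h0
    simp at this
    linarith
  have h1 : Integrable fun t : ℝ ↦ Complex.exp ((0 : ℝ) * (b + t * Complex.I)) /
      (b + t * Complex.I) ^ k := by
    refine integrable_line (f := fun s ↦ Complex.exp ((0 : ℝ) * s) / s ^ k) (fun s hs ↦ ?_)
      ((quadDecay_inv_pow hb le_rfl hk).mono fun s (hs : s.re = b) ↦ hs.ge)
    have hs0 : s ≠ 0 := fun h0 ↦ by
      rw [h0, Complex.zero_re] at hs
      linarith
    exact ContinuousAt.div (by fun_prop) (by fun_prop) (pow_ne_zero k hs0)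
  refine (h1.norm.const_mul (Real.exp (y * b))).mono' ?_ (.of_forall fun t ↦ ?_)
  · refine Continuous.aestronglyMeasurable ?_
    exact Continuous.div (by fun_prop) (by fun_prop) fun t ↦ pow_ne_zero k (hne t)
  · rw [norm_div, norm_div, Complex.norm_exp, Complex.norm_exp, Complex.re_ofReal_mul]
    simp [div_eq_mul_inv]

/-- A truncated power function. -/
noncomputable def cubicPart (y : ℝ) : ℝ := max y 0 ^ 3 / 6

/-- Perron's formula with a kernel of order four. -/
theorem integral_line_exp_div_pow_four {b : ℝ} (hb : 0 < b) (y : ℝ) :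
    ∫ t : ℝ, Complex.exp (y * (b + t * Complex.I)) / (b + t * Complex.I) ^ 4 =
      2 * Real.pi * (cubicPart y : ℝ) := by
  rcases le_total y 0 with hy | hy
  · rw [integral_line_exp_div_pow_eq_zero hb hy (by norm_num), cubicPart, max_eq_right hy]
    simp
  have hne : ∀ t : ℝ, (b + t * Complex.I : ℂ) ≠ 0 := fun t h0 ↦ by
    have := congr_arg Complex.re h0
    simp at this
    linarith
  obtain ⟨hi, h1⟩ := integral_line_div_sub (Φ := expRemainder y) (b := b) (β := 0)
    (C := Real.exp (y * b) + 1 + y + y ^ 2 / 2) hb (by positivity) (differentiable_expRemainder y)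
    fun s hs hs1 ↦ by
      have hs0 : 0 < ‖s‖ := by linarith
      rw [expRemainder_of_ne (norm_pos_iff.mp hs0), norm_div, norm_pow, div_mul_eq_mul_div,
        div_le_iff₀ (by positivity)]
      have h2 : ‖Complex.exp (y * s) - 1 - y * s - (y * s) ^ 2 / 2‖ ≤
          Real.exp (y * b) + 1 + y * ‖s‖ + (y * ‖s‖) ^ 2 / 2 := by
        refine (norm_sub_le _ _).trans (add_le_add ((norm_sub_le _ _).trans
          (add_le_add ((norm_sub_le _ _).trans (add_le_add ?_ ?_)) ?_)) ?_)
        · rw [Complex.norm_exp, Complex.re_ofReal_mul]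
          gcongr
        · simp
        · rw [norm_mul, Complex.norm_of_nonneg hy]
        · rw [norm_div, norm_pow, norm_mul, Complex.norm_of_nonneg hy, Complex.norm_ofNat]
      have h3 : Real.exp (y * b) + 1 + y * ‖s‖ + (y * ‖s‖) ^ 2 / 2 ≤
          (Real.exp (y * b) + 1 + y + y ^ 2 / 2) * ‖s‖ ^ 2 := by
        have h4 : 1 ≤ ‖s‖ ^ 2 := one_le_pow₀ hs1
        have h5 : ‖s‖ ≤ ‖s‖ ^ 2 := le_self_pow₀ hs1 two_ne_zero
        have h6 : 0 ≤ (Real.exp (y * b) + 1) * (‖s‖ ^ 2 - 1) :=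
          mul_nonneg (by positivity) (by linarith)
        have h7 : 0 ≤ y * (‖s‖ ^ 2 - ‖s‖) := mul_nonneg hy (by linarith)
        nlinarith
      calc _ ≤ (Real.exp (y * b) + 1 + y + y ^ 2 / 2) * ‖s‖ ^ 2 * ‖s‖ := by
            gcongr
            exact h2.trans h3
        _ = _ := by ring
  simp only [Complex.ofReal_zero, sub_zero, expRemainder_zero] at h1 hi
  have e : ∀ t : ℝ, Complex.exp (y * (b + t * Complex.I)) / (b + t * Complex.I) ^ 4 =
      expRemainder y (b + t * Complex.I) * (1 / (b + t * Complex.I)) +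
      (Complex.exp ((0 : ℝ) * (b + t * Complex.I)) / (b + t * Complex.I) ^ 4 +
      (y * (Complex.exp ((0 : ℝ) * (b + t * Complex.I)) / (b + t * Complex.I) ^ 3) +
      y ^ 2 / 2 * (Complex.exp ((0 : ℝ) * (b + t * Complex.I)) / (b + t * Complex.I) ^ 2))) :=
    fun t ↦ by
      have := hne t
      rw [expRemainder_of_ne this]
      simp only [Complex.ofReal_zero, zero_mul, Complex.exp_zero]
      field_simp
      ring
  have hk := fun k (hk : 2 ≤ k) ↦ integrable_line_exp_div_pow hb 0 hk
  have hz := fun k (hk : 2 ≤ k) ↦ integral_line_exp_div_pow_eq_zero hb le_rfl hk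
  simp only [e]
  have i2 := (hk 2 le_rfl).const_mul ((y : ℂ) ^ 2 / 2)
  have i3 := (hk 3 (by norm_num)).const_mul (y : ℂ)
  have i4 := hk 4 (by norm_num)
  have e1 := integral_add hi (i4.add (i3.add i2))
  have e2 := integral_add i4 (i3.add i2)
  simp only [Pi.add_apply] at e1 e2
  rw [e1, e2, integral_add i3 i2, integral_const_mul, integral_const_mul, hz 2 le_rfl, hz 3 (by norm_num), hz 4 (by norm_num), h1,
    cubicPart, max_eq_left hy]
  simp

/-- A smoothed Heaviside function, equal to `0` to the left of `-3 η` and to `1` to the right of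
`0`. -/
noncomputable def smoothStep (η x : ℝ) : ℝ :=
  (cubicPart (x + 3 * η) - 3 * cubicPart (x + 2 * η) + 3 * cubicPart (x + η) - cubicPart x) / η ^ 3

theorem cubicPart_of_nonneg {y : ℝ} (hy : 0 ≤ y) : cubicPart y = y ^ 3 / 6 := by
  rw [cubicPart, max_eq_left hy]

theorem cubicPart_of_nonpos {y : ℝ} (hy : y ≤ 0) : cubicPart y = 0 := by
  rw [cubicPart, max_eq_right hy]
  norm_num

theorem smoothStep_of_le {η x : ℝ} (hη : 0 < η) (hx : x ≤ -(3 * η)) : smoothStep η x = 0 := by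
  rw [smoothStep, cubicPart_of_nonpos (by linarith), cubicPart_of_nonpos (by linarith),
    cubicPart_of_nonpos (by linarith), cubicPart_of_nonpos (by linarith)]
  norm_num

theorem smoothStep_of_nonneg {η x : ℝ} (hη : 0 < η) (hx : 0 ≤ x) : smoothStep η x = 1 := by
  rw [smoothStep, cubicPart_of_nonneg (by linarith), cubicPart_of_nonneg (by linarith),
    cubicPart_of_nonneg (by linarith), cubicPart_of_nonneg (by linarith)]
  field_simp
  ring

theorem smoothStep_mem_Icc {η : ℝ} (hη : 0 < η) (x : ℝ) : smoothStep η x ∈ Set.Icc 0 1 := by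
  rcases le_total x (-(3 * η)) with h3 | h3
  · rw [smoothStep_of_le hη h3]
    simp
  rcases le_total 0 x with h0 | h0
  · rw [smoothStep_of_nonneg hη h0]
    simp
  obtain ⟨y, rfl⟩ : ∃ y, x = η * y := ⟨x / η, by field_simp⟩
  have hy0 : y ≤ 0 := by
    by_contra hcon
    have := mul_pos hη (not_le.mp hcon)
    linarith
  have hy3 : -3 ≤ y := by
    by_contra hcon
    nlinarith [not_le.mp hcon]
  rw [smoothStep, cubicPart_of_nonpos h0, cubicPart_of_nonneg (y := η * y + 3 * η) (by linarith)]
  have hη3 : 0 < η ^ 3 := by positivity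
  rcases le_total y (-2) with h2 | h2
  · rw [cubicPart_of_nonpos (by nlinarith), cubicPart_of_nonpos (by nlinarith)]
    have e : ((η * y + 3 * η) ^ 3 / 6 - 3 * 0 + 3 * 0 - 0) / η ^ 3 = (y + 3) ^ 3 / 6 := by
      field_simp
      ring
    rw [e]
    have h4 : 0 ≤ y + 3 := by linarith
    have h5 : (y + 3) ^ 3 ≤ 1 := pow_le_one₀ h4 (by linarith)
    exact ⟨by positivity, by linarith⟩
  rcases le_total y (-1) with h1 | h1
  · rw [cubicPart_of_nonneg (y := η * y + 2 * η) (by nlinarith), cubicPart_of_nonpos (by nlinarith)]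
    have e : ((η * y + 3 * η) ^ 3 / 6 - 3 * ((η * y + 2 * η) ^ 3 / 6) + 3 * 0 - 0) / η ^ 3 =
        (1 + 3 * (y + 2) + 3 * (y + 2) ^ 2 - 2 * (y + 2) ^ 3) / 6 := by
      field_simp
      ring
    rw [e]
    have h4 : 0 ≤ y + 2 := by linarith
    have h5 : (y + 2) ≤ 1 := by linarith
    have h6 : (y + 2) ^ 2 ≤ 1 := pow_le_one₀ h4 h5
    have h7 : (y + 2) ^ 3 ≤ (y + 2) ^ 2 := pow_le_pow_of_le_one h4 h5 (by norm_num)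
    have h8 : 0 ≤ (y + 2) ^ 3 := by positivity
    have h9 : 0 ≤ (1 - (y + 2)) ^ 2 * (1 + 2 * (y + 2)) := by positivity
    ring_nf at h5 h6 h7 h8 h9 ⊢
    exact ⟨by linarith, by linarith⟩
  · rw [cubicPart_of_nonneg (y := η * y + 2 * η) (by nlinarith),
      cubicPart_of_nonneg (y := η * y + η) (by nlinarith)]
    have e : ((η * y + 3 * η) ^ 3 / 6 - 3 * ((η * y + 2 * η) ^ 3 / 6) +
        3 * ((η * y + η) ^ 3 / 6) - 0) / η ^ 3 = 1 - (-y) ^ 3 / 6 := by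
      field_simp
      ring
    rw [e]
    have h4 : 0 ≤ -y := by linarith
    have h5 : (-y) ^ 3 ≤ 1 := pow_le_one₀ h4 (by linarith)
    have h6 : 0 ≤ (-y) ^ 3 := by positivity
    exact ⟨by linarith, by linarith⟩

/-- The inverse Laplace transform of `windowTransform`. -/
theorem integral_line_windowTransform_mul_exp {b a η c : ℝ} (hη : 0 < η) (hc : 0 < c) (l : ℝ) :
    ∫ t : ℝ, windowTransform a b η (c + t * Complex.I) * Complex.exp (-l * (c + t * Complex.I)) =
      2 * Real.pi * ((smoothStep η (b - l) - smoothStep η (a - l) : ℝ) : ℂ) := by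
  have hne : ∀ t : ℝ, (c + t * Complex.I : ℂ) ≠ 0 := fun t h0 ↦ by
    have := congr_arg Complex.re h0
    simp at this
    linarith
  have hηc : (η : ℂ) ≠ 0 := by exact_mod_cast hη.ne'
  set E : ℝ → ℝ → ℂ := fun y t ↦ Complex.exp (y * (c + t * Complex.I)) / (c + t * Complex.I) ^ 4
    with hE
  set Q : ℝ → ℝ → ℂ := fun x t ↦
    (E (x + 3 * η) t - 3 * E (x + 2 * η) t + 3 * E (x + η) t - E x t) with hQ
  have hEi : ∀ y, Integrable (E y) := fun y ↦ integrable_line_exp_div_pow hc y (by norm_num)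
  have hEv : ∀ y, ∫ t, E y t = 2 * Real.pi * (cubicPart y : ℝ) := integral_line_exp_div_pow_four hc
  have hQi : ∀ x, Integrable (Q x) := fun x ↦
    (((hEi _).sub ((hEi _).const_mul 3)).add ((hEi _).const_mul 3)).sub (hEi _)
  have hQv : ∀ x, ∫ t, Q x t = 2 * Real.pi * ((smoothStep η x * η ^ 3 : ℝ) : ℂ) := fun x ↦ by
    have e1 := integral_sub ((((hEi (x + 3 * η)).sub ((hEi (x + 2 * η)).const_mul 3))).add
      ((hEi (x + η)).const_mul 3)) (hEi x)
    have e2 := integral_add ((hEi (x + 3 * η)).sub ((hEi (x + 2 * η)).const_mul 3))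
      ((hEi (x + η)).const_mul 3)
    have e3 := integral_sub (hEi (x + 3 * η)) ((hEi (x + 2 * η)).const_mul 3)
    simp only [Pi.add_apply, Pi.sub_apply] at e1 e2 e3
    simp only [hQ]
    rw [e1, e2, e3, integral_const_mul, integral_const_mul, hEv, hEv, hEv, hEv, smoothStep,
      div_mul_cancel₀ _ (by positivity)]
    push_cast
    ring
  have key : ∀ t : ℝ, windowTransform a b η (c + t * Complex.I) *
      Complex.exp (-l * (c + t * Complex.I)) = (Q (b - l) t - Q (a - l) t) / η ^ 3 := fun t ↦ by
    have h1 := mul_windowTransform a b η hη.ne' (c + t * Complex.I)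
    have hs := hne t
    simp only [hQ, hE]
    set s : ℂ := c + t * Complex.I
    have h2 : windowTransform a b η s = (Complex.exp (b * s) - Complex.exp (a * s)) *
        (Complex.exp (η * s) - 1) ^ 3 / η ^ 3 / s ^ 4 := by
      rw [← h1]
      field_simp
    have h3 : ∀ (u : ℝ) (k : ℕ), Complex.exp (((u - l + k * η : ℝ) : ℂ) * s) =
        Complex.exp (u * s) * Complex.exp (-l * s) * Complex.exp (η * s) ^ k := fun u k ↦ by
      rw [← Complex.exp_nat_mul, ← Complex.exp_add, ← Complex.exp_add]
      congr 1
      push_cast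
      ring
    have h4 : ∀ u : ℝ, u - l = u - l + (0 : ℕ) * η ∧ u - l + η = u - l + (1 : ℕ) * η ∧
      u - l + 2 * η = u - l + (2 : ℕ) * η ∧ u - l + 3 * η = u - l + (3 : ℕ) * η := fun u ↦ by
      push_cast
      refine ⟨?_, ?_, ?_, ?_⟩ <;> ring
    rw [(h4 b).2.2.2, (h4 b).2.2.1, (h4 b).2.1, (h4 a).2.2.2, (h4 a).2.2.1, (h4 a).2.1]
    have h5 : ∀ u : ℝ, Complex.exp (((u - l : ℝ) : ℂ) * s) =
        Complex.exp (u * s) * Complex.exp (-l * s) := fun u ↦ by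
      simpa using h3 u 0
    simp only [h3, h5]
    rw [h2]
    field_simp
    ring
  simp only [key]
  rw [integral_div, integral_sub (hQi _) (hQi _), hQv, hQv]
  push_cast
  field_simp

end Perron

section ExplicitFormula

open Filter Topology IsDedekindDomain InfinitePlace

theorem integrable_line_windowTransform_mul {a b η c : ℝ} (ha : 0 < a) (hab : a ≤ b) (hη : 0 < η)
    (hc : 0 < c) {G : ℂ → ℂ} (hG : ∀ s : ℂ, s.re = c → ContinuousAt G s) {C₂ : ℝ}
    (hGb : ∀ s : ℂ, s.re = c → ‖G s‖ ≤ C₂ * (1 + ‖s‖ ^ 2)) :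
    Integrable fun t : ℝ ↦ windowTransform a b η (c + t * Complex.I) * G (c + t * Complex.I) := by
  obtain ⟨C₁, hC₁, hC₁'⟩ := exists_norm_windowTransform_le ha hab hη hc.le
  have hC₂ : 0 ≤ C₂ := by
    have h1 := (norm_nonneg _).trans (hGb c (by simp))
    exact nonneg_of_mul_nonneg_left h1 (by positivity)
  have hcont : ∀ s : ℂ, s.re = c → ContinuousAt (fun s ↦ windowTransform a b η s * G s) s :=
    fun s hs ↦ (differentiable_windowTransform a b η).continuous.continuousAt.mul (hG s hs)
  refine integrable_line (f := fun s ↦ windowTransform a b η s * G s) hcont ?_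
  refine QuadDecay.of_le (C := C₁ * (C₂ * 2)) (R := 1)
    (isClosed_eq Complex.continuous_re continuous_const)
    (fun s hs ↦ (hcont s hs).continuousWithinAt) fun s hs h1 ↦ ?_
  have h2 : 1 ≤ ‖s‖ ^ 2 := one_le_pow₀ h1
  rw [norm_mul, le_div_iff₀ (by positivity)]
  calc ‖windowTransform a b η s‖ * ‖G s‖ * ‖s‖ ^ 2 ≤
        ‖windowTransform a b η s‖ * (C₂ * (2 * ‖s‖ ^ 2)) * ‖s‖ ^ 2 := by
        have h3 : ‖G s‖ ≤ C₂ * (2 * ‖s‖ ^ 2) := (hGb s hs).trans (by gcongr; linarith)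
        gcongr
    _ = ‖windowTransform a b η s‖ * ‖s‖ ^ 4 * (C₂ * 2) := by ring
    _ ≤ C₁ * (C₂ * 2) := by
        have := hC₁' s (le_of_eq hs)
        gcongr

variable {K : Type*} [Field K] [NumberField K] {Ξ : ℂ → ℂ}

theorem countable_heightOneSpectrum : Countable (HeightOneSpectrum (𝓞 K) × ℕ) := by
  have h := (summable_mangoldt (K := K) one_lt_two).countable_support
  refine Set.countable_univ_iff.mp (h.mono fun x _ ↦ ?_)
  exact (mul_pos (logNormPrime_pos _) (Real.exp_pos _)).ne'

/-- The inverse Laplace transform of `windowTransform`. -/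
noncomputable def smoothWindow (a b η l : ℝ) : ℝ := smoothStep η (b - l) - smoothStep η (a - l)

/-- A smoothed sum over prime powers as an integral of the von Mangoldt series. -/
theorem hasSum_logNormPrime_mul_smoothWindow {a b η : ℝ} (ha : 0 < a) (hab : a ≤ b) (hη : 0 < η) :
    HasSum (fun x : HeightOneSpectrum (𝓞 K) × ℕ ↦ ((logNormPrime K x.1 *
      (1 - Real.exp (-(2 * logNormPow K x))) * smoothWindow a b η (logNormPow K x) : ℝ) : ℂ))
      ((2 * Real.pi : ℂ)⁻¹ * ∫ t : ℝ, windowTransform a b η (2 + t * Complex.I) *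
        (mangoldtSeries K (2 + t * Complex.I) - mangoldtSeries K (2 + t * Complex.I + 2))) := by
  have : Countable (HeightOneSpectrum (𝓞 K) × ℕ) := countable_heightOneSpectrum
  set W : ℝ → ℂ := fun t ↦ windowTransform a b η ((2 : ℝ) + t * Complex.I) with hW
  have hWi : Integrable W := by
    simpa [hW] using integrable_line_windowTransform_mul ha hab hη (c := 2) (by norm_num) (G := 1)
      (fun s _ ↦ continuousAt_const) (C₂ := 1) (fun s _ ↦ by
        simp)
  set A : HeightOneSpectrum (𝓞 K) × ℕ → ℝ :=
    fun x ↦ logNormPrime K x.1 * (1 - Real.exp (-(2 * logNormPow K x))) with hA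
  have hA0 : ∀ x, 0 ≤ A x ∧ A x ≤ logNormPrime K x.1 := fun x ↦ by
    have h1 : Real.exp (-(2 * logNormPow K x)) ≤ 1 := by
      have := logNormPow_pos (K := K) x
      rw [Real.exp_le_one_iff]
      linarith
    have h2 := (logNormPrime_pos (K := K) x.1).le
    have h3 := Real.exp_pos (-(2 * logNormPow K x))
    exact ⟨mul_nonneg h2 (by linarith), mul_le_of_le_one_right h2 (by linarith)⟩
  set F : HeightOneSpectrum (𝓞 K) × ℕ → ℝ → ℂ := fun x t ↦
    (A x : ℂ) * (W t * Complex.exp (-(logNormPow K x) * ((2 : ℝ) + t * Complex.I))) with hF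
  have hFn : ∀ x t, ‖F x t‖ = A x * Real.exp (-logNormPow K x * 2) * ‖W t‖ := fun x t ↦ by
    simp only [hF]
    rw [norm_mul, norm_mul, Complex.norm_of_nonneg (hA0 x).1, Complex.norm_exp]
    simp
    ring
  have hFi : ∀ x, Integrable (F x) := fun x ↦ by
    refine (hWi.norm.const_mul (A x * Real.exp (-logNormPow K x * 2))).mono' ?_
      (.of_forall fun t ↦ (hFn x t).le)
    refine AEStronglyMeasurable.const_mul (hWi.aestronglyMeasurable.mul ?_) _
    exact Continuous.aestronglyMeasurable (by fun_prop)
  have hs := hasSum_integral_of_summable_integral_norm (F := F) (μ := volume) hFi (by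
    simp only [hFn, integral_const_mul]
    refine Summable.mul_right _ ?_
    refine Summable.of_nonneg_of_le (fun x ↦ mul_nonneg (hA0 x).1 (Real.exp_pos _).le) (fun x ↦ ?_)
      (summable_mangoldt (K := K) one_lt_two)
    exact mul_le_mul_of_nonneg_right (hA0 x).2 (Real.exp_pos _).le)
  have e1 : ∀ x, ∫ t, F x t = 2 * Real.pi *
      ((A x * smoothWindow a b η (logNormPow K x) : ℝ) : ℂ) := fun x ↦ by
    simp only [hF]
    rw [integral_const_mul, hW, integral_line_windowTransform_mul_exp hη two_pos]
    simp only [smoothWindow]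
    push_cast
    ring
  have e2 : ∀ t : ℝ, ∑' x, F x t = windowTransform a b η (2 + t * Complex.I) *
      (mangoldtSeries K (2 + t * Complex.I) - mangoldtSeries K (2 + t * Complex.I + 2)) :=
    fun t ↦ by
    have hpos : ∀ x : HeightOneSpectrum (𝓞 K) × ℕ, 0 ≤ logNormPrime K x.1 := fun x ↦
      (logNormPrime_pos _).le
    have hpos' : ∀ x : HeightOneSpectrum (𝓞 K) × ℕ, 0 ≤ logNormPow K x := fun x ↦
      (logNormPow_pos _).le
    have s1 := summable_expSeries hpos hpos' (σ := 2) (s := 2 + t * Complex.I) (by simp)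
      (summable_mangoldt one_lt_two)
    have s2 := summable_expSeries hpos hpos' (σ := 2) (s := 2 + t * Complex.I + 2) (by simp)
      (summable_mangoldt one_lt_two)
    rw [mangoldtSeries, expSeries, expSeries, ← s1.tsum_sub s2, ← tsum_mul_left]
    refine tsum_congr fun x ↦ ?_
    have h1 : Complex.exp (-(logNormPow K x) * (2 + t * Complex.I + 2)) =
        Complex.exp (-(logNormPow K x) * (2 + t * Complex.I)) *
          Complex.exp (-(2 * logNormPow K x)) := by
      rw [← Complex.exp_add]
      congr 1
      ring
    rw [h1]
    simp only [hF, hA, hW]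
    push_cast
    ring
  simp only [e1, e2] at hs
  have hs' := hs.mul_left ((2 * Real.pi : ℂ)⁻¹)
  have hπ : (2 * Real.pi : ℂ) ≠ 0 := by
    have := Real.pi_ne_zero
    norm_cast
    positivity
  simpa only [inv_mul_cancel_left₀ hπ] using hs'

/-- An explicit formula in smoothed form. -/
theorem IsCompletedZeta.hasSum_smoothWindow (h : IsCompletedZeta K Ξ) {a b η : ℝ} (ha : 0 < a)
    (hab : a ≤ b) (hη : 0 < η) :
    HasSum (fun x : HeightOneSpectrum (𝓞 K) × ℕ ↦ ((logNormPrime K x.1 *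
      (1 - Real.exp (-(2 * logNormPow K x))) * smoothWindow a b η (logNormPow K x) : ℝ) : ℂ))
      (windowTransform a b η 1 +
        (1 - (nrRealPlaces K + nrComplexPlaces K : ℕ)) * windowTransform a b η 0 -
        (1 + nrComplexPlaces K) * windowTransform a b η (-1) - windowTransform a b η (-2) -
        (2 * Real.pi : ℂ)⁻¹ * ((∫ t : ℝ, windowTransform a b η (2 + t * Complex.I) *
          logDeriv Ξ (2 + t * Complex.I + (0 : ℝ))) - ∫ t : ℝ,
            windowTransform a b η (2 + t * Complex.I) *
              logDeriv Ξ (2 + t * Complex.I + (2 : ℝ)))) := by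
  convert hasSum_logNormPrime_mul_smoothWindow (K := K) ha hab hη using 1
  have hπ : (2 * Real.pi : ℂ) ≠ 0 := by
    have := Real.pi_ne_zero
    norm_cast
    positivity
  set W := windowTransform a b η with hW
  obtain ⟨C₁, hC₁, hC₁'⟩ := exists_norm_windowTransform_le ha hab hη (zero_le_two (α := ℝ))
  have hres : ∀ β : ℝ, β < 2 → Integrable (fun t : ℝ ↦ W (2 + t * Complex.I) *
      (1 / (2 + t * Complex.I - β))) ∧ ∫ t : ℝ, W (2 + t * Complex.I) *
      (1 / (2 + t * Complex.I - β)) = 2 * Real.pi * W β := fun β hβ ↦ by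
    have := integral_line_div_sub (Φ := W) (b := 2) (C := C₁) hβ hC₁
      (differentiable_windowTransform a b η) fun s hs h1 ↦ by
        refine le_trans ?_ (hC₁' s hs)
        gcongr
        exact le_self_pow₀ h1 (by norm_num)
    simpa using this
  have hF : ∀ c : ℝ, 0 ≤ c → Integrable (fun t : ℝ ↦ W (2 + t * Complex.I) *
      logDeriv Ξ (2 + t * Complex.I + c)) := fun c hc ↦ by
    obtain ⟨C₂, hC₂, hC₂'⟩ := h.exists_norm_logDeriv_le (σ := 2) (by norm_num)
    have := integrable_line_windowTransform_mul ha hab hη (c := 2) (by norm_num)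
      (G := fun s ↦ logDeriv Ξ (s + c)) (fun s hs ↦ by
        refine ContinuousAt.comp (f := fun s : ℂ ↦ s + c)
          (h.differentiableAt_logDeriv ?_).continuousAt (by fun_prop)
        simp
        linarith) (C₂ := C₂ * (1 + 2 * c ^ 2 + 2)) (fun s hs ↦ by
        refine (hC₂' _ (by simp; linarith)).trans ?_
        rw [mul_assoc]
        have h1 : ‖s + (c : ℂ)‖ ≤ ‖s‖ + |c| := by
          simpa using norm_add_le s (c : ℂ)
        have h2 : ‖s + (c : ℂ)‖ ^ 2 ≤ (‖s‖ + |c|) ^ 2 := by gcongr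
        gcongr
        nlinarith [sq_nonneg (|c| - ‖s‖), sq_abs c, sq_nonneg ‖s‖, sq_nonneg c,
          mul_nonneg (sq_nonneg c) (sq_nonneg ‖s‖)])
    simpa using this
  obtain ⟨i0, v0⟩ := hres 0 two_pos
  obtain ⟨i1, v1⟩ := hres 1 one_lt_two
  obtain ⟨im1, vm1⟩ := hres (-1) (by norm_num)
  obtain ⟨im2, vm2⟩ := hres (-2) (by norm_num)
  have j0 := hF 0 le_rfl
  have j2 := hF 2 zero_le_two
  have e : ∀ t : ℝ, W (2 + t * Complex.I) *
      (mangoldtSeries K (2 + t * Complex.I) - mangoldtSeries K (2 + t * Complex.I + 2)) =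
      W (2 + t * Complex.I) * (1 / (2 + t * Complex.I - (1 : ℝ))) +
      (1 - (nrRealPlaces K + nrComplexPlaces K : ℕ)) *
        (W (2 + t * Complex.I) * (1 / (2 + t * Complex.I - (0 : ℝ)))) -
      (1 + nrComplexPlaces K) * (W (2 + t * Complex.I) * (1 / (2 + t * Complex.I - (-1 : ℝ)))) -
      W (2 + t * Complex.I) * (1 / (2 + t * Complex.I - (-2 : ℝ))) -
      (W (2 + t * Complex.I) * logDeriv Ξ (2 + t * Complex.I + (0 : ℝ)) -
        W (2 + t * Complex.I) * logDeriv Ξ (2 + t * Complex.I + (2 : ℝ))) := fun t ↦ by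
    have := h.logDeriv_sub_logDeriv_add_two (s := 2 + t * Complex.I) (by simp)
    push_cast at this ⊢
    simp only [sub_neg_eq_add, sub_zero, add_zero] at this ⊢
    linear_combination W (2 + t * Complex.I) * this
  simp only [e]
  have k1 := i0.const_mul ((1 : ℂ) - (nrRealPlaces K + nrComplexPlaces K : ℕ))
  have k2 := im1.const_mul ((1 : ℂ) + nrComplexPlaces K)
  have e1 := integral_sub (((i1.add k1).sub k2).sub im2) (j0.sub j2)
  have e2 := integral_sub ((i1.add k1).sub k2) im2
  have e3 := integral_sub (i1.add k1) k2
  have e4 := integral_add i1 k1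
  have e5 := integral_sub j0 j2
  simp only [Pi.add_apply, Pi.sub_apply] at e1 e2 e3 e4 e5
  rw [e1, e2, e3, e4, e5, integral_const_mul, integral_const_mul, v0, v1, vm1, vm2]
  generalize ∫ t : ℝ, W (2 + t * Complex.I) * logDeriv Ξ (2 + t * Complex.I + (0 : ℝ)) = I₀
  generalize ∫ t : ℝ, W (2 + t * Complex.I) * logDeriv Ξ (2 + t * Complex.I + (2 : ℝ)) = I₂
  have hone : (2 * Real.pi : ℂ)⁻¹ * (2 * Real.pi) = 1 := inv_mul_cancel₀ hπ
  push_cast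
  linear_combination (-W 1 - (1 - (nrRealPlaces K + nrComplexPlaces K)) * W 0 +
    (1 + nrComplexPlaces K) * W (-1) + W (-2)) * hone

end ExplicitFormula

section WindowBounds

open Filter Topology IsDedekindDomain InfinitePlace

variable {K : Type*} [Field K] [NumberField K] {Ξ : ℂ → ℂ}

/-- Minkowski's bound: the degree is bounded in terms of the discriminant. -/
theorem finrank_le_logDiscr : (Module.finrank ℚ K : ℝ) ≤ 2 * (logDiscr K + 2) := by
  have hL := logDiscr_nonneg (K := K)
  rcases le_or_gt (Module.finrank ℚ K) 1 with h | h
  · have : (Module.finrank ℚ K : ℝ) ≤ 1 := by exact_mod_cast h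
    linarith
  have h1 := abs_discr_ge h
  rw [Int.cast_abs] at h1
  have h2 : Real.exp 1 ^ (1 / 2 : ℝ) ≤ 9 / 4 := by
    rw [← Real.sqrt_eq_rpow]
    refine Real.sqrt_le_iff.mpr ⟨by norm_num, ?_⟩
    have := Real.exp_one_lt_d9
    norm_num
    linarith
  rw [← Real.exp_mul, one_mul] at h2
  have h3 : Real.exp (1 / 2) ≤ 3 * Real.pi / 4 := by
    have := Real.pi_gt_three
    linarith
  obtain ⟨n, hn⟩ : ∃ n, Module.finrank ℚ K = n + 1 := ⟨_, (Nat.succ_pred_eq_of_pos (by omega)).symm⟩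
  rw [hn] at h1 ⊢
  have h4 : Real.exp (n / 2) ≤ |(discr K : ℝ)| := by
    refine le_trans ?_ h1
    rw [pow_succ, show (n / 2 : ℝ) = n * (1 / 2) by ring, Real.exp_nat_mul]
    have h5 : (1 : ℝ) ≤ 4 / 9 * (3 * Real.pi / 4) := by
      have := Real.pi_gt_three
      linarith
    calc Real.exp (1 / 2) ^ n ≤ (3 * Real.pi / 4) ^ n * 1 := by
          rw [mul_one]
          gcongr
      _ ≤ (3 * Real.pi / 4) ^ n * (4 / 9 * (3 * Real.pi / 4)) := by gcongr
      _ = 4 / 9 * ((3 * Real.pi / 4) ^ n * (3 * Real.pi / 4)) := by ring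
  have h6 : (n / 2 : ℝ) ≤ logDiscr K := by
    rw [logDiscr, ← Real.log_exp (n / 2)]
    exact Real.log_le_log (Real.exp_pos _) h4
  push_cast
  linarith

theorem exp_half_le_two : Real.exp (1 / 2) ≤ 2 := by
  rw [show (1 / 2 : ℝ) = 1 * (1 / 2) by ring, Real.exp_mul, ← Real.sqrt_eq_rpow]
  refine Real.sqrt_le_iff.mpr ⟨by norm_num, ?_⟩
  have := Real.exp_one_lt_d9
  linarith

theorem one_le_two_pow_mul_exp {X : ℝ} : 1 ≤ 2 ^ (⌈X⌉₊ + 4) * (Real.exp (-X / 2) / 10) := by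
  have h1 : Real.exp (X / 2) ≤ 2 ^ ⌈X⌉₊ := by
    calc Real.exp (X / 2) ≤ Real.exp (⌈X⌉₊ * (1 / 2)) := by
          rw [Real.exp_le_exp]
          linarith [Nat.le_ceil X]
      _ = Real.exp (1 / 2) ^ ⌈X⌉₊ := Real.exp_nat_mul _ _
      _ ≤ 2 ^ ⌈X⌉₊ := by
          have := exp_half_le_two
          gcongr
  have h2 : Real.exp (X / 2) * Real.exp (-X / 2) = 1 := by
    rw [← Real.exp_add, ← Real.exp_zero]
    congr 1
    ring
  have h3 : Real.exp (X / 2) * Real.exp (-X / 2) ≤ 2 ^ ⌈X⌉₊ * Real.exp (-X / 2) := by gcongr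
  rw [pow_add]
  linarith

theorem IsCompletedZeta.norm_integral_le_of_one_lt (h : IsCompletedZeta K Ξ) {a b X c : ℝ}
    (ha : 0 < a) (hab : a ≤ b) (hX : 1 < X) (hb : b ≤ X) (hc : 0 ≤ c) (hc2 : c ≤ 2) :
    ‖∫ t : ℝ, windowTransform a b (Real.exp (-X / 2) / 10) (2 + t * Complex.I) *
      logDeriv Ξ (2 + t * Complex.I + c)‖ ≤
      400000 * (X ^ 2 * (logDiscr K + 2) * Real.exp (X / 2)) := by
  set D := logDiscr K + 2 with hD
  have hL := logDiscr_nonneg (K := K)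
  have hn := finrank_le_logDiscr (K := K)
  set η := Real.exp (-X / 2) / 10 with hη
  have hη0 : 0 < η := by positivity
  have hη1 : η ≤ 1 / 10 := by
    have : Real.exp (-X / 2) ≤ 1 := Real.exp_le_one_iff.mpr (by linarith)
    rw [hη]
    linarith
  have hσ1 : (1 / 2 : ℝ) < 1 / 2 + 1 / (2 * X) := by
    have : 0 < 1 / (2 * X) := by positivity
    linarith
  have hσ2 : (1 / 2 : ℝ) + 1 / (2 * X) ≤ 1 := by
    have : 1 / (2 * X) ≤ 1 / 2 := by
      rw [div_le_div_iff₀ (by positivity) (by positivity)]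
      linarith
    linarith
  have h1 := h.norm_integral_windowTransform_le ha hab hη0 hσ1 (by linarith) hc hc2
    (one_le_two_pow_mul_exp (X := X))
  refine h1.trans ?_
  have h2 : Real.exp (b * (1 / 2 + 1 / (2 * X))) ≤ 2 * Real.exp (X / 2) := by
    calc Real.exp (b * (1 / 2 + 1 / (2 * X))) ≤ Real.exp (X * (1 / 2 + 1 / (2 * X))) := by
          rw [Real.exp_le_exp]
          gcongr
      _ = Real.exp (1 / 2) * Real.exp (X / 2) := by
          rw [← Real.exp_add]
          congr 1
          field_simp
          ring
      _ ≤ 2 * Real.exp (X / 2) := by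
          have := exp_half_le_two
          gcongr
  have h3 : Real.exp (η * (1 / 2 + 1 / (2 * X))) ≤ 2 := by
    refine (Real.exp_le_exp.mpr ?_).trans exp_half_le_two
    calc η * (1 / 2 + 1 / (2 * X)) ≤ 1 / 10 * 1 := by gcongr
      _ ≤ 1 / 2 := by norm_num
  have h4 : (⌈X⌉₊ : ℝ) < X + 1 := Nat.ceil_lt_add_one (by linarith)
  have hJ1 : ((⌈X⌉₊ + 4 : ℕ) : ℝ) + 1 ≤ 7 * X := by
    push_cast
    linarith
  have hJ2 : ((⌈X⌉₊ + 4 : ℕ) : ℝ) + 2 ≤ 8 * X := by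
    push_cast
    linarith
  have h5 : 3 + logDiscr K / 2 + Module.finrank ℚ K / 2 * (((⌈X⌉₊ + 4 : ℕ) : ℝ) + 2) ≤
      10 * (D * X) := by
    have hDX : D ≤ D * X := le_mul_of_one_le_right (by linarith) hX.le
    calc 3 + logDiscr K / 2 + Module.finrank ℚ K / 2 * (((⌈X⌉₊ + 4 : ℕ) : ℝ) + 2) ≤
          3 + logDiscr K / 2 + (2 * D) / 2 * (8 * X) := by gcongr
      _ = 3 + logDiscr K / 2 + 8 * (D * X) := by ring
      _ ≤ 10 * (D * X) := by linarith
  have h6 : Real.pi / 3 ≤ 11 / 10 := by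
    have := Real.pi_lt_d2
    linarith
  have hD0 : 0 < D := by linarith
  calc 2 * (20 * (2 * Real.exp (b * (1 / 2 + 1 / (2 * X))) *
        (1 + Real.exp (η * (1 / 2 + 1 / (2 * X)))) ^ 3) * ((((⌈X⌉₊ + 4 : ℕ) : ℝ) + 1) *
        (Real.pi / 3 * (3 + logDiscr K / 2 +
          Module.finrank ℚ K / 2 * (((⌈X⌉₊ + 4 : ℕ) : ℝ) + 2))))) ≤
      2 * (20 * (2 * (2 * Real.exp (X / 2)) * (1 + 2) ^ 3) * ((7 * X) *
        (11 / 10 * (10 * (D * X))))) := by gcongr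
    _ = 332640 * (X ^ 2 * D * Real.exp (X / 2)) := by ring
    _ ≤ 400000 * (X ^ 2 * D * Real.exp (X / 2)) := by gcongr; norm_num

end WindowBounds

section WindowSum

open Filter Topology IsDedekindDomain InfinitePlace

theorem windowTransform_ofReal (a b : ℝ) {η β : ℝ} (hη : η ≠ 0) (hβ : β ≠ 0) :
    windowTransform a b η β = (((Real.exp (b * β) - Real.exp (a * β)) *
      (Real.exp (η * β) - 1) ^ 3 / η ^ 3 / β ^ 4 : ℝ) : ℂ) := by
  have h := mul_windowTransform a b η hη β
  have hβ' : (β : ℂ) ^ 4 ≠ 0 := pow_ne_zero 4 (by exact_mod_cast hβ)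
  rw [← mul_right_inj' hβ', h]
  push_cast
  rw [mul_div_cancel₀ _ hβ']

theorem windowTransform_zero (a b : ℝ) {η : ℝ} (hη : η ≠ 0) :
    windowTransform a b η 0 = ((b - a : ℝ) : ℂ) := by
  have hη' : (η : ℂ) ≠ 0 := by exact_mod_cast hη
  rw [windowTransform, expQuot_zero, expQuot_zero, expQuot_zero, div_self hη']
  push_cast
  ring

theorem norm_windowTransform_neg_le {a b η β : ℝ} (ha : 0 < a) (hab : a ≤ b) (hη : 0 < η)
    (hβ : 1 ≤ β) : ‖windowTransform a b η (-β)‖ ≤ 1 := by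
  have hβ0 : 0 < β := by linarith
  have h := windowTransform_ofReal a b hη.ne' (neg_ne_zero.mpr hβ0.ne')
  rw [Complex.ofReal_neg] at h
  rw [h, Complex.norm_real, Real.norm_eq_abs, abs_div, abs_div, abs_mul, abs_pow, abs_pow, abs_pow,
    abs_neg, abs_of_pos hη, abs_of_pos hβ0]
  have h1 : |Real.exp (b * -β) - Real.exp (a * -β)| ≤ 1 := by
    have h2 : Real.exp (a * -β) ≤ 1 := Real.exp_le_one_iff.mpr (by nlinarith)
    have h3 : Real.exp (b * -β) ≤ Real.exp (a * -β) := Real.exp_le_exp.mpr (by nlinarith)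
    rw [abs_le]
    constructor <;> linarith [Real.exp_pos (b * -β)]
  have h4 : |Real.exp (η * -β) - 1| ≤ η * β := by
    have h2 : Real.exp (η * -β) ≤ 1 := Real.exp_le_one_iff.mpr (by nlinarith)
    have h3 := Real.add_one_le_exp (η * -β)
    rw [abs_le]
    constructor <;> linarith [mul_pos hη hβ0]
  calc |Real.exp (b * -β) - Real.exp (a * -β)| * |Real.exp (η * -β) - 1| ^ 3 / η ^ 3 / β ^ 4 ≤
        1 * (η * β) ^ 3 / η ^ 3 / β ^ 4 := by gcongr
    _ = 1 / β := by field_simp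
    _ ≤ 1 := by rwa [div_le_one hβ0]

variable {K : Type*} [Field K] [NumberField K] {Ξ : ℂ → ℂ}

/-- The smoothed explicit formula under the Riemann hypothesis. -/
theorem IsCompletedZeta.exists_hasSum_smoothWindow (h : IsCompletedZeta K Ξ) {a b X : ℝ}
    (ha : 0 < a) (hab : a ≤ b) (hX : 1 < X) (hb : b ≤ X) {η : ℝ}
    (hη : η = Real.exp (-X / 2) / 10) : ∃ S : ℝ,
    HasSum (fun x : HeightOneSpectrum (𝓞 K) × ℕ ↦ logNormPrime K x.1 *
      (1 - Real.exp (-(2 * logNormPow K x))) * smoothWindow a b η (logNormPow K x)) S ∧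
    |S - (Real.exp b - Real.exp a) * ((Real.exp η - 1) / η) ^ 3| ≤
      200000 * (X ^ 2 * (logDiscr K + 2) * Real.exp (X / 2)) := by
  have hη0 : 0 < η := by rw [hη]; positivity
  have hs := h.hasSum_smoothWindow ha hab hη0
  have hs' := Complex.hasSum_re hs
  simp only [Complex.ofReal_re] at hs'
  refine ⟨_, hs', ?_⟩
  have hI0 := h.norm_integral_le_of_one_lt ha hab hX hb le_rfl zero_le_two
  have hI2 := h.norm_integral_le_of_one_lt ha hab hX hb zero_le_two le_rfl
  rw [← hη] at hI0 hI2
  set I₀ := ∫ t : ℝ, windowTransform a b η (2 + t * Complex.I) *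
    logDeriv Ξ (2 + t * Complex.I + (0 : ℝ))
  set I₂ := ∫ t : ℝ, windowTransform a b η (2 + t * Complex.I) *
    logDeriv Ξ (2 + t * Complex.I + (2 : ℝ))
  set B := X ^ 2 * (logDiscr K + 2) * Real.exp (X / 2) with hB
  have hL := logDiscr_nonneg (K := K)
  have hn := finrank_le_logDiscr (K := K)
  have h1 : windowTransform a b η 1 =
      (((Real.exp b - Real.exp a) * ((Real.exp η - 1) / η) ^ 3 : ℝ) : ℂ) := by
    have := windowTransform_ofReal a b hη0.ne' one_ne_zero
    rw [Complex.ofReal_one] at this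
    rw [this]
    congr 1
    simp only [mul_one]
    field_simp
  have hm1 := norm_windowTransform_neg_le ha hab hη0 le_rfl
  have hm2 := norm_windowTransform_neg_le ha hab hη0 one_le_two
  rw [Complex.ofReal_one] at hm1
  rw [Complex.ofReal_ofNat] at hm2
  have hrank := card_add_two_mul_card_eq_rank K
  have hrank1 : 1 ≤ Module.finrank ℚ K := Module.finrank_pos
  have h0 : ‖((1 : ℂ) - (nrRealPlaces K + nrComplexPlaces K : ℕ)) * windowTransform a b η 0‖ ≤
      2 * B := by
    rw [windowTransform_zero a b hη0.ne', norm_mul, Complex.norm_real, Real.norm_eq_abs,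
      abs_of_nonneg (by linarith)]
    have h3 : ‖(1 : ℂ) - (nrRealPlaces K + nrComplexPlaces K : ℕ)‖ ≤ Module.finrank ℚ K := by
      rw [← Complex.ofReal_natCast, ← Complex.ofReal_one, ← Complex.ofReal_sub, Complex.norm_real,
        Real.norm_eq_abs, abs_le]
      have h4 : ((nrRealPlaces K + nrComplexPlaces K : ℕ) : ℝ) ≤ Module.finrank ℚ K := by
        exact_mod_cast (by omega : nrRealPlaces K + nrComplexPlaces K ≤ Module.finrank ℚ K)
      have h5 : (1 : ℝ) ≤ Module.finrank ℚ K := by exact_mod_cast hrank1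
      have h6 : (0 : ℝ) ≤ (nrRealPlaces K + nrComplexPlaces K : ℕ) := Nat.cast_nonneg _
      constructor <;> linarith
    calc _ ≤ (2 * (logDiscr K + 2)) * X := by
          gcongr
          · exact h3.trans hn
          · linarith
      _ = 2 * (X * (logDiscr K + 2) * 1) := by ring
      _ ≤ 2 * B := by
          rw [hB]
          have h7 : X ≤ X ^ 2 := by nlinarith
          have h8 : 1 ≤ Real.exp (X / 2) := Real.one_le_exp (by linarith)
          gcongr
  have hDB : logDiscr K + 2 ≤ B := by
    have h7 : 1 ≤ X ^ 2 := by nlinarith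
    have h8 : 1 ≤ Real.exp (X / 2) := Real.one_le_exp (by linarith)
    calc logDiscr K + 2 = 1 * (logDiscr K + 2) * 1 := by ring
      _ ≤ B := by
        rw [hB]
        gcongr
  have hc1 : ‖((1 : ℂ) + nrComplexPlaces K) * windowTransform a b η (-1)‖ ≤ 3 * B := by
    have h3 : ‖(1 : ℂ) + nrComplexPlaces K‖ ≤ 1 + Module.finrank ℚ K := by
      refine (norm_add_le _ _).trans ?_
      rw [norm_one, Complex.norm_natCast]
      have : nrComplexPlaces K ≤ Module.finrank ℚ K := by omega
      gcongr
    rw [norm_mul]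
    calc _ ≤ (1 + Module.finrank ℚ K : ℝ) * 1 := by gcongr
      _ ≤ 3 * B := by linarith
  have h_int : ‖(2 * Real.pi : ℂ)⁻¹ * (I₀ - I₂)‖ ≤ 1 / 6 * (800000 * B) := by
    rw [norm_mul]
    have h3 : ‖(2 * Real.pi : ℂ)⁻¹‖ ≤ 1 / 6 := by
      rw [norm_inv, norm_mul, Complex.norm_real, Real.norm_eq_abs, abs_of_pos Real.pi_pos,
        Complex.norm_ofNat, one_div]
      have := Real.pi_gt_three
      gcongr
      linarith
    have h4 := norm_sub_le I₀ I₂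
    gcongr
    linarith
  rw [← Complex.ofReal_re ((Real.exp b - Real.exp a) * ((Real.exp η - 1) / η) ^ 3), ← Complex.sub_re,
    ← h1]
  refine (Complex.abs_re_le_norm _).trans ?_
  set W0 := ((1 : ℂ) - (nrRealPlaces K + nrComplexPlaces K : ℕ)) * windowTransform a b η 0
  set W1 := ((1 : ℂ) + nrComplexPlaces K) * windowTransform a b η (-1)
  set V := (2 * Real.pi : ℂ)⁻¹ * (I₀ - I₂)
  rw [show windowTransform a b η 1 + W0 - W1 - windowTransform a b η (-2) - V -
    windowTransform a b η 1 = W0 - W1 - windowTransform a b η (-2) - V by ring]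
  have e1 := norm_sub_le (W0 - W1 - windowTransform a b η (-2)) V
  have e2 := norm_sub_le (W0 - W1) (windowTransform a b η (-2))
  have e3 := norm_sub_le W0 W1
  linarith

end WindowSum

section PrimeCounting

open Filter Topology IsDedekindDomain InfinitePlace Ideal

variable {K : Type*} [Field K] [NumberField K] {Ξ : ℂ → ℂ}

theorem finite_quotient_heightOneSpectrum (v : HeightOneSpectrum (𝓞 K)) :
    Finite (𝓞 K ⧸ v.asIdeal) := v.asIdeal.finiteQuotientOfFreeOfNeBot v.ne_bot

theorem isPrimePow_absNorm (v : HeightOneSpectrum (𝓞 K)) : IsPrimePow (absNorm v.asIdeal) := by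
  have := finite_quotient_heightOneSpectrum v
  have := Fintype.ofFinite (𝓞 K ⧸ v.asIdeal)
  have := v.isMaximal
  let _ := Ideal.Quotient.field v.asIdeal
  rw [Ideal.absNorm_apply, Submodule.cardQuot_apply, Nat.card_eq_fintype_card]
  exact FiniteField.isPrimePow_card (𝓞 K ⧸ v.asIdeal)

/-- The residue characteristic of a prime ideal. -/
noncomputable def residueChar (v : HeightOneSpectrum (𝓞 K)) : ℕ := (absNorm v.asIdeal).minFac

theorem prime_residueChar (v : HeightOneSpectrum (𝓞 K)) : (residueChar v).Prime :=
  Nat.minFac_prime (isPrimePow_absNorm v).one_lt.ne'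

theorem residueChar_mem (v : HeightOneSpectrum (𝓞 K)) : (residueChar v : 𝓞 K) ∈ v.asIdeal := by
  have h1 := (isPrimePow_absNorm v).minFac_pow_factorization_eq
  have h2 := Ideal.absNorm_mem v.asIdeal
  rw [← h1, Nat.cast_pow] at h2
  exact v.isPrime.mem_of_pow_mem _ h2

theorem residueChar_le_absNorm (v : HeightOneSpectrum (𝓞 K)) :
    residueChar v ≤ absNorm v.asIdeal :=
  Nat.minFac_le (isPrimePow_absNorm v).pos

theorem residueChar_sq_le_absNorm {v : HeightOneSpectrum (𝓞 K)} (hv : ¬ (absNorm v.asIdeal).Prime) :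
    residueChar v ^ 2 ≤ absNorm v.asIdeal :=
  Nat.minFac_sq_le_self (isPrimePow_absNorm v).pos hv

open scoped Classical in
theorem card_filter_residueChar_le (s : Finset (HeightOneSpectrum (𝓞 K))) (p : ℕ) :
    (s.filter fun v ↦ residueChar v = p).card ≤ Module.finrank ℚ K := by
  set t := s.filter fun v ↦ residueChar v = p with ht
  rcases t.eq_empty_or_nonempty with h0 | ⟨v₀, hv₀⟩
  · simp [h0]
  have hp : p.Prime := by
    have := (Finset.mem_filter.mp hv₀).2
    exact this ▸ prime_residueChar v₀
  have hdvd : ∏ v ∈ t, v.asIdeal ∣ span {(p : 𝓞 K)} := by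
    have h1 : ∏ I ∈ t.image HeightOneSpectrum.asIdeal, I ∣ span {(p : 𝓞 K)} := by
      refine Finset.prod_primes_dvd _ (fun I hI ↦ ?_) fun I hI ↦ ?_
      · obtain ⟨v, -, rfl⟩ := Finset.mem_image.mp hI
        exact v.prime
      · obtain ⟨v, hv, rfl⟩ := Finset.mem_image.mp hI
        rw [Ideal.dvd_span_singleton, ← (Finset.mem_filter.mp hv).2]
        exact residueChar_mem v
    rwa [Finset.prod_image fun v _ w _ h ↦ HeightOneSpectrum.ext h] at h1
  have h2 := map_dvd absNorm hdvd
  rw [map_prod, absNorm_span_natCast, RingOfIntegers.rank] at h2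
  have h3 := Nat.le_of_dvd (pow_pos hp.pos _) h2
  have h4 : p ^ t.card ≤ ∏ v ∈ t, absNorm v.asIdeal := by
    rw [← Finset.prod_const]
    refine Finset.prod_le_prod' fun v hv ↦ ?_
    rw [← (Finset.mem_filter.mp hv).2]
    exact residueChar_le_absNorm v
  exact (Nat.pow_le_pow_iff_right hp.one_lt).mp (h4.trans h3)

open scoped Classical in
theorem card_le_of_residueChar_le {s : Finset (HeightOneSpectrum (𝓞 K))} {Y : ℝ} (hY : 0 ≤ Y)
    (hs : ∀ v ∈ s, (residueChar v : ℝ) ≤ Y) : (s.card : ℝ) ≤ Module.finrank ℚ K * Y := by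
  have h1 : s.card ≤ Module.finrank ℚ K * (Finset.Icc 1 ⌊Y⌋₊).card :=
    Finset.card_le_mul_card_image_of_maps_to (f := residueChar) (fun v hv ↦ Finset.mem_Icc.mpr
      ⟨(prime_residueChar v).one_le, Nat.le_floor (hs v hv)⟩) _
      fun p _ ↦ by convert card_filter_residueChar_le s p
  rw [Nat.card_Icc, Nat.add_sub_cancel] at h1
  calc (s.card : ℝ) ≤ (Module.finrank ℚ K * ⌊Y⌋₊ : ℕ) := by exact_mod_cast h1
    _ ≤ Module.finrank ℚ K * Y := by
      push_cast
      gcongr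
      exact Nat.floor_le hY

theorem finite_logNormPow_le (X : ℝ) :
    {x : HeightOneSpectrum (𝓞 K) × ℕ | logNormPow K x ≤ X}.Finite := by
  have h := (summable_mangoldt (K := K) one_lt_two).tendsto_cofinite_zero
  have h2 := h.eventually_lt_const (mul_pos (Real.log_pos one_lt_two) (Real.exp_pos (-X * 2)))
  rw [eventually_cofinite] at h2
  refine h2.subset fun x hx ↦ ?_
  simp only [Set.mem_ofPred_eq, not_lt] at hx ⊢
  have h3 : Real.log 2 ≤ logNormPrime K x.1 := by
    refine Real.log_le_log two_pos ?_
    exact_mod_cast NumberField.HeightOneSpectrum.one_lt_absNorm x.1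
  have h4 := logNormPrime_pos x.1
  gcongr

theorem exp_logNormPrime (v : HeightOneSpectrum (𝓞 K)) :
    Real.exp (logNormPrime K v) = absNorm v.asIdeal :=
  Real.exp_log (by exact_mod_cast (isPrimePow_absNorm v).pos)

theorem residueChar_le_exp_half {x : HeightOneSpectrum (𝓞 K) × ℕ} {X : ℝ}
    (hx : logNormPow K x ≤ X) (hbad : ¬ (x.2 = 0 ∧ (absNorm x.1.asIdeal).Prime)) :
    (residueChar x.1 : ℝ) ≤ Real.exp (X / 2) := by
  have h1 : (residueChar x.1 : ℝ) ^ 2 ≤ Real.exp X := by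
    have hexp : Real.exp (logNormPow K x) = (absNorm x.1.asIdeal : ℝ) ^ (x.2 + 1) := by
      rw [logNormPow, ← Nat.cast_add_one, Real.exp_nat_mul, exp_logNormPrime]
    refine le_trans ?_ (Real.exp_le_exp.mpr hx)
    rw [hexp]
    have h1 : (1 : ℝ) ≤ absNorm x.1.asIdeal := by exact_mod_cast (isPrimePow_absNorm x.1).pos
    by_cases h0 : x.2 = 0
    · have h2 := residueChar_sq_le_absNorm (v := x.1) fun h ↦ hbad ⟨h0, h⟩
      rw [h0, zero_add, pow_one]
      exact_mod_cast h2
    · have h2 : (residueChar x.1 : ℝ) ≤ absNorm x.1.asIdeal := by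
        exact_mod_cast residueChar_le_absNorm x.1
      calc (residueChar x.1 : ℝ) ^ 2 ≤ (absNorm x.1.asIdeal : ℝ) ^ 2 := by gcongr
        _ ≤ (absNorm x.1.asIdeal : ℝ) ^ (x.2 + 1) := pow_le_pow_right₀ h1 (by omega)
  refine (pow_le_pow_iff_left₀ (Nat.cast_nonneg _) (Real.exp_pos _).le two_ne_zero).mp (h1.trans_eq ?_)
  rw [← Real.exp_nat_mul]
  congr 1
  push_cast
  ring

open scoped Classical in
/-- The contribution of prime powers of composite norm. -/
theorem sum_logNormPrime_le {s : Finset (HeightOneSpectrum (𝓞 K) × ℕ)} {X : ℝ} (hX : 0 ≤ X)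
    (hs : ∀ x ∈ s, logNormPow K x ≤ X ∧ ¬ (x.2 = 0 ∧ (absNorm x.1.asIdeal).Prime)) :
    ∑ x ∈ s, logNormPrime K x.1 ≤ Module.finrank ℚ K * X * Real.exp (X / 2) := by
  have h1 : ∀ v ∈ s.image Prod.fst, ∑ x ∈ s with x.1 = v, logNormPrime K x.1 ≤ X := fun v hv ↦ by
    rw [Finset.sum_congr rfl (g := fun _ ↦ logNormPrime K v) fun x hx ↦ by
      rw [(Finset.mem_filter.mp hx).2], Finset.sum_const, nsmul_eq_mul]
    have hpos := logNormPrime_pos v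
    have h2 : (s.filter fun x ↦ x.1 = v).card ≤ (Finset.range ⌊X / logNormPrime K v⌋₊).card := by
      refine Finset.card_le_card_of_injOn Prod.snd (fun x hx ↦ ?_) fun x hx y hy hxy ↦ ?_
      · obtain ⟨hx1, rfl⟩ := Finset.mem_filter.mp (Finset.mem_coe.mp hx)
        have h3 := (hs x hx1).1
        rw [logNormPow, ← le_div_iff₀ hpos] at h3
        rw [Finset.coe_range, Set.mem_Iio, ← Nat.succ_le_iff]
        refine Nat.le_floor ?_
        push_cast
        exact h3
      · obtain ⟨-, hx2⟩ := Finset.mem_filter.mp (Finset.mem_coe.mp hx)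
        obtain ⟨-, hy2⟩ := Finset.mem_filter.mp (Finset.mem_coe.mp hy)
        exact Prod.ext (hx2.trans hy2.symm) hxy
    rw [Finset.card_range] at h2
    calc ((s.filter fun x ↦ x.1 = v).card : ℝ) * logNormPrime K v ≤
          ⌊X / logNormPrime K v⌋₊ * logNormPrime K v := by gcongr
      _ ≤ X / logNormPrime K v * logNormPrime K v := by
          gcongr
          exact Nat.floor_le (by positivity)
      _ = X := div_mul_cancel₀ _ hpos.ne'
  rw [← Finset.sum_fiberwise_of_maps_to (g := Prod.fst) (t := s.image Prod.fst)
    fun x hx ↦ Finset.mem_image_of_mem _ hx]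
  refine (Finset.sum_le_sum h1).trans ?_
  rw [Finset.sum_const, nsmul_eq_mul]
  have h2 := card_le_of_residueChar_le (s := s.image Prod.fst) (Real.exp_pos (X / 2)).le fun v hv ↦ by
    obtain ⟨x, hx, rfl⟩ := Finset.mem_image.mp hv
    exact residueChar_le_exp_half (hs x hx).1 (hs x hx).2
  calc _ ≤ Module.finrank ℚ K * Real.exp (X / 2) * X := by gcongr
    _ = _ := by ring

end PrimeCounting

section DegreeOne

open Filter Topology IsDedekindDomain InfinitePlace Ideal

variable {K : Type*} [Field K] [NumberField K] {Ξ : ℂ → ℂ}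

theorem finite_degreeOneWindow (X : ℝ) : {v : HeightOneSpectrum (𝓞 K) |
    (absNorm v.asIdeal).Prime ∧ X - Real.log 2 < logNormPrime K v ∧ logNormPrime K v ≤ X}.Finite := by
  refine ((finite_logNormPow_le (K := K) X).preimage (f := fun v ↦ (v, 0))
    (Prod.mk_left_injective 0).injOn).subset fun v hv ↦ ?_
  simpa [logNormPow] using hv.2.2

variable (K) in
/-- The prime ideals of prime norm `p` with `X - log 2 < log p ≤ X`. -/
noncomputable def degreeOneWindow (X : ℝ) : Finset (HeightOneSpectrum (𝓞 K)) :=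
  (finite_degreeOneWindow X).toFinset

theorem mem_degreeOneWindow {X : ℝ} {v : HeightOneSpectrum (𝓞 K)} : v ∈ degreeOneWindow K X ↔
    (absNorm v.asIdeal).Prime ∧ X - Real.log 2 < logNormPrime K v ∧ logNormPrime K v ≤ X :=
  Set.Finite.mem_toFinset _

theorem absNorm_eq_card (I : Ideal (𝓞 K)) : absNorm I = Nat.card (𝓞 K ⧸ I) := by
  rw [Ideal.absNorm_apply, Submodule.cardQuot_apply]

open scoped Classical in
theorem primeIdealCount_eq_card {X : ℝ} {p : ℕ} (hp : p.Prime) (h1 : X - Real.log 2 < Real.log p)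
    (h2 : Real.log p ≤ X) : primeIdealCount (𝓞 K) p =
      ((degreeOneWindow K X).filter fun v ↦ absNorm v.asIdeal = p).card := by
  rw [primeIdealCount, ← Nat.subtype_card (p := fun v : HeightOneSpectrum (𝓞 K) ↦
    absNorm v.asIdeal = p) _ fun v ↦ ?_]
  · refine Nat.card_congr ⟨fun P ↦ ⟨⟨P.1, P.2.1, fun h ↦ ?_⟩, ?_⟩, fun v ↦ ⟨v.1.asIdeal, v.1.isPrime, ?_⟩,
      fun P ↦ rfl, fun v ↦ rfl⟩
    · have h3 := P.2.2
      rw [h, ← absNorm_eq_card, absNorm_bot] at h3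
      exact hp.ne_zero h3.symm
    · exact (absNorm_eq_card _).trans P.2.2
    · exact (absNorm_eq_card _).symm.trans v.2
  · rw [Finset.mem_filter, mem_degreeOneWindow]
    refine ⟨fun h ↦ h.2, fun h ↦ ⟨?_, h⟩⟩
    rw [logNormPrime, h]
    exact ⟨hp, h1, h2⟩

theorem hasSum_primeIdealCount_mul_hweight (X : ℝ) : HasSum (fun p : Nat.Primes ↦
    (primeIdealCount (𝓞 K) p : ℝ) * Real.log p * hweight X (Real.log p))
    (∑ v ∈ degreeOneWindow K X, logNormPrime K v * (2 * Real.exp (-X))) := by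
  classical
  have h1 : HasSum (fun p : Nat.Primes ↦ ∑ v ∈ degreeOneWindow K X,
      if absNorm v.asIdeal = p then logNormPrime K v * (2 * Real.exp (-X)) else 0)
      (∑ v ∈ degreeOneWindow K X, logNormPrime K v * (2 * Real.exp (-X))) := by
    refine hasSum_sum fun v hv ↦ ?_
    have := hasSum_single (f := fun p : Nat.Primes ↦ if absNorm v.asIdeal = p then
      logNormPrime K v * (2 * Real.exp (-X)) else 0)
      (⟨absNorm v.asIdeal, (mem_degreeOneWindow.mp hv).1⟩ : Nat.Primes)
      fun p hp ↦ if_neg fun h ↦ hp (Subtype.ext h.symm)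
    simpa using this
  convert h1 using 2 with p
  rw [← Finset.sum_filter]
  by_cases hp : X - Real.log 2 < Real.log p ∧ Real.log p ≤ X
  · rw [Finset.sum_congr rfl (g := fun _ ↦ Real.log p * (2 * Real.exp (-X))) fun v hv ↦ by
      rw [logNormPrime, (Finset.mem_filter.mp hv).2], Finset.sum_const, nsmul_eq_mul, hweight,
      if_pos hp, primeIdealCount_eq_card p.2 hp.1 hp.2, mul_assoc]
  · rw [hweight, if_neg hp, mul_zero, Finset.sum_eq_zero]
    intro v hv
    obtain ⟨h2, h3⟩ := Finset.mem_filter.mp hv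
    have h4 := (mem_degreeOneWindow.mp h2).2
    rw [logNormPrime, h3] at h4
    exact absurd h4 hp

theorem smoothWindow_mem_Icc {a b η : ℝ} (hη : 0 < η) (hab : a + 3 * η ≤ b) (l : ℝ) :
    smoothWindow a b η l ∈ Set.Icc 0 1 := by
  have h1 := smoothStep_mem_Icc hη (b - l)
  have h2 := smoothStep_mem_Icc hη (a - l)
  rw [smoothWindow]
  rcases le_total (a + 3 * η) l with h | h
  · rwa [smoothStep_of_le hη (x := a - l) (by linarith), sub_zero]
  · rw [smoothStep_of_nonneg hη (x := b - l) (by linarith)]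
    exact ⟨sub_nonneg.mpr h2.2, sub_le_self _ h2.1⟩

theorem one_sub_exp_mem_Icc {l : ℝ} (hl : 0 < l) : 1 - Real.exp (-(2 * l)) ∈ Set.Icc 0 1 :=
  ⟨sub_nonneg.mpr (Real.exp_le_one_iff.mpr (by linarith)), sub_le_self _ (Real.exp_pos _).le⟩

theorem sum_degreeOneWindow_mul_le {X η S : ℝ} (hη : 0 < η)
    (hS : HasSum (fun x : HeightOneSpectrum (𝓞 K) × ℕ ↦ logNormPrime K x.1 *
      (1 - Real.exp (-(2 * logNormPow K x))) *
        smoothWindow (X - Real.log 2 - 3 * η) X η (logNormPow K x)) S) :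
    (∑ v ∈ degreeOneWindow K X, logNormPrime K v) * (1 - 4 * Real.exp (-(2 * X))) ≤ S := by
  have hlog := Real.log_pos one_lt_two
  have h1 := sum_le_hasSum ((degreeOneWindow K X).map ⟨fun v ↦ (v, 0), Prod.mk_left_injective 0⟩)
    (fun x _ ↦ mul_nonneg (mul_nonneg (logNormPrime_pos _).le
      (one_sub_exp_mem_Icc (logNormPow_pos x)).1)
      (smoothWindow_mem_Icc hη (by linarith) _).1) hS
  refine le_trans ?_ h1
  rw [Finset.sum_map, Finset.sum_mul]
  refine Finset.sum_le_sum fun v hv ↦ ?_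
  obtain ⟨-, h2, h3⟩ := mem_degreeOneWindow.mp hv
  simp only [Function.Embedding.coeFn_mk, logNormPow, Nat.cast_zero, zero_add, one_mul]
  rw [smoothWindow, smoothStep_of_nonneg hη (by linarith), smoothStep_of_le hη (by linarith),
    sub_zero, mul_one]
  have h4 : Real.exp (-(2 * logNormPrime K v)) ≤ 4 * Real.exp (-(2 * X)) := by
    calc Real.exp (-(2 * logNormPrime K v)) ≤ Real.exp (2 * Real.log 2 + -(2 * X)) := by
          rw [Real.exp_le_exp]
          linarith
      _ = 4 * Real.exp (-(2 * X)) := by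
          rw [Real.exp_add, two_mul, Real.exp_add, Real.exp_log two_pos]
          norm_num
  have := (logNormPrime_pos v).le
  gcongr

theorem le_sum_degreeOneWindow_add {X η S : ℝ} (hX : 0 ≤ X) (hη : 0 < η) (hη2 : η ≤ 1 / 10)
    (hS : HasSum (fun x : HeightOneSpectrum (𝓞 K) × ℕ ↦ logNormPrime K x.1 *
      (1 - Real.exp (-(2 * logNormPow K x))) *
        smoothWindow (X - Real.log 2) (X - 3 * η) η (logNormPow K x)) S) :
    S ≤ ∑ v ∈ degreeOneWindow K X, logNormPrime K v +
      Module.finrank ℚ K * X * Real.exp (X / 2) := by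
  classical
  have hlog := Real.log_two_gt_d9
  set f := fun x : HeightOneSpectrum (𝓞 K) × ℕ ↦ logNormPrime K x.1 *
      (1 - Real.exp (-(2 * logNormPow K x))) *
        smoothWindow (X - Real.log 2) (X - 3 * η) η (logNormPow K x) with hf
  set F := (finite_logNormPow_le (K := K) X).toFinset with hF
  have hle : ∀ x, f x ≤ logNormPrime K x.1 := fun x ↦ by
    have h1 := one_sub_exp_mem_Icc (logNormPow_pos x)
    have h2 := smoothWindow_mem_Icc (a := X - Real.log 2) (b := X - 3 * η) hη (by linarith)
      (logNormPow K x)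
    have h3 := (logNormPrime_pos x.1).le
    calc f x ≤ logNormPrime K x.1 * 1 * 1 :=
          mul_le_mul (mul_le_mul_of_nonneg_left h1.2 h3) h2.2 h2.1 (by rwa [mul_one])
      _ = logNormPrime K x.1 := by ring
  have hzero : ∀ x, logNormPow K x ≤ X - Real.log 2 → f x = 0 := fun x hx ↦ by
    rw [hf]
    simp only
    rw [smoothWindow, smoothStep_of_nonneg hη (by linarith), smoothStep_of_nonneg hη (by linarith),
      sub_self, mul_zero]
  have hzero2 : ∀ x, X < logNormPow K x → f x = 0 := fun x hx ↦ by
    rw [hf]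
    simp only
    rw [smoothWindow, smoothStep_of_le hη (by linarith), smoothStep_of_le hη (by linarith),
      sub_self, mul_zero]
  have hsum : S = ∑ x ∈ F, f x := hS.unique (hasSum_sum_of_ne_finset_zero fun x hx ↦ by
    rw [hF, Set.Finite.mem_toFinset, Set.mem_ofPred_eq, not_le] at hx
    exact hzero2 x hx)
  rw [hsum, ← Finset.sum_filter_add_sum_filter_not F
    fun x ↦ x.2 = 0 ∧ (absNorm x.1.asIdeal).Prime]
  refine add_le_add ?_ ?_
  · have hmap := Finset.sum_map (degreeOneWindow K X)
      ⟨fun v ↦ (v, 0), Prod.mk_left_injective (0 : ℕ)⟩ fun x ↦ logNormPrime K x.1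
    simp only [Function.Embedding.coeFn_mk] at hmap
    rw [← hmap]
    calc _ = ∑ x ∈ (F.filter fun x ↦ x.2 = 0 ∧ (absNorm x.1.asIdeal).Prime) with
          X - Real.log 2 < logNormPow K x, f x := by
          refine (Finset.sum_filter_of_ne fun x _ hx ↦ ?_).symm
          by_contra h
          exact hx (hzero x (not_lt.mp h))
      _ ≤ ∑ x ∈ (F.filter fun x ↦ x.2 = 0 ∧ (absNorm x.1.asIdeal).Prime) with
          X - Real.log 2 < logNormPow K x, logNormPrime K x.1 := Finset.sum_le_sum fun x _ ↦ hle x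
      _ ≤ _ := by
          refine Finset.sum_le_sum_of_subset_of_nonneg (fun x hx ↦ ?_)
            fun x _ _ ↦ (logNormPrime_pos _).le
          obtain ⟨hx1, hx2⟩ := Finset.mem_filter.mp hx
          obtain ⟨hx3, hx4, hx5⟩ := Finset.mem_filter.mp hx1
          rw [hF, Set.Finite.mem_toFinset, Set.mem_ofPred_eq] at hx3
          obtain ⟨v, k⟩ := x
          obtain rfl : k = 0 := hx4
          refine Finset.mem_map_of_mem _ (mem_degreeOneWindow.mpr ?_)
          simp only [logNormPow, Nat.cast_zero, zero_add, one_mul] at hx2 hx3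
          exact ⟨hx5, hx2, hx3⟩
  · refine (Finset.sum_le_sum fun x _ ↦ hle x).trans (sum_logNormPrime_le hX fun x hx ↦ ?_)
    obtain ⟨hx1, hx2⟩ := Finset.mem_filter.mp hx
    rw [hF, Set.Finite.mem_toFinset, Set.mem_ofPred_eq] at hx1
    exact ⟨hx1, hx2⟩

end DegreeOne

section MainEstimate

open Filter Topology IsDedekindDomain InfinitePlace

theorem main_term_le {X η : ℝ} (hη : 0 < η) (hη2 : η ≤ 1 / 15) :
    (Real.exp X - Real.exp (X - Real.log 2 - 3 * η)) * ((Real.exp η - 1) / η) ^ 3 ≤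
      Real.exp X / 2 + 4 * (η * Real.exp X) := by
  have hX := Real.exp_pos X
  have h1 : Real.exp (X - Real.log 2 - 3 * η) = Real.exp X * (Real.exp (-(3 * η)) / 2) := by
    rw [show X - Real.log 2 - 3 * η = X + -(3 * η) - Real.log 2 by ring, Real.exp_sub, Real.exp_add,
      Real.exp_log two_pos]
    ring
  have h2 := Real.add_one_le_exp (-(3 * η))
  have h3 : (Real.exp η - 1) / η ≤ 1 + η := by
    rw [div_le_iff₀ hη]
    have := Real.abs_exp_sub_one_sub_id_le (x := η) (by rw [abs_of_pos hη]; linarith)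
    nlinarith [(abs_le.mp this).2]
  have h4 : 0 ≤ (Real.exp η - 1) / η :=
    div_nonneg (by linarith [Real.add_one_le_exp η]) hη.le
  have h5 : (1 + η) ^ 3 ≤ 1 + 4 * η := by
    have h6 : 0 ≤ 1 - 3 * η - η ^ 2 := by nlinarith
    linarith [mul_nonneg hη.le h6]
  have h6 : 0 ≤ 1 / 2 + 3 / 2 * η := by positivity
  calc (Real.exp X - Real.exp (X - Real.log 2 - 3 * η)) * ((Real.exp η - 1) / η) ^ 3 =
        Real.exp X * ((1 - Real.exp (-(3 * η)) / 2) * ((Real.exp η - 1) / η) ^ 3) := by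
        rw [h1]
        ring
    _ ≤ Real.exp X * ((1 / 2 + 3 / 2 * η) * (1 + 4 * η)) := by
        have h7 : ((Real.exp η - 1) / η) ^ 3 ≤ (1 + η) ^ 3 := by gcongr
        refine mul_le_mul_of_nonneg_left (mul_le_mul (by linarith) (h7.trans h5) (by positivity) h6)
          hX.le
    _ ≤ Real.exp X * (1 / 2 + 4 * η) := by
        refine mul_le_mul_of_nonneg_left ?_ hX.le
        nlinarith
    _ = _ := by ring

theorem le_main_term {X η : ℝ} (hη : 0 < η) (hη2 : η ≤ 1 / 15) :
    Real.exp X / 2 - 4 * (η * Real.exp X) ≤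
      (Real.exp (X - 3 * η) - Real.exp (X - Real.log 2)) * ((Real.exp η - 1) / η) ^ 3 := by
  have hX := Real.exp_pos X
  have h2 := Real.add_one_le_exp (-(3 * η))
  have h3 : 1 ≤ ((Real.exp η - 1) / η) ^ 3 := by
    refine one_le_pow₀ ?_
    rw [le_div_iff₀ hη]
    linarith [Real.add_one_le_exp η]
  have h4 : Real.exp X * (1 / 2 - 3 * η) ≤ Real.exp (X - 3 * η) - Real.exp (X - Real.log 2) := by
    rw [sub_eq_add_neg X, Real.exp_add, Real.exp_sub, Real.exp_log two_pos]
    nlinarith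
  have h5 : 0 ≤ Real.exp X * (1 / 2 - 3 * η) := mul_nonneg hX.le (by linarith)
  calc Real.exp X / 2 - 4 * (η * Real.exp X) ≤ Real.exp X * (1 / 2 - 3 * η) * 1 := by
        nlinarith [mul_pos hη hX]
    _ ≤ _ := mul_le_mul h4 h3 zero_le_one (h5.trans h4)

theorem exp_neg_two_le : Real.exp (-2) ≤ 5 / 36 := by
  have h : (7.2 : ℝ) ≤ Real.exp 2 := by
    rw [show (2 : ℝ) = 1 + 1 by norm_num, Real.exp_add]
    nlinarith [Real.exp_one_gt_d9]
  rw [Real.exp_neg, inv_le_comm₀ (Real.exp_pos _) (by norm_num)]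
  linarith

theorem upper_bound_of_mul_le {T M q : ℝ} (hT : 0 ≤ T) (hq : 0 ≤ q) (hq1 : q ≤ 5 / 36) (hqM : q ≤ M)
    (h : T * (1 - 4 * q) ≤ 1 / 2 + 200001 * M) : 2 * T - 1 ≤ 2000000 * M := by
  have h1 : T * 1 ≤ T * ((1 - 4 * q) * (1 + 9 * q)) :=
    mul_le_mul_of_nonneg_left (by nlinarith) hT
  have h2 : T * (1 - 4 * q) * (1 + 9 * q) ≤ (1 / 2 + 200001 * M) * (1 + 9 * q) :=
    mul_le_mul_of_nonneg_right h (by linarith)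
  have h3 : M * q ≤ M * (5 / 36) := mul_le_mul_of_nonneg_left hq1 (hq.trans hqM)
  linarith

variable {K : Type*} [Field K] [NumberField K] {Ξ : ℂ → ℂ}

set_option maxHeartbeats 1000000 in
theorem IsCompletedZeta.abs_sum_degreeOneWindow_sub_le (h : IsCompletedZeta K Ξ) {X : ℝ}
    (hX : 1 < X) : |(∑ v ∈ degreeOneWindow K X, logNormPrime K v) * (2 * Real.exp (-X)) - 1| ≤
      2000000 * (X ^ 2 * (logDiscr K + 2) * Real.exp (-X / 2)) := by
  have hL := logDiscr_nonneg (K := K)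
  have hn := finrank_le_logDiscr (K := K)
  have hlog := Real.log_two_gt_d9
  have hlog' := Real.log_two_lt_d9
  set T := ∑ v ∈ degreeOneWindow K X, logNormPrime K v with hT
  have hT0 : 0 ≤ T := Finset.sum_nonneg fun v _ ↦ (logNormPrime_pos v).le
  set e := Real.exp (-X / 2) with he
  have he0 : 0 < e := Real.exp_pos _
  set η := e / 10 with hη
  have hη0 : 0 < η := by positivity
  have he1 : e ≤ 2 / 3 := by
    have h1 : e ≤ Real.exp (-(1 / 2)) := Real.exp_le_exp.mpr (by linarith)
    have h2 := Real.add_one_le_exp (1 / 2 : ℝ)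
    rw [Real.exp_neg] at h1
    refine h1.trans ?_
    rw [inv_le_comm₀ (Real.exp_pos _) (by norm_num)]
    linarith
  have hη1 : η ≤ 1 / 15 := by rw [hη]; linarith
  obtain ⟨S₁, hS₁, hS₁'⟩ := h.exists_hasSum_smoothWindow (a := X - Real.log 2 - 3 * η) (b := X)
    (by linarith) (by linarith) hX le_rfl hη
  obtain ⟨S₂, hS₂, hS₂'⟩ := h.exists_hasSum_smoothWindow (a := X - Real.log 2) (b := X - 3 * η)
    (by linarith) (by linarith) hX (by linarith) hη
  have hup := sum_degreeOneWindow_mul_le hη0 hS₁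
  have hlow := le_sum_degreeOneWindow_add (by linarith) hη0 (by linarith) hS₂
  rw [← hT] at hup hlow
  have hm1 := main_term_le (X := X) hη0 hη1
  have hm2 := le_main_term (X := X) hη0 hη1
  set M := X ^ 2 * (logDiscr K + 2) * e with hM
  have hEe : Real.exp (X / 2) * e = 1 := by
    rw [he, ← Real.exp_add, ← Real.exp_zero]
    congr 1
    ring
  have hEX : Real.exp (-X) = e * e := by
    rw [he, ← Real.exp_add]
    congr 1
    ring
  have hXX : Real.exp X * (e * e) = 1 := by
    rw [← hEX, ← Real.exp_add, add_neg_cancel, Real.exp_zero]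
  have hB : X ^ 2 * (logDiscr K + 2) * Real.exp (X / 2) * (e * e) = M := by
    linear_combination X ^ 2 * (logDiscr K + 2) * e * hEe
  have heM : e ≤ M := by
    have h7 : 1 ≤ X ^ 2 := by nlinarith
    calc e = 1 * 1 * e := by ring
      _ ≤ M := by
        rw [hM]
        gcongr
        linarith
  have hηX : η * Real.exp X * (e * e) = e / 10 := by
    rw [hη]
    linear_combination e / 10 * hXX
  have hnX : Module.finrank ℚ K * X * Real.exp (X / 2) * (e * e) ≤ 2 * M := by
    have h7 : X ≤ X ^ 2 := by nlinarith
    calc Module.finrank ℚ K * X * Real.exp (X / 2) * (e * e) = Module.finrank ℚ K * X * e := by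
          linear_combination Module.finrank ℚ K * X * e * hEe
      _ ≤ 2 * (logDiscr K + 2) * X ^ 2 * e := by gcongr
      _ = 2 * M := by ring
  have hee : 0 < e * e := by positivity
  rw [hEX, abs_le]
  constructor
  · have h1 := (abs_le.mp hS₂').1
    have h2 : (Real.exp X / 2 - 4 * (η * Real.exp X) - 200000 * (X ^ 2 * (logDiscr K + 2) *
        Real.exp (X / 2)) - Module.finrank ℚ K * X * Real.exp (X / 2)) * (e * e) ≤ T * (e * e) := by
      gcongr
      linarith
    linarith
  · have hq : Real.exp (-(2 * X)) = e * e * (e * e) := by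
      rw [← hEX, ← Real.exp_add]
      congr 1
      ring
    set q := e * e * (e * e) with hq'
    have hq0 : 0 < q := by positivity
    have hq1 : q ≤ 5 / 36 := by
      have h1 : Real.exp (-(2 * X)) ≤ Real.exp (-2) := Real.exp_le_exp.mpr (by linarith)
      rw [hq] at h1
      exact h1.trans exp_neg_two_le
    have hqe : q ≤ e := by
      have h1 : e * e ≤ 1 := by nlinarith
      have h2 : e * e ≤ e := by nlinarith
      calc q ≤ 1 * e := mul_le_mul h1 h2 hee.le zero_le_one
        _ = e := one_mul e
    rw [hq] at hup
    have h1 := (abs_le.mp hS₁').2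
    have h2 : S₁ * (e * e) ≤ (Real.exp X / 2 + 4 * (η * Real.exp X) + 200000 *
        (X ^ 2 * (logDiscr K + 2) * Real.exp (X / 2))) * (e * e) := by
      gcongr
      linarith
    have h3 : S₁ * (e * e) ≤ 1 / 2 + 200001 * M := by linarith
    have h4 : T * (1 - 4 * q) * (e * e) ≤ S₁ * (e * e) := mul_le_mul_of_nonneg_right hup hee.le
    have h5 := upper_bound_of_mul_le (T := T * (e * e)) (M := M) (mul_nonneg hT0 hee.le) hq0.le hq1
      (hqe.trans heM) (by linarith)
    linarith

end MainEstimate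

theorem stmt8 :
    ∃ C : ℝ, 0 < C ∧
      ∀ (K : Type) (_ : Field K) (_ : NumberField K), RHFor K →
        ∀ X : ℝ, 1 < X →
          |(∑' p : Nat.Primes,
              (primeIdealCount (𝓞 K) p : ℝ) * Real.log p * hweight X (Real.log p)) - 1| ≤
            C * X ^ 2 * (Real.log |(NumberField.discr K : ℝ)| + 2) * Real.exp (-X / 2) := by
  refine ⟨2000000, by norm_num, fun K _ _ hRH X hX ↦ ?_⟩
  obtain ⟨Ξ, h1, h2, h3, h4, h5, h6⟩ := exists_completedZeta_of_RHFor K hRH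
  have h : IsCompletedZeta K Ξ := ⟨h1, h2, h3, h4, h5, h6⟩
  rw [(hasSum_primeIdealCount_mul_hweight X).tsum_eq, ← Finset.sum_mul]
  refine (h.abs_sum_degreeOneWindow_sub_le hX).trans_eq ?_
  rw [logDiscr]
  ring
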